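/- Fix an integer k ≥ 2. For every ε > 0 there exists n₀ such that for all n ≥ n₀, the number of k-SAT functions on n Boolean variables is at least (1−ε)·2^{n + C(n,k)} and at most (1+ε)·2^{n + C(n,k)}, where C(n,k) denotes the binomial coefficient 'n choose k'. -/

import Mathlib

section Defs

variable {V W : Type*}

/-- A clause is a finite set of literals; a literal is a variable paired with a polarity
(`true` = positive, `false` = negative). -/
abbrev SatClause (V : Type*) := Finset (V × Bool)

/-- A formula is a finite set of clauses. -/
abbrev SatFormula (V : Type*) := Finset (SatClause V)

/-- The set of variables used by a clause. -/
def clauseVars [DecidableEq V] (C : SatClause V) : Finset V := C.image Prod.fst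

/-- A valid `k`-SAT clause: `k` literals on `k` distinct variables. -/
def IsKClause [DecidableEq V] (k : ℕ) (C : SatClause V) : Prop :=
  C.card = k ∧ (clauseVars C).card = k

/-- A valid `k`-SAT formula. -/
def IsKFormula [DecidableEq V] (k : ℕ) (G : SatFormula V) : Prop :=
  ∀ C ∈ G, IsKClause k C

/-- An assignment satisfies a clause if it makes all of its literals true. -/
def SatisfiesClause (a : V → Bool) (C : SatClause V) : Prop := ∀ l ∈ C, a l.1 = l.2

/-- A formula is minimal if every clause has a witness assignment satisfying it and no other
clause. -/
def MinimalFormula (G : SatFormula V) : Prop :=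
  ∀ C ∈ G, ∃ w : V → Bool, SatisfiesClause w C ∧ ∀ C' ∈ G, SatisfiesClause w C' → C' = C

/-- A formula is simple if no two distinct clauses use the same set of variables. -/
def SimpleFormula [DecidableEq V] (G : SatFormula V) : Prop :=
  ∀ C ∈ G, ∀ C' ∈ G, clauseVars C = clauseVars C' → C = C'

/-- A formula is unate if every variable occurs with only one polarity. -/
def UnateFormula (G : SatFormula V) : Prop :=
  ∀ x : V, ¬ ((∃ C ∈ G, (x, true) ∈ C) ∧ (∃ C ∈ G, (x, false) ∈ C))

/-- The set of variables used by a formula. -/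
def formulaVars [DecidableEq V] (G : SatFormula V) : Finset V := G.biUnion clauseVars

/-- `f` is a `k`-SAT function: it is computed by some `k`-SAT formula (value `1` iff some
clause has all its literals satisfied). -/
def IsKSatFunction (k n : ℕ) (f : (Fin n → Bool) → Bool) : Prop :=
  ∃ G : SatFormula (Fin n), IsKFormula k G ∧
    ∀ a : Fin n → Bool, f a = true ↔ ∃ C ∈ G, SatisfiesClause a C

/-- Relabel the variables of a formula along `φ`. -/
def mapFormula [DecidableEq V] [DecidableEq W] (φ : W → V) (F : SatFormula W) : SatFormula V :=
  F.image (fun C => C.image (fun l => (φ l.1, l.2)))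

/-- `G'` is a copy of `F`: it is obtained from `F` by an injective relabeling of variables. -/
def IsCopyOf [DecidableEq V] [DecidableEq W] (F : SatFormula W) (G' : SatFormula V) : Prop :=
  ∃ φ : W → V, Set.InjOn φ ↑(formulaVars F) ∧ G' = mapFormula φ F

/-- The number of copies of `F` in `G`, i.e. of subformulae of `G` isomorphic to `F`. -/
noncomputable def copyCount [DecidableEq V] [DecidableEq W] (F : SatFormula W)
    (G : SatFormula V) : ℕ :=
  Set.ncard {G' : SatFormula V | G' ⊆ G ∧ IsCopyOf F G'}

/-- The `b`-blowup of a clause: replace each literal by the literal of the same polarity on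
one of the `b` duplicates of its variable, in all possible ways. -/
def clauseBlowup [DecidableEq V] (b : ℕ) (C : SatClause V) :
    Finset (SatClause (V × Fin b)) :=
  (C.pi (fun _ => (Finset.univ : Finset (Fin b)))).image
    (fun g => C.attach.image (fun l => ((l.1.1, g l.1 l.2), l.1.2)))

/-- The `b`-blowup of a formula. -/
def formulaBlowup [DecidableEq V] (b : ℕ) (G : SatFormula V) : SatFormula (V × Fin b) :=
  G.biUnion (clauseBlowup b)

/-- The weight of a formula on `n` variables:
`wt(G) = Σ_i log₂(i+1)·α_i(G)` where `α_i(G)·C(n,k)` counts the `k`-sets of variables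
supporting exactly `i` clauses. -/
noncomputable def formulaWt (k n : ℕ) (G : SatFormula (Fin n)) : ℝ :=
  (∑ S ∈ (Finset.univ : Finset (Fin n)).powersetCard k,
    Real.logb 2 (((G.filter (fun C => clauseVars C = S)).card : ℝ) + 1)) / (n.choose k)

/-- A partially directed graph: a set of undirected edges together with a set of directed
(pointed) edges. -/
structure PDG (V : Type*) where
  undir : Finset (Finset V)
  dir : Finset (Finset V × V)

/-- `H` is a valid `k`-PDG: all edges have `k` vertices, each directed edge is pointed at one
of its vertices, and each `k`-set carries at most one edge (undirected or directed). -/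
def PDG.IsValid (k : ℕ) (H : PDG V) : Prop :=
  (∀ e ∈ H.undir, e.card = k) ∧
  (∀ p ∈ H.dir, p.1.card = k ∧ p.2 ∈ p.1) ∧
  (∀ p ∈ H.dir, p.1 ∉ H.undir) ∧
  (∀ p ∈ H.dir, ∀ q ∈ H.dir, p.1 = q.1 → p = q)

/-- `F` is a subgraph of `H`: a copy of `F` can be obtained from `H` by deleting vertices,
deleting edges, and/or forgetting directions of edges. -/
def PDG.IsSubgraph [DecidableEq V] (F : PDG W) (H : PDG V) : Prop :=
  ∃ φ : W → V, Function.Injective φ ∧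
    (∀ e ∈ F.undir, e.image φ ∈ H.undir ∨ ∃ v, (e.image φ, v) ∈ H.dir) ∧
    (∀ p ∈ F.dir, (p.1.image φ, φ p.2) ∈ H.dir)

/-- The image of a PDG under a relabeling of vertices. -/
def PDG.map [DecidableEq V] (φ : W → V) (F : PDG W) : PDG V :=
  ⟨F.undir.image (Finset.image φ), F.dir.image (fun p => (p.1.image φ, φ p.2))⟩

/-- The PDG `T_k` on vertex set `{0, …, k}` (0-indexed): undirected edges everything-but-`k`
and everything-but-`k-2`, and the edge everything-but-`k-1` directed toward `k`. -/
def TkPDG (k : ℕ) : PDG (Fin (k + 1)) where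
  undir := { Finset.univ.erase ⟨k, Nat.lt_succ_self k⟩,
             Finset.univ.erase ⟨k - 2, by omega⟩ }
  dir := { (Finset.univ.erase ⟨k - 1, by omega⟩, ⟨k, Nat.lt_succ_self k⟩) }

/-- A semisimple formula: every `k`-set of variables supports at most one clause, or exactly
two clauses whose polarities differ on exactly one variable. -/
def SemisimpleFormula [DecidableEq V] (G : SatFormula V) : Prop :=
  ∀ C₁ ∈ G, ∀ C₂ ∈ G, C₁ ≠ C₂ → clauseVars C₁ = clauseVars C₂ →
    (((C₁ \ C₂).image Prod.fst).card = 1 ∧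
      ∀ C₃ ∈ G, clauseVars C₃ = clauseVars C₁ → C₃ = C₁ ∨ C₃ = C₂)

/-- The type of a (semisimple) formula: an undirected edge on each variable set supporting
exactly one clause, and for each variable set supporting two clauses a directed edge pointed
at the variable where the two clauses differ. -/
def formulaType [DecidableEq V] (G : SatFormula V) : PDG V where
  undir := (G.filter (fun C => ∀ C' ∈ G, clauseVars C' = clauseVars C → C' = C)).image
    clauseVars
  dir := ((G ×ˢ G).filter (fun p => p.1 ≠ p.2 ∧ clauseVars p.1 = clauseVars p.2)).biUnion
    (fun p => ((p.1 \ p.2).image Prod.fst).image (fun v => (clauseVars p.1, v)))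

end Defs

namespace KSat

open Finset

set_option linter.unusedSectionVars false

/-- The indicator of a proposition, as a real number. -/
noncomputable def ind (p : Prop) : ℝ := open Classical in if p then 1 else 0

lemma ind_true {p : Prop} (h : p) : ind p = 1 := by simp [ind, h]
lemma ind_false {p : Prop} (h : ¬ p) : ind p = 0 := by simp [ind, h]

lemma ind_nonneg (p : Prop) : 0 ≤ ind p := by
  by_cases h : p <;> simp [ind, h]

lemma ind_le_one (p : Prop) : ind p ≤ 1 := by
  by_cases h : p <;> simp [ind, h]

lemma ind_mono {p q : Prop} (h : p → q) : ind p ≤ ind q := by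
  by_cases hp : p
  · rw [ind_true hp, ind_true (h hp)]
  · rw [ind_false hp]; exact ind_nonneg q

lemma ind_congr {p q : Prop} (h : p ↔ q) : ind p = ind q := by rw [propext h]

lemma ind_and (p q : Prop) : ind (p ∧ q) = ind p * ind q := by
  by_cases hp : p <;> by_cases hq : q <;> simp [ind, hp, hq]

lemma ind_or_le (p q : Prop) : ind (p ∨ q) ≤ ind p + ind q := by
  by_cases hp : p <;> by_cases hq : q <;> simp [ind, hp, hq]

lemma ind_not (p : Prop) : ind (¬ p) = 1 - ind p := by
  by_cases hp : p <;> simp [ind, hp]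

lemma ind_le_of_pos {p : Prop} {a : ℝ} (ha : 0 ≤ a) (h : p → 1 ≤ a) : ind p ≤ a := by
  by_cases hp : p
  · rw [ind_true hp]; exact h hp
  · rw [ind_false hp]; exact ha

lemma ind_exists_le {ι : Type*} (s : Finset ι) (p : ι → Prop) :
    ind (∃ i ∈ s, p i) ≤ ∑ i ∈ s, ind (p i) := by
  apply ind_le_of_pos (sum_nonneg fun i _ => ind_nonneg _)
  rintro ⟨i, hi, h⟩
  rw [← ind_true h]
  exact single_le_sum (f := fun i => ind (p i)) (fun i _ => ind_nonneg _) hi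

lemma ind_forall_eq {ι : Type*} (s : Finset ι) (p : ι → Prop) :
    ind (∀ i ∈ s, p i) = ∏ i ∈ s, ind (p i) := by
  by_cases h : ∀ i ∈ s, p i
  · rw [ind_true h, prod_congr rfl (fun i hi => ind_true (h i hi))]; simp
  · rw [ind_false h]
    push Not at h
    obtain ⟨i, hi, h⟩ := h
    exact (prod_eq_zero hi (ind_false h)).symm

lemma sum_ind {ι : Type*} (s : Finset ι) (p : ι → Prop) [DecidablePred p] :
    ∑ i ∈ s, ind (p i) = ((s.filter p).card : ℝ) := by
  rw [card_filter]; push_cast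
  refine sum_congr rfl fun i _ => ?_
  by_cases h : p i <;> simp [ind, h]

section Average

variable {α β : Type*} [Fintype α] [Fintype β]

/-- The average of a real function over a finite type. -/
noncomputable def Ex (f : α → ℝ) : ℝ := (∑ x, f x) / Fintype.card α

lemma Ex_add (f g : α → ℝ) : Ex (fun x => f x + g x) = Ex f + Ex g := by
  simp [Ex, sum_add_distrib, add_div]

lemma Ex_sub (f g : α → ℝ) : Ex (fun x => f x - g x) = Ex f - Ex g := by
  simp [Ex, sum_sub_distrib, sub_div]

lemma Ex_const_mul (c : ℝ) (f : α → ℝ) : Ex (fun x => c * f x) = c * Ex f := by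
  simp [Ex, ← mul_sum, mul_div_assoc]

lemma Ex_mul_const (f : α → ℝ) (c : ℝ) : Ex (fun x => f x * c) = Ex f * c := by
  simp_rw [mul_comm _ c]; exact Ex_const_mul c f

lemma Ex_sum {ι : Type*} (s : Finset ι) (f : ι → α → ℝ) :
    Ex (fun x => ∑ i ∈ s, f i x) = ∑ i ∈ s, Ex (f i) := by
  simp only [Ex]; rw [sum_comm, sum_div]

lemma Ex_mono {f g : α → ℝ} (h : ∀ x, f x ≤ g x) : Ex f ≤ Ex g :=
  div_le_div_of_nonneg_right (sum_le_sum fun x _ => h x) (Nat.cast_nonneg _)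

lemma Ex_congr {f g : α → ℝ} (h : ∀ x, f x = g x) : Ex f = Ex g := by
  rw [funext h]

lemma Ex_nonneg {f : α → ℝ} (h : ∀ x, 0 ≤ f x) : 0 ≤ Ex f :=
  div_nonneg (sum_nonneg fun x _ => h x) (Nat.cast_nonneg _)

lemma Ex_const [Nonempty α] (c : ℝ) : Ex (fun _ : α => c) = c := by
  simp [Ex]

lemma Ex_le_of_le [Nonempty α] {f : α → ℝ} {c : ℝ} (h : ∀ x, f x ≤ c) : Ex f ≤ c := by
  rw [← Ex_const (α := α) c]; exact Ex_mono h

lemma Ex_const_le {c : ℝ} (hc : 0 ≤ c) : Ex (fun _ : α => c) ≤ c := by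
  rcases isEmpty_or_nonempty α with h | h
  · simp [Ex, hc]
  · rw [Ex_const]

lemma exists_le_Ex [Nonempty α] (f : α → ℝ) : ∃ x, f x ≤ Ex f := by
  by_contra! h
  have hc : (0 : ℝ) < Fintype.card α := by exact_mod_cast Fintype.card_pos
  have : ∑ _x : α, Ex f < ∑ x, f x := sum_lt_sum_of_nonempty univ_nonempty fun x _ => h x
  rw [sum_const, card_univ, nsmul_eq_mul, Ex, mul_div_cancel₀ _ hc.ne'] at this
  exact lt_irrefl _ this

lemma Ex_comm (f : α → β → ℝ) :
    Ex (fun x => Ex (fun y => f x y)) = Ex (fun y => Ex (fun x => f x y)) := by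
  simp only [Ex, ← sum_div]
  rw [sum_comm, div_right_comm]

lemma Ex_prod (f : α × β → ℝ) : Ex f = Ex (fun x => Ex (fun y => f (x, y))) := by
  simp only [Ex, ← sum_div]
  rw [Fintype.sum_prod_type, Fintype.card_prod, Nat.cast_mul, mul_comm, div_div]

lemma Ex_equiv (e : α ≃ β) (f : β → ℝ) : Ex (fun x => f (e x)) = Ex f := by
  simp only [Ex]
  rw [Equiv.sum_comp e f, Fintype.card_congr e]

lemma Ex_pow_le {f : α → ℝ} (hf : ∀ x, 0 ≤ f x) (m : ℕ) :
    (Ex f) ^ (m + 1) ≤ Ex (fun x => f x ^ (m + 1)) := by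
  rcases isEmpty_or_nonempty α with h | h
  · simp [Ex]
  have hc : (0 : ℝ) < Fintype.card α := by exact_mod_cast Fintype.card_pos
  have key := pow_sum_div_card_le_sum_pow (s := (univ : Finset α)) (f := f)
    (fun x _ => hf x) m
  simp only [Ex, div_pow]
  rw [div_le_div_iff₀ (by positivity) hc, pow_succ (Fintype.card α : ℝ), ← mul_assoc]
  rw [div_le_iff₀ (by rw [card_univ]; positivity), card_univ] at key
  exact mul_le_mul_of_nonneg_right key hc.le

lemma card_filter_eq_Ex (p : α → Prop) [DecidablePred p] :
    ((univ.filter p).card : ℝ) = Fintype.card α * Ex (fun x => ind (p x)) := by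
  rw [Ex, sum_ind]
  rcases isEmpty_or_nonempty α with h | h
  · simp
  have hc : (Fintype.card α : ℝ) ≠ 0 := by exact_mod_cast Fintype.card_ne_zero
  field_simp

end Average

section Tuples

variable {I J V : Type*} [Fintype I] [Fintype J] [Fintype V] [DecidableEq I] [DecidableEq J]

lemma Ex_sum_arrow (f : (I ⊕ J → V) → ℝ) :
    Ex f = Ex (fun a : I → V => Ex (fun b : J → V => f (Sum.elim a b))) := by
  rw [← Ex_equiv (Equiv.sumArrowEquivProdArrow I J V).symm, Ex_prod]
  rfl

lemma Ex_comp_inj [Nonempty V] {j : I → J} (hj : Function.Injective j) (f : (I → V) → ℝ) :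
    Ex (fun x : J → V => f (x ∘ j)) = Ex f := by
  classical
  let e : I ⊕ ((Set.range j)ᶜ : Set J) ≃ J :=
    ((Equiv.ofInjective j hj).sumCongr (Equiv.refl _)).trans (Equiv.Set.sumCompl _)
  rw [← Ex_equiv (Equiv.arrowCongr e (Equiv.refl V)), Ex_sum_arrow]
  refine Ex_congr fun a => ?_
  rw [← Ex_const (α := ((Set.range j)ᶜ : Set J) → V) (f a)]
  refine Ex_congr fun b => ?_
  congr 1
  funext i
  have : e.symm (j i) = Sum.inl i := by
    rw [Equiv.symm_apply_eq]; simp [e]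
  simp [this]

lemma Ex_coincide_le {i j : I} (hij : i ≠ j) :
    Ex (fun x : I → V => ind (x i = x j)) ≤ 1 / Fintype.card V := by
  rcases isEmpty_or_nonempty V with h | h
  · have : IsEmpty (I → V) := ⟨fun x => h.elim (x i)⟩
    simp [Ex]
  have hinj : Function.Injective ![i, j] := by
    intro a b; fin_cases a <;> fin_cases b <;> simp [hij, hij.symm]
  have h1 := Ex_comp_inj (V := V) hinj (fun y => ind (y 0 = y 1))
  simp only [Function.comp_apply, Matrix.cons_val_zero, Matrix.cons_val_one] at h1
  rw [h1, ← Ex_equiv (finTwoArrowEquiv V).symm, Ex_prod]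
  simp only [finTwoArrowEquiv_symm_apply, Matrix.cons_val_zero, Matrix.cons_val_one]
  have : ∀ a : V, Ex (fun b : V => ind (a = b)) = 1 / Fintype.card V := by
    intro a; classical
    rw [Ex, sum_ind]; simp [filter_eq]
  simp only [this]
  exact (Ex_const _).le

lemma Ex_not_injective_le :
    Ex (fun x : I → V => ind (¬ Function.Injective x)) ≤
      (Fintype.card I : ℝ) ^ 2 / Fintype.card V := by
  classical
  have h1 : ∀ x : I → V, ind (¬ Function.Injective x) ≤
      ∑ p ∈ (univ : Finset (I × I)).filter (fun p => p.1 ≠ p.2), ind (x p.1 = x p.2) := by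
    intro x
    refine le_trans (ind_mono ?_) (ind_exists_le _ _)
    intro h
    rw [Function.not_injective_iff] at h
    obtain ⟨a, b, h, hne⟩ := h
    exact ⟨(a, b), by simpa using hne, h⟩
  refine (Ex_mono h1).trans ?_
  rw [Ex_sum]
  calc _ ≤ ∑ p ∈ (univ : Finset (I × I)).filter (fun p => p.1 ≠ p.2),
        (1 : ℝ) / Fintype.card V :=
        sum_le_sum fun p hp => Ex_coincide_le (by simpa using hp)
    _ ≤ ∑ p : I × I, (1 : ℝ) / Fintype.card V :=
        sum_le_sum_of_subset_of_nonneg (filter_subset _ _) fun _ _ _ => by positivity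
    _ = _ := by simp [sq]; ring

end Tuples

section Basics

variable {V : Type*} [DecidableEq V]

/-- The clause agrees with the assignment `σ` on the sign of every one of its literals. -/
def Cons (σ : V → Bool) (C : SatClause V) : Prop := ∀ l ∈ C, l.2 = σ l.1

/-- The clause on the variable set `e` with signs given by `σ`. -/
def signed (σ : V → Bool) (e : Finset V) : SatClause V := e.image (fun v => (v, σ v))

lemma mem_signed {σ : V → Bool} {e : Finset V} {l : V × Bool} :
    l ∈ signed σ e ↔ l.1 ∈ e ∧ l.2 = σ l.1 := by
  obtain ⟨v, b⟩ := l
  simp only [signed, mem_image, Prod.mk.injEq]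
  constructor
  · rintro ⟨a, ha, rfl, rfl⟩; exact ⟨ha, rfl⟩
  · rintro ⟨h1, h2⟩; exact ⟨v, h1, rfl, h2.symm⟩

lemma clauseVars_signed (σ : V → Bool) (e : Finset V) : clauseVars (signed σ e) = e := by
  ext v; simp [clauseVars, mem_signed]

lemma card_signed (σ : V → Bool) (e : Finset V) : (signed σ e).card = e.card :=
  card_image_of_injective _ fun _ _ h => (Prod.mk.inj h).1

lemma isKClause_signed {k : ℕ} (σ : V → Bool) {e : Finset V} (he : e.card = k) :
    IsKClause k (signed σ e) := by
  rw [IsKClause, card_signed, clauseVars_signed]; exact ⟨he, he⟩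

lemma signed_clauseVars {σ : V → Bool} {C : SatClause V} (h : Cons σ C) :
    signed σ (clauseVars C) = C := by
  ext ⟨v, b⟩
  simp only [mem_signed, clauseVars, mem_image, Prod.exists, exists_and_right, exists_eq_right]
  constructor
  · rintro ⟨⟨c, hc⟩, rfl⟩
    have := h _ hc
    simp only at this
    rwa [← this]
  · intro hb; exact ⟨⟨b, hb⟩, h _ hb⟩

lemma satisfies_signed {a σ : V → Bool} {e : Finset V} :
    SatisfiesClause a (signed σ e) ↔ ∀ v ∈ e, a v = σ v := by
  constructor
  · intro h v hv; exact h (v, σ v) (mem_signed.2 ⟨hv, rfl⟩)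
  · rintro h ⟨v, b⟩ hl
    rw [mem_signed] at hl
    exact (h v hl.1).trans hl.2.symm

lemma satisfies_iff_cons {a : V → Bool} {C : SatClause V} :
    SatisfiesClause a C ↔ Cons a C :=
  ⟨fun h l hl => (h l hl).symm, fun h l hl => (h l hl).symm⟩

/-- The function with all variable signs given by `σ` and clauses on the edges of `H`. -/
noncomputable def unateFun (σ : V → Bool) (H : Finset (Finset V)) : (V → Bool) → Bool :=
  open Classical in fun a => decide (∃ e ∈ H, ∀ v ∈ e, a v = σ v)

lemma unateFun_eq_true {σ : V → Bool} {H : Finset (Finset V)} {a : V → Bool} :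
    unateFun σ H a = true ↔ ∃ e ∈ H, ∀ v ∈ e, a v = σ v := by
  simp [unateFun]

variable [Fintype V]

open Classical in
/-- The minimal `k`-formulas on `V`. -/
noncomputable def minForms (V : Type*) [DecidableEq V] [Fintype V] (k : ℕ) :
    Finset (SatFormula V) :=
  univ.filter fun G => IsKFormula k G ∧ MinimalFormula G

lemma mem_minForms {k : ℕ} {G : SatFormula V} :
    G ∈ minForms V k ↔ IsKFormula k G ∧ MinimalFormula G := by
  simp [minForms]

lemma exists_minimal_formula {k n : ℕ} {f : (Fin n → Bool) → Bool} (hf : IsKSatFunction k n f) :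
    ∃ G ∈ minForms (Fin n) k, ∀ a, f a = true ↔ ∃ C ∈ G, SatisfiesClause a C := by
  classical
  let P : ℕ → Prop := fun m => ∃ G : SatFormula (Fin n), G.card = m ∧ IsKFormula k G ∧
    ∀ a, f a = true ↔ ∃ C ∈ G, SatisfiesClause a C
  have hP : ∃ m, P m := by obtain ⟨G, h1, h2⟩ := hf; exact ⟨_, G, rfl, h1, h2⟩
  obtain ⟨G, hc, h1, h2⟩ := Nat.find_spec hP
  refine ⟨G, mem_minForms.2 ⟨h1, ?_⟩, h2⟩
  intro C hC
  by_contra! hw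
  refine Nat.find_min hP (m := (G.erase C).card) ?_ ⟨G.erase C, rfl, ?_, ?_⟩
  · rw [← hc]; exact card_erase_lt_of_mem hC
  · exact fun D hD => h1 D (mem_of_mem_erase hD)
  · intro a
    rw [h2 a]
    constructor
    · rintro ⟨D, hD, hs⟩
      by_cases hDC : D = C
      · subst hDC
        obtain ⟨D', hD', hs', hne⟩ := hw a hs
        exact ⟨D', mem_erase.2 ⟨hne, hD'⟩, hs'⟩
      · exact ⟨D, mem_erase.2 ⟨hDC, hD⟩, hs⟩
    · rintro ⟨D, hD, hs⟩; exact ⟨D, mem_of_mem_erase hD, hs⟩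

lemma ncard_ksat_le (k n : ℕ) :
    Set.ncard {f : (Fin n → Bool) → Bool | IsKSatFunction k n f} ≤ (minForms (Fin n) k).card := by
  classical
  let F : SatFormula (Fin n) → ((Fin n → Bool) → Bool) :=
    fun G a => decide (∃ C ∈ G, SatisfiesClause a C)
  have : {f : (Fin n → Bool) → Bool | IsKSatFunction k n f} ⊆
      ((minForms (Fin n) k).image F : Set _) := by
    intro f hf
    obtain ⟨G, hG, h⟩ := exists_minimal_formula hf
    simp only [coe_image, Set.mem_image, mem_coe]
    refine ⟨G, hG, ?_⟩
    funext a
    rw [Bool.eq_iff_iff, h a]; simp [F]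
  calc _ ≤ Set.ncard (((minForms (Fin n) k).image F : Finset _) : Set _) :=
        Set.ncard_le_ncard this (finite_toSet _)
    _ = ((minForms (Fin n) k).image F).card := Set.ncard_coe_finset _
    _ ≤ _ := card_image_le

lemma isKSatFunction_unateFun {k n : ℕ} (σ : Fin n → Bool) {H : Finset (Finset (Fin n))}
    (hH : ∀ e ∈ H, e.card = k) : IsKSatFunction k n (unateFun σ H) := by
  refine ⟨H.image (signed σ), ?_, ?_⟩
  · intro C hC
    obtain ⟨e, he, rfl⟩ := mem_image.1 hC
    exact isKClause_signed σ (hH e he)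
  · intro a
    rw [unateFun_eq_true]
    simp only [mem_image, exists_exists_and_eq_and, satisfies_signed]

lemma unateFun_test {σ : V → Bool} {H : Finset (Finset V)} {e : Finset V} :
    (unateFun σ H (fun v => if v ∈ e then σ v else !σ v) = true ↔ ∃ f ∈ H, f ⊆ e) := by
  rw [unateFun_eq_true]
  refine exists_congr fun f => and_congr_right fun _ => forall₂_congr fun v _ => ?_
  by_cases hv : v ∈ e <;> simp [hv]

lemma unateFun_sign {k : ℕ} {σ σ' : V → Bool} {H H' : Finset (Finset V)}
    (hH : ∀ e ∈ H, e.card = k) (hcov : ∀ v, ∃ e ∈ H, v ∈ e)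
    (h : unateFun σ H = unateFun σ' H') : σ = σ' := by
  by_contra hne
  obtain ⟨v, hv⟩ := Function.ne_iff.1 hne
  obtain ⟨e, he, hve⟩ := hcov v
  have h1 : unateFun σ H (fun v => if v ∈ e then σ v else !σ v) = true :=
    unateFun_test.2 ⟨e, he, subset_rfl⟩
  have h2 : ¬ unateFun σ H (fun u => if u ∈ e.erase v then σ u else !σ u) = true := by
    rw [unateFun_test]
    rintro ⟨f, hf, hfe⟩
    have := card_le_card hfe
    rw [hH f hf, card_erase_of_mem hve, hH e he] at this
    have : 0 < e.card := card_pos.2 ⟨v, hve⟩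
    rw [hH e he] at this
    omega
  apply h2
  rw [h, unateFun_eq_true] at h1 ⊢
  obtain ⟨f, hf, hs⟩ := h1
  refine ⟨f, hf, fun u hu => ?_⟩
  by_cases huv : u = v
  · subst huv
    simp only [mem_erase, ne_eq, not_true_eq_false, false_and, if_false]
    revert hv; cases σ u <;> cases σ' u <;> simp
  · have := hs u hu
    simpa [huv] using this

lemma unateFun_edges {k : ℕ} {σ : V → Bool} {H H' : Finset (Finset V)}
    (hH : ∀ e ∈ H, e.card = k) (hH' : ∀ e ∈ H', e.card = k)
    (h : unateFun σ H = unateFun σ H') : H ⊆ H' := by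
  intro e he
  have h1 := (unateFun_test (σ := σ) (e := e)).2 ⟨e, he, subset_rfl⟩
  rw [h, unateFun_test] at h1
  obtain ⟨f, hf, hfe⟩ := h1
  have := eq_of_subset_of_card_le hfe (by rw [hH e he, hH' f hf])
  rwa [← this]

open Classical in
/-- The `k`-uniform hypergraphs on `V` without isolated vertices. -/
noncomputable def covering (V : Type*) [DecidableEq V] [Fintype V] (k : ℕ) :
    Finset (Finset (Finset V)) :=
  ((univ : Finset V).powersetCard k).powerset.filter fun H => ∀ v, ∃ e ∈ H, v ∈ e

lemma card_covering (k : ℕ) :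
    2 ^ (Fintype.card V).choose k ≤
      (covering V k).card + Fintype.card V * 2 ^ (Fintype.card V - 1).choose k := by
  classical
  have h1 : ((univ : Finset V).powersetCard k).powerset ⊆ covering V k ∪
      (univ : Finset V).biUnion fun v => ((univ.erase v).powersetCard k).powerset := by
    intro H hH
    by_cases hc : ∀ v, ∃ e ∈ H, v ∈ e
    · exact mem_union_left _ (mem_filter.2 ⟨hH, hc⟩)
    · push Not at hc
      obtain ⟨v, hv⟩ := hc
      refine mem_union_right _ (mem_biUnion.2 ⟨v, mem_univ _, mem_powerset.2 fun e he => ?_⟩)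
      have := mem_powersetCard.1 (mem_powerset.1 hH he)
      exact mem_powersetCard.2 ⟨fun u hu => mem_erase.2
        ⟨fun h => hv e he (h ▸ hu), mem_univ _⟩, this.2⟩
  have h2 := (card_le_card h1).trans (card_union_le _ _)
  rw [card_powerset, card_powersetCard, card_univ] at h2
  refine h2.trans (Nat.add_le_add_left ?_ _)
  refine card_biUnion_le.trans (le_of_eq ?_)
  simp [card_erase_of_mem]

lemma le_ncard_ksat (k n : ℕ) :
    2 ^ n * (covering (Fin n) k).card ≤
      Set.ncard {f : (Fin n → Bool) → Bool | IsKSatFunction k n f} := by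
  classical
  have hmem : ∀ {H}, H ∈ covering (Fin n) k → (∀ e ∈ H, e.card = k) ∧ ∀ v, ∃ e ∈ H, v ∈ e := by
    intro H hH
    simp only [covering, mem_filter, mem_powerset] at hH
    exact ⟨fun e he => (mem_powersetCard.1 (hH.1 he)).2, hH.2⟩
  let S := ((univ : Finset (Fin n → Bool)) ×ˢ covering (Fin n) k)
  let F : (Fin n → Bool) × Finset (Finset (Fin n)) → ((Fin n → Bool) → Bool) :=
    fun p => unateFun p.1 p.2
  have hinj : Set.InjOn F S := by
    rintro ⟨σ, H⟩ h1 ⟨σ', H'⟩ h2 h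
    simp only [S, coe_product, Set.mem_prod, mem_coe] at h1 h2
    obtain ⟨a1, a2⟩ := hmem h1.2
    obtain ⟨b1, b2⟩ := hmem h2.2
    have hs : σ = σ' := unateFun_sign a1 a2 h
    subst hs
    have : H = H' := Subset.antisymm (unateFun_edges a1 b1 h) (unateFun_edges b1 a1 h.symm)
    rw [this]
  have hc : (S.image F).card = 2 ^ n * (covering (Fin n) k).card := by
    rw [card_image_of_injOn hinj, card_product]; simp
  rw [← hc, ← Set.ncard_coe_finset]
  refine Set.ncard_le_ncard ?_ (Set.toFinite _)
  intro f hf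
  simp only [coe_image, Set.mem_image, mem_coe] at hf
  obtain ⟨p, hp, rfl⟩ := hf
  exact isKSatFunction_unateFun _ (hmem (mem_product.1 hp).2).1

lemma card_consistent_le (k : ℕ) (S : Finset (SatFormula V)) (hS : ∀ G ∈ S, IsKFormula k G)
    (hu : ∀ G ∈ S, ∃ σ, ∀ C ∈ G, Cons σ C) :
    S.card ≤ 2 ^ (Fintype.card V + (Fintype.card V).choose k) := by
  classical
  let T := ((univ : Finset (V → Bool)) ×ˢ ((univ : Finset V).powersetCard k).powerset)
  have : S ⊆ T.image (fun p => p.2.image (signed p.1)) := by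
    intro G hG
    obtain ⟨σ, hσ⟩ := hu G hG
    refine mem_image.2 ⟨(σ, G.image clauseVars), ?_, ?_⟩
    · refine mem_product.2 ⟨mem_univ _, mem_powerset.2 fun e he => ?_⟩
      obtain ⟨C, hC, rfl⟩ := mem_image.1 he
      exact mem_powersetCard.2 ⟨subset_univ _, (hS G hG C hC).2⟩
    · simp only [image_image]
      calc _ = G.image id := image_congr fun C hC => signed_clauseVars (hσ C hC)
        _ = G := image_id
  refine (card_le_card this).trans (card_image_le.trans ?_)
  rw [card_product, card_powerset, card_powersetCard, card_univ, card_univ, Fintype.card_fun]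
  simp [pow_add]

end Basics

section Lift

variable {U V : Type*} [DecidableEq U] [DecidableEq V]

/-- The clause on the variables `x u`, `u ∈ e`, with the sign `s u` at `x u`. -/
def lift (x : U → V) (s : U → Bool) (e : Finset U) : SatClause V := e.image fun u => (x u, s u)

lemma mem_lift {x : U → V} {s : U → Bool} {e : Finset U} {l : V × Bool} :
    l ∈ lift x s e ↔ ∃ u ∈ e, x u = l.1 ∧ s u = l.2 := by
  simp [lift, Prod.ext_iff]

lemma clauseVars_lift (x : U → V) (s : U → Bool) (e : Finset U) :
    clauseVars (lift x s e) = e.image x := by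
  rw [clauseVars, lift, image_image]; rfl

lemma isKClause_lift {k : ℕ} {x : U → V} {s : U → Bool} {e : Finset U} (he : e.card = k)
    (hx : Set.InjOn x e) : IsKClause k (lift x s e) := by
  rw [IsKClause, clauseVars_lift, lift, card_image_of_injOn hx, card_image_of_injOn]
  · exact ⟨he, he⟩
  · intro a ha b hb h; exact hx ha hb (Prod.mk.inj h).1

lemma satisfies_lift {a : V → Bool} {x : U → V} {s : U → Bool} {e : Finset U} :
    SatisfiesClause a (lift x s e) ↔ ∀ u ∈ e, a (x u) = s u := by
  constructor
  · intro h u hu; exact h (x u, s u) (mem_lift.2 ⟨u, hu, rfl, rfl⟩)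
  · intro h l hl
    obtain ⟨u, hu, h1, h2⟩ := mem_lift.1 hl
    rw [← h1, ← h2]; exact h u hu

lemma exists_sign {k : ℕ} {C : SatClause V} (hC : IsKClause k C) :
    ∃ σ : V → Bool, C = signed σ (clauseVars C) := by
  have hinj : Set.InjOn Prod.fst (C : Set (V × Bool)) :=
    card_image_iff.1 (hC.2.trans hC.1.symm)
  classical
  refine ⟨fun v => decide ((v, true) ∈ C), (signed_clauseVars ?_).symm⟩
  rintro ⟨v, b⟩ hl
  cases b
  · simp only [Bool.false_eq, decide_eq_false_iff_not]
    intro h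
    have := hinj hl h rfl
    simp at this
  · simpa using hl

lemma exists_lift {k : ℕ} {C : SatClause V} (hC : IsKClause k C) {x : U → V}
    {e : Finset U} (h : clauseVars C = e.image x) : ∃ s, C = lift x s e := by
  obtain ⟨σ, hσ⟩ := exists_sign hC
  refine ⟨σ ∘ x, ?_⟩
  rw [hσ, h]
  simp only [signed, lift, image_image]; rfl

end Lift

section Counting

universe u

variable {V : Type*} [Fintype V] [DecidableEq V]

lemma card_tuples_image_eq {k : ℕ} {f : Finset V} (hf : f.card = k) :
    (univ.filter fun z : Fin k → V => univ.image z = f).card = k.factorial := by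
  have h0 : Fintype.card (Fin k ≃ f) = k.factorial := by
    rw [Fintype.card_equiv (Fintype.equivOfCardEq (by simp [hf]))]; simp
  rw [← h0, ← Fintype.card_coe]
  refine Fintype.card_congr (Equiv.ofBijective
    (fun z : {z // z ∈ univ.filter fun z : Fin k → V => univ.image z = f} =>
      Equiv.ofBijective (fun i => (⟨z.1 i, by
        have := (mem_filter.1 z.2).2
        exact (Finset.ext_iff.1 this _).1 (mem_image_of_mem _ (mem_univ i))⟩ : f)) ?_) ⟨?_, ?_⟩)
  · rw [Fintype.bijective_iff_surjective_and_card]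
    refine ⟨?_, by simp [hf]⟩
    rintro ⟨v, hv⟩
    have := (mem_filter.1 z.2).2
    rw [← this, mem_image] at hv
    obtain ⟨i, -, hi⟩ := hv
    exact ⟨i, Subtype.ext hi⟩
  · intro z z' h
    apply Subtype.ext
    funext i
    have := congrArg (fun e => ((e i : f) : V)) h
    simpa using this
  · intro e
    refine ⟨⟨fun i => e i, ?_⟩, ?_⟩
    · refine mem_filter.2 ⟨mem_univ _, ?_⟩
      ext v
      simp only [mem_image, mem_univ, true_and]
      constructor
      · rintro ⟨i, rfl⟩; exact (e i).2
      · intro hv; exact ⟨e.symm ⟨v, hv⟩, by simp⟩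
    · ext i; simp

lemma sum_tuples_image {k : ℕ} (g : Finset V → ℝ) (hg : ∀ f, f.card < k → g f = 0) :
    ∑ z : Fin k → V, g (univ.image z) =
      k.factorial * ∑ f ∈ (univ : Finset V).powersetCard k, g f := by
  rw [← sum_fiberwise_of_maps_to (s := univ) (t := (univ : Finset (Finset V)))
    (g := fun z : Fin k → V => univ.image z) (fun _ _ => mem_univ _), mul_sum]
  symm
  apply sum_subset_zero_on_sdiff (subset_univ _)
  · intro f hf
    refine sum_eq_zero fun z hz => ?_
    have hz := (mem_filter.1 hz).2
    rw [hz]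
    apply hg
    have h1 : f.card ≤ k := by
      rw [← hz]; exact card_image_le.trans (by simp)
    have h2 : f.card ≠ k := fun h => (mem_sdiff.1 hf).2
      (mem_powersetCard.2 ⟨subset_univ _, h⟩)
    omega
  · intro f hf
    rw [sum_congr rfl (fun z hz => by rw [(mem_filter.1 hz).2]), sum_const,
      card_tuples_image_eq (mem_powersetCard.1 hf).2, nsmul_eq_mul]

lemma Ex_tuples_image {k : ℕ} (g : Finset V → ℝ) (hg : ∀ f, f.card < k → g f = 0) :
    (Fintype.card V : ℝ) ^ k * Ex (fun z : Fin k → V => g (univ.image z)) =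
      k.factorial * ∑ f ∈ (univ : Finset V).powersetCard k, g f := by
  rw [← sum_tuples_image g hg, Ex, Fintype.card_fun, Fintype.card_fin, Nat.cast_pow]
  rcases eq_or_ne ((Fintype.card V : ℝ) ^ k) 0 with h | h
  · have : IsEmpty (Fin k → V) := by
      rw [← Fintype.card_eq_zero_iff, Fintype.card_fun, Fintype.card_fin]
      exact_mod_cast h
    simp
  · field_simp

/-- The `k`-clauses on `V`. -/
def kClauses (V : Type*) [Fintype V] [DecidableEq V] (k : ℕ) : Finset (SatClause V) :=
  univ.filter fun C => C.card = k ∧ (clauseVars C).card = k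

lemma mem_kClauses {k : ℕ} {C : SatClause V} : C ∈ kClauses V k ↔ IsKClause k C := by
  simp [kClauses, IsKClause]

lemma card_kClauses_above_le {k : ℕ} {E : SatClause V} :
    ((kClauses V k).filter fun C => E ⊆ C).card ≤ (2 * Fintype.card V) ^ (k - E.card) := by
  have h1 : ((kClauses V k).filter fun C => E ⊆ C).card ≤
      ((univ : Finset (V × Bool)).powersetCard (k - E.card)).card := by
    apply card_le_card_of_injOn (fun C => C \ E)
    · intro C hC
      obtain ⟨h1, h2⟩ := mem_filter.1 hC
      refine mem_powersetCard.2 ⟨subset_univ _, ?_⟩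
      rw [card_sdiff_of_subset h2, (mem_kClauses.1 h1).1]
    · intro C hC D hD h
      have hC := (mem_filter.1 hC).2
      have hD := (mem_filter.1 hD).2
      have h : C \ E = D \ E := h
      rw [← sdiff_union_of_subset hC, ← sdiff_union_of_subset hD, h]
  refine h1.trans ?_
  rw [card_powersetCard]
  refine (Nat.choose_le_pow _ _).trans ?_
  simp [mul_comm]

lemma card_kClauses_le (k : ℕ) : (kClauses V k).card ≤ (2 * Fintype.card V) ^ k := by
  have := card_kClauses_above_le (V := V) (k := k) (E := ∅)
  simpa using this

lemma card_kClauses_touching_le (k : ℕ) (Y : Finset V) :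
    ((kClauses V k).filter fun C => ¬ Disjoint (clauseVars C) Y).card ≤
      2 * Y.card * (2 * Fintype.card V) ^ (k - 1) := by
  have h1 : ((kClauses V k).filter fun C => ¬ Disjoint (clauseVars C) Y) ⊆
      (Y ×ˢ (univ : Finset Bool)).biUnion fun l => (kClauses V k).filter fun C => {l} ⊆ C := by
    intro C hC
    obtain ⟨h1, h2⟩ := mem_filter.1 hC
    rw [not_disjoint_iff] at h2
    obtain ⟨v, hv, hY⟩ := h2
    obtain ⟨⟨w, b⟩, hl, rfl⟩ := mem_image.1 hv
    exact mem_biUnion.2 ⟨(w, b), mem_product.2 ⟨hY, mem_univ _⟩,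
      mem_filter.2 ⟨h1, singleton_subset_iff.2 hl⟩⟩
  refine (card_le_card h1).trans (card_biUnion_le.trans ?_)
  calc _ ≤ ∑ _l ∈ Y ×ˢ (univ : Finset Bool), (2 * Fintype.card V) ^ (k - 1) :=
        sum_le_sum fun l _ => by
          have := card_kClauses_above_le (V := V) (k := k) (E := {l})
          simpa using this
    _ = _ := by
        rw [sum_const, card_product]
        simp [mul_comm]

lemma card_small_subsets_le {α : Type*} [DecidableEq α] (A : Finset α) {r x : ℝ} (hx : 0 < x)
    (hx1 : x ≤ 1) (S : Finset (Finset α)) (hS : ∀ B ∈ S, B ⊆ A ∧ (B.card : ℝ) ≤ r) :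
    (S.card : ℝ) ≤ Real.exp (r * Real.log (1 / x) + x * A.card) := by
  have h1 : ∑ B ∈ A.powerset, x ^ B.card = (1 + x) ^ A.card := by
    have := prod_add (fun _ : α => x) (fun _ => (1 : ℝ)) A
    simp only [prod_const, one_pow, mul_one] at this
    rw [← this, add_comm]
  have h2 : ∀ B ∈ S, Real.exp (- (r * Real.log (1 / x))) ≤ x ^ B.card := by
    intro B hB
    rw [one_div, Real.log_inv, mul_neg, neg_neg]
    calc _ ≤ Real.exp (B.card * Real.log x) := by
          apply Real.exp_le_exp.2
          exact mul_le_mul_of_nonpos_right (hS B hB).2 (Real.log_nonpos hx.le hx1)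
      _ = _ := by rw [Real.exp_nat_mul, Real.exp_log hx]
  have h3 : S.card * Real.exp (- (r * Real.log (1 / x))) ≤ Real.exp (x * A.card) := by
    calc _ = ∑ B ∈ S, Real.exp (- (r * Real.log (1 / x))) := by simp
      _ ≤ ∑ B ∈ S, x ^ B.card := sum_le_sum h2
      _ ≤ ∑ B ∈ A.powerset, x ^ B.card :=
          sum_le_sum_of_subset_of_nonneg (fun B hB => mem_powerset.2 (hS B hB).1)
            fun _ _ _ => by positivity
      _ = (1 + x) ^ A.card := h1
      _ ≤ Real.exp x ^ A.card := by
          gcongr; rw [add_comm]; exact Real.add_one_le_exp x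
      _ = _ := by rw [← Real.exp_nat_mul, mul_comm]
  rw [Real.exp_neg, ← div_eq_mul_inv, div_le_iff₀ (Real.exp_pos _)] at h3
  rw [add_comm, Real.exp_add]; exact h3

/-- Few subsets of a set of size `O(N)` have size at most a small multiple of `N`. -/
lemma exists_card_small_subsets_le (K : ℝ) {η : ℝ} (hη : 0 < η) :
    ∃ ε > 0, ∀ (α : Type u) [DecidableEq α] (A : Finset α) (N : ℝ) (S : Finset (Finset α)),
      0 ≤ N → (A.card : ℝ) ≤ K * N → (∀ B ∈ S, B ⊆ A ∧ (B.card : ℝ) ≤ ε * N) →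
      (S.card : ℝ) ≤ Real.exp (η * N) := by
  let K' := max K 1
  have hK' : 1 ≤ K' := le_max_right _ _
  let x := min 1 (η / (2 * K'))
  have hx : 0 < x := lt_min one_pos (by positivity)
  have hx1 : x ≤ 1 := min_le_left _ _
  have hL : 0 ≤ Real.log (1 / x) := Real.log_nonneg (by rw [le_div_iff₀ hx]; linarith)
  refine ⟨η / (2 * (Real.log (1 / x) + 1)), by positivity, ?_⟩
  intro α _ A N S hN hA hS
  refine (card_small_subsets_le A hx hx1 S hS).trans (Real.exp_le_exp.2 ?_)
  have h1 : x * A.card ≤ η / 2 * N := by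
    calc x * A.card ≤ (η / (2 * K')) * (K' * N) := by
          apply mul_le_mul (min_le_right _ _) _ (Nat.cast_nonneg _) (by positivity)
          exact hA.trans (mul_le_mul_of_nonneg_right (le_max_left _ _) hN)
      _ = _ := by field_simp
  have h2 : η / (2 * (Real.log (1 / x) + 1)) * N * Real.log (1 / x) ≤ η / 2 * N := by
    rw [div_mul_eq_mul_div, div_mul_eq_mul_div, div_le_iff₀ (by positivity)]
    nlinarith [mul_nonneg hη.le hN]
  linarith

end Counting

section Box

variable {X V : Type*} [Fintype X] [Fintype V]

lemma Ex_fin_succ {w : ℕ} (f : (Fin (w + 1) → X) → ℝ) :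
    Ex f = Ex (fun y : Fin w → X => Ex (fun a : X => f (Fin.cons a y))) := by
  rw [← Ex_equiv (Fin.consEquiv (fun _ : Fin (w + 1) => X)), Ex_prod, Ex_comm]
  rfl

lemma Ex_sq_eq (f : X → ℝ) :
    (Ex f) ^ 2 = Ex (fun c : Bool → X => f (c false) * f (c true)) := by
  rw [← Ex_equiv (Equiv.boolArrowEquivProd X).symm, Ex_prod, sq, ← Ex_mul_const]
  refine Ex_congr fun a => ?_
  rw [← Ex_const_mul]
  rfl

/-- Doubling all coordinates: the box-norm inequality for nonnegative functions. -/
lemma box_inequality : ∀ (w : ℕ) (F : (Fin w → V) → ℝ), (∀ z, 0 ≤ F z) →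
    (Ex F) ^ (2 ^ w) ≤
      Ex (fun x : Fin w → Bool → V => ∏ ω : Fin w → Bool, F (fun i => x i (ω i)))
  | 0, F, _ => by
    simp only [pow_zero, pow_one, Ex, univ_unique, sum_singleton, Fintype.card_unique,
      prod_singleton]
    rw [Subsingleton.elim (default : Fin 0 → V) (fun i => (default : Fin 0 → Bool → V) i
      ((default : Fin 0 → Bool) i))]
    simp only [Nat.cast_one, div_one]
    exact le_of_eq (congrArg F (Subsingleton.elim _ _))
  | w + 1, F, hF => by
    let H : (Bool → V) → (Fin w → V) → ℝ :=
      fun c y => F (Fin.cons (c false) y) * F (Fin.cons (c true) y)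
    have hH : ∀ c y, 0 ≤ H c y := fun c y => mul_nonneg (hF _) (hF _)
    have h1 : (Ex F) ^ 2 ≤ Ex (fun c => Ex (H c)) := by
      rw [Ex_fin_succ]
      refine (Ex_pow_le (fun y => Ex_nonneg fun a => hF _) 1).trans ?_
      simp only [Nat.reduceAdd]
      rw [Ex_comm H]
      exact Ex_mono fun y => (Ex_sq_eq _).le
    obtain ⟨m, hm⟩ : ∃ m, 2 ^ w = m + 1 := ⟨2 ^ w - 1, by have := Nat.one_le_two_pow (n := w); omega⟩
    have hE : 0 ≤ Ex F := Ex_nonneg hF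
    calc (Ex F) ^ (2 ^ (w + 1)) = ((Ex F) ^ 2) ^ (2 ^ w) := by rw [← pow_mul, pow_succ, mul_comm]
      _ ≤ (Ex (fun c => Ex (H c))) ^ (2 ^ w) := by gcongr
      _ ≤ Ex (fun c => (Ex (H c)) ^ (2 ^ w)) := by
          rw [hm]; exact Ex_pow_le (fun c => Ex_nonneg (hH c)) m
      _ ≤ Ex (fun c => Ex (fun x : Fin w → Bool → V =>
            ∏ ω : Fin w → Bool, H c (fun i => x i (ω i)))) :=
          Ex_mono fun c => box_inequality w (H c) (hH c)
      _ = _ := by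
          rw [Ex_fin_succ, Ex_comm]
          refine Ex_congr fun x => Ex_congr fun c => ?_
          rw [← (Fin.consEquiv (fun _ : Fin (w + 1) => Bool)).prod_comp, Fintype.prod_prod_type,
            Fintype.prod_bool, mul_comm, ← prod_mul_distrib]
          refine prod_congr rfl fun ω _ => ?_
          simp only [H]
          congr 2 <;>
          · funext i
            refine Fin.cases ?_ (fun i => ?_) i <;> simp [Fin.consEquiv]

lemma box_density (w : ℕ) (P : (Fin w → V) → Prop) :
    (Ex fun z => ind (P z)) ^ (2 ^ w) ≤
      Ex (fun x : Fin w × Bool → V => ind (∀ ω : Fin w → Bool, P fun i => x (i, ω i))) := by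
  refine (box_inequality w _ fun z => ind_nonneg _).trans (le_of_eq ?_)
  rw [← Ex_equiv (Equiv.curry (Fin w) Bool V)]
  refine Ex_congr fun x => ?_
  rw [← ind_forall_eq]
  simp [Function.curry]

end Box

section CondExp

variable {Ω : Type*} [Fintype Ω] {α β : Type*}

/-- The conditional average of `φ` over the fibre of `D`. -/
noncomputable def condE (D : Ω → α) (φ : Ω → ℝ) (ω : Ω) : ℝ :=
  (∑ ω', ind (D ω' = D ω) * φ ω') / ∑ ω', ind (D ω' = D ω)

lemma condE_meas (D : Ω → α) (φ : Ω → ℝ) {ω ω' : Ω} (h : D ω = D ω') :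
    condE D φ ω = condE D φ ω' := by
  simp only [condE, h]

lemma condE_denom_pos (D : Ω → α) (ω : Ω) : 0 < ∑ ω', ind (D ω' = D ω) := by
  refine sum_pos' (fun _ _ => ind_nonneg _) ⟨ω, mem_univ _, ?_⟩
  rw [ind_true rfl]; exact one_pos

lemma condE_nonneg (D : Ω → α) {φ : Ω → ℝ} (h : ∀ ω, 0 ≤ φ ω) (ω : Ω) : 0 ≤ condE D φ ω :=
  div_nonneg (sum_nonneg fun _ _ => mul_nonneg (ind_nonneg _) (h _)) (condE_denom_pos D ω).le

lemma condE_le_one (D : Ω → α) {φ : Ω → ℝ} (h : ∀ ω, φ ω ≤ 1) (ω : Ω) : condE D φ ω ≤ 1 := by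
  rw [condE, div_le_one (condE_denom_pos D ω)]
  exact sum_le_sum fun _ _ => mul_le_of_le_one_right (ind_nonneg _) (h _)

lemma Ex_condE_mul (D : Ω → α) (φ ψ : Ω → ℝ) (hψ : ∀ ω ω', D ω = D ω' → ψ ω = ψ ω') :
    Ex (fun ω => condE D φ ω * ψ ω) = Ex (fun ω => φ ω * ψ ω) := by
  simp only [Ex]
  congr 1
  calc ∑ ω, condE D φ ω * ψ ω
      = ∑ ω, ∑ ω', ind (D ω' = D ω) * φ ω' * ψ ω' / ∑ ω'', ind (D ω'' = D ω') := by
        refine sum_congr rfl fun ω _ => ?_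
        rw [condE, div_mul_eq_mul_div, sum_mul, sum_div]
        refine sum_congr rfl fun ω' _ => ?_
        by_cases h : D ω' = D ω
        · rw [hψ _ _ h, h]
        · rw [ind_false h]; simp
    _ = ∑ ω', φ ω' * ψ ω' := by
        rw [sum_comm]
        refine sum_congr rfl fun ω' _ => ?_
        rw [← sum_div, ← sum_mul, ← sum_mul, mul_assoc, mul_comm]
        have h := condE_denom_pos D ω'
        have h2 : ∑ ω, ind (D ω' = D ω) = ∑ ω'', ind (D ω'' = D ω') :=
          sum_congr rfl fun _ _ => ind_congr eq_comm
        rw [h2, mul_div_assoc, div_self h.ne', mul_one]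

lemma Ex_condE_sub_sq (D : Ω → α) (D' : Ω → β) (φ : Ω → ℝ)
    (hD : ∀ ω ω', D' ω = D' ω' → D ω = D ω') :
    Ex (fun ω => (condE D' φ ω - condE D φ ω) ^ 2) =
      Ex (fun ω => condE D' φ ω ^ 2) - Ex (fun ω => condE D φ ω ^ 2) := by
  have h1 : Ex (fun ω => condE D' φ ω * condE D φ ω) = Ex (fun ω => condE D φ ω ^ 2) := by
    rw [Ex_condE_mul D' φ _ fun ω ω' h => condE_meas D φ (hD ω ω' h),
      ← Ex_condE_mul D φ _ fun ω ω' h => condE_meas D φ h]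
    exact Ex_congr fun ω => (sq _).symm
  have h2 : ∀ ω, (condE D' φ ω - condE D φ ω) ^ 2 =
      condE D' φ ω ^ 2 - 2 * (condE D' φ ω * condE D φ ω) + condE D φ ω ^ 2 := fun ω => by ring
  simp only [h2, Ex_add, Ex_sub, Ex_const_mul, h1]
  ring

/-- Replacing events by approximate conditional probabilities one at a time. -/
lemma Ex_prod_telescope {ι : Type*} [DecidableEq ι] (a b : ι → Ω → ℝ) (D : ι → Ω → α)
    (ha : ∀ i ω, 0 ≤ a i ω ∧ a i ω ≤ 1) (hb : ∀ i ω, 0 ≤ b i ω ∧ b i ω ≤ 1) :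
    ∀ (S T : Finset ι), Disjoint S T →
    (∀ i ∈ S, ∀ j ∈ S ∪ T, j ≠ i → ∀ ω ω', D i ω = D i ω' → a j ω = a j ω' ∧ b j ω = b j ω') →
    Ex (fun ω => (∏ i ∈ S, b i ω) * ∏ i ∈ T, a i ω) ≤
      Ex (fun ω => ∏ i ∈ S ∪ T, a i ω) +
        ∑ i ∈ S, Ex (fun ω => |condE (D i) (a i) ω - b i ω|) := by
  intro S
  induction S using Finset.induction_on with
  | empty => intro T _ _; simp
  | insert i S hi ih =>
    intro T hd hm
    rw [disjoint_insert_left] at hd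
    have hrest : ∀ ω, 0 ≤ (∏ j ∈ S, b j ω) * ∏ j ∈ T, a j ω ∧
        (∏ j ∈ S, b j ω) * ∏ j ∈ T, a j ω ≤ 1 := by
      intro ω
      have h1 := prod_nonneg (s := S) fun j _ => (hb j ω).1
      have h2 := prod_nonneg (s := T) fun j _ => (ha j ω).1
      have h3 := prod_le_one (s := S) (fun j _ => (hb j ω).1) fun j _ => (hb j ω).2
      have h4 := prod_le_one (s := T) (fun j _ => (ha j ω).1) fun j _ => (ha j ω).2
      exact ⟨mul_nonneg h1 h2, mul_le_one₀ h3 h2 h4⟩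
    have h1 : Ex (fun ω => (∏ j ∈ insert i S, b j ω) * ∏ j ∈ T, a j ω) ≤
        Ex (fun ω => condE (D i) (a i) ω * ((∏ j ∈ S, b j ω) * ∏ j ∈ T, a j ω)) +
          Ex (fun ω => |condE (D i) (a i) ω - b i ω|) := by
      rw [← Ex_add]
      refine Ex_mono fun ω => ?_
      rw [prod_insert hi]
      have h1 := neg_abs_le (condE (D i) (a i) ω - b i ω)
      have h2 := (hrest ω)
      set r := (∏ j ∈ S, b j ω) * ∏ j ∈ T, a j ω
      rw [mul_assoc]
      change b i ω * r ≤ _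
      nlinarith [abs_nonneg (condE (D i) (a i) ω - b i ω)]
    rw [Ex_condE_mul] at h1
    · have h2 := ih (insert i T) (disjoint_insert_right.2 ⟨hi, hd.2⟩) (by
        intro i' hi' j hj
        refine hm i' (mem_insert_of_mem hi') j ?_
        rw [union_insert] at hj
        rwa [insert_union])
      have h3 : ∀ ω, a i ω * ((∏ j ∈ S, b j ω) * ∏ j ∈ T, a j ω) =
          (∏ j ∈ S, b j ω) * ∏ j ∈ insert i T, a j ω := by
        intro ω; rw [prod_insert hd.1]; ring
      simp only [h3] at h1
      rw [sum_insert hi, insert_union, ← union_insert]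
      linarith
    · intro ω ω' h
      congr 1
      · refine prod_congr rfl fun j hj => (hm i (mem_insert_self _ _) j ?_ ?_ ω ω' h).2
        · exact mem_union_left _ (mem_insert_of_mem hj)
        · rintro rfl; exact hi hj
      · refine prod_congr rfl fun j hj => (hm i (mem_insert_self _ _) j ?_ ?_ ω ω' h).1
        · exact mem_union_right _ hj
        · rintro rfl; exact hd.1 hj

end CondExp

section ClauseMap

variable {U V : Type*} [DecidableEq U] [DecidableEq V]

/-- Relabel the variables of a clause. -/
def cmap (x : U → V) (C : SatClause U) : SatClause V := C.image fun l => (x l.1, l.2)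

lemma mem_cmap {x : U → V} {C : SatClause U} {l : V × Bool} :
    l ∈ cmap x C ↔ ∃ v, (v, l.2) ∈ C ∧ x v = l.1 := by
  obtain ⟨w, b⟩ := l
  simp [cmap]

lemma clauseVars_cmap (x : U → V) (C : SatClause U) :
    clauseVars (cmap x C) = (clauseVars C).image x := by
  simp only [clauseVars, cmap, image_image]; rfl

lemma satisfies_cmap {a : V → Bool} {x : U → V} {C : SatClause U} :
    SatisfiesClause a (cmap x C) ↔ SatisfiesClause (a ∘ x) C := by
  constructor
  · rintro h ⟨v, b⟩ hl; exact h (x v, b) (mem_cmap.2 ⟨v, hl, rfl⟩)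
  · rintro h ⟨v, b⟩ hl
    obtain ⟨w, hw, hv⟩ := mem_cmap.1 hl
    have := h _ hw
    simp only [Function.comp_apply] at this hv ⊢
    rw [← hv]; exact this

lemma cmap_injective {x : U → V} (hx : Function.Injective x) : Function.Injective (cmap x) :=
  image_injective fun a b h => by
    obtain ⟨h1, h2⟩ := Prod.mk.inj h
    exact Prod.ext (hx h1) h2

lemma cmap_lift {W : Type*} [DecidableEq W] (x : U → V) (j : W → U) (s : W → Bool)
    (e : Finset W) : cmap x (lift j s e) = lift (x ∘ j) s e := by
  simp only [cmap, lift, image_image]; rfl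

lemma exists_fin_lift {k : ℕ} {C : SatClause U} (hC : IsKClause k C) :
    ∃ (e : Fin k → U) (s : Fin k → Bool), Function.Injective e ∧ C = lift e s univ := by
  let e : Fin k → U := fun i => ((clauseVars C).equivFinOfCardEq hC.2).symm i
  have he : Function.Injective e := fun i j h => by
    simpa using Subtype.ext h
  have h1 : clauseVars C = univ.image e := by
    ext v
    simp only [mem_image, mem_univ, true_and, e]
    constructor
    · intro hv; exact ⟨(clauseVars C).equivFinOfCardEq hC.2 ⟨v, hv⟩, by simp⟩
    · rintro ⟨i, rfl⟩; exact (((clauseVars C).equivFinOfCardEq hC.2).symm i).2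
  obtain ⟨s, hs⟩ := exists_lift hC h1
  exact ⟨e, s, he, hs⟩

end ClauseMap

section Energy

variable {V Ω : Type*} [Fintype V] [DecidableEq V] [Fintype Ω] (Gf : Ω → SatFormula V)

/-- The clauses supported inside `X` but not exactly on `f`. -/
def restr (X f : Finset V) (ω : Ω) : SatFormula V :=
  (Gf ω).filter fun C => clauseVars C ⊆ X ∧ clauseVars C ≠ f

/-- The conditional probability that `C` is present given the other clauses inside `X`. -/
noncomputable def prb (X : Finset V) (C : SatClause V) (ω : Ω) : ℝ :=
  condE (restr Gf X (clauseVars C)) (fun ω => ind (C ∈ Gf ω)) ω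

/-- The mean square of `prb` over random sets of `k + m` vertices. -/
noncomputable def energy {k : ℕ} (m : ℕ) (s : Fin k → Bool) : ℝ :=
  Ex fun x : Fin k ⊕ Fin m → V =>
    Ex fun ω => prb Gf (univ.image x) (lift (x ∘ Sum.inl) s univ) ω ^ 2

lemma prb_nonneg (X : Finset V) (C : SatClause V) (ω : Ω) : 0 ≤ prb Gf X C ω :=
  condE_nonneg _ (fun _ => ind_nonneg _) _

lemma prb_le_one (X : Finset V) (C : SatClause V) (ω : Ω) : prb Gf X C ω ≤ 1 :=
  condE_le_one _ (fun _ => ind_le_one _) _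

lemma restr_mono {X X' f : Finset V} (h : X ⊆ X') {ω ω' : Ω}
    (hr : restr Gf X' f ω = restr Gf X' f ω') : restr Gf X f ω = restr Gf X f ω' := by
  have : ∀ ω, restr Gf X f ω = (restr Gf X' f ω).filter fun C => clauseVars C ⊆ X := by
    intro ω
    ext C
    simp only [restr, mem_filter]
    constructor
    · rintro ⟨h1, h2, h3⟩; exact ⟨⟨h1, h2.trans h, h3⟩, h2⟩
    · rintro ⟨⟨h1, h2, h3⟩, h4⟩; exact ⟨h1, h4, h3⟩
  rw [this ω, this ω', hr]

lemma energy_eq {k m : ℕ} [Nonempty V] {I : Type*} [Fintype I] [DecidableEq I] {e : Fin k → I}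
    (he : Function.Injective e) (hI : Fintype.card I = k + m) (s : Fin k → Bool) :
    Ex (fun x : I → V => Ex fun ω => prb Gf (univ.image x) (lift (x ∘ e) s univ) ω ^ 2) =
      energy Gf m s := by
  have hc : Fintype.card ((Set.range e)ᶜ : Set I) = m := by
    rw [Fintype.card_compl_set, Set.card_range_of_injective he, hI]; simp
  let j : Fin k ⊕ Fin m ≃ I :=
    ((Equiv.ofInjective e he).sumCongr (Fintype.equivFinOfCardEq hc).symm).trans
      (Equiv.Set.sumCompl _)
  rw [energy, ← Ex_comp_inj j.injective]
  refine Ex_congr fun x => Ex_congr fun ω => ?_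
  have h1 : univ.image (x ∘ j) = univ.image x := by
    rw [← image_image, image_univ_equiv]
  have h2 : (x ∘ j) ∘ Sum.inl = x ∘ e := by funext i; simp [j]
  rw [h1, h2]

lemma Ex_prb_sub_sq {k m m' : ℕ} [Nonempty V] {I J : Type*} [Fintype I] [DecidableEq I]
    [Fintype J] [DecidableEq J] {j : I → J} (hj : Function.Injective j) {e : Fin k → I}
    (he : Function.Injective e) (hI : Fintype.card I = k + m) (hJ : Fintype.card J = k + m')
    (s : Fin k → Bool) :
    Ex (fun x : J → V => Ex fun ω => (prb Gf (univ.image x) (lift (x ∘ j ∘ e) s univ) ω -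
      prb Gf (univ.image (x ∘ j)) (lift (x ∘ j ∘ e) s univ) ω) ^ 2) =
      energy Gf m' s - energy Gf m s := by
  rw [← energy_eq Gf (hj.comp he) hJ, ← energy_eq Gf he hI, ← Ex_comp_inj hj, ← Ex_sub]
  refine Ex_congr fun x => ?_
  rw [← Function.comp_assoc]
  refine Ex_condE_sub_sq _ _ _ fun ω ω' h => restr_mono Gf ?_ h
  rw [← image_image]
  exact (image_subset_image (subset_univ _) : (univ.image j).image x ⊆ univ.image x)

lemma energy_mono {k : ℕ} [Nonempty V] {m m' : ℕ} (h : m ≤ m') (s : Fin k → Bool) :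
    energy Gf m s ≤ energy Gf m' s := by
  have := Ex_prb_sub_sq Gf (I := Fin k ⊕ Fin m) (J := Fin k ⊕ Fin m')
    (j := Sum.map id (Fin.castLE h)) (Function.injective_id.sumMap (Fin.castLE_injective h))
    (e := Sum.inl) Sum.inl_injective (m := m) (m' := m') (by simp) (by simp) s
  have h2 := Ex_nonneg fun x : Fin k ⊕ Fin m' → V => Ex_nonneg fun ω =>
    sq_nonneg (prb Gf (univ.image x)
      (lift (x ∘ Sum.map id (Fin.castLE h) ∘ Sum.inl) s univ) ω -
      prb Gf (univ.image (x ∘ Sum.map id (Fin.castLE h)))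
      (lift (x ∘ Sum.map id (Fin.castLE h) ∘ Sum.inl) s univ) ω)
  rw [this] at h2
  linarith

lemma energy_nonneg {k : ℕ} (m : ℕ) (s : Fin k → Bool) : 0 ≤ energy Gf m s :=
  Ex_nonneg fun _ => Ex_nonneg fun _ => sq_nonneg _

lemma energy_le_one {k : ℕ} (m : ℕ) (s : Fin k → Bool) : energy Gf m s ≤ 1 := by
  refine (Ex_mono fun x => (Ex_mono fun ω => ?_).trans (Ex_const_le zero_le_one)).trans
    (Ex_const_le zero_le_one)
  exact pow_le_one₀ (prb_nonneg _ _ _ _) (prb_le_one _ _ _ _)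

lemma exists_energy_step [Nonempty V] {k : ℕ} (u J : ℕ) (hJ : 0 < J) :
    ∃ j < J, ∀ s : Fin k → Bool,
      energy Gf (j * u + u) s - energy Gf (j * u) s ≤ 2 ^ k / J := by
  have h1 : ∑ j ∈ range J, ∑ s : Fin k → Bool,
      (energy Gf (j * u + u) s - energy Gf (j * u) s) ≤ ∑ _j ∈ range J, (2 ^ k / J : ℝ) := by
    rw [sum_comm, sum_const, card_range, nsmul_eq_mul]
    have : (J : ℝ) * (2 ^ k / J) = ∑ _s : Fin k → Bool, (1 : ℝ) := by
      have : (J : ℝ) ≠ 0 := by exact_mod_cast hJ.ne'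
      field_simp; simp
    rw [this]
    refine sum_le_sum fun s _ => ?_
    have h2 := sum_range_sub (fun j => energy Gf (j * u) s) J
    simp only [Nat.succ_mul] at h2
    rw [h2]
    have := energy_le_one Gf (J * u) s
    have := energy_nonneg Gf (0 * u) s
    linarith
  obtain ⟨j, hj, h⟩ := exists_le_of_sum_le (by simpa using hJ.ne') h1
  refine ⟨j, mem_range.1 hj, fun s => le_trans ?_ h⟩
  exact single_le_sum (f := fun s => energy Gf (j * u + u) s - energy Gf (j * u) s)
    (fun s _ => sub_nonneg.2 (energy_mono Gf (Nat.le_add_right _ _) s)) (mem_univ s)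

lemma prod_prb_le [Nonempty V] {k u t : ℕ} {U : Type*} [Fintype U] [DecidableEq U]
    {P : SatFormula U} (hP : IsKFormula k P) (hS : SimpleFormula P)
    (hU : Fintype.card U = k + u)
    (hG : ∀ x : U → V, Function.Injective x → ∀ ω, ¬ ∀ C ∈ P, cmap x C ∈ Gf ω)
    {l : ℝ} (hl : 0 < l) (hE : ∀ s : Fin k → Bool, energy Gf (t + u) s - energy Gf t s ≤ l ^ 2) :
    Ex (fun y : Fin t → V => Ex fun ω => Ex fun x : U → V =>
      ∏ C ∈ P, prb Gf (univ.image y ∪ clauseVars (cmap x C)) (cmap x C) ω) ≤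
      ((k + u + t : ℕ) : ℝ) ^ 2 / Fintype.card V + P.card * (2 * l) := by
  let A : (U ⊕ Fin t → V) → SatClause U → Ω → ℝ := fun z C ω => ind (cmap (z ∘ Sum.inl) C ∈ Gf ω)
  let D : (U ⊕ Fin t → V) → SatClause U → Ω → SatFormula V :=
    fun z C => restr Gf (univ.image z) (clauseVars (cmap (z ∘ Sum.inl) C))
  let B : (U ⊕ Fin t → V) → SatClause U → Ω → ℝ := fun z C ω =>
    prb Gf (univ.image (z ∘ Sum.inr) ∪ clauseVars (cmap (z ∘ Sum.inl) C)) (cmap (z ∘ Sum.inl) C) ω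
  have hA : ∀ z C ω, 0 ≤ A z C ω ∧ A z C ω ≤ 1 := fun z C ω => ⟨ind_nonneg _, ind_le_one _⟩
  have hB : ∀ z C ω, 0 ≤ B z C ω ∧ B z C ω ≤ 1 :=
    fun z C ω => ⟨prb_nonneg _ _ _ _, prb_le_one _ _ _ _⟩
  have hnn : ∀ z, 0 ≤ ∑ C ∈ P, Ex (fun ω => |condE (D z C) (A z C) ω - B z C ω|) :=
    fun z => sum_nonneg fun C _ => Ex_nonneg fun ω => abs_nonneg _
  have hinj : ∀ z : U ⊕ Fin t → V, Function.Injective z →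
      Ex (fun ω => ∏ C ∈ P, B z C ω) ≤
        ∑ C ∈ P, Ex (fun ω => |condE (D z C) (A z C) ω - B z C ω|) := by
    intro z hz
    have hzl : Function.Injective (z ∘ Sum.inl) := hz.comp Sum.inl_injective
    have hne : ∀ C ∈ P, ∀ C' ∈ P, C' ≠ C →
        clauseVars (cmap (z ∘ Sum.inl) C') ≠ clauseVars (cmap (z ∘ Sum.inl) C) := by
      intro C hC C' hC' hne h
      rw [clauseVars_cmap, clauseVars_cmap] at h
      exact hne (hS C' hC' C hC (image_injective hzl h))
    have hsub : ∀ C, clauseVars (cmap (z ∘ Sum.inl) C) ⊆ univ.image z := by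
      intro C
      rw [clauseVars_cmap, ← image_image]
      exact image_subset_image (subset_univ _)
    have h := Ex_prod_telescope (A z) (B z) (D z) (hA z) (hB z) P ∅ (disjoint_empty_right _) ?_
    · simp only [prod_empty, mul_one, union_empty] at h
      have h0 : Ex (fun ω => ∏ C ∈ P, A z C ω) = 0 := by
        rw [show (fun ω => ∏ C ∈ P, A z C ω) = fun _ => (0 : ℝ) from ?_]
        · simp [Ex]
        · funext ω
          rw [← ind_forall_eq]
          exact ind_false (hG _ hzl ω)
      rwa [h0, zero_add] at h
    · intro C hC C' hC' hCC ω ω' hD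
      rw [union_empty] at hC'
      have hD : restr Gf (univ.image z) (clauseVars (cmap (z ∘ Sum.inl) C)) ω =
        restr Gf (univ.image z) (clauseVars (cmap (z ∘ Sum.inl) C)) ω' := hD
      constructor
      · refine ind_congr ?_
        have hm : ∀ ω, cmap (z ∘ Sum.inl) C' ∈ Gf ω ↔ cmap (z ∘ Sum.inl) C' ∈
            restr Gf (univ.image z) (clauseVars (cmap (z ∘ Sum.inl) C)) ω := by
          intro ω
          rw [restr, mem_filter]
          exact ⟨fun h => ⟨h, hsub _, hne C hC C' hC' hCC⟩, fun h => h.1⟩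
        rw [hm ω, hm ω', hD]
      · refine condE_meas _ _ ?_
        have hX : ∀ E : SatClause V, clauseVars E ⊆ univ.image (z ∘ Sum.inr) ∪
            clauseVars (cmap (z ∘ Sum.inl) C') →
            clauseVars E ≠ clauseVars (cmap (z ∘ Sum.inl) C) := by
          intro E hE hEC
          rw [hEC, clauseVars_cmap, clauseVars_cmap] at hE
          have h1 : clauseVars C ⊆ clauseVars C' := by
            intro v hv
            rcases mem_union.1 (hE (mem_image_of_mem _ hv)) with h | h
            · obtain ⟨i, -, hi⟩ := mem_image.1 h
              have := hz hi
              simp at this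
            · obtain ⟨v', hv', h⟩ := mem_image.1 h
              rwa [← hzl h]
          exact hCC (hS _ hC' _ hC (eq_of_subset_of_card_le h1
            (by rw [(hP _ hC).2, (hP _ hC').2])).symm)
        have hm : ∀ ω, restr Gf (univ.image (z ∘ Sum.inr) ∪ clauseVars (cmap (z ∘ Sum.inl) C'))
            (clauseVars (cmap (z ∘ Sum.inl) C')) ω =
            (restr Gf (univ.image z) (clauseVars (cmap (z ∘ Sum.inl) C)) ω).filter fun E =>
              clauseVars E ⊆ univ.image (z ∘ Sum.inr) ∪ clauseVars (cmap (z ∘ Sum.inl) C') ∧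
              clauseVars E ≠ clauseVars (cmap (z ∘ Sum.inl) C') := by
          intro ω
          ext E
          simp only [restr, mem_filter]
          constructor
          · rintro ⟨h1, h2, h3⟩
            refine ⟨⟨h1, h2.trans (union_subset ?_ (hsub _)), hX E h2⟩, h2, h3⟩
            rw [← image_image]
            exact image_subset_image (subset_univ _)
          · rintro ⟨⟨h1, -, -⟩, h2, h3⟩; exact ⟨h1, h2, h3⟩
        rw [hm ω, hm ω', hD]
  have hall : ∀ z : U ⊕ Fin t → V, Ex (fun ω => ∏ C ∈ P, B z C ω) ≤
      ind (¬ Function.Injective z) +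
        ∑ C ∈ P, Ex (fun ω => (l + (condE (D z C) (A z C) ω - B z C ω) ^ 2 / l)) := by
    intro z
    have h2 : ∑ C ∈ P, Ex (fun ω => |condE (D z C) (A z C) ω - B z C ω|) ≤
        ∑ C ∈ P, Ex (fun ω => (l + (condE (D z C) (A z C) ω - B z C ω) ^ 2 / l)) := by
      refine sum_le_sum fun C _ => Ex_mono fun ω => ?_
      rw [← sq_abs (condE (D z C) (A z C) ω - B z C ω)]
      set d := |condE (D z C) (A z C) ω - B z C ω|
      rw [← sub_nonneg]
      have : l + d ^ 2 / l - d = ((d - l / 2) ^ 2 + 3 / 4 * l ^ 2) / l := by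
        field_simp; ring
      rw [this]; positivity
    by_cases hz : Function.Injective z
    · rw [ind_false (not_not.2 hz), zero_add]
      exact (hinj z hz).trans h2
    · rw [ind_true hz]
      have h1 : Ex (fun ω => ∏ C ∈ P, B z C ω) ≤ 1 :=
        (Ex_mono fun ω => prod_le_one (fun C _ => (hB z C ω).1) fun C _ => (hB z C ω).2).trans
          (Ex_const_le zero_le_one)
      linarith [(hnn z).trans h2]
  have hC : ∀ C ∈ P, Ex (fun z => Ex (fun ω =>
      (l + (condE (D z C) (A z C) ω - B z C ω) ^ 2 / l))) ≤ 2 * l := by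
    intro C hC
    obtain ⟨e, s, he, rfl⟩ := exists_fin_lift (hP C hC)
    have key := Ex_prb_sub_sq Gf (I := Fin k ⊕ Fin t) (J := U ⊕ Fin t) (j := Sum.map e id)
      (he.sumMap Function.injective_id) (e := Sum.inl) Sum.inl_injective (m := t) (m' := t + u)
      (by simp) (by simp [hU]; ring) s
    have h2 : ∀ (z : U ⊕ Fin t → V) (ω : Ω),
        (condE (D z (lift e s univ)) (A z (lift e s univ)) ω - B z (lift e s univ) ω) ^ 2 =
        (prb Gf (univ.image z) (lift (z ∘ Sum.map e id ∘ Sum.inl) s univ) ω -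
          prb Gf (univ.image (z ∘ Sum.map e id)) (lift (z ∘ Sum.map e id ∘ Sum.inl) s univ) ω)
          ^ 2 := by
      intro z ω
      have e1 : cmap (z ∘ Sum.inl) (lift e s univ) =
          lift (z ∘ Sum.map e id ∘ Sum.inl) s univ := by
        rw [cmap_lift]; rfl
      have e2 : univ.image (z ∘ Sum.inr) ∪ clauseVars (cmap (z ∘ Sum.inl) (lift e s univ)) =
          univ.image (z ∘ Sum.map e id) := by
        rw [e1, clauseVars_lift]
        ext v
        simp only [mem_union, mem_image, mem_univ, true_and, Function.comp_apply, Sum.exists,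
          Sum.map_inl, Sum.map_inr, id]
        tauto
      simp only [B, D, A]
      rw [e2, e1]
      rfl
    simp only [h2, Ex_add]
    refine (add_le_add (Ex_mono fun z => Ex_const_le hl.le) le_rfl).trans ?_
    have h3 : Ex (fun _ : U ⊕ Fin t → V => l) ≤ l := Ex_const_le hl.le
    simp only [div_eq_mul_inv, Ex_mul_const]
    rw [key]
    have h4 := hE s
    have h5 : (energy Gf (t + u) s - energy Gf t s) * l⁻¹ ≤ l := by
      rw [← div_eq_mul_inv, div_le_iff₀ hl, ← sq]; exact h4
    linarith
  have hlhs : Ex (fun y : Fin t → V => Ex fun ω => Ex fun x : U → V =>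
      ∏ C ∈ P, prb Gf (univ.image y ∪ clauseVars (cmap x C)) (cmap x C) ω) =
      Ex (fun z : U ⊕ Fin t → V => Ex fun ω => ∏ C ∈ P, B z C ω) := by
    rw [Ex_sum_arrow, Ex_comm (α := U → V)]
    refine Ex_congr fun y => ?_
    rw [Ex_comm]
    rfl
  rw [hlhs]
  refine (Ex_mono hall).trans ?_
  rw [Ex_add, Ex_sum]
  refine add_le_add ?_ ?_
  · refine Ex_not_injective_le.trans (le_of_eq ?_)
    simp [hU]
  · refine (sum_le_sum hC).trans ?_
    simp

end Energy

section Patterns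

/-- Every witness of some clause of `P` satisfies another clause of `P`. -/
def NonMin {U : Type*} (P : SatFormula U) : Prop :=
  ∃ C ∈ P, ∀ w : U → Bool, SatisfiesClause w C → ∃ C' ∈ P, C' ≠ C ∧ SatisfiesClause w C'

lemma NonMin.not_cmap {U V : Type*} [DecidableEq U] [DecidableEq V] {P : SatFormula U}
    (hP : NonMin P) {G : SatFormula V} (hG : MinimalFormula G) {x : U → V}
    (hx : Function.Injective x) : ¬ ∀ C ∈ P, cmap x C ∈ G := by
  intro h
  obtain ⟨C, hC, hw⟩ := hP
  obtain ⟨w, hs, hu⟩ := hG _ (h C hC)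
  obtain ⟨C', hC', hne, hs'⟩ := hw (w ∘ x) (satisfies_cmap.1 hs)
  exact hne (cmap_injective hx (hu _ (h C' hC') (satisfies_cmap.2 hs')))

variable {w : ℕ}

/-- The clause with signs `s` on the copies of the coordinates in `E` chosen by `τ`. -/
def twin (s τ : Fin w → Bool) (E : Finset (Fin w)) : SatClause (Fin w × Bool) :=
  lift (fun i => (i, τ i)) s E

/-- The clause `twin s 0 E` together with all its single-coordinate swaps. -/
def core (s : Fin w → Bool) (E : Finset (Fin w)) : SatFormula (Fin w × Bool) :=
  insert (twin s (fun _ => false) E) (E.image fun i => twin s (fun j => decide (j = i)) E)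

lemma cmap_twin {V : Type*} [DecidableEq V] (x : Fin w × Bool → V) (s τ : Fin w → Bool)
    (E : Finset (Fin w)) : cmap x (twin s τ E) = lift (fun i => x (i, τ i)) s E :=
  cmap_lift _ _ _ _

lemma satisfies_twin {a : Fin w × Bool → Bool} {s τ : Fin w → Bool} {E : Finset (Fin w)} :
    SatisfiesClause a (twin s τ E) ↔ ∀ i ∈ E, a (i, τ i) = s i := satisfies_lift

lemma clauseVars_twin {s τ : Fin w → Bool} {E : Finset (Fin w)} :
    clauseVars (twin s τ E) = E.image fun i => (i, τ i) := clauseVars_lift _ _ _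

lemma clauseVars_twin_eq {s s' τ τ' : Fin w → Bool} {E E' : Finset (Fin w)}
    (h : clauseVars (twin s τ E) = clauseVars (twin s' τ' E')) :
    E = E' ∧ ∀ i ∈ E, τ i = τ' i := by
  rw [clauseVars_twin, clauseVars_twin] at h
  have h1 : E = E' := by
    have := congrArg (Finset.image Prod.fst) h
    simpa [image_image, Function.comp_def] using this
  refine ⟨h1, fun i hi => ?_⟩
  have := (Finset.ext_iff.1 h (i, τ i)).1 (mem_image_of_mem _ hi)
  obtain ⟨j, -, hj⟩ := mem_image.1 this
  obtain ⟨h1, h2⟩ := Prod.mk.inj hj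
  rw [← h2, h1]

lemma twin_congr {s τ τ' : Fin w → Bool} {E : Finset (Fin w)} (h : ∀ i ∈ E, τ i = τ' i) :
    twin s τ E = twin s τ' E := by
  refine image_congr fun i hi => ?_
  simp [h i hi]

lemma isKClause_twin {k : ℕ} {s τ : Fin w → Bool} {E : Finset (Fin w)} (hE : E.card = k) :
    IsKClause k (twin s τ E) :=
  isKClause_lift hE fun _ _ _ _ h => (Prod.mk.inj h).1

lemma mem_core {s : Fin w → Bool} {E : Finset (Fin w)} {C : SatClause (Fin w × Bool)} :
    C ∈ core s E ↔ C = twin s (fun _ => false) E ∨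
      ∃ i ∈ E, C = twin s (fun j => decide (j = i)) E := by
  simp [core, eq_comm]

lemma exists_twin_of_mem_core {s : Fin w → Bool} {E : Finset (Fin w)}
    {C : SatClause (Fin w × Bool)} (h : C ∈ core s E) : ∃ τ, C = twin s τ E := by
  rcases mem_core.1 h with h | ⟨i, -, h⟩ <;> exact ⟨_, h⟩

/-- A witness of the main clause of the core that satisfies no swapped clause takes both values
on each doubled coordinate. -/
lemma core_witness {s : Fin w → Bool} {E : Finset (Fin w)} {a : Fin w × Bool → Bool}
    (h0 : SatisfiesClause a (twin s (fun _ => false) E))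
    (h1 : ∀ C ∈ core s E, C ≠ twin s (fun _ => false) E → ¬ SatisfiesClause a C)
    {i : Fin w} (hi : i ∈ E) (b : Bool) : a (i, b) = xor (s i) b := by
  rw [satisfies_twin] at h0
  cases b
  · simpa using h0 i hi
  · have hne : twin s (fun j => decide (j = i)) E ≠ twin s (fun _ => false) E := by
      intro h
      have := (clauseVars_twin_eq (congrArg clauseVars h)).2 i hi
      simp at this
    have h2 := h1 _ (mem_core.2 (Or.inr ⟨i, hi, rfl⟩)) hne
    rw [satisfies_twin] at h2
    have : a (i, true) ≠ s i := by
      intro h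
      apply h2
      intro j hj
      by_cases hji : j = i
      · subst hji; simpa using h
      · simpa [hji] using h0 j hj
    revert this
    cases a (i, true) <;> cases s i <;> simp

lemma nonMin_insert {s : Fin w → Bool} {E : Finset (Fin w)} {P : SatFormula (Fin w × Bool)}
    (hP : core s E ⊆ P)
    (h : ∀ a : Fin w × Bool → Bool, (∀ i ∈ E, ∀ b, a (i, b) = xor (s i) b) →
      ∃ C ∈ P, C ≠ twin s (fun _ => false) E ∧ SatisfiesClause a C) : NonMin P := by
  refine ⟨twin s (fun _ => false) E, hP (mem_core.2 (Or.inl rfl)), fun a ha => ?_⟩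
  by_contra! hc
  obtain ⟨C, hC, hne, hs⟩ := h a fun i hi b =>
    core_witness ha (fun C hC hne => hc C (hP hC) hne) hi b
  exact hc C hC hne hs

/-- Two sign patterns on the same set that differ at two places. -/
def patternTwo (s s' : Fin w → Bool) (E : Finset (Fin w)) : SatFormula (Fin w × Bool) :=
  insert (twin s' (fun i => xor (s i) (s' i)) E) (core s E)

/-- Three sets, the last two disagreeing at a coordinate outside the first. -/
def patternThree (s s₁ s₂ : Fin w → Bool) (E E₁ E₂ : Finset (Fin w)) :
    SatFormula (Fin w × Bool) :=
  insert (twin s₁ (fun i => decide (i ∈ E) && xor (s i) (s₁ i)) E₁)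
    (insert (twin s₂ (fun i => decide (i ∈ E) && xor (s i) (s₂ i)) E₂) (core s E))

lemma nonMin_patternTwo {s s' : Fin w → Bool} {E : Finset (Fin w)} (h : ∃ i ∈ E, s i ≠ s' i) :
    NonMin (patternTwo s s' E) := by
  refine nonMin_insert (subset_insert _ _) fun a ha => ⟨_, mem_insert_self _ _, ?_, ?_⟩
  · intro heq
    obtain ⟨i, hi, hne⟩ := h
    have := (clauseVars_twin_eq (congrArg clauseVars heq)).2 i hi
    revert hne this; cases s i <;> cases s' i <;> simp
  · rw [satisfies_twin]
    intro i hi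
    rw [ha i hi]; cases s i <;> cases s' i <;> simp

lemma nonMin_patternThree {s s₁ s₂ : Fin w → Bool} {E E₁ E₂ : Finset (Fin w)} {c : Fin w}
    (hc1 : c ∈ E₁) (hc2 : c ∈ E₂) (h1 : E₁ ⊆ insert c E) (h2 : E₂ ⊆ insert c E) (hc : c ∉ E)
    (hs : s₁ c ≠ s₂ c) : NonMin (patternThree s s₁ s₂ E E₁ E₂) := by
  refine nonMin_insert ((subset_insert _ _).trans (subset_insert _ _)) fun a ha => ?_
  have key : ∀ (s' : Fin w → Bool) (E' : Finset (Fin w)), c ∈ E' → E' ⊆ insert c E →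
      a (c, false) = s' c →
      twin s' (fun i => decide (i ∈ E) && xor (s i) (s' i)) E' ≠ twin s (fun _ => false) E ∧
      SatisfiesClause a (twin s' (fun i => decide (i ∈ E) && xor (s i) (s' i)) E') := by
    intro s' E' hcE hE hac
    constructor
    · intro heq
      have := (clauseVars_twin_eq (congrArg clauseVars heq)).1
      exact hc (this ▸ hcE)
    · rw [satisfies_twin]
      intro i hi
      by_cases hiE : i ∈ E
      · rw [ha i hiE]; simp [hiE]
      · have : i = c := (mem_insert.1 (hE hi)).resolve_right hiE
        subst this
        simpa [hiE] using hac
  by_cases hac : a (c, false) = s₁ c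
  · exact ⟨_, mem_insert_self _ _, key s₁ E₁ hc1 h1 hac⟩
  · refine ⟨_, mem_insert_of_mem (mem_insert_self _ _), key s₂ E₂ hc2 h2 ?_⟩
    revert hac hs; cases a (c, false) <;> cases s₁ c <;> cases s₂ c <;> simp

lemma isKFormula_core {k : ℕ} {s : Fin w → Bool} {E : Finset (Fin w)} (hE : E.card = k) :
    IsKFormula k (core s E) := by
  intro C hC
  obtain ⟨τ, rfl⟩ := exists_twin_of_mem_core hC
  exact isKClause_twin hE

lemma isKFormula_insert {U : Type*} [DecidableEq U] {k : ℕ} {C : SatClause U} {P : SatFormula U}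
    (hC : IsKClause k C) (hP : IsKFormula k P) : IsKFormula k (insert C P) := by
  intro D hD
  rcases mem_insert.1 hD with rfl | hD
  · exact hC
  · exact hP D hD

lemma isKFormula_patternTwo {k : ℕ} {s s' : Fin w → Bool} {E : Finset (Fin w)}
    (hE : E.card = k) : IsKFormula k (patternTwo s s' E) :=
  isKFormula_insert (isKClause_twin hE) (isKFormula_core hE)

lemma isKFormula_patternThree {k : ℕ} {s s₁ s₂ : Fin w → Bool} {E E₁ E₂ : Finset (Fin w)}
    (hE : E.card = k) (h1 : E₁.card = k) (h2 : E₂.card = k) :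
    IsKFormula k (patternThree s s₁ s₂ E E₁ E₂) :=
  isKFormula_insert (isKClause_twin h1) (isKFormula_insert (isKClause_twin h2)
    (isKFormula_core hE))

lemma simple_insert {U : Type*} [DecidableEq U] {C : SatClause U} {P : SatFormula U}
    (hP : SimpleFormula P) (hC : ∀ D ∈ P, clauseVars C ≠ clauseVars D) :
    SimpleFormula (insert C P) := by
  intro A hA B hB h
  rw [mem_insert] at hA hB
  rcases hA with hA | hA <;> rcases hB with hB | hB
  · rw [hA, hB]
  · exact absurd (hA ▸ h) (hC _ hB)
  · exact absurd (hB ▸ h.symm) (hC _ hA)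
  · exact hP A hA B hB h

lemma simple_core {s : Fin w → Bool} {E : Finset (Fin w)} : SimpleFormula (core s E) := by
  intro A hA B hB h
  obtain ⟨τ, rfl⟩ := exists_twin_of_mem_core hA
  obtain ⟨τ', rfl⟩ := exists_twin_of_mem_core hB
  exact twin_congr (clauseVars_twin_eq h).2

lemma simple_patternTwo {s s' : Fin w → Bool} {E : Finset (Fin w)}
    (h : ∃ i ∈ E, ∃ j ∈ E, i ≠ j ∧ s i ≠ s' i ∧ s j ≠ s' j) :
    SimpleFormula (patternTwo s s' E) := by
  refine simple_insert simple_core fun D hD heq => ?_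
  obtain ⟨i, hi, j, hj, hij, h1, h2⟩ := h
  rcases mem_core.1 hD with rfl | ⟨l, -, rfl⟩
  · have := (clauseVars_twin_eq heq).2 i hi
    simp at this; exact h1 this
  · have a1 := (clauseVars_twin_eq heq).2 i hi
    have a2 := (clauseVars_twin_eq heq).2 j hj
    have c1 : (s i ^^ s' i) = true := by simpa using h1
    have c2 : (s j ^^ s' j) = true := by simpa using h2
    rw [c1] at a1
    rw [c2] at a2
    have b1 : i = l := by simpa using a1.symm
    have b2 : j = l := by simpa using a2.symm
    exact hij (b1.trans b2.symm)

lemma simple_patternThree {s s₁ s₂ : Fin w → Bool} {E E₁ E₂ : Finset (Fin w)}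
    (h1 : E₁ ≠ E) (h2 : E₂ ≠ E) (h12 : E₁ ≠ E₂) :
    SimpleFormula (patternThree s s₁ s₂ E E₁ E₂) := by
  refine simple_insert (simple_insert simple_core fun D hD heq => ?_) fun D hD heq => ?_
  · obtain ⟨τ, rfl⟩ := exists_twin_of_mem_core hD
    exact h2 (clauseVars_twin_eq heq).1
  · rcases mem_insert.1 hD with rfl | hD
    · exact h12 (clauseVars_twin_eq heq).1
    · obtain ⟨τ, rfl⟩ := exists_twin_of_mem_core hD
      exact h1 (clauseVars_twin_eq heq).1

lemma patternTwo_cmap {V : Type*} [DecidableEq V] {A : SatFormula V} {s s' : Fin w → Bool}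
    {E : Finset (Fin w)} {x : Fin w × Bool → V}
    (h : ∀ ω : Fin w → Bool, lift (fun i => x (i, ω i)) s E ∈ A ∧
      lift (fun i => x (i, ω i)) s' E ∈ A) :
    ∀ C ∈ patternTwo s s' E, cmap x C ∈ A := by
  intro C hC
  rcases mem_insert.1 hC with rfl | hC
  · rw [cmap_twin]; exact (h _).2
  · obtain ⟨τ, rfl⟩ := exists_twin_of_mem_core hC
    rw [cmap_twin]; exact (h _).1

lemma patternThree_cmap {V : Type*} [DecidableEq V] {A : SatFormula V}
    {s s₁ s₂ : Fin w → Bool} {E E₁ E₂ : Finset (Fin w)} {x : Fin w × Bool → V}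
    (h : ∀ ω : Fin w → Bool, lift (fun i => x (i, ω i)) s E ∈ A ∧
      lift (fun i => x (i, ω i)) s₁ E₁ ∈ A ∧ lift (fun i => x (i, ω i)) s₂ E₂ ∈ A) :
    ∀ C ∈ patternThree s s₁ s₂ E E₁ E₂, cmap x C ∈ A := by
  intro C hC
  rcases mem_insert.1 hC with rfl | hC
  · rw [cmap_twin]; exact (h _).2.1
  rcases mem_insert.1 hC with rfl | hC
  · rw [cmap_twin]; exact (h _).2.2
  · obtain ⟨τ, rfl⟩ := exists_twin_of_mem_core hC
    rw [cmap_twin]; exact (h _).1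

end Patterns

section FewBad

variable {V : Type*} [Fintype V] [DecidableEq V]

/-- The two forbidden configurations have density at most `η` in `A`. -/
def FewBad (k : ℕ) (A : SatFormula V) (η : ℝ) : Prop :=
  (∀ (s s' : Fin (k + 1) → Bool) (E : Finset (Fin (k + 1))), E.card = k →
    (∃ i ∈ E, ∃ j ∈ E, i ≠ j ∧ s i ≠ s' i ∧ s j ≠ s' j) →
    Ex (fun z : Fin (k + 1) → V => ind (lift z s E ∈ A ∧ lift z s' E ∈ A)) ≤ η) ∧
  (∀ (s s₁ s₂ : Fin (k + 1) → Bool) (c a b : Fin (k + 1)), a ≠ c → b ≠ c → a ≠ b →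
    s₁ c ≠ s₂ c →
    Ex (fun z : Fin (k + 1) → V => ind (lift z s (univ.erase c) ∈ A ∧
      lift z s₁ (univ.erase a) ∈ A ∧ lift z s₂ (univ.erase b) ∈ A)) ≤ η)

lemma fewBad_of_pattern {k : ℕ} {A : SatFormula V} {η : ℝ} (hη : 0 ≤ η)
    (h : ∀ P : SatFormula (Fin (k + 1) × Bool), IsKFormula k P → SimpleFormula P → NonMin P →
      Ex (fun x : Fin (k + 1) × Bool → V => ind (∀ C ∈ P, cmap x C ∈ A)) ≤
        η ^ (2 ^ (k + 1))) : FewBad k A η := by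
  refine ⟨fun s s' E hE hd => ?_, fun s s₁ s₂ c a b hac hbc hab hs => ?_⟩
  · refine le_of_pow_le_pow_left₀ (n := 2 ^ (k + 1)) (by positivity) hη ?_
    refine (box_density _ _).trans ((Ex_mono fun x => ind_mono patternTwo_cmap).trans
      (h _ (isKFormula_patternTwo hE) (simple_patternTwo hd) (nonMin_patternTwo ?_)))
    obtain ⟨i, hi, j, hj, -, h1, -⟩ := hd
    exact ⟨i, hi, h1⟩
  · refine le_of_pow_le_pow_left₀ (n := 2 ^ (k + 1)) (by positivity) hη ?_
    have hne : ∀ {p q : Fin (k + 1)}, p ≠ q →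
        (univ : Finset (Fin (k + 1))).erase p ≠ univ.erase q := by
      intro p q hpq h
      have := Finset.ext_iff.1 h q
      simp [hpq.symm] at this
    have hins : insert c ((univ : Finset (Fin (k + 1))).erase c) = univ :=
      insert_erase (mem_univ _)
    refine (box_density _ _).trans ((Ex_mono fun x => ind_mono patternThree_cmap).trans
      (h _ (isKFormula_patternThree ?_ ?_ ?_) (simple_patternThree (hne hac) (hne hbc) (hne hab))
        (nonMin_patternThree (c := c) ?_ ?_ ?_ ?_ ?_ hs)))
    any_goals simp
    · exact hac.symm
    · exact hbc.symm

end FewBad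

section Good

variable {V Ω : Type*} [Fintype V] [DecidableEq V] [Fintype Ω]

open Classical in
/-- The `k`-clauses of conditional probability at least `δ`. -/
noncomputable def likely (k : ℕ) (Gf : Ω → SatFormula V) (δ : ℝ) (Y : Finset V) (ω : Ω) :
    SatFormula V :=
  (kClauses V k).filter fun C => δ ≤ prb Gf (Y ∪ clauseVars C) C ω

lemma mem_likely {k : ℕ} {Gf : Ω → SatFormula V} {δ : ℝ} {Y : Finset V} {ω : Ω}
    {C : SatClause V} :
    C ∈ likely k Gf δ Y ω ↔ IsKClause k C ∧ δ ≤ prb Gf (Y ∪ clauseVars C) C ω := by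
  simp [likely, mem_kClauses]

lemma likely_congr {k : ℕ} {Gf : Ω → SatFormula V} (hG : ∀ ω, IsKFormula k (Gf ω)) {δ : ℝ}
    {Y : Finset V} {ω ω' : Ω}
    (h : (Gf ω).filter (fun C => ¬ Disjoint (clauseVars C) Y) =
      (Gf ω').filter (fun C => ¬ Disjoint (clauseVars C) Y)) :
    likely k Gf δ Y ω = likely k Gf δ Y ω' := by
  ext C
  rw [mem_likely, mem_likely]
  refine and_congr_right fun hC => ?_
  have : prb Gf (Y ∪ clauseVars C) C ω = prb Gf (Y ∪ clauseVars C) C ω' := by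
    refine condE_meas _ _ ?_
    have hm : ∀ ω, restr Gf (Y ∪ clauseVars C) (clauseVars C) ω =
        ((Gf ω).filter (fun C => ¬ Disjoint (clauseVars C) Y)).filter fun D =>
          clauseVars D ⊆ Y ∪ clauseVars C ∧ clauseVars D ≠ clauseVars C := by
      intro ω
      ext D
      simp only [restr, mem_filter]
      constructor
      · rintro ⟨h1, h2, h3⟩
        refine ⟨⟨h1, fun hd => h3 ?_⟩, h2, h3⟩
        have : clauseVars D ⊆ clauseVars C := fun v hv =>
          (mem_union.1 (h2 hv)).resolve_left fun hY => disjoint_left.1 hd hv hY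
        exact eq_of_subset_of_card_le this (by rw [hC.2, (hG ω D h1).2])
      · rintro ⟨⟨h1, -⟩, h2, h3⟩; exact ⟨h1, h2, h3⟩
    rw [hm, hm, h]
  rw [this]

lemma Ex_card_unlikely_le (k : ℕ) (Gf : Ω → SatFormula V) (hG : ∀ ω, IsKFormula k (Gf ω))
    {δ : ℝ} (hδ : 0 ≤ δ) (Y : Finset V) :
    Ex (fun ω => ((Gf ω \ likely k Gf δ Y ω).card : ℝ)) ≤
      δ * (2 * Fintype.card V : ℕ) ^ k := by
  have h1 : ∀ ω, ((Gf ω \ likely k Gf δ Y ω).card : ℝ) ≤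
      ∑ C ∈ kClauses V k, ind (C ∈ Gf ω) * ind (prb Gf (Y ∪ clauseVars C) C ω < δ) := by
    intro ω
    simp only [← ind_and]
    classical
    rw [sum_ind]
    gcongr
    intro C hC
    obtain ⟨h1, h2⟩ := mem_sdiff.1 hC
    rw [mem_likely, not_and, not_le] at h2
    exact mem_filter.2 ⟨mem_kClauses.2 (hG ω C h1), h1, h2 (hG ω C h1)⟩
  refine (Ex_mono h1).trans ?_
  rw [Ex_sum]
  have h2 : ∀ C ∈ kClauses V k,
      Ex (fun ω => ind (C ∈ Gf ω) * ind (prb Gf (Y ∪ clauseVars C) C ω < δ)) ≤ δ := by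
    intro C _
    rw [← Ex_condE_mul (restr Gf (Y ∪ clauseVars C) (clauseVars C))]
    · refine (Ex_mono fun ω => ?_).trans (Ex_const_le hδ)
      change prb Gf (Y ∪ clauseVars C) C ω * _ ≤ δ
      by_cases h : prb Gf (Y ∪ clauseVars C) C ω < δ
      · rw [ind_true h]; linarith
      · rw [ind_false h]; simpa using hδ
    · intro ω ω' h
      have : prb Gf (Y ∪ clauseVars C) C ω = prb Gf (Y ∪ clauseVars C) C ω' := condE_meas _ _ h
      rw [this]
  refine (sum_le_sum h2).trans ?_
  rw [sum_const, nsmul_eq_mul, mul_comm]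
  gcongr
  exact_mod_cast card_kClauses_le k

lemma Ex_pattern_likely_le [Nonempty V] {k t : ℕ} {Gf : Ω → SatFormula V}
    (hm : ∀ ω, MinimalFormula (Gf ω))
    {P : SatFormula (Fin (k + 1) × Bool)} (hP : IsKFormula k P) (hS : SimpleFormula P)
    (hN : NonMin P) {l δ : ℝ} (hl : 0 < l) (hδ : 0 < δ)
    (hE : ∀ s : Fin k → Bool, energy Gf (t + (k + 2)) s - energy Gf t s ≤ l ^ 2) :
    Ex (fun y : Fin t → V => Ex fun ω => Ex fun x : Fin (k + 1) × Bool → V =>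
      ind (∀ C ∈ P, cmap x C ∈ likely k Gf δ (univ.image y) ω)) ≤
      (((k + (k + 2) + t : ℕ) : ℝ) ^ 2 / Fintype.card V + P.card * (2 * l)) / δ ^ P.card := by
  rw [le_div_iff₀ (by positivity), ← Ex_mul_const]
  refine le_trans (Ex_mono fun y => ?_) (prod_prb_le Gf hP hS (by simp; ring)
    (fun x hx ω => hN.not_cmap (hm ω) hx) hl hE)
  rw [← Ex_mul_const]
  refine Ex_mono fun ω => ?_
  rw [← Ex_mul_const]
  refine Ex_mono fun x => ?_
  by_cases h : ∀ C ∈ P, cmap x C ∈ likely k Gf δ (univ.image y) ω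
  · rw [ind_true h, one_mul, ← prod_const]
    exact prod_le_prod (fun _ _ => hδ.le) fun C hC => (mem_likely.1 (h C hC)).2
  · rw [ind_false h, zero_mul]
    exact prod_nonneg fun _ _ => prb_nonneg _ _ _ _

end Good

section GoodSet

/-- Every family of minimal formulas admits a bounded set of vertices such that for at least half
of the family, the likely clauses have few forbidden configurations and cover almost all
clauses. -/
lemma exists_good_set (k : ℕ) {δ η : ℝ} (hδ : 0 < δ) (hδ1 : δ ≤ 1) (hη : 0 < η) :
    ∃ T n₁ : ℕ, ∀ {V Ω : Type} [Fintype V] [DecidableEq V] [Fintype Ω]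
      (Gf : Ω → SatFormula V), n₁ ≤ Fintype.card V → (∀ ω, IsKFormula k (Gf ω)) →
      (∀ ω, MinimalFormula (Gf ω)) →
      ∃ Y : Finset V, Y.card ≤ T ∧ ∃ S : Finset Ω, (Fintype.card Ω : ℝ) ≤ 2 * S.card ∧
        ∀ ω ∈ S, FewBad k (likely k Gf δ Y ω) η ∧
          ((Gf ω \ likely k Gf δ Y ω).card : ℝ) ≤ 4 * δ * (2 * Fintype.card V : ℕ) ^ k := by
  classical
  obtain ⟨M, hM0, hM⟩ : ∃ M : ℕ, 0 < M ∧
      ∀ P : SatFormula (Fin (k + 1) × Bool), P.card ≤ M :=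
    ⟨_, Fintype.card_pos, fun P => card_le_univ P⟩
  obtain ⟨Np, hNp0, hNp⟩ : ∃ Np : ℕ, 0 < Np ∧
      ∀ Q : Finset (SatFormula (Fin (k + 1) × Bool)), Q.card ≤ Np :=
    ⟨_, Fintype.card_pos, fun P => card_le_univ P⟩
  have hMr : (0 : ℝ) < M := by exact_mod_cast hM0
  have hNpr : (0 : ℝ) < Np := by exact_mod_cast hNp0
  set τ : ℝ := η ^ (2 ^ (k + 1)) with hτ
  have hτ0 : 0 < τ := by positivity
  set l : ℝ := τ * δ ^ M / (16 * Np * M) with hl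
  have hl0 : 0 < l := by positivity
  obtain ⟨J, hJ⟩ := exists_nat_gt ((2 : ℝ) ^ k / l ^ 2)
  have hJ0 : 0 < J := by
    have : (0 : ℝ) < J := lt_of_le_of_lt (by positivity) hJ
    exact_mod_cast this
  have hJr : (0 : ℝ) < J := by exact_mod_cast hJ0
  have hJl : (2 : ℝ) ^ k / J ≤ l ^ 2 := by
    rw [div_le_iff₀ hJr]
    rw [div_lt_iff₀ (by positivity)] at hJ
    linarith
  set T : ℕ := J * (k + 2) with hT
  obtain ⟨n₁, hn₁⟩ := exists_nat_gt (((k + (k + 2) + T : ℕ) : ℝ) ^ 2 / (M * (2 * l)))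
  refine ⟨T, max n₁ 1, ?_⟩
  intro V Ω _ _ _ Gf hn hk hm
  rcases isEmpty_or_nonempty Ω with hΩ | hΩ
  · exact ⟨∅, by simp, ∅, by simp, by simp⟩
  have hV : Nonempty V := Fintype.card_pos_iff.1 (lt_of_lt_of_le one_pos ((le_max_right _ _).trans hn))
  have hnr : (n₁ : ℝ) ≤ Fintype.card V := by exact_mod_cast (le_max_left _ _).trans hn
  have hVr : (0 : ℝ) < Fintype.card V := by exact_mod_cast Fintype.card_pos
  obtain ⟨j, hj, hs⟩ := exists_energy_step (k := k) (Gf := Gf) (k + 2) J hJ0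
  set t : ℕ := j * (k + 2) with ht
  have htT : t ≤ T := Nat.mul_le_mul_right _ hj.le
  set Pats : Finset (SatFormula (Fin (k + 1) × Bool)) :=
    univ.filter fun P => IsKFormula k P ∧ SimpleFormula P ∧ NonMin P with hPats
  -- the bad event
  set dens : SatFormula (Fin (k + 1) × Bool) → (Fin t → V) → Ω → ℝ := fun P y ω =>
    Ex fun x : Fin (k + 1) × Bool → V =>
      ind (∀ C ∈ P, cmap x C ∈ likely k Gf δ (univ.image y) ω) with hdens
  have hdens0 : ∀ P y ω, 0 ≤ dens P y ω := fun P y ω => Ex_nonneg fun _ => ind_nonneg _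
  have hb1 : ∀ P ∈ Pats, Ex (fun y => Ex fun ω => dens P y ω) ≤ τ / (4 * Np) := by
    intro P hP
    obtain ⟨h1, h2, h3⟩ := (mem_filter.1 hP).2
    refine (Ex_pattern_likely_le hm h1 h2 h3 hl0 hδ fun s => (hs s).trans hJl).trans ?_
    have hPM : P.card ≤ M := hM P
    have h4 : ((k + (k + 2) + t : ℕ) : ℝ) ^ 2 / Fintype.card V ≤ M * (2 * l) := by
      rw [div_le_iff₀ hVr]
      rw [div_lt_iff₀ (by positivity)] at hn₁
      have : ((k + (k + 2) + t : ℕ) : ℝ) ≤ ((k + (k + 2) + T : ℕ) : ℝ) := by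
        exact_mod_cast (by omega)
      calc ((k + (k + 2) + t : ℕ) : ℝ) ^ 2 ≤ ((k + (k + 2) + T : ℕ) : ℝ) ^ 2 := by gcongr
        _ ≤ n₁ * (M * (2 * l)) := hn₁.le
        _ ≤ Fintype.card V * (M * (2 * l)) := by gcongr
        _ = _ := by ring
    have h5 : (P.card : ℝ) * (2 * l) ≤ M * (2 * l) := by gcongr
    have h6 : δ ^ M ≤ δ ^ P.card := pow_le_pow_of_le_one hδ.le hδ1 hPM
    calc _ ≤ (M * (2 * l) + M * (2 * l)) / δ ^ M := by gcongr
      _ = τ / (4 * Np) := by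
        rw [hl]; field_simp; ring
  have hb2 : Ex (fun y : Fin t → V => Ex fun ω => (∑ P ∈ Pats, dens P y ω / τ +
      ((Gf ω \ likely k Gf δ (univ.image y) ω).card : ℝ) / (4 * δ * (2 * Fintype.card V : ℕ) ^ k)))
      ≤ 1 / 2 := by
    simp only [Ex_add, Ex_sum, div_eq_mul_inv, Ex_mul_const]
    have h1 : ∑ P ∈ Pats, Ex (fun y => Ex fun ω => dens P y ω) * τ⁻¹ ≤ 1 / 4 := by
      calc _ ≤ ∑ P ∈ Pats, τ / (4 * Np) * τ⁻¹ := by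
            refine sum_le_sum fun P hP => ?_
            have := hb1 P hP
            gcongr
        _ = Pats.card * (1 / (4 * Np)) := by
            rw [sum_const, nsmul_eq_mul]; field_simp
        _ ≤ Np * (1 / (4 * Np)) := by
            have : Pats.card ≤ Np := hNp _
            gcongr
        _ = 1 / 4 := by field_simp
    have h2 : Ex (fun y : Fin t → V => Ex fun ω =>
        ((Gf ω \ likely k Gf δ (univ.image y) ω).card : ℝ)) *
        (4 * δ * (2 * Fintype.card V : ℕ) ^ k)⁻¹ ≤ 1 / 4 := by
      have h3 : Ex (fun y : Fin t → V => Ex fun ω =>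
        ((Gf ω \ likely k Gf δ (univ.image y) ω).card : ℝ)) ≤
          δ * (2 * Fintype.card V : ℕ) ^ k :=
        Ex_le_of_le fun y => Ex_card_unlikely_le k Gf hk hδ.le _
      have h4 : (0 : ℝ) < ((2 * Fintype.card V : ℕ) : ℝ) ^ k := by push_cast; positivity
      rw [← div_eq_mul_inv, div_le_iff₀ (by positivity)]
      linarith
    norm_num at h1 h2 ⊢
    linarith
  obtain ⟨y, hy⟩ := exists_le_Ex (fun y : Fin t → V => Ex fun ω => (∑ P ∈ Pats, dens P y ω / τ +
      ((Gf ω \ likely k Gf δ (univ.image y) ω).card : ℝ) / (4 * δ * (2 * Fintype.card V : ℕ) ^ k)))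
  replace hy := hy.trans hb2
  have h4 : (0 : ℝ) < ((2 * Fintype.card V : ℕ) : ℝ) ^ k := by push_cast; positivity
  set Y : Finset V := univ.image y with hY
  refine ⟨Y, card_image_le.trans (by simpa using htT),
    univ.filter fun ω => FewBad k (likely k Gf δ Y ω) η ∧
          ((Gf ω \ likely k Gf δ Y ω).card : ℝ) ≤ 4 * δ * (2 * Fintype.card V : ℕ) ^ k,
    ?_, fun ω hω => (mem_filter.1 hω).2⟩
  rw [card_filter_eq_Ex]
  have h5 : 1 / 2 ≤ Ex (fun ω => ind (FewBad k (likely k Gf δ Y ω) η ∧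
          ((Gf ω \ likely k Gf δ Y ω).card : ℝ) ≤ 4 * δ * (2 * Fintype.card V : ℕ) ^ k)) := by
    have h6 : Ex (fun ω => 1 - ind (FewBad k (likely k Gf δ Y ω) η ∧
          ((Gf ω \ likely k Gf δ Y ω).card : ℝ) ≤ 4 * δ * (2 * Fintype.card V : ℕ) ^ k))
        ≤ 1 / 2 := by
      refine le_trans (Ex_mono fun ω => ?_) hy
      rw [← ind_not]
      have hnn : 0 ≤ ∑ P ∈ Pats, dens P y ω / τ :=
        sum_nonneg fun P _ => div_nonneg (hdens0 _ _ _) hτ0.le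
      have hnn2 : 0 ≤ ((Gf ω \ likely k Gf δ Y ω).card : ℝ) /
          (4 * δ * (2 * Fintype.card V : ℕ) ^ k) := by positivity
      refine ind_le_of_pos (add_nonneg hnn hnn2) fun hbad => ?_
      by_cases hc : ((Gf ω \ likely k Gf δ Y ω).card : ℝ) ≤ 4 * δ * (2 * Fintype.card V : ℕ) ^ k
      · have hF : ¬ FewBad k (likely k Gf δ Y ω) η := fun h => hbad ⟨h, hc⟩
        have : ∃ P ∈ Pats, τ < dens P y ω := by
          by_contra! hall
          exact hF (fewBad_of_pattern hη.le fun P h1 h2 h3 =>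
            hall P (mem_filter.2 ⟨mem_univ _, h1, h2, h3⟩))
        obtain ⟨P, hP, hlt⟩ := this
        have := single_le_sum (f := fun P => dens P y ω / τ)
          (fun P _ => div_nonneg (hdens0 P y ω) hτ0.le) hP
        have h7 : 1 ≤ dens P y ω / τ := (one_le_div hτ0).2 hlt.le
        linarith
      · have : 1 ≤ ((Gf ω \ likely k Gf δ Y ω).card : ℝ) /
          (4 * δ * (2 * Fintype.card V : ℕ) ^ k) :=
          (one_le_div (by positivity)).2 (not_le.1 hc).le
        linarith
    rw [Ex_sub, Ex_const] at h6
    linarith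
  have : (0 : ℝ) ≤ Fintype.card Ω := by positivity
  nlinarith

end GoodSet

section Omit

variable {V : Type*} [Fintype V] [DecidableEq V] {w : ℕ}

/-- The set of entries of a tuple other than the `p`-th. -/
def dropAt (x : Fin w → V) (p : Fin w) : Finset V := (univ.erase p).image x

lemma dropAt_comp (x : Fin w → V) (σ : Equiv.Perm (Fin w)) (p : Fin w) :
    dropAt (x ∘ σ) p = dropAt x (σ p) := by
  rw [dropAt, dropAt, ← image_image]
  congr 1
  ext q
  simp only [mem_image, mem_erase, mem_univ, and_true]
  constructor
  · rintro ⟨r, hr, rfl⟩; exact fun h => hr (σ.injective h)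
  · intro h; exact ⟨σ.symm q, fun h' => h (by rw [← h']; simp), by simp⟩

lemma mem_dropAt {x : Fin w → V} {p q : Fin w} (h : q ≠ p) : x q ∈ dropAt x p :=
  mem_image_of_mem _ (mem_erase.2 ⟨h, mem_univ _⟩)

lemma Ex_pair_eq [Nonempty V] (F : (Fin w → V) → Fin w → Fin w → ℝ)
    (hF : ∀ x (σ : Equiv.Perm (Fin w)) p q, F (x ∘ σ) p q = F x (σ p) (σ q))
    {p q p' q' : Fin w} (h : p ≠ q) (h' : p' ≠ q') :
    Ex (fun x => F x p q) = Ex (fun x => F x p' q') := by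
  have inj : ∀ {a b : Fin w}, a ≠ b → Function.Injective ![a, b] := by
    intro a b hab i j; fin_cases i <;> fin_cases j <;> simp [hab, hab.symm]
  obtain ⟨σ, hσ⟩ := Equiv.Perm.exists_extending_pair ![p, q] ![p', q'] (inj h) (inj h')
  have h0 := hσ 0
  have h1 := hσ 1
  simp only [Matrix.cons_val_zero, Matrix.cons_val_one] at h0 h1
  rw [← Ex_comp_inj σ.injective (fun x => F x p q)]
  refine Ex_congr fun x => ?_
  rw [hF, h0, h1]

lemma Ex_dropAt [Nonempty V] (F : Finset V → ℝ) (p : Fin (w + 1)) :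
    Ex (fun x => F (dropAt x p)) = Ex (fun z : Fin w → V => F (univ.image z)) := by
  rw [← Ex_comp_inj (Fin.succAbove_right_injective (p := p)) (fun z => F (univ.image z))]
  refine Ex_congr fun x => ?_
  rw [dropAt, ← image_image]
  congr 2
  ext q
  simp [eq_comm]

lemma dropAt_cons_cons_zero (R : Fin w → V) (v u : V) :
    dropAt (Fin.cons v (Fin.cons u R) : Fin (w + 2) → V) 0 = insert u (univ.image R) := by
  ext a
  simp only [dropAt, mem_image, mem_erase, mem_univ, and_true, mem_insert, true_and]
  constructor
  · rintro ⟨i, hi, rfl⟩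
    obtain ⟨j, rfl⟩ := Fin.exists_succ_eq.2 hi
    refine Fin.cases ?_ (fun l => ?_) j
    · simp
    · right; exact ⟨l, by simp⟩
  · rintro (rfl | ⟨l, rfl⟩)
    · exact ⟨Fin.succ 0, Fin.succ_ne_zero _, by rw [Fin.cons_succ, Fin.cons_zero]⟩
    · exact ⟨l.succ.succ, Fin.succ_ne_zero _, by simp⟩

lemma dropAt_cons_cons_one (R : Fin w → V) (v u : V) :
    dropAt (Fin.cons v (Fin.cons u R) : Fin (w + 2) → V) 1 = insert v (univ.image R) := by
  ext a
  simp only [dropAt, mem_image, mem_erase, mem_univ, and_true, mem_insert, true_and]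
  constructor
  · rintro ⟨i, hi, rfl⟩
    revert hi
    refine Fin.cases (fun _ => by simp) (fun j => ?_) i
    refine Fin.cases (fun h => absurd (Fin.succ_zero_eq_one) h) (fun l _ => ?_) j
    right; exact ⟨l, by simp⟩
  · rintro (rfl | ⟨l, rfl⟩)
    · exact ⟨0, by simp, by simp⟩
    · exact ⟨l.succ.succ, fun h => Fin.succ_ne_zero l
        (Fin.succ_injective _ (h.trans Fin.succ_zero_eq_one.symm)), by simp⟩

end Omit

section Turan

variable {V : Type*} [Fintype V] [DecidableEq V]

lemma tangent_bound {d y z a b : ℝ} (hy : 0 ≤ y) (hz : 0 ≤ z) (hyz : y + z ≤ d) (hd : d ≤ 1) :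
    y * (2 * a - 1 - a ^ 2 * d) + z * (2 * b - 1 - b ^ 2 * d) ≤ 1 - d := by
  rcases eq_or_lt_of_le (show 0 ≤ d by linarith) with h | h
  · have h1 : y = 0 := by linarith
    have h2 : z = 0 := by linarith
    rw [h1, h2, ← h]; norm_num
  · have key : ∀ c : ℝ, 2 * c - 1 - c ^ 2 * d ≤ (1 - d) / d := by
      intro c
      rw [le_div_iff₀ h]
      nlinarith [sq_nonneg (c * d - 1)]
    calc _ ≤ y * ((1 - d) / d) + z * ((1 - d) / d) := by gcongr <;> exact key _
      _ = (y + z) * ((1 - d) / d) := by ring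
      _ ≤ d * ((1 - d) / d) := by
        have : 0 ≤ (1 - d) / d := div_nonneg (by linarith) h.le
        gcongr
      _ = 1 - d := by field_simp

lemma quadratic_bound {d y k : ℝ} (hk : 9 ≤ k) (hy : 0 ≤ y) (hyd : y ≤ d) (hd : d ≤ 1) :
    0.6 * k * y ≤ 1 / 2 * (1 - d) + 1 / 4 * (k * (k - 1)) * (y * d) := by
  rcases le_total 0 (1 / 4 * (k * (k - 1)) * d - 0.6 * k) with h | h
  · nlinarith [mul_nonneg hy h]
  · have h1 := mul_le_mul_of_nonpos_right hyd h
    have hA : 0 < k * (k - 1) := by nlinarith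
    have h2 : (1 / 2 + 0.6 * k) ^ 2 ≤ 1 / 2 * (k * (k - 1)) := by nlinarith
    have h3 : 0 ≤ (k * (k - 1)) * (1 / 2 - (1 / 2 + 0.6 * k) * d + 1 / 4 * (k * (k - 1)) * d ^ 2) := by
      nlinarith [sq_nonneg (1 / 2 * (k * (k - 1)) * d - (1 / 2 + 0.6 * k))]
    have h4 := nonneg_of_mul_nonneg_right h3 hA
    nlinarith

variable {m : ℕ} {Ed : Finset V → Prop} {Bi : Finset V → V → Prop} {η : ℝ}

/-- The pairs of distinct non-zero indices. -/
def nzPairs (m : ℕ) : Finset (Fin (m + 2) × Fin (m + 2)) :=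
  ((univ : Finset (Fin (m + 2))).erase 0).offDiag

lemma card_nzPairs (m : ℕ) : ((nzPairs m).card : ℝ) = (m + 1) * m := by
  rw [nzPairs, offDiag_card, card_erase_of_mem (mem_univ _), card_univ, Fintype.card_fin]
  have : (m + 2 - 1) * (m + 2 - 1) - (m + 2 - 1) = (m + 1) * m := by
    rw [show m + 2 - 1 = m + 1 by omega, ← Nat.mul_sub_one, Nat.add_sub_cancel]
  rw [this]; push_cast; ring

/-- The triples of distinct indices. -/
def dTriples (m : ℕ) : Finset (Fin (m + 2) × Fin (m + 2) × Fin (m + 2)) :=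
  univ.filter fun t => t.1 ≠ t.2.1 ∧ t.1 ≠ t.2.2 ∧ t.2.1 ≠ t.2.2

lemma card_dTriples (m : ℕ) : ((dTriples m).card : ℝ) ≤ (m + 2) ^ 3 := by
  have := card_le_univ (dTriples m)
  simp only [Fintype.card_prod, Fintype.card_fin] at this
  calc ((dTriples m).card : ℝ) ≤ (((m + 2) * ((m + 2) * (m + 2)) : ℕ) : ℝ) := by exact_mod_cast this
    _ = _ := by push_cast; ring

lemma sum_pairs_le (hBi : ∀ f v, Bi f v → Ed f ∧ v ∈ f) (x : Fin (m + 2) → V) :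
    ∑ t ∈ nzPairs m, ind (Bi (dropAt x t.2) (x t.1) ∧ Ed (dropAt x t.1)) ≤
      2 * (1 - ind (Ed (dropAt x 0))) + (m + 1) * m * ∑ t ∈ dTriples m,
        ind (Bi (dropAt x t.2.1) (x t.1) ∧ Ed (dropAt x t.1) ∧ Ed (dropAt x t.2.2)) := by
  set viol : ℝ := ∑ t ∈ dTriples m,
    ind (Bi (dropAt x t.2.1) (x t.1) ∧ Ed (dropAt x t.1) ∧ Ed (dropAt x t.2.2)) with hviol
  have hviol0 : 0 ≤ viol := sum_nonneg fun _ _ => ind_nonneg _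
  have hnn : 0 ≤ 1 - ind (Ed (dropAt x 0)) := sub_nonneg.2 (ind_le_one _)
  have hmm : (0 : ℝ) ≤ (m + 1) * m := by positivity
  by_cases hv : ∃ t ∈ dTriples m, Bi (dropAt x t.2.1) (x t.1) ∧ Ed (dropAt x t.1) ∧ Ed (dropAt x t.2.2)
  · have h1 : 1 ≤ viol := by
      obtain ⟨t, ht, h⟩ := hv
      rw [← ind_true h]
      exact single_le_sum (f := fun t : Fin (m + 2) × Fin (m + 2) × Fin (m + 2) =>
        ind (Bi (dropAt x t.2.1) (x t.1) ∧ Ed (dropAt x t.1) ∧ Ed (dropAt x t.2.2)))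
        (fun _ _ => ind_nonneg _) ht
    have h2 : ∑ t ∈ nzPairs m, ind (Bi (dropAt x t.2) (x t.1) ∧ Ed (dropAt x t.1)) ≤ (m + 1) * m := by
      rw [← card_nzPairs]
      calc _ ≤ ∑ _t ∈ nzPairs m, (1 : ℝ) := sum_le_sum fun _ _ => ind_le_one _
        _ = _ := by simp
    nlinarith [mul_le_mul_of_nonneg_left h1 hmm]
  · push Not at hv
    have hbad : ∀ p q r : Fin (m + 2), p ≠ q → p ≠ r → q ≠ r → Bi (dropAt x q) (x p) →
        Ed (dropAt x p) → ¬ Ed (dropAt x r) := fun p q r h1 h2 h3 h4 h5 =>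
      hv (p, q, r) (by simp [dTriples, h1, h2, h3]) h4 h5
    have h2 : 0 ≤ (m + 1) * m * viol := mul_nonneg hmm hviol0
    by_cases hall : ∃ t ∈ nzPairs m, Bi (dropAt x t.2) (x t.1) ∧ Ed (dropAt x t.1)
    · obtain ⟨⟨p, q⟩, ht, hb, he⟩ := hall
      simp only [nzPairs, mem_offDiag, mem_erase, mem_univ, and_true] at ht
      obtain ⟨hp0, hq0, hne⟩ := ht
      have h0 := hbad p q 0 hne hp0 hq0 hb he
      rw [ind_false h0]
      have hsub : ∀ t ∈ nzPairs m, t ∉ ({(p, q), (q, p)} : Finset (Fin (m + 2) × Fin (m + 2))) →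
          ind (Bi (dropAt x t.2) (x t.1) ∧ Ed (dropAt x t.1)) = 0 := by
        rintro ⟨p', q'⟩ ht' hnot
        refine ind_false fun h => hnot ?_
        simp only [nzPairs, mem_offDiag, mem_erase, mem_univ, and_true] at ht'
        have e1 : p' = p ∨ p' = q := by
          by_contra! hc
          exact hbad p q p' hne hc.1.symm hc.2.symm hb he h.2
        have e2 : q' = p ∨ q' = q := by
          by_contra! hc
          exact hbad p q q' hne hc.1.symm hc.2.symm hb he (hBi _ _ h.1).1
        have := ht'.2.2
        rcases e1 with e1 | e1 <;> rcases e2 with e2 | e2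
        · exact absurd (e1.trans e2.symm) this
        · simp [e1, e2]
        · simp [e1, e2]
        · exact absurd (e1.trans e2.symm) this
      have h3 : ∑ t ∈ nzPairs m, ind (Bi (dropAt x t.2) (x t.1) ∧ Ed (dropAt x t.1)) ≤
          ∑ t ∈ ({(p, q), (q, p)} : Finset (Fin (m + 2) × Fin (m + 2))), (1 : ℝ) := by
        calc _ ≤ ∑ t ∈ ({(p, q), (q, p)} : Finset (Fin (m + 2) × Fin (m + 2))),
              ind (Bi (dropAt x t.2) (x t.1) ∧ Ed (dropAt x t.1)) := by
              rw [← sum_filter_add_sum_filter_not (nzPairs m)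
                (· ∈ ({(p, q), (q, p)} : Finset (Fin (m + 2) × Fin (m + 2)))),
                sum_eq_zero (s := (nzPairs m).filter (· ∉ _)) fun t ht =>
                  hsub t (mem_filter.1 ht).1 (mem_filter.1 ht).2, add_zero]
              exact sum_le_sum_of_subset_of_nonneg (fun t ht => (mem_filter.1 ht).2)
                fun _ _ _ => ind_nonneg _
          _ ≤ _ := sum_le_sum fun _ _ => ind_le_one _
      have h4 : (({(p, q), (q, p)} : Finset (Fin (m + 2) × Fin (m + 2))).card : ℝ) ≤ 2 := by
        exact_mod_cast card_le_two
      rw [sum_const, nsmul_eq_mul, mul_one] at h3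
      linarith
    · push Not at hall
      rw [sum_eq_zero fun t ht => ind_false fun h => hall t ht h.1 h.2]
      linarith

set_option maxHeartbeats 800000 in
/-- A Turán-type inequality between the density of missing edges and that of edges carrying a
direction. -/
lemma directed_density_le [Nonempty V] (hm : 1 ≤ m)
    (hcard : ∀ f, Ed f → f.card = m + 1) (hBi : ∀ f v, Bi f v → Ed f ∧ v ∈ f)
    (huniq : ∀ f v v', Bi f v → Bi f v' → v = v')
    (hη : ∀ p q r : Fin (m + 2), p ≠ q → p ≠ r → q ≠ r →
      Ex (fun x => ind (Bi (dropAt x q) (x p) ∧ Ed (dropAt x p) ∧ Ed (dropAt x r))) ≤ η)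
    {p₀ q₀ : Fin (m + 2)} (hpq : p₀ ≠ q₀) :
    0.6 * (m + 1) * Ex (fun x => ind (Bi (dropAt x q₀) (x p₀))) ≤
      1 - Ex (fun z : Fin (m + 1) → V => ind (Ed (univ.image z))) + (m + 3) ^ 5 * η := by
  set β := Ex (fun x => ind (Bi (dropAt x q₀) (x p₀))) with hβdef
  set μ := 1 - Ex (fun z : Fin (m + 1) → V => ind (Ed (univ.image z))) with hμdef
  set ω := Ex (fun x : Fin (m + 2) → V => ind (Bi (dropAt x 1) (x 0) ∧ Ed (dropAt x 0))) with hω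
  have h01 : (0 : Fin (m + 2)) ≠ 1 := by simp
  have hβ : ∀ p q : Fin (m + 2), p ≠ q → Ex (fun x => ind (Bi (dropAt x q) (x p))) = β := by
    intro p q h
    exact Ex_pair_eq (fun x p q => ind (Bi (dropAt x q) (x p)))
      (fun x σ p q => by simp only [dropAt_comp]; rfl) h hpq
  have hωe : ∀ p q : Fin (m + 2), p ≠ q →
      Ex (fun x => ind (Bi (dropAt x q) (x p) ∧ Ed (dropAt x p))) = ω := by
    intro p q h
    exact Ex_pair_eq (fun x p q => ind (Bi (dropAt x q) (x p) ∧ Ed (dropAt x p)))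
      (fun x σ p q => by simp only [dropAt_comp]; rfl) h h01
  have hμ : ∀ p : Fin (m + 2), Ex (fun x => ind (Ed (dropAt x p))) = 1 - μ := by
    intro p
    rw [Ex_dropAt (fun f => ind (Ed f))]; simp [hμdef]
  have hη0 : 0 ≤ η := by
    obtain ⟨l⟩ : Nonempty (Fin m) := ⟨⟨0, hm⟩⟩
    exact (Ex_nonneg fun _ => ind_nonneg _).trans (hη l.succ.succ 1 0
      (fun h => Fin.succ_ne_zero l (Fin.succ_injective _ (h.trans Fin.succ_zero_eq_one.symm)))
      (Fin.succ_ne_zero _) h01.symm)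
  set d : (Fin m → V) → ℝ := fun R => Ex fun u => ind (Ed (insert u (univ.image R))) with hd
  set y : (Fin m → V) → ℝ := fun R => Ex fun v => ind (Bi (insert v (univ.image R)) v) with hy
  set zl : Fin m → (Fin m → V) → ℝ := fun l R =>
    Ex fun v => ind (Bi (insert v (univ.image R)) (R l)) with hzl
  have hd1 : ∀ R, d R ≤ 1 := fun R => Ex_le_of_le fun _ => ind_le_one _
  have hy0 : ∀ R, 0 ≤ y R := fun R => Ex_nonneg fun _ => ind_nonneg _
  have hz0 : ∀ l R, 0 ≤ zl l R := fun l R => Ex_nonneg fun _ => ind_nonneg _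
  have hEd : Ex d = 1 - μ := by
    rw [← hμ 0, Ex_fin_succ, Ex_fin_succ]
    refine Ex_congr fun R => Ex_congr fun u => ?_
    simp only [dropAt_cons_cons_zero]
    rw [Ex_const]
  have hEy : Ex y = β := by
    rw [← hβ 0 1 h01, Ex_fin_succ, Ex_fin_succ]
    refine Ex_congr fun R => ?_
    simp only [dropAt_cons_cons_one, Fin.cons_zero]
    rw [Ex_const]
  have hEyd : Ex (fun R => y R * d R) = ω := by
    rw [hω, Ex_fin_succ, Ex_fin_succ]
    refine Ex_congr fun R => ?_
    simp only [dropAt_cons_cons_one, dropAt_cons_cons_zero, Fin.cons_zero, ind_and, Ex_mul_const,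
      Ex_const_mul]
    rfl
  have hl0 : ∀ l : Fin m, l.succ.succ ≠ (0 : Fin (m + 2)) := fun l => Fin.succ_ne_zero _
  have hl1 : ∀ l : Fin m, l.succ.succ ≠ (1 : Fin (m + 2)) := fun l h =>
    Fin.succ_ne_zero l (Fin.succ_injective _ (h.trans Fin.succ_zero_eq_one.symm))
  have hEz : ∀ l, Ex (zl l) = β := by
    intro l
    rw [← hβ l.succ.succ 1 (hl1 l), Ex_fin_succ, Ex_fin_succ]
    refine Ex_congr fun R => ?_
    simp only [dropAt_cons_cons_one, Fin.cons_succ]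
    rw [Ex_const]
  have hEzd : ∀ l, Ex (fun R => zl l R * d R) ≤ β + η - ω := by
    intro l
    have h1 : Ex (fun R => zl l R * d R) = Ex (fun x : Fin (m + 2) → V =>
        ind (Bi (dropAt x 1) (x l.succ.succ) ∧ Ed (dropAt x 0))) := by
      rw [Ex_fin_succ, Ex_fin_succ]
      refine Ex_congr fun R => ?_
      simp only [dropAt_cons_cons_one, dropAt_cons_cons_zero, Fin.cons_succ, ind_and,
        Ex_mul_const, Ex_const_mul]
      rfl
    have h2 : Ex (fun x : Fin (m + 2) → V =>
        ind (Bi (dropAt x 1) (x l.succ.succ) ∧ Ed (dropAt x 0)) +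
        ind (Bi (dropAt x 1) (x l.succ.succ) ∧ Ed (dropAt x l.succ.succ))) ≤
        Ex (fun x => ind (Bi (dropAt x 1) (x l.succ.succ)) + ind (Bi (dropAt x 1) (x l.succ.succ) ∧
          Ed (dropAt x l.succ.succ) ∧ Ed (dropAt x 0))) := by
      refine Ex_mono fun x => ?_
      simp only [ind_and]
      have e1 := ind_nonneg (Bi (dropAt x 1) (x l.succ.succ))
      have e2 := ind_le_one (Ed (dropAt x 0))
      have e3 := ind_le_one (Ed (dropAt x l.succ.succ))
      nlinarith [mul_nonneg e1 (mul_nonneg (sub_nonneg.2 e2) (sub_nonneg.2 e3))]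
    rw [Ex_add, Ex_add, hωe _ _ (hl1 l), hβ _ _ (hl1 l)] at h2
    have h3 := hη l.succ.succ 1 0 (hl1 l) (hl0 l) h01.symm
    linarith
  have hsum : ∀ R, y R + ∑ l, zl l R ≤ d R := by
    intro R
    simp only [hy, hzl, hd]
    rw [← Ex_sum, ← Ex_add]
    refine Ex_mono fun v => ?_
    by_cases hE : Ed (insert v (univ.image R))
    · have hinj : Function.Injective (Fin.cons v R : Fin (m + 1) → V) := by
        have := hcard _ hE
        have h2 : univ.image (Fin.cons v R : Fin (m + 1) → V) = insert v (univ.image R) := by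
          ext a; simp [Fin.exists_fin_succ, eq_comm]
        rw [← h2] at this
        have h3 := card_image_iff.1 (this.trans (by simp : m + 1 = (univ : Finset (Fin (m + 1))).card))
        simpa [Set.injOn_univ] using h3
      have h4 : ind (Bi (insert v (univ.image R)) v) +
          ∑ l, ind (Bi (insert v (univ.image R)) (R l)) =
          ∑ i : Fin (m + 1), ind (Bi (insert v (univ.image R)) ((Fin.cons v R : Fin (m + 1) → V) i)) := by
        rw [Fin.sum_univ_succ]; simp
      rw [h4, ind_true hE]
      by_cases hex : ∃ i, Bi (insert v (univ.image R)) ((Fin.cons v R : Fin (m + 1) → V) i)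
      · obtain ⟨i, hi⟩ := hex
        rw [sum_eq_single i]
        · exact ind_le_one _
        · intro j _ hj
          exact ind_false fun h => hj (hinj (huniq _ _ _ h hi))
        · simp
      · push Not at hex
        rw [sum_eq_zero fun i _ => ind_false (hex i)]; exact zero_le_one
    · rw [ind_false (fun h => hE (hBi _ _ h).1), sum_eq_zero fun l _ =>
        ind_false (fun h => hE (hBi _ _ h).1), ind_false hE]; norm_num
  have hβ0 : 0 ≤ β := Ex_nonneg fun _ => ind_nonneg _
  rcases le_total m 9 with hm9 | hm9
  · have hmr : (1 : ℝ) ≤ m := by exact_mod_cast hm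
    have hm9r : (m : ℝ) ≤ 9 := by exact_mod_cast hm9
    set q := Real.sqrt m with hq
    have hq2 : q ^ 2 = m := Real.sq_sqrt (by linarith)
    have hq1 : 1 ≤ q := by rw [hq]; exact Real.one_le_sqrt.2 hmr
    have hpt : Ex (fun R => (y R * (2 * (1 + q) - 1) - (1 + q) ^ 2 * (y R * d R)) +
        ∑ l, (zl l R * (2 * (1 + 1 / q) - 1) - (1 + 1 / q) ^ 2 * (zl l R * d R))) ≤
        Ex (fun R => 1 - d R) := by
      refine Ex_mono fun R => le_trans (le_of_eq ?_)
        (tangent_bound (a := 1 + q) (b := 1 + 1 / q) (hy0 R)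
        (sum_nonneg fun l _ => hz0 l R) (hsum R) (hd1 R))
      rw [sum_mul]
      congr 1
      · ring
      · exact sum_congr rfl fun l _ => by ring
    simp only [Ex_add, Ex_sum, Ex_sub, Ex_const_mul, Ex_mul_const, Ex_const] at hpt
    rw [hEd, hEy, hEyd] at hpt
    have h5 : (m : ℝ) * (β * (2 * (1 + 1 / q) - 1) - (1 + 1 / q) ^ 2 * (β + η - ω)) ≤
        ∑ l, (Ex (zl l) * (2 * (1 + 1 / q) - 1) - (1 + 1 / q) ^ 2 * Ex (fun R => zl l R * d R)) := by
      have : (m : ℝ) * (β * (2 * (1 + 1 / q) - 1) - (1 + 1 / q) ^ 2 * (β + η - ω)) =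
        ∑ _l : Fin m, (β * (2 * (1 + 1 / q) - 1) - (1 + 1 / q) ^ 2 * (β + η - ω)) := by
        rw [sum_const, card_univ, Fintype.card_fin, nsmul_eq_mul]
      rw [this]
      refine sum_le_sum fun l _ => ?_
      rw [hEz l]
      have := hEzd l
      gcongr
    have h6 : (m : ℝ) * (β * (2 * (1 + 1 / q) - 1) - (1 + 1 / q) ^ 2 * (β + η - ω)) =
        β * (q ^ 2 + 2 * q) - (1 + q) ^ 2 * (β + η - ω) := by
      rw [← hq2]; field_simp; ring
    have h7 : 2 * q * β - (1 + q) ^ 2 * η ≤ μ := by nlinarith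
    have h8 : 0.6 * ((m : ℝ) + 1) ≤ 2 * q := by nlinarith
    have h9 : (1 + q) ^ 2 ≤ ((m : ℝ) + 3) ^ 5 := by
      have : q ≤ m := by nlinarith
      calc (1 + q) ^ 2 ≤ ((m : ℝ) + 3) ^ 2 := pow_le_pow_left₀ (by linarith) (by linarith) 2
        _ ≤ _ := pow_le_pow_right₀ (by linarith) (by norm_num)
    nlinarith [mul_le_mul_of_nonneg_right h8 hβ0, mul_le_mul_of_nonneg_right h9 hη0]
  · have hm9r : (9 : ℝ) ≤ m := by exact_mod_cast hm9
    set viol : (Fin (m + 2) → V) → ℝ := fun x => ∑ t ∈ dTriples m,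
      ind (Bi (dropAt x t.2.1) (x t.1) ∧ Ed (dropAt x t.1) ∧ Ed (dropAt x t.2.2)) with hviol
    have hEviol : Ex viol ≤ (m + 2) ^ 3 * η := by
      rw [hviol, Ex_sum]
      calc _ ≤ ∑ _t ∈ dTriples m, η := sum_le_sum fun t ht => by
              obtain ⟨h1, h2, h3⟩ := (mem_filter.1 ht).2
              exact hη _ _ _ h1 h2 h3
        _ = (dTriples m).card * η := by rw [sum_const, nsmul_eq_mul]
        _ ≤ _ := by
          have := card_dTriples m
          gcongr
    have hpt := fun x => sum_pairs_le (m := m) hBi x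
    have hsumω := Ex_mono hpt
    rw [Ex_sum, sum_congr rfl (g := fun _ => ω) fun t ht => hωe t.1 t.2 (by
        unfold nzPairs at ht; exact (mem_offDiag.1 ht).2.2), sum_const,
      nsmul_eq_mul, card_nzPairs, Ex_add, Ex_const_mul, Ex_const_mul, Ex_sub, Ex_const, hμ] at hsumω
    change _ ≤ _ + _ * Ex viol at hsumω
    have hpt2 := Ex_mono fun R => quadratic_bound (k := (m : ℝ) + 1) (by linarith) (hy0 R)
      (by have := hsum R
          have h0 : 0 ≤ ∑ l, zl l R := sum_nonneg fun l _ => hz0 l R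
          linarith) (hd1 R)
    simp only [Ex_add, Ex_sub, Ex_const_mul, Ex_const] at hpt2
    rw [hEy, hEd, hEyd] at hpt2
    have h9 : 1 / 4 * ((m + 1) * m) * (m + 2) ^ 3 ≤ ((m : ℝ) + 3) ^ 5 := by
      have e1 : 1 / 4 * (((m : ℝ) + 1) * m) ≤ (m + 3) ^ 2 := by nlinarith
      calc _ ≤ ((m : ℝ) + 3) ^ 2 * (m + 3) ^ 3 := by gcongr; norm_num
        _ = _ := by ring
    have h10 := mul_le_mul_of_nonneg_right h9 hη0
    have h11 : ((m : ℝ) + 1) * m * Ex viol ≤ (m + 1) * m * ((m + 2) ^ 3 * η) := by gcongr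
    nlinarith

end Turan

section Hybrid

variable {V α : Type*} [Fintype V] [Nonempty V]

/-- Changing all coordinates is controlled by changing one coordinate at a time. -/
lemma hybrid_le {m : ℕ} (g : (Fin m → V) → α) :
    Ex (fun R => Ex fun R' => ind (g R ≠ g R')) ≤
      ∑ l, Ex (fun R => Ex fun a => ind (g R ≠ g (Function.update R l a))) := by
  classical
  let H : (Fin m ⊕ Fin m → V) → ℕ → Fin m → V := fun y i j =>
    if (j : ℕ) < i then y (Sum.inr j) else y (Sum.inl j)
  have hstep : ∀ y (l : Fin m), H y (l + 1) = Function.update (H y l) l (y (Sum.inr l)) := by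
    intro y l
    funext j
    by_cases hj : j = l
    · subst hj; simp [H]
    · have : (j : ℕ) ≠ l := fun h => hj (Fin.ext h)
      rw [Function.update_of_ne hj]
      simp only [H]
      have h2 : ((j : ℕ) < l + 1) ↔ (j : ℕ) < l := by omega
      simp only [h2]
  have hpt : ∀ y : Fin m ⊕ Fin m → V, ind (g (y ∘ Sum.inl) ≠ g (y ∘ Sum.inr)) ≤
      ∑ l : Fin m, ind (g (H y l) ≠ g (H y (l + 1))) := by
    intro y
    refine ind_le_of_pos (sum_nonneg fun _ _ => ind_nonneg _) fun hne => ?_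
    by_contra hlt
    have hall : ∀ l : Fin m, g (H y l) = g (H y (l + 1)) := by
      intro l
      by_contra hl
      refine hlt ?_
      rw [← ind_true hl]
      exact single_le_sum (f := fun l : Fin m => ind (g (H y l) ≠ g (H y (l + 1))))
        (fun _ _ => ind_nonneg _) (mem_univ l)
    have hi : ∀ i ≤ m, g (H y 0) = g (H y i) := by
      intro i
      induction i with
      | zero => simp
      | succ i ih => intro h; rw [ih (by omega)]; exact hall ⟨i, h⟩
    refine hne ?_
    have h0 : H y 0 = y ∘ Sum.inl := by funext j; simp [H]
    have h1 : H y m = y ∘ Sum.inr := by funext j; simp [H]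
    rw [← h0, ← h1]; exact hi m le_rfl
  calc Ex (fun R => Ex fun R' => ind (g R ≠ g R'))
      = Ex (fun y : Fin m ⊕ Fin m → V => ind (g (y ∘ Sum.inl) ≠ g (y ∘ Sum.inr))) := by
        rw [Ex_sum_arrow]; rfl
    _ ≤ Ex (fun y : Fin m ⊕ Fin m → V => ∑ l : Fin m, ind (g (H y l) ≠ g (H y (l + 1)))) :=
        Ex_mono hpt
    _ = ∑ l : Fin m, Ex (fun y : Fin m ⊕ Fin m → V => ind (g (H y l) ≠ g (H y (l + 1)))) :=
        Ex_sum _ _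
    _ = _ := by
        refine sum_congr rfl fun l _ => ?_
        let j : Fin m ⊕ Unit → Fin m ⊕ Fin m := Sum.elim
          (fun i => if (i : ℕ) < l then Sum.inr i else Sum.inl i) (fun _ => Sum.inr l)
        have hj : Function.Injective j := by
          rintro (a | a) (b | b) h
          · simp only [j, Sum.elim_inl] at h
            split_ifs at h <;> simp_all
          · simp only [j, Sum.elim_inl, Sum.elim_inr] at h
            split_ifs at h with h1
            have := Sum.inr_injective h
            subst this; simp at h1
          · simp only [j, Sum.elim_inl, Sum.elim_inr] at h
            split_ifs at h with h1
            have := Sum.inr_injective h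
            subst this; simp at h1
          · rfl
        have h1 := Ex_comp_inj (V := V) hj (fun x : Fin m ⊕ Unit → V =>
          ind (g (x ∘ Sum.inl) ≠ g (Function.update (x ∘ Sum.inl) l (x (Sum.inr ())))))
        have h2 : ∀ y : Fin m ⊕ Fin m → V, (y ∘ j) ∘ Sum.inl = H y l := by
          intro y; funext i
          simp only [j, H, Function.comp, Sum.elim_inl]
          split_ifs <;> rfl
        refine Eq.trans (Ex_congr fun y => ?_) (h1.trans ?_)
        · rw [h2, hstep]; rfl
        · rw [Ex_sum_arrow]
          refine Ex_congr fun R => ?_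
          rw [← Ex_equiv (Equiv.funUnique Unit V)]; rfl

end Hybrid

section Signs

variable {V : Type*} [DecidableEq V]

/-- Some clause of `A` has variable set `f`. -/
def Ed (A : SatFormula V) (f : Finset V) : Prop := ∃ τ, signed τ f ∈ A

/-- Some clause of `A` on `f` contains the literal `(v, b)`. -/
def Sg (A : SatFormula V) (f : Finset V) (v : V) (b : Bool) : Prop :=
  v ∈ f ∧ ∃ τ : V → Bool, τ v = b ∧ signed τ f ∈ A

/-- Two clauses of `A` on `f` differ in at least two variables. -/
def Two (A : SatFormula V) (f : Finset V) : Prop :=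
  ∃ τ τ' : V → Bool, signed τ f ∈ A ∧ signed τ' f ∈ A ∧
    ∃ v ∈ f, ∃ w ∈ f, v ≠ w ∧ τ v ≠ τ' v ∧ τ w ≠ τ' w

/-- The clauses of `A` on `f` are two clauses differing at `v`. -/
def Bi (A : SatFormula V) (f : Finset V) (v : V) : Prop :=
  ¬ Two A f ∧ Sg A f v true ∧ Sg A f v false

variable {A : SatFormula V} {f : Finset V}

lemma Bi.ed {v : V} (h : Bi A f v) : Ed A f ∧ v ∈ f := by
  obtain ⟨-, ⟨hv, τ, -, h⟩, -⟩ := h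
  exact ⟨⟨τ, h⟩, hv⟩

lemma Ed.sg (h : Ed A f) {v : V} (hv : v ∈ f) : Sg A f v true ∨ Sg A f v false := by
  obtain ⟨τ, hτ⟩ := h
  cases hb : τ v
  · exact Or.inr ⟨hv, τ, hb, hτ⟩
  · exact Or.inl ⟨hv, τ, hb, hτ⟩

lemma Bi.unique {v v' : V} (h : Bi A f v) (h' : Bi A f v') : v = v' := by
  by_contra hne
  obtain ⟨hT, ⟨hv, τ, h1, h2⟩, ⟨-, τ', h3, h4⟩⟩ := h
  obtain ⟨-, ⟨hv', ρ, h5, h6⟩, ⟨-, ρ', h7, h8⟩⟩ := h'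
  have key : ∀ τ₁ τ₂ : V → Bool, signed τ₁ f ∈ A → signed τ₂ f ∈ A → τ₁ v ≠ τ₂ v →
      τ₁ v' = τ₂ v' := by
    intro τ₁ τ₂ m1 m2 hd
    by_contra hd'
    exact hT ⟨τ₁, τ₂, m1, m2, v, hv, v', hv', hne, hd, hd'⟩
  have e1 := key τ τ' h2 h4 (by simp [h1, h3])
  rcases hb : ρ v with _ | _ <;> rcases hb' : ρ' v with _ | _
  · have a1 := key τ ρ h2 h6 (by simp [h1, hb])
    have a2 := key τ ρ' h2 h8 (by simp [h1, hb'])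
    simp_all
  · have a1 := key ρ ρ' h6 h8 (by simp [hb, hb'])
    simp_all
  · have a1 := key ρ ρ' h6 h8 (by simp [hb, hb'])
    simp_all
  · have a1 := key τ' ρ h4 h6 (by simp [h3, hb])
    have a2 := key τ' ρ' h4 h8 (by simp [h3, hb'])
    simp_all

variable {k : ℕ}

lemma exists_signed (hA : IsKFormula k A) {C : SatClause V} (hC : C ∈ A) (h : clauseVars C = f) :
    ∃ τ, C = signed τ f := by
  obtain ⟨τ, hτ⟩ := exists_sign (hA C hC)
  exact ⟨τ, by rw [← h]; exact hτ⟩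

lemma signed_ne {τ τ' : V → Bool} (h : signed τ f ≠ signed τ' f) : ∃ v ∈ f, τ v ≠ τ' v := by
  by_contra! hc
  refine h ?_
  unfold signed
  exact image_congr fun v hv => by simp [hc v hv]

lemma card_clauses_on_le (hA : IsKFormula k A) (hf : f.card = k) :
    (A.filter fun C => clauseVars C = f).card ≤ 2 ^ k := by
  have : A.filter (fun C => clauseVars C = f) ⊆
      f.powerset.image fun g => signed (fun v => decide (v ∈ g)) f := by
    intro C hC
    obtain ⟨h1, h2⟩ := mem_filter.1 hC
    obtain ⟨τ, rfl⟩ := exists_signed hA h1 h2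
    refine mem_image.2 ⟨f.filter fun v => τ v = true, by simp, ?_⟩
    unfold signed
    refine image_congr fun v hv => ?_
    have : v ∈ f := hv
    cases h : τ v <;> simp [h, this]
  calc _ ≤ _ := card_le_card this
    _ ≤ _ := card_image_le
    _ = _ := by rw [card_powerset, hf]

lemma Ed.card (hA : IsKFormula k A) (h : Ed A f) : f.card = k := by
  obtain ⟨τ, hτ⟩ := h
  have := (hA _ hτ).2
  rwa [clauseVars_signed] at this

lemma logb_three_le : Real.logb 2 3 ≤ 1.59 := by
  rw [Real.logb_le_iff_le_rpow (by norm_num) (by norm_num)]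
  have h : ((2 : ℝ) ^ (1.59 : ℝ)) ^ (100 : ℕ) = 2 ^ (159 : ℕ) := by
    rw [← Real.rpow_natCast, ← Real.rpow_mul (by norm_num), ← Real.rpow_natCast]
    norm_num
  refine le_of_pow_le_pow_left₀ (n := 100) (by norm_num) (by positivity) ?_
  rw [h]; norm_num

lemma logb_clauses_le (hA : IsKFormula k A) (z : Fin k → V) :
    Real.logb 2 (1 + (A.filter fun C => clauseVars C = univ.image z).card) ≤
      ind (Ed A (univ.image z)) + 0.59 * ∑ c, ind (Bi A (univ.image z) (z c)) +
        (k + 1) * ind (Two A (univ.image z)) := by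
  set f := univ.image z with hf
  set B := A.filter fun C => clauseVars C = f with hB
  have hsum : 0 ≤ ∑ c, ind (Bi A f (z c)) := sum_nonneg fun _ _ => ind_nonneg _
  have hed := ind_nonneg (Ed A f)
  by_cases hT : Two A f
  · have hcard : B.card ≤ 2 ^ k := card_clauses_on_le hA
      (by obtain ⟨τ, -, h, -⟩ := hT; exact Ed.card hA ⟨τ, h⟩)
    have h1 : Real.logb 2 (1 + B.card) ≤ k + 1 := by
      rw [Real.logb_le_iff_le_rpow (by norm_num) (by positivity)]
      have : (B.card : ℝ) ≤ 2 ^ k := by exact_mod_cast hcard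
      rw [show ((k : ℝ) + 1) = ((k + 1 : ℕ) : ℝ) by push_cast; rfl, Real.rpow_natCast, pow_succ]
      have : (1 : ℝ) ≤ 2 ^ k := one_le_pow₀ (by norm_num)
      linarith
    rw [ind_true hT]
    linarith
  rw [ind_false hT]
  by_cases hE : Ed A f
  swap
  · have : B = ∅ := by
      rw [hB, filter_eq_empty_iff]
      intro C hC h
      obtain ⟨τ, rfl⟩ := exists_signed hA hC h
      exact hE ⟨τ, hC⟩
    rw [this]; simp; linarith
  rw [ind_true hE]
  by_cases hcard : B.card ≤ 1
  · have : Real.logb 2 (1 + B.card) ≤ 1 := by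
      rw [Real.logb_le_iff_le_rpow (by norm_num) (by positivity)]
      have : (B.card : ℝ) ≤ 1 := by exact_mod_cast hcard
      rw [Real.rpow_one]; linarith
    linarith
  obtain ⟨C₁, hC₁, C₂, hC₂, hne⟩ := one_lt_card.1 (not_le.1 hcard)
  obtain ⟨τ₁, rfl⟩ := exists_signed hA (mem_filter.1 hC₁).1 (mem_filter.1 hC₁).2
  obtain ⟨τ₂, rfl⟩ := exists_signed hA (mem_filter.1 hC₂).1 (mem_filter.1 hC₂).2
  have m1 := (mem_filter.1 hC₁).1
  have m2 := (mem_filter.1 hC₂).1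
  obtain ⟨v, hv, hd⟩ := signed_ne hne
  have hsub : B ⊆ {signed τ₁ f, signed τ₂ f} := by
    intro C hC
    obtain ⟨τ, rfl⟩ := exists_signed hA (mem_filter.1 hC).1 (mem_filter.1 hC).2
    have m := (mem_filter.1 hC).1
    by_contra hcon
    simp only [mem_insert, mem_singleton, not_or] at hcon
    obtain ⟨w₁, hw₁, hd₁⟩ := signed_ne hcon.1
    obtain ⟨w₂, hw₂, hd₂⟩ := signed_ne hcon.2
    have key : ∀ τ₁ τ₂ : V → Bool, signed τ₁ f ∈ A → signed τ₂ f ∈ A → τ₁ v ≠ τ₂ v →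
        ∀ w ∈ f, τ₁ w ≠ τ₂ w → w = v := by
      intro ρ ρ' n1 n2 hh w hw hh'
      by_contra hwv
      exact hT ⟨ρ, ρ', n1, n2, w, hw, v, hv, hwv, hh', hh⟩
    by_cases hv1 : τ v = τ₁ v
    · have e2 := key τ τ₂ m m2 (by rw [hv1]; exact hd)
      have hw : w₁ ≠ v := by rintro rfl; exact hd₁ hv1
      have e3 : τ w₁ = τ₂ w₁ := by by_contra h; exact hw (e2 _ hw₁ h)
      exact hw (key τ₁ τ₂ m1 m2 hd w₁ hw₁ fun h => hd₁ (e3.trans h.symm))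
    · have hv2 : τ v = τ₂ v := by
        revert hd hv1; cases τ v <;> cases τ₁ v <;> cases τ₂ v <;> simp
      have e1 := key τ τ₁ m m1 hv1
      have hw : w₂ ≠ v := by rintro rfl; exact hd₂ hv2
      have e3 : τ w₂ = τ₁ w₂ := by by_contra h; exact hw (e1 _ hw₂ h)
      exact hw (key τ₁ τ₂ m1 m2 hd w₂ hw₂ fun h => hd₂ (e3.trans h))
  have h2 : (B.card : ℝ) ≤ 2 := by exact_mod_cast (card_le_card hsub).trans card_le_two
  have hbi : Bi A f v := by
    refine ⟨hT, ?_⟩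
    cases h1 : τ₁ v <;> cases h2 : τ₂ v
    · exact absurd (h1.trans h2.symm) hd
    · exact ⟨⟨hv, τ₂, h2, m2⟩, ⟨hv, τ₁, h1, m1⟩⟩
    · exact ⟨⟨hv, τ₁, h1, m1⟩, ⟨hv, τ₂, h2, m2⟩⟩
    · exact absurd (h1.trans h2.symm) hd
  obtain ⟨c, -, rfl⟩ := mem_image.1 hv
  have h3 : 1 ≤ ∑ c, ind (Bi A f (z c)) := by
    rw [← ind_true hbi]
    exact single_le_sum (f := fun c => ind (Bi A f (z c))) (fun _ _ => ind_nonneg _) (mem_univ c)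
  have h4 : Real.logb 2 (1 + B.card) ≤ Real.logb 2 3 :=
    Real.logb_le_logb_of_le (by norm_num) (by positivity) (by linarith)
  have := logb_three_le
  linarith

end Signs

section Few

variable {V : Type*} [Fintype V] [DecidableEq V] {A : SatFormula V} {k : ℕ} {η : ℝ}

lemma signed_dropAt {w : ℕ} (τ : V → Bool) (x : Fin w → V) (p : Fin w) :
    signed τ (dropAt x p) = lift x (τ ∘ x) (univ.erase p) := by
  rw [signed, dropAt, lift, image_image]; rfl

lemma FewBad.two_le (h : FewBad k A η) (hη : 0 ≤ η) (p : Fin (k + 1)) :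
    Ex (fun x : Fin (k + 1) → V => ind (Two A (dropAt x p))) ≤ 8 ^ (k + 1) * η := by
  let P : (Fin (k + 1) → Bool) × (Fin (k + 1) → Bool) → Prop := fun q =>
    ∃ i ∈ univ.erase p, ∃ j ∈ univ.erase p, i ≠ j ∧ q.1 i ≠ q.2 i ∧ q.1 j ≠ q.2 j
  have hpt : ∀ x : Fin (k + 1) → V, ind (Two A (dropAt x p)) ≤
      ∑ q : (Fin (k + 1) → Bool) × (Fin (k + 1) → Bool),
        ind (P q) * ind (lift x q.1 (univ.erase p) ∈ A ∧ lift x q.2 (univ.erase p) ∈ A) := by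
    intro x
    refine ind_le_of_pos (sum_nonneg fun _ _ => mul_nonneg (ind_nonneg _) (ind_nonneg _)) ?_
    rintro ⟨τ, τ', h1, h2, v, hv, w, hw, hvw, d1, d2⟩
    rw [signed_dropAt] at h1 h2
    obtain ⟨i, hi, rfl⟩ := mem_image.1 hv
    obtain ⟨j, hj, rfl⟩ := mem_image.1 hw
    refine le_trans (le_of_eq ?_) (single_le_sum (f := fun q : (Fin (k + 1) → Bool) × _ =>
      ind (P q) * ind (lift x q.1 (univ.erase p) ∈ A ∧ lift x q.2 (univ.erase p) ∈ A))
      (fun _ _ => mul_nonneg (ind_nonneg _) (ind_nonneg _)) (mem_univ (τ ∘ x, τ' ∘ x)))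
    have : P (τ ∘ x, τ' ∘ x) := ⟨i, hi, j, hj, fun h => hvw (by rw [h]), d1, d2⟩
    simp only
    rw [ind_true this, ind_true ⟨h1, h2⟩, one_mul]
  refine (Ex_mono hpt).trans ?_
  rw [Ex_sum]
  have hb : ∀ q : (Fin (k + 1) → Bool) × (Fin (k + 1) → Bool), Ex (fun x : Fin (k + 1) → V =>
      ind (P q) * ind (lift x q.1 (univ.erase p) ∈ A ∧ lift x q.2 (univ.erase p) ∈ A)) ≤ η := by
    intro q
    rw [Ex_const_mul]
    by_cases hq : P q
    · rw [ind_true hq, one_mul]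
      exact h.1 q.1 q.2 _ (by simp) hq
    · rw [ind_false hq, zero_mul]; exact hη
  refine (sum_le_sum fun q _ => hb q).trans ?_
  rw [sum_const, nsmul_eq_mul, card_univ, Fintype.card_prod, Fintype.card_fun, Fintype.card_bool,
    Fintype.card_fin]
  push_cast
  rw [← mul_pow]
  gcongr
  norm_num

lemma FewBad.clash_le (h : FewBad k A η) {c a b : Fin (k + 1)} (hac : a ≠ c)
    (hbc : b ≠ c) (hab : a ≠ b) (t : Bool) :
    Ex (fun x : Fin (k + 1) → V => ind (Sg A (dropAt x a) (x c) t ∧ Sg A (dropAt x b) (x c) (!t) ∧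
      Ed A (dropAt x c))) ≤ 8 ^ (k + 1) * η := by
  have hη : 0 ≤ η := (Ex_nonneg fun _ => ind_nonneg _).trans
    (h.2 (fun _ => true) (fun _ => true) (fun _ => false) c a b hac hbc hab (by simp))
  let X := (Fin (k + 1) → Bool) × (Fin (k + 1) → Bool) × (Fin (k + 1) → Bool)
  let F : X → (Fin (k + 1) → V) → Prop := fun q x => lift x q.1 (univ.erase c) ∈ A ∧
    lift x q.2.1 (univ.erase a) ∈ A ∧ lift x q.2.2 (univ.erase b) ∈ A
  have hpt : ∀ x : Fin (k + 1) → V, ind (Sg A (dropAt x a) (x c) t ∧ Sg A (dropAt x b) (x c) (!t) ∧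
      Ed A (dropAt x c)) ≤ ∑ q : X, ind (q.2.1 c ≠ q.2.2 c) * ind (F q x) := by
    intro x
    refine ind_le_of_pos (sum_nonneg fun _ _ => mul_nonneg (ind_nonneg _) (ind_nonneg _)) ?_
    rintro ⟨⟨-, τ₁, e1, h1⟩, ⟨-, τ₂, e2, h2⟩, ⟨τ, h0⟩⟩
    rw [signed_dropAt] at h1 h2 h0
    refine le_trans (le_of_eq ?_) (single_le_sum (f := fun q : X =>
      ind (q.2.1 c ≠ q.2.2 c) * ind (F q x))
      (fun _ _ => mul_nonneg (ind_nonneg _) (ind_nonneg _)) (mem_univ (τ ∘ x, τ₁ ∘ x, τ₂ ∘ x)))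
    simp only
    rw [ind_true (by simp [e1, e2]), ind_true (show F (τ ∘ x, τ₁ ∘ x, τ₂ ∘ x) x from ⟨h0, h1, h2⟩),
      one_mul]
  refine (Ex_mono hpt).trans ?_
  rw [Ex_sum]
  have hb : ∀ q : X, Ex (fun x => ind (q.2.1 c ≠ q.2.2 c) * ind (F q x)) ≤ η := by
    intro q
    rw [Ex_const_mul]
    by_cases hq : q.2.1 c ≠ q.2.2 c
    · rw [ind_true hq, one_mul]
      exact h.2 q.1 q.2.1 q.2.2 c a b hac hbc hab hq
    · rw [ind_false hq, zero_mul]; exact hη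
  refine (sum_le_sum fun q _ => hb q).trans ?_
  rw [sum_const, nsmul_eq_mul, card_univ, Fintype.card_prod, Fintype.card_prod, Fintype.card_fun,
    Fintype.card_bool, Fintype.card_fin]
  push_cast
  rw [← mul_pow, ← mul_pow]
  norm_num

end Few

section Stability

variable {V : Type*} [Fintype V] [DecidableEq V] [Nonempty V] {A : SatFormula V} {m : ℕ} {η : ℝ}

lemma dropAt_zero {w : ℕ} (x : Fin (w + 1) → V) : dropAt x 0 = univ.image (x ∘ Fin.succ) := by
  rw [dropAt, ← image_image]
  congr 1
  ext i
  simp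

lemma image_cons {w : ℕ} (v : V) (R : Fin w → V) :
    univ.image (Fin.cons v R : Fin (w + 1) → V) = insert v (univ.image R) := by
  ext a
  simp [Fin.exists_fin_succ, eq_comm]

lemma image_comp_equiv {w : ℕ} (z : Fin w → V) (σ : Equiv.Perm (Fin w)) :
    univ.image (z ∘ σ) = univ.image z := by
  ext a
  simp only [mem_image, mem_univ, true_and, Function.comp]
  exact ⟨fun ⟨i, h⟩ => ⟨_, h⟩, fun ⟨i, h⟩ => ⟨σ.symm i, by simpa using h⟩⟩

lemma dropAt_cons_cons_succ {w : ℕ} (R : Fin w → V) (v u : V) (l : Fin w) :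
    dropAt (Fin.cons v (Fin.cons u R) : Fin (w + 2) → V) l.succ.succ =
      insert v (univ.image (Function.update R l u)) := by
  ext a
  simp only [dropAt, mem_image, mem_erase, mem_univ, and_true, mem_insert, true_and,
    Fin.exists_fin_succ]
  constructor
  · rintro (⟨-, h⟩ | ⟨-, h⟩ | ⟨i, hi, h⟩)
    · exact Or.inl h.symm
    · exact Or.inr ⟨l, by simpa using h⟩
    · refine Or.inr ⟨i, ?_⟩
      have : i ≠ l := fun e => hi (by rw [e])
      simpa [Function.update_of_ne this] using h
  · rintro (h | ⟨i, h⟩)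
    · exact Or.inl ⟨(Fin.succ_ne_zero _).symm, h.symm⟩
    · by_cases hi : i = l
      · subst hi
        refine Or.inr (Or.inl ⟨fun e => ?_, by simpa using h⟩)
        exact Fin.succ_ne_zero _ (Fin.succ_injective _ e).symm
      · refine Or.inr (Or.inr ⟨i, fun e => hi ?_, by simpa [Function.update_of_ne hi] using h⟩)
        exact Fin.succ_injective _ (Fin.succ_injective _ e)

lemma FewBad.two_image_le (h : FewBad (m + 1) A η) (hη : 0 ≤ η) :
    Ex (fun z : Fin (m + 1) → V => ind (Two A (univ.image z))) ≤ 8 ^ (m + 2) * η := by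
  rw [← Ex_dropAt (fun f => ind (Two A f)) 0]
  exact h.two_le hη 0

lemma FewBad.bi_le (hm : 1 ≤ m) (hA : IsKFormula (m + 1) A) (h : FewBad (m + 1) A η)
    (c : Fin (m + 1)) :
    0.6 * (m + 1) * Ex (fun z : Fin (m + 1) → V => ind (Bi A (univ.image z) (z c))) ≤
      1 - Ex (fun z : Fin (m + 1) → V => ind (Ed A (univ.image z))) +
        (m + 3) ^ 5 * (2 * 8 ^ (m + 2) * η) := by
  have h1 := directed_density_le (V := V) (Ed := Ed A) (Bi := Bi A) (η := 2 * 8 ^ (m + 2) * η)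
    hm (fun f hf => Ed.card hA hf) (fun f v hb => hb.ed) (fun f v v' hb hb' => hb.unique hb') ?_
    (p₀ := c.succ) (q₀ := 0) (Fin.succ_ne_zero _)
  · convert h1 using 3
    rw [← Ex_comp_inj (Fin.succ_injective (m + 1)) (fun z => ind (Bi A (univ.image z) (z c)))]
    refine Ex_congr fun x => ?_
    rw [dropAt_zero]; rfl
  · intro p q r hpq hpr hqr
    have e1 := h.clash_le hpq.symm hpr.symm hqr true
    have e2 := h.clash_le hpq.symm hpr.symm hqr false
    have e3 : 2 * 8 ^ (m + 2) * η = 8 ^ (m + 1 + 1) * η + 8 ^ (m + 1 + 1) * η := by ring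
    rw [e3]
    refine le_trans ?_ (add_le_add e1 e2)
    rw [← Ex_add]
    refine Ex_mono fun x => ?_
    refine le_trans (ind_mono ?_) (ind_or_le _ _)
    rintro ⟨hb, hp, hr⟩
    rcases hr.sg (mem_dropAt hpr) with hs | hs
    · exact Or.inr ⟨hb.2.2, hs, hp⟩
    · exact Or.inl ⟨hb.2.1, hs, hp⟩

/-- If `A` carries a clause on almost every set, the sign of a variable hardly depends on the
clause. -/
lemma FewBad.exists_sign_assignment (h : FewBad (m + 1) A η) :
    ∃ σ : V → Bool, Ex (fun z : Fin (m + 1) → V =>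
      ind ((Sg A (univ.image z) (z 0) true) ≠ (σ (z 0) = true))) ≤
      m * (3 * (1 - Ex (fun z : Fin (m + 1) → V => ind (Ed A (univ.image z)))) +
        2 * 8 ^ (m + 2) * η) := by
  set μ := 1 - Ex (fun z : Fin (m + 1) → V => ind (Ed A (univ.image z))) with hμdef
  classical
  let g : V → (Fin m → V) → Prop := fun v R => Sg A (insert v (univ.image R)) v true
  have hμ : ∀ p : Fin (m + 2), Ex (fun x => ind (¬ Ed A (dropAt x p))) = μ := by
    intro p
    rw [Ex_dropAt (fun f => ind (¬ Ed A f))]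
    simp_rw [ind_not]
    rw [Ex_sub, Ex_const]
  have hl0 : ∀ l : Fin m, l.succ.succ ≠ (0 : Fin (m + 2)) := fun l => Fin.succ_ne_zero _
  have hl1 : ∀ l : Fin m, l.succ.succ ≠ (1 : Fin (m + 2)) := fun l h =>
    Fin.succ_ne_zero l (Fin.succ_injective _ (h.trans Fin.succ_zero_eq_one.symm))
  have hone : ∀ l : Fin m, Ex (fun R => Ex fun a => Ex fun v =>
      ind (g v R ≠ g v (Function.update R l a))) ≤ 3 * μ + 2 * 8 ^ (m + 2) * η := by
    intro l
    have e0 : Ex (fun R => Ex fun a => Ex fun v => ind (g v R ≠ g v (Function.update R l a))) =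
        Ex (fun x : Fin (m + 2) → V => ind (Sg A (dropAt x 1) (x 0) true ≠
          Sg A (dropAt x l.succ.succ) (x 0) true)) := by
      rw [Ex_fin_succ, Ex_fin_succ]
      refine Ex_congr fun R => Ex_congr fun a => Ex_congr fun v => ?_
      rw [dropAt_cons_cons_one, dropAt_cons_cons_succ, Fin.cons_zero]
    rw [e0]
    have e1 := h.clash_le (c := 0) (a := 1) (b := l.succ.succ) (by simp) (hl0 l) (hl1 l).symm true
    have e2 := h.clash_le (c := 0) (a := 1) (b := l.succ.succ) (by simp) (hl0 l) (hl1 l).symm false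
    have e3 : 3 * μ + 2 * 8 ^ (m + 2) * η = (μ + (μ + (μ +
      (8 ^ (m + 1 + 1) * η + 8 ^ (m + 1 + 1) * η)))) := by ring
    rw [e3]
    nth_rw 1 [← hμ 0]; nth_rw 1 [← hμ 1]; nth_rw 1 [← hμ l.succ.succ]
    refine le_trans ?_ (add_le_add_right (add_le_add_right (add_le_add_right
      (add_le_add e1 e2) _) _) _)
    simp only [← Ex_add]
    refine Ex_mono fun x => ?_
    refine le_trans (ind_mono ?_) ((ind_or_le _ _).trans (add_le_add_right ((ind_or_le _ _).trans
      (add_le_add_right ((ind_or_le _ _).trans (add_le_add_right (ind_or_le _ _) _)) _)) _))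
    intro hne
    by_cases d0 : Ed A (dropAt x 0)
    swap
    · exact Or.inl d0
    by_cases d1 : Ed A (dropAt x 1)
    swap
    · exact Or.inr (Or.inl d1)
    by_cases d2 : Ed A (dropAt x l.succ.succ)
    swap
    · exact Or.inr (Or.inr (Or.inl d2))
    refine Or.inr (Or.inr (Or.inr ?_))
    have s1 := d1.sg (v := x 0) (mem_dropAt (by simp))
    have s2 := d2.sg (v := x 0) (mem_dropAt (hl0 l).symm)
    by_cases t1 : Sg A (dropAt x 1) (x 0) true
    · by_cases t2 : Sg A (dropAt x l.succ.succ) (x 0) true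
      · exact absurd (propext ⟨fun _ => t2, fun _ => t1⟩) hne
      · exact Or.inl ⟨t1, s2.resolve_left t2, d0⟩
    · by_cases t2 : Sg A (dropAt x l.succ.succ) (x 0) true
      · exact Or.inr ⟨s1.resolve_left t1, t2, d0⟩
      · exact absurd (propext ⟨fun t => absurd t t1, fun t => absurd t t2⟩) hne
  have hhyb : Ex (fun v => Ex fun R' => Ex fun R => ind (g v R ≠ g v R')) ≤
      m * (3 * μ + 2 * 8 ^ (m + 2) * η) := by
    calc _ = Ex (fun v => Ex fun R => Ex fun R' => ind (g v R ≠ g v R')) :=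
          Ex_congr fun v => Ex_comm _
      _ ≤ Ex (fun v => ∑ l, Ex (fun R => Ex fun a => ind (g v R ≠ g v (Function.update R l a)))) :=
          Ex_mono fun v => hybrid_le (g v)
      _ = ∑ l, Ex (fun v => Ex (fun R => Ex fun a =>
            ind (g v R ≠ g v (Function.update R l a)))) := Ex_sum _ _
      _ ≤ ∑ _l : Fin m, (3 * μ + 2 * 8 ^ (m + 2) * η) := by
          refine sum_le_sum fun l _ => le_trans (le_of_eq ?_) (hone l)
          rw [Ex_comm]
          exact Ex_congr fun R => Ex_comm _
      _ = _ := by rw [sum_const, nsmul_eq_mul, card_univ, Fintype.card_fin]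
  choose y hy using fun v => exists_le_Ex (fun R' => Ex fun R => ind (g v R ≠ g v R'))
  refine ⟨fun v => decide (g v (y v)), ?_⟩
  rw [Ex_fin_succ, Ex_comm]
  refine le_trans (Ex_mono fun v => le_trans (le_of_eq ?_) (hy v)) hhyb
  refine Ex_congr fun R => ?_
  simp only [image_cons, Fin.cons_zero, decide_eq_true_eq]
  rfl

/-- Either the clauses of `A` leave an exponential gap or `A` is almost unate. -/
lemma turan_stability_succ (m : ℕ) (hm : 1 ≤ m) {κ : ℝ} (hκ : 0 < κ) :
    ∃ η > 0, ∃ δ > 0, ∀ {V : Type} [Fintype V] [DecidableEq V] [Nonempty V] {A : SatFormula V},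
      IsKFormula (m + 1) A → FewBad (m + 1) A η →
      Ex (fun z : Fin (m + 1) → V => Real.logb 2
        (1 + (A.filter fun C => clauseVars C = univ.image z).card)) ≤ 1 - δ ∨
      ∃ σ : V → Bool, Ex (fun z : Fin (m + 1) → V =>
        ind (∃ C ∈ A, clauseVars C = univ.image z ∧ ¬ Cons σ C)) ≤ κ := by
  obtain ⟨B, hB⟩ : ∃ B : ℝ, B = 8 ^ (m + 2) := ⟨_, rfl⟩
  obtain ⟨D, hD⟩ : ∃ D : ℝ, D = (m + 3) ^ 5 * (2 * 8 ^ (m + 2)) := ⟨_, rfl⟩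
  have hB0 : 0 < B := by rw [hB]; positivity
  have hD0 : 0 < D := by rw [hD]; positivity
  obtain ⟨M, hM⟩ : ∃ M : ℝ, M = m + 1 := ⟨_, rfl⟩
  have hm1 : (1 : ℝ) ≤ m := by exact_mod_cast hm
  have hM0 : 0 < M := by rw [hM]; linarith
  obtain ⟨μ₀, hμ₀⟩ : ∃ μ₀ : ℝ, μ₀ = κ / (M * (3 * M + 10)) := ⟨_, rfl⟩
  have hμp : 0 < μ₀ := by rw [hμ₀]; positivity
  obtain ⟨η, hη⟩ : ∃ η : ℝ, η = μ₀ / (240 * (D + (M + 1) * B)) := ⟨_, rfl⟩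
  have hηp : 0 < η := by rw [hη]; positivity
  have hηe : D * η + (M + 1) * B * η = μ₀ / 240 := by rw [hη]; field_simp
  refine ⟨η, hηp, μ₀ / 120, by positivity, ?_⟩
  intro V _ _ _ A hA h
  set μ := 1 - Ex (fun z : Fin (m + 1) → V => ind (Ed A (univ.image z))) with hμ
  have hBi : ∀ c, 0.6 * M * Ex (fun z : Fin (m + 1) → V => ind (Bi A (univ.image z) (z c))) ≤
      μ + D * η := fun c => by
    have := FewBad.bi_le hm hA h c
    rw [hM, hD]
    linarith
  have hT := FewBad.two_image_le h hηp.le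
  rw [← hB] at hT
  have hBηp : 0 < B * η := by positivity
  have hDηp : 0 < D * η := by positivity
  have hMBp : 0 < M * (B * η) := by positivity
  by_cases hcase : μ₀ ≤ μ
  · left
    have hlog := Ex_mono fun z => logb_clauses_le hA z
    simp only [Ex_add, Ex_const_mul, Ex_sum] at hlog
    have hs : M * ∑ c, Ex (fun z : Fin (m + 1) → V => ind (Bi A (univ.image z) (z c))) ≤
        M * ((μ + D * η) / 0.6) := by
      rw [mul_sum]
      calc _ ≤ ∑ _c : Fin (m + 1), (μ + D * η) / 0.6 := sum_le_sum fun c _ => by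
            have := hBi c
            rw [le_div_iff₀ (by norm_num)]; linarith
        _ = _ := by simp [hM]
    have hs' := le_of_mul_le_mul_left hs hM0
    refine hlog.trans ?_
    have e2 : (((m + 1 : ℕ) : ℝ) + 1) * Ex (fun z : Fin (m + 1) → V => ind (Two A (univ.image z)))
        ≤ (M + 1) * (B * η) := by
      push_cast
      rw [← hM]
      gcongr
    have e3 : Ex (fun z : Fin (m + 1) → V => ind (Ed A (univ.image z))) = 1 - μ := by
      rw [hμ]; ring
    rw [e3]
    have e4 : (0.59 : ℝ) * ((μ + D * η) / 0.6) ≤ (1 - 1 / 60) * μ + D * η := by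
      have : (0.59 : ℝ) * ((μ + D * η) / 0.6) = (59 / 60) * (μ + D * η) := by ring
      rw [this]; linarith
    have e5 := mul_le_mul_of_nonneg_left hs' (show (0 : ℝ) ≤ 0.59 by norm_num)
    linarith
  · right
    push Not at hcase
    obtain ⟨σ, hσ⟩ := h.exists_sign_assignment
    refine ⟨σ, ?_⟩
    rw [← hμ, ← hB] at hσ
    have hsym : ∀ c : Fin (m + 1), Ex (fun z : Fin (m + 1) → V =>
        ind ((Sg A (univ.image z) (z c) true) ≠ (σ (z c) = true))) =
        Ex (fun z : Fin (m + 1) → V =>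
          ind ((Sg A (univ.image z) (z 0) true) ≠ (σ (z 0) = true))) := by
      intro c
      rw [← Ex_comp_inj (Equiv.swap 0 c).injective (fun z : Fin (m + 1) → V =>
          ind ((Sg A (univ.image z) (z 0) true) ≠ (σ (z 0) = true)))]
      refine Ex_congr fun z => ?_
      rw [image_comp_equiv]; simp
    have hpt : ∀ z : Fin (m + 1) → V, ind (∃ C ∈ A, clauseVars C = univ.image z ∧ ¬ Cons σ C) ≤
        ∑ c, (ind ((Sg A (univ.image z) (z c) true) ≠ (σ (z c) = true)) +
          (ind (Bi A (univ.image z) (z c)) + ind (Two A (univ.image z)))) := by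
      intro z
      refine ind_le_of_pos (sum_nonneg fun _ _ => by
        have := ind_nonneg (Two A (univ.image z))
        exact add_nonneg (ind_nonneg _) (add_nonneg (ind_nonneg _) this)) ?_
      rintro ⟨C, hC, hvars, hcons⟩
      obtain ⟨τ, rfl⟩ := exists_signed hA hC hvars
      simp only [Cons, not_forall] at hcons
      obtain ⟨l, hl, hne⟩ := hcons
      rw [mem_signed] at hl
      obtain ⟨c, -, hc⟩ := mem_image.1 hl.1
      refine le_trans ?_ (single_le_sum (f := fun c =>
        (ind ((Sg A (univ.image z) (z c) true) ≠ (σ (z c) = true)) +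
          (ind (Bi A (univ.image z) (z c)) + ind (Two A (univ.image z)))))
        (fun _ _ => add_nonneg (ind_nonneg _) (add_nonneg (ind_nonneg _) (ind_nonneg _)))
        (mem_univ c))
      refine le_trans ?_ (add_le_add_right (ind_or_le _ _) _)
      refine le_trans (le_of_eq ?_) (ind_or_le _ _)
      symm
      apply ind_true
      by_contra hcon
      rw [not_or, not_or, not_not] at hcon
      obtain ⟨g1, g2, g3⟩ := hcon
      have hmem : z c ∈ univ.image z := mem_image_of_mem _ (mem_univ _)
      have hτ : Sg A (univ.image z) (z c) (τ (z c)) := ⟨hmem, τ, rfl, hC⟩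
      have hd : τ (z c) ≠ σ (z c) := by rw [hc]; rw [← hl.2]; exact hne
      cases h1 : σ (z c) <;> cases h2 : τ (z c)
      · exact hd (h2.trans h1.symm)
      · rw [h2] at hτ
        rw [h1] at g1
        rw [g1] at hτ
        exact absurd hτ (by simp)
      · rw [h2] at hτ
        rw [h1] at g1
        exact g2 ⟨g3, by rw [g1], hτ⟩
      · exact hd (h2.trans h1.symm)
    refine (Ex_mono hpt).trans ?_
    simp only [Ex_sum, Ex_add, hsym]
    have hbc : ∀ c, Ex (fun z : Fin (m + 1) → V => ind (Bi A (univ.image z) (z c))) ≤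
        2 * (μ₀ + D * η) := by
      intro c
      have h1 := hBi c
      have h0 : 0 ≤ Ex (fun z : Fin (m + 1) → V => ind (Bi A (univ.image z) (z c))) :=
        Ex_nonneg fun _ => ind_nonneg _
      have : 1 ≤ M := by rw [hM]; linarith
      nlinarith
    have hlam : m * (3 * μ + 2 * B * η) ≤ M * (3 * μ₀ + 2 * B * η) := by
      have : (m : ℝ) * (3 * μ + 2 * B * η) ≤ m * (3 * μ₀ + 2 * B * η) := by gcongr
      have h3 : (m : ℝ) * (3 * μ₀ + 2 * B * η) ≤ M * (3 * μ₀ + 2 * B * η) := by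
        gcongr; rw [hM]; linarith
      linarith
    calc _ ≤ ∑ _c : Fin (m + 1), (M * (3 * μ₀ + 2 * B * η) + (2 * (μ₀ + D * η) + B * η)) :=
          sum_le_sum fun c _ => by
            have := hbc c
            linarith
      _ = M * (M * (3 * μ₀ + 2 * B * η) + (2 * (μ₀ + D * η) + B * η)) := by
          rw [sum_const, nsmul_eq_mul, card_univ, Fintype.card_fin, hM]; push_cast; ring
      _ ≤ M * ((3 * M + 10) * μ₀) := by
          gcongr
          nlinarith
      _ = κ := by rw [hμ₀]; field_simp

end Stability

section SimpleCount

open Classical in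
/-- The number of clauses not consistent with `σ`. -/
noncomputable def inconsistent {V : Type*} (σ : V → Bool) (G : SatFormula V) : ℕ :=
  (G.filter fun C => ¬ Cons σ C).card

open Classical in
lemma inconsistent_le_add {V : Type*} (σ : V → Bool) (G A : SatFormula V) :
    inconsistent σ G ≤ (G \ A).card + inconsistent σ A := by
  refine le_trans (card_le_card ?_) (card_union_le _ _)
  intro C hC
  obtain ⟨hc1, hc2⟩ := mem_filter.1 hC
  by_cases h : C ∈ A
  · exact mem_union_right _ (mem_filter.2 ⟨h, hc2⟩)
  · exact mem_union_left _ (mem_sdiff.2 ⟨hc1, h⟩)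

variable {V : Type} [Fintype V] [DecidableEq V]

lemma card_simple_subsets_le {k : ℕ} {A : SatFormula V} (hA : IsKFormula k A)
    (S : Finset (SatFormula V)) (hS : ∀ B ∈ S, B ⊆ A ∧ SimpleFormula B) :
    S.card ≤ ∏ f ∈ (univ : Finset V).powersetCard k,
      (1 + (A.filter fun C => clauseVars C = f).card) := by
  classical
  let t : ∀ f : Finset V, Finset (SatFormula V) := fun f =>
    insert ∅ ((A.filter fun C => clauseVars C = f).image fun C => {C})
  have h1 : S.card ≤ (((univ : Finset V).powersetCard k).pi t).card := by
    apply card_le_card_of_injOn (fun B f _ => B.filter fun C => clauseVars C = f)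
    · intro B hB
      obtain ⟨hsub, hsim⟩ := hS B hB
      simp only [mem_coe, mem_pi]
      intro f hf
      rcases (B.filter fun C => clauseVars C = f).eq_empty_or_nonempty with h | ⟨C, hC⟩
      · rw [h]; exact mem_insert_self _ _
      · refine mem_insert_of_mem (mem_image.2 ⟨C, ?_, ?_⟩)
        · exact mem_filter.2 ⟨hsub (mem_filter.1 hC).1, (mem_filter.1 hC).2⟩
        · symm
          rw [eq_singleton_iff_unique_mem]
          refine ⟨hC, fun D hD => ?_⟩
          exact hsim _ (mem_filter.1 hD).1 _ (mem_filter.1 hC).1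
            ((mem_filter.1 hD).2.trans (mem_filter.1 hC).2.symm)
    · intro B hB B' hB' h
      have key : ∀ B₁ B₂ : SatFormula V, B₁ ⊆ A →
          (fun (f : Finset V) (_ : f ∈ (univ : Finset V).powersetCard k) =>
            B₁.filter fun C => clauseVars C = f) =
          (fun f _ => B₂.filter fun C => clauseVars C = f) → B₁ ⊆ B₂ := by
        intro B₁ B₂ hs h C hC
        have := congrFun (congrFun h (clauseVars C))
          (mem_powersetCard.2 ⟨subset_univ _, (hA C (hs hC)).2⟩)
        have h2 : C ∈ B₁.filter fun D => clauseVars D = clauseVars C := mem_filter.2 ⟨hC, rfl⟩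
        rw [this] at h2
        exact (mem_filter.1 h2).1
      exact (key B B' (hS B hB).1 h).antisymm (key B' B (hS B' hB').1 h.symm)
  rw [card_pi] at h1
  refine h1.trans (prod_le_prod' fun f _ => ?_)
  refine (card_insert_le _ _).trans ?_
  rw [add_comm]
  exact Nat.add_le_add_left card_image_le _

lemma prod_clauses_eq {k : ℕ} (A : SatFormula V) (hA : IsKFormula k A) :
    ((∏ f ∈ (univ : Finset V).powersetCard k,
      (1 + (A.filter fun C => clauseVars C = f).card) : ℕ) : ℝ) =
    2 ^ ((Fintype.card V : ℝ) ^ k / k.factorial * Ex (fun z : Fin k → V =>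
      Real.logb 2 (1 + (A.filter fun C => clauseVars C = univ.image z).card))) := by
  have h := Ex_tuples_image (V := V) (k := k)
    (fun f => Real.logb 2 (1 + (A.filter fun C => clauseVars C = f).card)) (fun f hf => by
      have : A.filter (fun C => clauseVars C = f) = ∅ := by
        rw [filter_eq_empty_iff]
        intro C hC h
        have := (hA C hC).2
        rw [h] at this; omega
      simp [this])
  have hk : (0 : ℝ) < k.factorial := by exact_mod_cast k.factorial_pos
  rw [div_mul_eq_mul_div, h, mul_div_cancel_left₀ _ hk.ne', Real.rpow_sum_of_pos (by norm_num)]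
  push_cast
  refine prod_congr rfl fun f _ => ?_
  rw [Real.rpow_logb (by norm_num) (by norm_num) (by positivity)]

lemma card_inconsistent_le {k : ℕ} {A : SatFormula V} (hA : IsKFormula k A) (σ : V → Bool) :
    (inconsistent σ A : ℝ) ≤ 2 ^ k * ((Fintype.card V : ℝ) ^ k *
      Ex (fun z : Fin k → V => ind (∃ C ∈ A, clauseVars C = univ.image z ∧ ¬ Cons σ C))) := by
  classical
  have h := Ex_tuples_image (V := V) (k := k)
    (fun f => ind (∃ C ∈ A, clauseVars C = f ∧ ¬ Cons σ C)) (fun f hf => by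
      apply ind_false
      rintro ⟨C, hC, h, -⟩
      have := (hA C hC).2
      rw [h] at this; omega)
  rw [h, sum_ind]
  have h1 : inconsistent σ A ≤
      ((univ.powersetCard k).filter fun f => ∃ C ∈ A, clauseVars C = f ∧ ¬ Cons σ C).card * 2 ^ k := by
    rw [mul_comm]
    refine card_le_mul_card_image_of_maps_to (f := fun C : SatClause V => clauseVars C) (fun C hC => ?_) _ fun f hf => ?_
    · obtain ⟨h1, h2⟩ := mem_filter.1 hC
      exact mem_filter.2 ⟨mem_powersetCard.2 ⟨subset_univ _, (hA C h1).2⟩, C, h1, rfl, h2⟩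
    · refine le_trans (card_le_card ?_)
        (card_clauses_on_le hA (mem_powersetCard.1 (mem_filter.1 hf).1).2)
      intro C hC
      exact mem_filter.2 ⟨(mem_filter.1 (mem_filter.1 hC).1).1, (mem_filter.1 hC).2⟩
  have h2 : (inconsistent σ A : ℝ) ≤
      ((univ.powersetCard k).filter fun f => ∃ C ∈ A, clauseVars C = f ∧ ¬ Cons σ C).card * 2 ^ k := by
    exact_mod_cast h1
  refine h2.trans ?_
  have hk : (1 : ℝ) ≤ k.factorial := by exact_mod_cast k.factorial_pos
  rw [mul_comm]
  gcongr
  exact le_mul_of_one_le_left (by positivity) hk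

/-- There are few simple minimal formulas far from every unate formula. -/
lemma simple_far_count (m : ℕ) (hm : 1 ≤ m) {ζ : ℝ} (hζ : 0 < ζ) :
    ∃ c > 0, ∃ n₀ : ℕ, ∀ {V : Type} [Fintype V] [DecidableEq V] (S : Finset (SatFormula V)),
      n₀ ≤ Fintype.card V → (∀ G ∈ S, IsKFormula (m + 1) G ∧ MinimalFormula G ∧ SimpleFormula G ∧
        ∀ σ, ζ * (Fintype.card V : ℝ) ^ (m + 1) < inconsistent σ G) →
      (S.card : ℝ) ≤ 2 ^ ((1 - c) * ((Fintype.card V : ℝ) ^ (m + 1) / (m + 1).factorial)) := by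
  classical
  obtain ⟨k, hk⟩ : ∃ k, k = m + 1 := ⟨_, rfl⟩
  obtain ⟨η, hη, d, hd, hturan⟩ := turan_stability_succ m hm (κ := ζ / (2 * 2 ^ k)) (by positivity)
  rw [← hk] at hturan ⊢
  have hfac : (0 : ℝ) < k.factorial := by exact_mod_cast k.factorial_pos
  have hlog2 : 0 < Real.log 2 := Real.log_pos (by norm_num)
  obtain ⟨ε, hε, hsmall⟩ := exists_card_small_subsets_le.{0} (2 ^ k)
    (η := Real.log 2 * (d / (4 * k.factorial))) (by positivity)
  obtain ⟨δ, hδ, hδ1, hδε, hδζ⟩ : ∃ δ : ℝ, 0 < δ ∧ δ ≤ 1 ∧ 4 * δ * 2 ^ k ≤ ε ∧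
      4 * δ * 2 ^ k ≤ ζ / 2 := by
    refine ⟨min 1 (min ε (ζ / 2) / (4 * 2 ^ k)), by positivity, min_le_left _ _, ?_, ?_⟩
    · have h1 : min 1 (min ε (ζ / 2) / (4 * 2 ^ k)) ≤ ε / (4 * 2 ^ k) :=
        (min_le_right _ _).trans (by gcongr; exact min_le_left _ _)
      calc _ ≤ 4 * (ε / (4 * 2 ^ k)) * 2 ^ k := by gcongr
        _ = ε := by field_simp
    · have h1 : min 1 (min ε (ζ / 2) / (4 * 2 ^ k)) ≤ (ζ / 2) / (4 * 2 ^ k) :=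
        (min_le_right _ _).trans (by gcongr; exact min_le_right _ _)
      calc _ ≤ 4 * ((ζ / 2) / (4 * 2 ^ k)) * 2 ^ k := by gcongr
        _ = ζ / 2 := by field_simp
  obtain ⟨T, n₁, hgood⟩ := exists_good_set k hδ hδ1 hη
  obtain ⟨n₂, hn₂⟩ := exists_nat_ge ((1 + 2 * T * 2 ^ m) * (4 * k.factorial / d))
  refine ⟨d / 2, by positivity, max (max n₁ n₂) 1, ?_⟩
  intro V _ _ S hn hS
  obtain ⟨n, hndef⟩ : ∃ n, n = Fintype.card V := ⟨_, rfl⟩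
  rw [← hndef] at hn hS ⊢
  have hn1 : 1 ≤ n := (le_max_right _ _).trans hn
  have hnn₁ : n₁ ≤ n := ((le_max_left _ _).trans (le_max_left _ _)).trans hn
  have hnn₂ : n₂ ≤ n := ((le_max_right _ _).trans (le_max_left _ _)).trans hn
  have hV : Nonempty V := Fintype.card_pos_iff.1 (by omega)
  let Gf : S → SatFormula V := Subtype.val
  obtain ⟨Y, hY, S', hS', hS'good⟩ := hgood Gf (by omega) (fun ω => (hS _ ω.2).1)
    (fun ω => (hS _ ω.2).2.1)
  set L : S → SatFormula V := likely k Gf δ Y with hL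
  have hLk : ∀ ω, IsKFormula k (L ω) := fun ω C hC => (mem_likely.1 hC).1
  have hnk : (0 : ℝ) < (n : ℝ) ^ k := by positivity
  have hexc : ∀ ω ∈ S', ((Gf ω \ L ω).card : ℝ) ≤ 4 * δ * 2 ^ k * (n : ℝ) ^ k := by
    intro ω hω
    have := (hS'good ω hω).2
    rw [← hndef] at this
    push_cast at this
    rw [mul_pow] at this
    linarith
  have hgap : ∀ ω ∈ S', Ex (fun z : Fin k → V => Real.logb 2
      (1 + ((L ω).filter fun C => clauseVars C = univ.image z).card)) ≤ 1 - d := by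
    intro ω hω
    have hf : FewBad (m + 1) (L ω) η := by rw [← hk]; exact (hS'good ω hω).1
    have ht : Ex (fun z : Fin k → V => Real.logb 2
        (1 + ((L ω).filter fun C => clauseVars C = univ.image z).card)) ≤ 1 - d ∨
        ∃ σ : V → Bool, Ex (fun z : Fin k → V =>
          ind (∃ C ∈ L ω, clauseVars C = univ.image z ∧ ¬ Cons σ C)) ≤ ζ / (2 * 2 ^ k) := by
      subst hk
      exact hturan (hLk ω) hf
    refine ht.resolve_right ?_
    rintro ⟨σ, hσ⟩
    have hfar := (hS _ ω.2).2.2.2 σ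
    have h1 := card_inconsistent_le (hLk ω) σ
    have h3 : (inconsistent σ (Gf ω) : ℝ) ≤ (Gf ω \ L ω).card + inconsistent σ (L ω) := by
      have h2 := inconsistent_le_add σ (Gf ω) (L ω)
      have h2' : inconsistent σ (Gf ω) ≤ (Gf ω \ L ω).card + inconsistent σ (L ω) := by
        convert h2
      exact_mod_cast h2'
    have h4 := hexc ω hω
    rw [← hndef] at h1
    have h5 : (2 : ℝ) ^ k * ((n : ℝ) ^ k * Ex (fun z : Fin k → V =>
        ind (∃ C ∈ L ω, clauseVars C = univ.image z ∧ ¬ Cons σ C))) ≤ ζ / 2 * (n : ℝ) ^ k := by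
      calc _ ≤ (2 : ℝ) ^ k * ((n : ℝ) ^ k * (ζ / (2 * 2 ^ k))) := by gcongr
        _ = _ := by field_simp
    have h6 : 4 * δ * 2 ^ k * (n : ℝ) ^ k ≤ ζ / 2 * (n : ℝ) ^ k := by gcongr
    have h7 : ζ * (n : ℝ) ^ k < inconsistent σ (Gf ω) := hfar
    linarith
  set D : S → SatFormula V := fun ω => (Gf ω).filter fun C => ¬ Disjoint (clauseVars C) Y with hD
  set N := (n : ℝ) ^ k / k.factorial with hN
  have hfib : ∀ E ∈ S'.image D, (((S'.filter fun ω => D ω = E).card : ℕ) : ℝ) ≤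
      2 ^ (d / 4 * N) * 2 ^ ((1 - d) * N) := by
    intro E hE
    obtain ⟨ω₀, hω₀, rfl⟩ := mem_image.1 hE
    have hsame : ∀ ω ∈ S'.filter (fun ω => D ω = D ω₀), L ω = L ω₀ := fun ω hω =>
      likely_congr (fun ω => (hS _ ω.2).1) (mem_filter.1 hω).2
    have hinj : (S'.filter fun ω => D ω = D ω₀).card ≤
        ((kClauses V k).powerset.filter fun B => (B.card : ℝ) ≤ ε * (n : ℝ) ^ k).card *
        ((L ω₀).powerset.filter fun B => SimpleFormula B).card := by
      rw [← card_product]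
      apply card_le_card_of_injOn (fun ω => (Gf ω \ L ω₀, Gf ω ∩ L ω₀))
      · intro ω hω
        have hω' := (mem_filter.1 hω).1
        have hs := hsame ω hω
        simp only [coe_product, Set.mem_prod, mem_coe, mem_filter, mem_powerset]
        refine ⟨⟨?_, ?_⟩, inter_subset_right, ?_⟩
        · intro C hC
          exact mem_kClauses.2 ((hS _ ω.2).1 C (mem_sdiff.1 hC).1)
        · rw [← hs]
          refine (hexc ω hω').trans ?_
          gcongr
        · intro C hC C' hC' h
          exact (hS _ ω.2).2.2.1 C (mem_inter.1 hC).1 C' (mem_inter.1 hC').1 h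
      · intro ω _ ω' _ h
        obtain ⟨h1, h2⟩ := Prod.mk.inj h
        apply Subtype.ext
        change Gf ω = Gf ω'
        rw [← sdiff_union_inter (Gf ω) (L ω₀), ← sdiff_union_inter (Gf ω') (L ω₀), h1, h2]
    have hb1 : (((kClauses V k).powerset.filter fun B => (B.card : ℝ) ≤ ε * (n : ℝ) ^ k).card : ℝ)
        ≤ 2 ^ (d / 4 * N) := by
      refine (hsmall _ (kClauses V k) ((n : ℝ) ^ k) _ (by positivity) ?_ ?_).trans (le_of_eq ?_)
      · rw [← mul_pow, hndef]
        exact_mod_cast card_kClauses_le (V := V) k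
      · intro B hB
        exact ⟨mem_powerset.1 (mem_filter.1 hB).1, (mem_filter.1 hB).2⟩
      · rw [Real.rpow_def_of_pos (by norm_num), hN]
        congr 1; ring
    have hb2 : (((L ω₀).powerset.filter fun B => SimpleFormula B).card : ℝ) ≤
        2 ^ ((1 - d) * N) := by
      have h1 := card_simple_subsets_le (hLk ω₀)
        ((L ω₀).powerset.filter fun B => SimpleFormula B)
        (fun B hB => ⟨mem_powerset.1 (mem_filter.1 hB).1, (mem_filter.1 hB).2⟩)
      refine (Nat.cast_le (α := ℝ).2 h1).trans ?_
      rw [prod_clauses_eq _ (hLk ω₀), ← hndef]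
      apply Real.rpow_le_rpow_of_exponent_le (by norm_num)
      rw [mul_comm]
      exact mul_le_mul_of_nonneg_right (hgap ω₀ hω₀) (by positivity)
    calc (((S'.filter fun ω => D ω = D ω₀).card : ℕ) : ℝ) ≤ _ := Nat.cast_le.2 hinj
      _ ≤ _ := by push_cast; gcongr
  have hDcard : ((S'.image D).card : ℝ) ≤ 2 ^ ((2 * T * (2 * n) ^ m : ℕ) : ℝ) := by
    rw [Real.rpow_natCast]
    have : S'.image D ⊆ ((kClauses V k).filter fun C => ¬ Disjoint (clauseVars C) Y).powerset := by
      intro E hE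
      obtain ⟨ω, -, rfl⟩ := mem_image.1 hE
      rw [mem_powerset]
      intro C hC
      exact mem_filter.2 ⟨mem_kClauses.2 ((hS _ ω.2).1 C (mem_filter.1 hC).1), (mem_filter.1 hC).2⟩
    have h1 := card_le_card this
    rw [card_powerset] at h1
    have h2 : ((kClauses V k).filter fun C => ¬ Disjoint (clauseVars C) Y).card ≤
        2 * T * (2 * n) ^ m := by
      refine (card_kClauses_touching_le k Y).trans ?_
      rw [← hndef, hk, Nat.add_sub_cancel]
      gcongr
    exact_mod_cast h1.trans (Nat.pow_le_pow_right (by norm_num) h2)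
  have hS'card : (S'.card : ℝ) ≤ 2 ^ ((2 * T * (2 * n) ^ m : ℕ) : ℝ) *
      (2 ^ (d / 4 * N) * 2 ^ ((1 - d) * N)) := by
    rw [card_eq_sum_card_image D S', Nat.cast_sum]
    refine (sum_le_sum hfib).trans ?_
    rw [sum_const, nsmul_eq_mul]
    gcongr
  have hScard : (S.card : ℝ) ≤ 2 * S'.card := by simpa using hS'
  have hN' : (d / 4) * N = n ^ m * (n * (d / (4 * k.factorial))) := by
    rw [hN, hk, pow_succ]; field_simp
  have hmain : 1 + ((2 * T * (2 * n) ^ m : ℕ) : ℝ) ≤ d / 4 * N := by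
    rw [hN']
    have h1 : (1 + 2 * T * 2 ^ m : ℝ) ≤ n * (d / (4 * k.factorial)) := by
      have h2 : (1 + 2 * T * 2 ^ m : ℝ) * (4 * k.factorial / d) ≤ n :=
        hn₂.trans (by exact_mod_cast hnn₂)
      calc (1 + 2 * T * 2 ^ m : ℝ) = (1 + 2 * T * 2 ^ m : ℝ) * (4 * k.factorial / d) *
            (d / (4 * k.factorial)) := by field_simp
        _ ≤ _ := by gcongr
    have h3 : (1 : ℝ) ≤ (n : ℝ) ^ m := one_le_pow₀ (by exact_mod_cast hn1)
    calc 1 + ((2 * T * (2 * n) ^ m : ℕ) : ℝ) = 1 + n ^ m * (2 * T * 2 ^ m) := by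
          push_cast; rw [mul_pow]; ring
      _ ≤ n ^ m * 1 + n ^ m * (2 * T * 2 ^ m) := by linarith
      _ = n ^ m * (1 + 2 * T * 2 ^ m) := by ring
      _ ≤ _ := by gcongr
  calc (S.card : ℝ) ≤ 2 * (2 ^ ((2 * T * (2 * n) ^ m : ℕ) : ℝ) *
        (2 ^ (d / 4 * N) * 2 ^ ((1 - d) * N))) := hScard.trans (by gcongr)
    _ = 2 ^ ((1 + ((2 * T * (2 * n) ^ m : ℕ) : ℝ)) + d / 4 * N + (1 - d) * N) := by
        rw [Real.rpow_add (by norm_num), Real.rpow_add (by norm_num), Real.rpow_add (by norm_num),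
          Real.rpow_one]
        ring
    _ ≤ 2 ^ ((1 - d / 2) * N) := by
        apply Real.rpow_le_rpow_of_exponent_le (by norm_num)
        linarith

end SimpleCount

section FarCount

variable {V : Type} [Fintype V] [DecidableEq V]

lemma Ex_two_lifts_le [Nonempty V] {k : ℕ} {G : SatFormula V} (hG : MinimalFormula G)
    {s s' : Fin k → Bool} (h : s ≠ s') :
    Ex (fun z : Fin k → V => ind (lift z s univ ∈ G ∧ lift z s' univ ∈ G)) ^ 2 ^ k ≤
      ((k * 2 : ℕ) : ℝ) ^ 2 / Fintype.card V := by
  refine (box_density _ _).trans ((Ex_mono fun x => ind_mono fun hx => ?_).trans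
    ((Ex_not_injective_le (I := Fin k × Bool) (V := V)).trans (le_of_eq (by simp))))
  intro hinj
  obtain ⟨i, hi⟩ := Function.ne_iff.1 h
  exact (nonMin_patternTwo ⟨i, mem_univ i, hi⟩).not_cmap hG hinj (patternTwo_cmap hx)

/-- The clauses sharing their variable set with another clause. -/
noncomputable def doubled (G : SatFormula V) : SatFormula V :=
  G.filter fun C => ∃ C' ∈ G, C' ≠ C ∧ clauseVars C' = clauseVars C

lemma simple_sdiff_doubled (G : SatFormula V) : SimpleFormula (G \ doubled G) := by
  intro C hC C' hC' h
  by_contra hne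
  exact (mem_sdiff.1 hC).2 (mem_filter.2 ⟨(mem_sdiff.1 hC).1, C', (mem_sdiff.1 hC').1,
    fun h' => hne h'.symm, h.symm⟩)

lemma minimal_mono {G G' : SatFormula V} (hG : MinimalFormula G) (h : G' ⊆ G) :
    MinimalFormula G' := by
  intro C hC
  obtain ⟨w, h1, h2⟩ := hG C (h hC)
  exact ⟨w, h1, fun C' hC' => h2 C' (h hC')⟩

lemma card_doubled_le {k : ℕ} {G : SatFormula V} (hGk : IsKFormula k G) {ν : ℝ}
    (hν : ∀ s s' : Fin k → Bool, s ≠ s' →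
      Ex (fun z : Fin k → V => ind (lift z s univ ∈ G ∧ lift z s' univ ∈ G)) ≤ ν) (hν0 : 0 ≤ ν) :
    ((doubled G).card : ℝ) ≤ 2 ^ k * 4 ^ k * ν * (Fintype.card V : ℝ) ^ k := by
  classical
  have h := Ex_tuples_image (V := V) (k := k)
    (fun f => ind (∃ C ∈ G, ∃ C' ∈ G, C' ≠ C ∧ clauseVars C = f ∧ clauseVars C' = f))
    (fun f hf => by
      apply ind_false
      rintro ⟨C, hC, -, -, -, h, -⟩
      have := (hGk C hC).2
      rw [h] at this; omega)
  rw [sum_ind] at h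
  set P := (univ.powersetCard k).filter fun f : Finset V =>
    ∃ C ∈ G, ∃ C' ∈ G, C' ≠ C ∧ clauseVars C = f ∧ clauseVars C' = f with hP
  have h1 : (doubled G).card ≤ 2 ^ k * P.card := by
    refine card_le_mul_card_image_of_maps_to (f := fun C : SatClause V => clauseVars C)
      (fun C hC => ?_) _ fun f hf => ?_
    · obtain ⟨h1, C', h2, h3, h4⟩ := mem_filter.1 hC
      exact mem_filter.2 ⟨mem_powersetCard.2 ⟨subset_univ _, (hGk C h1).2⟩, C, h1, C', h2, h3, rfl, h4⟩
    · refine le_trans (card_le_card ?_)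
        (card_clauses_on_le hGk (mem_powersetCard.1 (mem_filter.1 hf).1).2)
      intro C hC
      exact mem_filter.2 ⟨(mem_filter.1 (mem_filter.1 hC).1).1, (mem_filter.1 hC).2⟩
  have h2 : Ex (fun z : Fin k → V => ind (∃ C ∈ G, ∃ C' ∈ G, C' ≠ C ∧
      clauseVars C = univ.image z ∧ clauseVars C' = univ.image z)) ≤ 4 ^ k * ν := by
    calc _ ≤ Ex (fun z : Fin k → V => ∑ p ∈ (univ : Finset ((Fin k → Bool) × (Fin k → Bool))).filter
          (fun p => p.1 ≠ p.2), ind (lift z p.1 univ ∈ G ∧ lift z p.2 univ ∈ G)) := by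
          refine Ex_mono fun z => ind_le_of_pos (sum_nonneg fun _ _ => ind_nonneg _) ?_
          rintro ⟨C, hC, C', hC', hne, h1, h2⟩
          obtain ⟨s, hs⟩ := exists_lift (hGk C hC) h1
          obtain ⟨s', hs'⟩ := exists_lift (hGk C' hC') h2
          have hss : s ≠ s' := by
            rintro rfl
            exact hne (hs'.trans hs.symm)
          refine le_trans ?_ (single_le_sum (fun _ _ => ind_nonneg _)
            (mem_filter.2 ⟨mem_univ (s, s'), hss⟩))
          rw [ind_true]
          exact ⟨hs ▸ hC, hs' ▸ hC'⟩
      _ = ∑ p ∈ (univ : Finset ((Fin k → Bool) × (Fin k → Bool))).filter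
          (fun p => p.1 ≠ p.2), Ex (fun z : Fin k → V =>
            ind (lift z p.1 univ ∈ G ∧ lift z p.2 univ ∈ G)) := Ex_sum _ _
      _ ≤ ∑ p ∈ (univ : Finset ((Fin k → Bool) × (Fin k → Bool))).filter
          (fun p => p.1 ≠ p.2), ν := sum_le_sum fun p hp => hν _ _ (mem_filter.1 hp).2
      _ ≤ 4 ^ k * ν := by
          rw [sum_const, nsmul_eq_mul]
          gcongr
          have := card_filter_le (univ : Finset ((Fin k → Bool) × (Fin k → Bool)))
            (fun p => p.1 ≠ p.2)
          have h4 : (univ : Finset ((Fin k → Bool) × (Fin k → Bool))).card = 4 ^ k := by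
            simp [← mul_pow]
          rw [h4] at this
          exact_mod_cast this
  have hk : (1 : ℝ) ≤ k.factorial := by exact_mod_cast k.factorial_pos
  calc ((doubled G).card : ℝ) ≤ 2 ^ k * P.card := by exact_mod_cast h1
    _ ≤ 2 ^ k * (k.factorial * P.card) := by
        gcongr; exact le_mul_of_one_le_left (by positivity) hk
    _ ≤ 2 ^ k * ((Fintype.card V : ℝ) ^ k * (4 ^ k * ν)) := by rw [← h]; gcongr
    _ = _ := by ring

/-- There are few minimal formulas far from every unate formula. -/
lemma far_count (k : ℕ) (hk : 2 ≤ k) {ζ : ℝ} (hζ : 0 < ζ) :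
    ∃ c > 0, ∃ n₀ : ℕ, ∀ {V : Type} [Fintype V] [DecidableEq V] (S : Finset (SatFormula V)),
      n₀ ≤ Fintype.card V → (∀ G ∈ S, IsKFormula k G ∧ MinimalFormula G ∧
        ∀ σ, ζ * (Fintype.card V : ℝ) ^ k < inconsistent σ G) →
      (S.card : ℝ) ≤ 2 ^ ((1 - c) * ((Fintype.card V : ℝ) ^ k / k.factorial)) := by
  classical
  obtain ⟨m, rfl⟩ : ∃ m, k = m + 1 := ⟨k - 1, by omega⟩
  obtain ⟨c, hc, n₁, hsimple⟩ := simple_far_count m (by omega) (half_pos hζ)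
  obtain ⟨k, hkdef⟩ : ∃ k, k = m + 1 := ⟨_, rfl⟩
  rw [← hkdef] at hsimple ⊢
  have hfac : (0 : ℝ) < k.factorial := by exact_mod_cast k.factorial_pos
  have hlog2 : 0 < Real.log 2 := Real.log_pos (by norm_num)
  obtain ⟨ε, hε, hsmall⟩ := exists_card_small_subsets_le.{0} (2 ^ k)
    (η := Real.log 2 * (c / (2 * k.factorial))) (by positivity)
  obtain ⟨ν, hν, hν1⟩ : ∃ ν > 0, 2 ^ k * 4 ^ k * ν ≤ min ε (ζ / 2) :=
    ⟨min ε (ζ / 2) / (2 ^ k * 4 ^ k), by positivity, by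
      apply le_of_eq; field_simp⟩
  obtain ⟨n₂, hn₂⟩ := exists_nat_ge (((k * 2 : ℕ) : ℝ) ^ 2 / ν ^ 2 ^ k)
  refine ⟨c / 2, by positivity, max (max n₁ n₂) 1, ?_⟩
  intro V _ _ S hn hS
  obtain ⟨n, hndef⟩ : ∃ n, n = Fintype.card V := ⟨_, rfl⟩
  have hn1 : 1 ≤ n := by rw [hndef]; exact (le_max_right _ _).trans hn
  have hnn₁ : n₁ ≤ Fintype.card V := ((le_max_left _ _).trans (le_max_left _ _)).trans hn
  have hnn₂ : n₂ ≤ n := by rw [hndef]; exact ((le_max_right _ _).trans (le_max_left _ _)).trans hn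
  have hV : Nonempty V := Fintype.card_pos_iff.1 (by omega)
  have hdoub : ∀ G ∈ S, ((doubled G).card : ℝ) ≤ min ε (ζ / 2) * (n : ℝ) ^ k := by
    intro G hG
    refine (card_doubled_le (hS G hG).1 (ν := ν) (fun s s' h => ?_) hν.le).trans ?_
    · refine le_of_pow_le_pow_left₀ (n := 2 ^ k) (by positivity) hν.le ?_
      refine (Ex_two_lifts_le (hS G hG).2.1 h).trans ?_
      have h0 : (0 : ℝ) < n := by exact_mod_cast hn1
      rw [← hndef, div_le_iff₀ h0]
      have h1 : ((k * 2 : ℕ) : ℝ) ^ 2 / ν ^ 2 ^ k ≤ n := hn₂.trans (by exact_mod_cast hnn₂)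
      rw [div_le_iff₀ (by positivity)] at h1
      linarith
    · rw [← hndef]; gcongr
  have hinj : S.card ≤
      ((kClauses V k).powerset.filter fun B => (B.card : ℝ) ≤ ε * (n : ℝ) ^ k).card *
      (S.image fun G => G \ doubled G).card := by
    rw [← card_product]
    apply card_le_card_of_injOn (fun G => (doubled G, G \ doubled G))
    · intro G hG
      simp only [coe_product, Set.mem_prod, mem_coe, mem_filter, mem_powerset]
      refine ⟨⟨fun C hC => mem_kClauses.2 ((hS G hG).1 C (mem_filter.1 hC).1), ?_⟩,
        mem_image_of_mem _ hG⟩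
      exact (hdoub G hG).trans (by gcongr; exact min_le_left _ _)
    · intro G _ G' _ h
      obtain ⟨h1, h2⟩ := Prod.mk.inj h
      have hs : ∀ G : SatFormula V, doubled G ⊆ G := fun G => filter_subset _ _
      rw [← union_sdiff_of_subset (hs G), ← union_sdiff_of_subset (hs G'), h2, h1]
  have hb1 : (((kClauses V k).powerset.filter fun B => (B.card : ℝ) ≤ ε * (n : ℝ) ^ k).card : ℝ)
      ≤ 2 ^ (c / 2 * ((n : ℝ) ^ k / k.factorial)) := by
    refine (hsmall _ (kClauses V k) ((n : ℝ) ^ k) _ (by positivity) ?_ ?_).trans (le_of_eq ?_)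
    · rw [← mul_pow, hndef]
      exact_mod_cast card_kClauses_le (V := V) k
    · intro B hB
      exact ⟨mem_powerset.1 (mem_filter.1 hB).1, (mem_filter.1 hB).2⟩
    · rw [Real.rpow_def_of_pos (by norm_num)]
      congr 1; ring
  have hb2 : (((S.image fun G => G \ doubled G).card : ℕ) : ℝ) ≤
      2 ^ ((1 - c) * ((n : ℝ) ^ k / k.factorial)) := by
    rw [hndef]
    refine hsimple _ hnn₁ fun G' hG' => ?_
    obtain ⟨G, hG, rfl⟩ := mem_image.1 hG'
    refine ⟨fun C hC => (hS G hG).1 C (mem_sdiff.1 hC).1, minimal_mono (hS G hG).2.1 sdiff_subset,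
      simple_sdiff_doubled G, fun σ => ?_⟩
    have h1 := (hS G hG).2.2 σ
    have h2 : inconsistent σ G ≤ (G \ (G \ doubled G)).card + inconsistent σ (G \ doubled G) := by
      convert inconsistent_le_add σ G (G \ doubled G)
    have h3 : (G \ (G \ doubled G)).card ≤ (doubled G).card := card_le_card fun C hC => by
      by_contra h
      exact (mem_sdiff.1 hC).2 (mem_sdiff.2 ⟨(mem_sdiff.1 hC).1, h⟩)
    have h4 : (inconsistent σ G : ℝ) ≤ (doubled G).card + inconsistent σ (G \ doubled G) := by
      exact_mod_cast h2.trans (Nat.add_le_add_right h3 _)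
    have h5 : min ε (ζ / 2) * (n : ℝ) ^ k ≤ ζ / 2 * (n : ℝ) ^ k := by
      gcongr; exact min_le_right _ _
    have h6 := hdoub G hG
    rw [← hndef] at h1 ⊢
    linarith
  rw [← hndef]
  calc (S.card : ℝ) ≤ _ := Nat.cast_le.2 hinj
    _ ≤ 2 ^ (c / 2 * ((n : ℝ) ^ k / k.factorial)) * 2 ^ ((1 - c) * ((n : ℝ) ^ k / k.factorial)) := by
        push_cast; gcongr
    _ = _ := by
        rw [← Real.rpow_add (by norm_num)]
        congr 1; ring

end FarCount

section Disjoint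

variable {α β : Type*} [DecidableEq α] [DecidableEq β]

lemma exists_maximal_disjoint (S : Finset α) (Φ : α → Finset β) (hΦ : ∀ s ∈ S, (Φ s).Nonempty) :
    ∃ T ⊆ S, (∀ s ∈ T, ∀ t ∈ T, s ≠ t → Disjoint (Φ s) (Φ t)) ∧
      ∀ s ∈ S, ∃ t ∈ T, ¬ Disjoint (Φ s) (Φ t) := by
  classical
  induction S using Finset.induction_on with
  | empty => exact ⟨∅, subset_rfl, by simp, by simp⟩
  | insert a S ha ih =>
    obtain ⟨T, hTS, hdis, hmax⟩ := ih fun s hs => hΦ s (mem_insert_of_mem hs)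
    by_cases h : ∃ t ∈ T, ¬ Disjoint (Φ a) (Φ t)
    · refine ⟨T, hTS.trans (subset_insert _ _), hdis, fun s hs => ?_⟩
      rcases mem_insert.1 hs with rfl | hs
      · exact h
      · exact hmax s hs
    · push Not at h
      refine ⟨insert a T, insert_subset_insert _ hTS, ?_, fun s hs => ?_⟩
      · intro s hs t ht hst
        rcases mem_insert.1 hs with rfl | hs' <;> rcases mem_insert.1 ht with rfl | ht'
        · exact absurd rfl hst
        · exact h t ht'
        · exact (h s hs').symm
        · exact hdis s hs' t ht' hst
      · rcases mem_insert.1 hs with rfl | hs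
        · refine ⟨s, mem_insert_self _ _, fun hd => ?_⟩
          exact (hΦ s (mem_insert_self _ _)).ne_empty (disjoint_self.1 hd)
        · obtain ⟨t, ht, h'⟩ := hmax s hs
          exact ⟨t, mem_insert_of_mem ht, h'⟩

/-- The number of subsets of `U` containing none of the pairwise disjoint sets `Φ i`. -/
lemma card_avoid_le {r : ℕ} (I : Finset α) (Φ : α → Finset β) (U : Finset β)
    (hU : ∀ i ∈ I, Φ i ⊆ U) (hr : ∀ i ∈ I, (Φ i).card ≤ r)
    (hdis : ∀ i ∈ I, ∀ j ∈ I, i ≠ j → Disjoint (Φ i) (Φ j)) :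
    ((U.powerset.filter fun H => ∀ i ∈ I, ¬ Φ i ⊆ H).card : ℝ) ≤
      2 ^ U.card * (1 - (1 / 2) ^ r) ^ I.card := by
  classical
  induction I using Finset.induction_on generalizing U with
  | empty => simp
  | insert a I ha ih =>
    have haU := hU a (mem_insert_self _ _)
    have h1 := ih (U \ Φ a)
      (fun i hi => subset_sdiff.2 ⟨hU i (mem_insert_of_mem hi),
        hdis i (mem_insert_of_mem hi) a (mem_insert_self _ _) (by rintro rfl; exact ha hi)⟩)
      (fun i hi => hr i (mem_insert_of_mem hi))
      (fun i hi j hj => hdis i (mem_insert_of_mem hi) j (mem_insert_of_mem hj))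
    have h2 : (U.powerset.filter fun H => ∀ i ∈ insert a I, ¬ Φ i ⊆ H).card ≤
        ((Φ a).powerset.erase (Φ a)).card *
        ((U \ Φ a).powerset.filter fun H => ∀ i ∈ I, ¬ Φ i ⊆ H).card := by
      rw [← card_product]
      apply card_le_card_of_injOn (fun H => (H ∩ Φ a, H \ Φ a))
      · intro H hH
        obtain ⟨hHU, hH⟩ := mem_filter.1 hH
        simp only [coe_product, Set.mem_prod, mem_coe, mem_filter, mem_powerset, mem_erase]
        refine ⟨⟨fun h => hH a (mem_insert_self _ _) (inter_eq_right.1 h), inter_subset_right⟩,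
          sdiff_subset_sdiff (mem_powerset.1 hHU) subset_rfl, fun i hi h => ?_⟩
        exact hH i (mem_insert_of_mem hi) (h.trans sdiff_subset)
      · intro H _ H' _ h
        obtain ⟨h1, h2⟩ := Prod.mk.inj h
        rw [← sdiff_union_inter H (Φ a), ← sdiff_union_inter H' (Φ a), h1, h2]
    rw [card_erase_of_mem (mem_powerset_self _), card_powerset] at h2
    have h3 : (((2 ^ (Φ a).card - 1 : ℕ) : ℕ) : ℝ) ≤ 2 ^ (Φ a).card * (1 - (1 / 2) ^ r) := by
      rw [Nat.cast_sub Nat.one_le_two_pow]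
      push_cast
      have : (1 / 2 : ℝ) ^ r ≤ (1 / 2) ^ (Φ a).card :=
        pow_le_pow_of_le_one (by norm_num) (by norm_num) (hr a (mem_insert_self _ _))
      have h4 : (2 : ℝ) ^ (Φ a).card * (1 / 2) ^ (Φ a).card = 1 := by
        rw [← mul_pow]; norm_num
      have h5 : (2 : ℝ) ^ (Φ a).card * (1 / 2) ^ r ≤ 2 ^ (Φ a).card * (1 / 2) ^ (Φ a).card := by
        gcongr
      linarith
    have h6 : (0 : ℝ) ≤ 1 - (1 / 2) ^ r := by
      have : (1 / 2 : ℝ) ^ r ≤ 1 := pow_le_one₀ (by norm_num) (by norm_num)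
      linarith
    calc ((U.powerset.filter fun H => ∀ i ∈ insert a I, ¬ Φ i ⊆ H).card : ℝ)
        ≤ ((2 ^ (Φ a).card - 1 : ℕ) : ℝ) *
          ((U \ Φ a).powerset.filter fun H => ∀ i ∈ I, ¬ Φ i ⊆ H).card := by exact_mod_cast h2
      _ ≤ (2 ^ (Φ a).card * (1 - (1 / 2) ^ r)) *
          (2 ^ (U \ Φ a).card * (1 - (1 / 2) ^ r) ^ I.card) := by gcongr
      _ = 2 ^ ((Φ a).card + (U \ Φ a).card) * (1 - (1 / 2) ^ r) ^ (insert a I).card := by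
          rw [card_insert_of_notMem ha]; ring
      _ = _ := by rw [add_comm, card_sdiff_add_card_eq_card haU]

end Disjoint

section Peel

variable {V : Type*} [DecidableEq V]

/-- The subsets of size `i` of the members of `L`. -/
def shadowAt (L : Finset (Finset V)) (i : ℕ) : Finset (Finset V) :=
  L.biUnion fun P => P.powersetCard i

lemma mem_shadowAt {L : Finset (Finset V)} {i : ℕ} {Q : Finset V} :
    Q ∈ shadowAt L i ↔ ∃ P ∈ L, Q ⊆ P ∧ Q.card = i := by
  simp [shadowAt, mem_powersetCard]

lemma shadowAt_mul_le {L : Finset (Finset V)} {j d : ℕ} (hL : ∀ P ∈ L, P.card = j)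
    (hd : ∀ P ∈ L, ∀ a ∈ P, d ≤ (L.filter fun P' => P.erase a ⊆ P').card) {i : ℕ} (hi : i < j) :
    (shadowAt L i).card * d ≤ (shadowAt L (i + 1)).card * (i + 1) := by
  classical
  refine card_mul_le_card_mul (fun Q Q' => Q ⊆ Q') (fun Q hQ => ?_) fun Q' hQ' => ?_
  · obtain ⟨P, hP, hQP, hQi⟩ := mem_shadowAt.1 hQ
    obtain ⟨a, haP, haQ⟩ : ∃ a ∈ P, a ∉ Q := by
      by_contra! h
      have := card_le_card (show P ⊆ Q from h)
      rw [hL P hP] at this; omega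
    have hQF : Q ⊆ P.erase a := fun x hx => mem_erase.2 ⟨by rintro rfl; exact haQ hx, hQP hx⟩
    have hFc : (P.erase a).card = j - 1 := by rw [card_erase_of_mem haP, hL P hP]
    have hext : ∀ P' ∈ L.filter (fun P' => P.erase a ⊆ P'),
        ∃ b, b ∉ P.erase a ∧ P' = insert b (P.erase a) := by
      intro P' hP'
      obtain ⟨h1, h2⟩ := mem_filter.1 hP'
      have h3 : (P' \ P.erase a).card = 1 := by
        rw [card_sdiff_of_subset h2, hL P' h1, hFc]; omega
      obtain ⟨b, hb⟩ := card_eq_one.1 h3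
      have hb' : b ∈ P' \ P.erase a := by rw [hb]; exact mem_singleton_self b
      refine ⟨b, (mem_sdiff.1 hb').2, ?_⟩
      rw [← sdiff_union_of_subset h2, hb]; rfl
    refine (hd P hP a haP).trans (card_le_card_of_injOn (fun P' => Q ∪ (P' \ P.erase a)) ?_ ?_)
    · intro P' hP'
      obtain ⟨b, hb, rfl⟩ := hext P' hP'
      have hs : insert b (P.erase a) \ P.erase a = {b} := by
        rw [insert_sdiff_of_notMem _ hb, sdiff_self]; rfl
      simp only [hs]
      refine mem_filter.2 ⟨mem_shadowAt.2 ⟨_, (mem_filter.1 hP').1, ?_, ?_⟩, subset_union_left⟩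
      · exact union_subset (hQF.trans (subset_insert _ _)) (by simp)
      · rw [card_union_of_disjoint (by simp; exact fun h => hb (hQF h)), hQi, card_singleton]
    · intro P' hP' P'' hP'' h
      obtain ⟨b, hb, rfl⟩ := hext P' hP'
      obtain ⟨c, hc, rfl⟩ := hext P'' hP''
      have hs : ∀ b, b ∉ P.erase a → insert b (P.erase a) \ P.erase a = {b} := fun b hb => by
        rw [insert_sdiff_of_notMem _ hb, sdiff_self]; rfl
      simp only [hs b hb, hs c hc] at h
      have : b ∈ Q ∪ {c} := by rw [← h]; simp
      rcases mem_union.1 this with h' | h'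
      · exact absurd (hQF h') hb
      · rw [mem_singleton.1 h']
  · obtain ⟨P, hP, -, hc⟩ := mem_shadowAt.1 hQ'
    calc _ ≤ (Q'.powersetCard i).card := by
          refine card_le_card fun Q hQ => ?_
          obtain ⟨h1, h2⟩ := mem_filter.1 hQ
          exact mem_powersetCard.2 ⟨h2, (mem_shadowAt.1 h1).choose_spec.2.2⟩
      _ = i + 1 := by rw [card_powersetCard, hc]; exact Nat.choose_succ_self_right i

lemma pow_le_factorial_mul_card {L : Finset (Finset V)} {j d : ℕ} (hne : L.Nonempty)
    (hL : ∀ P ∈ L, P.card = j)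
    (hd : ∀ P ∈ L, ∀ a ∈ P, d ≤ (L.filter fun P' => P.erase a ⊆ P').card) :
    d ^ j ≤ j.factorial * L.card := by
  have key : ∀ i ≤ j, d ^ i ≤ i.factorial * (shadowAt L i).card := by
    intro i
    induction i with
    | zero =>
      intro _
      have : (∅ : Finset V) ∈ shadowAt L 0 := by
        obtain ⟨P, hP⟩ := hne
        exact mem_shadowAt.2 ⟨P, hP, empty_subset _, rfl⟩
      simpa using Nat.one_le_iff_ne_zero.2 (card_ne_zero_of_mem this)
    | succ i ih =>
      intro hi
      calc d ^ (i + 1) = d ^ i * d := pow_succ _ _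
        _ ≤ i.factorial * (shadowAt L i).card * d := Nat.mul_le_mul_right _ (ih (by omega))
        _ = i.factorial * ((shadowAt L i).card * d) := by ring
        _ ≤ i.factorial * ((shadowAt L (i + 1)).card * (i + 1)) :=
            Nat.mul_le_mul_left _ (shadowAt_mul_le hL hd (by omega))
        _ = (i + 1).factorial * (shadowAt L (i + 1)).card := by rw [Nat.factorial_succ]; ring
  have h : shadowAt L j = L := by
    ext Q
    rw [mem_shadowAt]
    constructor
    · rintro ⟨P, hP, hQP, hc⟩
      rwa [eq_of_subset_of_card_le hQP (by rw [hL P hP, hc])]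
    · exact fun hQ => ⟨Q, hQ, subset_rfl, hL Q hQ⟩
  have := key j le_rfl
  rwa [h] at this

/-- In a sparse uniform hypergraph every edge can be assigned one of its facets so that few edges
share a facet. -/
lemma exists_facet_assignment [Nonempty V] {j d : ℕ} (L : Finset (Finset V)) (hL : ∀ P ∈ L, P.card = j)
    (hcard : j.factorial * L.card < (d + 1) ^ j) :
    ∃ f : Finset V → V, (∀ P ∈ L, f P ∈ P) ∧
      ∀ Q, (L.filter fun P => P.erase (f P) = Q).card ≤ d := by
  classical
  induction hn : L.card using Nat.strong_induction_on generalizing L with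
  | _ n ih =>
    rcases L.eq_empty_or_nonempty with rfl | hne
    · exact ⟨fun _ => Classical.arbitrary V, by simp, by simp⟩
    · obtain ⟨P₀, hP₀, a, ha, hlt⟩ : ∃ P ∈ L, ∃ a ∈ P,
          (L.filter fun P' => P.erase a ⊆ P').card < d + 1 := by
        by_contra! h
        exact absurd (pow_le_factorial_mul_card hne hL h) (by omega)
      set B := L.filter fun P' => P₀.erase a ⊆ P' with hB
      have hBL : B ⊆ L := filter_subset _ _
      have hP₀B : P₀ ∈ B := mem_filter.2 ⟨hP₀, erase_subset _ _⟩
      have hlt' : (L \ B).card < n := by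
        rw [← hn]
        exact card_lt_card (sdiff_ssubset hBL ⟨P₀, hP₀B⟩)
      obtain ⟨f, hf, hfib⟩ := ih _ hlt' (L \ B) (fun P hP => hL P (mem_sdiff.1 hP).1)
        (lt_of_le_of_lt (Nat.mul_le_mul_left _ (card_le_card sdiff_subset)) hcard) rfl
      have hext : ∀ P ∈ B, ∃ b ∈ P, P.erase b = P₀.erase a := by
        intro P hP
        obtain ⟨h1, h2⟩ := mem_filter.1 hP
        have hj : 0 < j := by rw [← hL P₀ hP₀]; exact card_pos.2 ⟨a, ha⟩
        have hc : (P₀.erase a).card = j - 1 := by rw [card_erase_of_mem ha, hL P₀ hP₀]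
        obtain ⟨b, hbP, hb⟩ : ∃ b ∈ P, b ∉ P₀.erase a := by
          by_contra! h
          have := card_le_card (show P ⊆ P₀.erase a from h)
          rw [hL P h1] at this; omega
        refine ⟨b, hbP, (eq_of_subset_of_card_le ?_ ?_).symm⟩
        · exact fun x hx => mem_erase.2 ⟨by rintro rfl; exact hb hx, h2 hx⟩
        · rw [card_erase_of_mem hbP, hL P h1, hc]
      have hg : ∀ P, ∃ b, P ∈ B → b ∈ P ∧ P.erase b = P₀.erase a := fun P => by
        by_cases h : P ∈ B
        · obtain ⟨b, h1, h2⟩ := hext P h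
          exact ⟨b, fun _ => ⟨h1, h2⟩⟩
        · exact ⟨a, fun h' => absurd h' h⟩
      choose g hg using hg
      refine ⟨fun P => if P ∈ B then g P else f P, fun P hP => ?_, fun Q => ?_⟩
      · by_cases h : P ∈ B
        · simp only [h, if_true]; exact (hg P h).1
        · simp only [h, if_false]; exact hf P (mem_sdiff.2 ⟨hP, h⟩)
      · by_cases hQ : Q = P₀.erase a
        · refine le_trans (card_le_card fun P hP => ?_) (Nat.lt_succ_iff.1 hlt)
          obtain ⟨h1, h2⟩ := mem_filter.1 hP
          refine mem_filter.2 ⟨h1, ?_⟩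
          rw [← hQ, ← h2]; exact erase_subset _ _
        · refine le_trans (card_le_card fun P hP => ?_) (hfib Q)
          obtain ⟨h1, h2⟩ := mem_filter.1 hP
          by_cases h : P ∈ B
          · simp only [h, if_true] at h2
            exact absurd (h2.symm.trans (hg P h).2) hQ
          · simp only [h, if_false] at h2
            exact mem_filter.2 ⟨mem_sdiff.2 ⟨h1, h⟩, h2⟩

end Peel

section Constraints

variable {V : Type*} [Fintype V] [DecidableEq V]

/-- `H` contains no set of the form `{F ∪ {b} : F ∈ Φ}`. -/
def Blocks (Φ H : Finset (Finset V)) : Prop :=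
  ∀ b, b ∉ Φ.biUnion id → ∃ F ∈ Φ, insert b F ∉ H

open Classical in
lemma exists_blocking_family {k : ℕ} (hk : 2 ≤ k) (K : Finset (Finset (Finset V)))
    (hK : ∀ Φ ∈ K, Φ.Nonempty ∧ Φ.card ≤ k + 1 ∧ ∀ F ∈ Φ, F.card = k - 1)
    (hdis : ∀ Φ ∈ K, ∀ Ψ ∈ K, Φ ≠ Ψ → Disjoint Φ Ψ) (hN : 2 * ((k + 1) * k) ≤ Fintype.card V) :
    ∃ (T : Finset (Finset (Finset V) × V)) (c : Finset (Finset V) × V → Finset (Finset V)),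
      (∀ p ∈ T, c p ⊆ (univ : Finset V).powersetCard k) ∧ (∀ p ∈ T, (c p).card ≤ k + 1) ∧
      (∀ s ∈ T, ∀ t ∈ T, s ≠ t → Disjoint (c s) (c t)) ∧
      (∀ H, (∀ Φ ∈ K, Blocks Φ H) → ∀ p ∈ T, ¬ c p ⊆ H) ∧
      K.card * Fintype.card V ≤ T.card * (2 * ((k + 1) * k)) := by
  obtain ⟨n, hn⟩ : ∃ n, n = Fintype.card V := ⟨_, rfl⟩
  rw [← hn] at hN ⊢
  obtain ⟨c, hc⟩ : ∃ c : Finset (Finset V) × V → Finset (Finset V),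
    ∀ p, c p = p.1.image (insert p.2) := ⟨_, fun _ => rfl⟩
  obtain ⟨I, hIdef⟩ : ∃ I : Finset (Finset (Finset V) × V),
    I = K.biUnion fun Φ => (univ \ Φ.biUnion id).image fun b => (Φ, b) := ⟨_, rfl⟩
  have hmem : ∀ p, p ∈ I ↔ p.1 ∈ K ∧ p.2 ∉ p.1.biUnion id := by
    rintro ⟨Φ, b⟩
    simp only [hIdef, mem_biUnion, mem_image, mem_sdiff, mem_univ, true_and, Prod.mk.injEq]
    constructor
    · rintro ⟨Ψ, h1, x, h2, rfl, rfl⟩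
      exact ⟨h1, by simpa using h2⟩
    · rintro ⟨h1, h2⟩
      exact ⟨Φ, h1, b, by simpa using h2, rfl, rfl⟩
  have hI : ∀ p ∈ I, p.1 ∈ K ∧ ∀ F ∈ p.1, p.2 ∉ F := by
    intro p hp
    obtain ⟨h1, h2⟩ := (hmem p).1 hp
    exact ⟨h1, fun F hF h => h2 (mem_biUnion.2 ⟨F, hF, h⟩)⟩
  have hcU : ∀ p ∈ I, c p ⊆ (univ : Finset V).powersetCard k := by
    intro p hp e he
    rw [hc] at he
    obtain ⟨F, hF, rfl⟩ := mem_image.1 he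
    refine mem_powersetCard.2 ⟨subset_univ _, ?_⟩
    rw [card_insert_of_notMem ((hI p hp).2 F hF), (hK _ (hI p hp).1).2.2 F hF]; omega
  have hcc : ∀ p ∈ I, (c p).card ≤ k + 1 := fun p hp => by
    rw [hc]; exact card_image_le.trans (hK _ (hI p hp).1).2.1
  obtain ⟨T, hTI, hTd, hTm⟩ := exists_maximal_disjoint I c fun p hp => by
    rw [hc]; exact (hK _ (hI p hp).1).1.image _
  have hIcard : K.card * n ≤ 2 * I.card := by
    rw [hIdef, card_biUnion, mul_sum, ← smul_eq_mul]
    · refine card_nsmul_le_sum _ _ _ fun Φ hΦ => ?_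
      have h1 : (Φ.biUnion id).card ≤ (k + 1) * k := by
        refine card_biUnion_le.trans ?_
        refine (sum_le_card_nsmul _ _ k fun F hF => ?_).trans
          (Nat.mul_le_mul_right _ (hK Φ hΦ).2.1)
        simp only [id, (hK Φ hΦ).2.2 F hF]; omega
      rw [card_image_of_injective _ (fun a b h => (Prod.mk.injEq .. ▸ h).2), card_univ_sdiff, ← hn]
      omega
    · intro Φ _ Ψ _ hne
      refine disjoint_left.2 fun p hp hp' => hne ?_
      obtain ⟨_, _, rfl⟩ := mem_image.1 hp
      obtain ⟨_, _, h⟩ := mem_image.1 hp'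
      exact (congrArg Prod.fst h).symm
  have hTcard : I.card ≤ T.card * ((k + 1) * k) := by
    have hsub : I ⊆ T.biUnion fun t => (c t).biUnion fun e => e.biUnion fun b =>
        I.filter fun p => p.2 = b ∧ e.erase b ∈ p.1 := by
      intro p hp
      obtain ⟨t, ht, hnd⟩ := hTm p hp
      obtain ⟨e, he, het⟩ := not_disjoint_iff.1 hnd
      rw [hc] at he
      obtain ⟨F, hF, rfl⟩ := mem_image.1 he
      refine mem_biUnion.2 ⟨t, ht, mem_biUnion.2 ⟨_, het, mem_biUnion.2 ⟨p.2,
        mem_insert_self _ _, mem_filter.2 ⟨hp, rfl, ?_⟩⟩⟩⟩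
      rwa [erase_insert ((hI p hp).2 F hF)]
    refine (card_le_card hsub).trans (card_biUnion_le.trans ?_)
    refine (sum_le_card_nsmul _ _ ((k + 1) * k) fun t ht => ?_)
    refine card_biUnion_le.trans ?_
    refine (sum_le_card_nsmul _ _ k fun e he => ?_).trans
      (Nat.mul_le_mul_right _ (hcc t (hTI ht)))
    refine card_biUnion_le.trans ?_
    refine (sum_le_card_nsmul _ _ 1 fun b hb => ?_).trans ?_
    · refine card_le_one.2 fun p hp q hq => ?_
      obtain ⟨hp1, hp2, hp3⟩ := mem_filter.1 hp
      obtain ⟨hq1, hq2, hq3⟩ := mem_filter.1 hq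
      have h1 : p.1 = q.1 := by
        by_contra h
        exact disjoint_left.1 (hdis _ (hI p hp1).1 _ (hI q hq1).1 h) hp3 hq3
      exact Prod.ext h1 (hp2.trans hq2.symm)
    · rw [(mem_powersetCard.1 (hcU t (hTI ht) he)).2]; simp
  refine ⟨T, c, fun p hp => hcU p (hTI hp), fun p hp => hcc p (hTI hp), hTd, ?_, ?_⟩
  · intro H h2 p hp hsub
    obtain ⟨h3, h4⟩ := (hmem p).1 (hTI hp)
    obtain ⟨F, hF, h⟩ := h2 p.1 h3 p.2 h4
    rw [hc] at hsub
    exact h (hsub (mem_image_of_mem _ hF))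
  · calc K.card * n ≤ 2 * I.card := hIcard
      _ ≤ 2 * (T.card * ((k + 1) * k)) := Nat.mul_le_mul_left _ hTcard
      _ = _ := by ring

lemma one_sub_pow_le_exp {x y D : ℝ} {t : ℕ} (hx0 : 0 ≤ x) (hx : x ≤ 1) (hD : 0 < D)
    (h : y ≤ t * D) : (1 - x) ^ t ≤ Real.exp (-(x / D * y)) := by
  calc (1 - x) ^ t ≤ Real.exp (-x) ^ t := by
        have := Real.add_one_le_exp (-x)
        exact pow_le_pow_left₀ (by linarith) (by linarith) _
    _ = Real.exp (-(x * t)) := by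
        rw [← Real.exp_nat_mul]; congr 1; ring
    _ ≤ _ := by
        apply Real.exp_le_exp.2
        apply neg_le_neg
        rw [div_mul_eq_mul_div, div_le_iff₀ hD, mul_assoc]
        exact mul_le_mul_of_nonneg_left h hx0

open Classical in
lemma card_blocks_le {k : ℕ} (hk : 2 ≤ k) (K : Finset (Finset (Finset V)))
    (hK : ∀ Φ ∈ K, Φ.Nonempty ∧ Φ.card ≤ k + 1 ∧ ∀ F ∈ Φ, F.card = k - 1)
    (hdis : ∀ Φ ∈ K, ∀ Ψ ∈ K, Φ ≠ Ψ → Disjoint Φ Ψ) (hN : 2 * ((k + 1) * k) ≤ Fintype.card V) :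
    ((((univ : Finset V).powersetCard k).powerset.filter fun H =>
        ∀ Φ ∈ K, Blocks Φ H).card : ℝ) ≤
      2 ^ (Fintype.card V).choose k *
        Real.exp (-((1 / 2) ^ (k + 1) / (2 * ((k + 1) * k)) * (K.card * Fintype.card V))) := by
  obtain ⟨T, c, hcU, hcc, hTd, hT, hcard⟩ := exists_blocking_family hk K hK hdis hN
  have h1 : (((univ : Finset V).powersetCard k).powerset.filter fun H =>
      ∀ Φ ∈ K, Blocks Φ H) ⊆
      (((univ : Finset V).powersetCard k).powerset.filter fun H => ∀ p ∈ T, ¬ c p ⊆ H) := by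
    intro H hH
    obtain ⟨h1, h2⟩ := mem_filter.1 hH
    exact mem_filter.2 ⟨h1, hT H h2⟩
  have h2 := card_avoid_le T c ((univ : Finset V).powersetCard k) hcU hcc hTd
  rw [card_powersetCard, card_univ] at h2
  have h3 : ((((univ : Finset V).powersetCard k).powerset.filter fun H =>
      ∀ p ∈ T, ¬ c p ⊆ H).card : ℝ) ≤
      2 ^ (Fintype.card V).choose k * (1 - (1 / 2) ^ (k + 1)) ^ T.card := by
    convert h2
  have h4 := (Nat.cast_le (α := ℝ)).2 (card_le_card h1)
  refine le_trans h4 (le_trans h3 ?_)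
  refine mul_le_mul_of_nonneg_left ?_ (by positivity)
  have hk0 : (0 : ℝ) < 2 * ((k + 1) * k) := by
    have : (0 : ℝ) < k := by exact_mod_cast (by omega : 0 < k)
    positivity
  refine one_sub_pow_le_exp (by positivity) (pow_le_one₀ (by norm_num) (by norm_num)) hk0 ?_
  exact_mod_cast hcard

end Constraints

section Assigned

variable {V : Type} [Fintype V] [DecidableEq V]

/-- The clauses of `X` can be assigned to members of `P` they contain, in such a way that each
`E ∈ P` is used at most `ε n^(k-|E|)` times. -/
def Assignable (k : ℕ) (ε : ℝ) (P : Finset (SatClause V)) (X : SatFormula V) : Prop :=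
  ∃ g : SatClause V → SatClause V, (∀ C ∈ X, g C ∈ P ∧ g C ⊆ C) ∧
    ∀ E ∈ P, ((X.filter fun C => g C = E).card : ℝ) ≤ ε * (Fintype.card V : ℝ) ^ (k - E.card)

lemma card_assignable_le (k : ℕ) {η : ℝ} (hη : 0 < η) : ∃ ε > 0, ∀ {V : Type} [Fintype V]
    [DecidableEq V] (S : Finset (SatFormula V)) (P : Finset (SatClause V)),
    (∀ X ∈ S, IsKFormula k X ∧ Assignable k ε P X) →
    (S.card : ℝ) ≤ Real.exp (η * ∑ E ∈ P, (Fintype.card V : ℝ) ^ (k - E.card)) := by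
  classical
  obtain ⟨ε, hε, hsmall⟩ := exists_card_small_subsets_le.{0} (2 ^ k) hη
  refine ⟨ε, hε, ?_⟩
  intro V _ _ S P hS
  have hex : ∀ X : SatFormula V, ∃ g : SatClause V → SatClause V, X ∈ S →
      (∀ C ∈ X, g C ∈ P ∧ g C ⊆ C) ∧ ∀ E ∈ P, ((X.filter fun C => g C = E).card : ℝ) ≤
        ε * (Fintype.card V : ℝ) ^ (k - E.card) := fun X => by
    by_cases h : X ∈ S
    · obtain ⟨g, hg⟩ := (hS X h).2
      exact ⟨g, fun _ => hg⟩
    · exact ⟨id, fun h' => absurd h' h⟩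
  choose g hg using hex
  let above : SatClause V → Finset (SatClause V) := fun E => (kClauses V k).filter fun C => E ⊆ C
  let t : SatClause V → Finset (SatFormula V) := fun E => (above E).powerset.filter fun B =>
    (B.card : ℝ) ≤ ε * (Fintype.card V : ℝ) ^ (k - E.card)
  have hinj : S.card ≤ (P.pi fun E => t E).card := by
    apply card_le_card_of_injOn (fun X E _ => X.filter fun C => g X C = E)
    · intro X hX
      simp only [mem_coe, mem_pi]
      intro E hE
      refine mem_filter.2 ⟨mem_powerset.2 fun C hC => ?_, (hg X hX).2 E hE⟩
      obtain ⟨h1, h2⟩ := mem_filter.1 hC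
      exact mem_filter.2 ⟨mem_kClauses.2 ((hS X hX).1 C h1), h2 ▸ ((hg X hX).1 C h1).2⟩
    · have key : ∀ X ∈ S, ∀ X' ∈ S,
          (fun (E : SatClause V) (_ : E ∈ P) => X.filter fun C => g X C = E) =
          (fun E _ => X'.filter fun C => g X' C = E) → X ⊆ X' := by
        intro X hX X' hX' h C hC
        have h1 := congrFun (congrFun h (g X C)) ((hg X hX).1 C hC).1
        have h2 : C ∈ X.filter fun D => g X D = g X C := mem_filter.2 ⟨hC, rfl⟩
        rw [h1] at h2
        exact (mem_filter.1 h2).1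
      intro X hX X' hX' h
      exact (key X hX X' hX' h).antisymm (key X' hX' X hX h.symm)
  rw [card_pi] at hinj
  calc (S.card : ℝ) ≤ ∏ E ∈ P, ((t E).card : ℝ) := by exact_mod_cast hinj
    _ ≤ ∏ E ∈ P, Real.exp (η * (Fintype.card V : ℝ) ^ (k - E.card)) := by
        refine prod_le_prod (fun _ _ => Nat.cast_nonneg _) fun E _ => ?_
        refine hsmall _ (above E) _ (t E) (by positivity) ?_ fun B hB =>
          ⟨mem_powerset.1 (mem_filter.1 hB).1, (mem_filter.1 hB).2⟩
        have h1 : ((above E).card : ℝ) ≤ ((2 * Fintype.card V) ^ (k - E.card) : ℕ) :=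
          Nat.cast_le.2 card_kClauses_above_le
        refine h1.trans ?_
        push_cast
        rw [mul_pow]
        gcongr
        · norm_num
        · omega
    _ = _ := by rw [← Real.exp_sum, mul_sum]

open Classical in
/-- Partial clauses whose variable set lies in many members of `F`. -/
noncomputable def heavy (k : ℕ) (c : ℝ) (F : Finset (Finset V)) : Finset (SatClause V) :=
  univ.filter fun E => E.card < k ∧
    c * (Fintype.card V : ℝ) ^ (k - 1 - E.card) ≤ (F.filter fun f => clauseVars E ⊆ f).card

lemma sum_heavy_le {k : ℕ} {c : ℝ} (hc : 0 < c) {F : Finset (Finset V)}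
    (hF : ∀ f ∈ F, f.card = k - 1) :
    ∑ E ∈ heavy k c F, (Fintype.card V : ℝ) ^ (k - E.card) ≤
      4 ^ k / c * (F.card * Fintype.card V) := by
  classical
  have h1 : ∀ E ∈ heavy k c F, (Fintype.card V : ℝ) ^ (k - E.card) ≤
      Fintype.card V / c * ∑ f ∈ F, ind (clauseVars E ⊆ f) := by
    intro E hE
    obtain ⟨-, h1, h2⟩ := mem_filter.1 hE
    rw [sum_ind, show k - E.card = k - 1 - E.card + 1 by omega, pow_succ]
    rw [div_mul_eq_mul_div, le_div_iff₀ hc]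
    calc _ = Fintype.card V * (c * (Fintype.card V : ℝ) ^ (k - 1 - E.card)) := by ring
      _ ≤ _ := by
        gcongr
  refine (sum_le_sum h1).trans ?_
  rw [← mul_sum, sum_comm]
  have h2 : ∀ f ∈ F, ∑ E ∈ heavy k c F, ind (clauseVars E ⊆ f) ≤ 4 ^ k := by
    intro f hf
    rw [sum_ind]
    have : (heavy k c F).filter (fun E => clauseVars E ⊆ f) ⊆ (f ×ˢ univ).powerset := by
      intro E hE
      refine mem_powerset.2 fun l hl => mem_product.2 ⟨(mem_filter.1 hE).2 ?_, mem_univ _⟩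
      exact mem_image_of_mem _ hl
    have h3 := card_le_card this
    rw [card_powerset, card_product, hF f hf] at h3
    have h4 : 2 ^ ((k - 1) * (univ : Finset Bool).card) ≤ 4 ^ k := by
      rw [card_univ, Fintype.card_bool, mul_comm, pow_mul]
      exact Nat.pow_le_pow_right (by norm_num) (by omega)
    exact_mod_cast h3.trans h4
  calc _ ≤ Fintype.card V / c * ∑ f ∈ F, (4 : ℝ) ^ k := by gcongr with f hf; exact h2 f hf
    _ = _ := by rw [sum_const, nsmul_eq_mul]; ring

end Assigned

section Parts

variable {V : Type*} [DecidableEq V]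

/-- The clause consisting of the positive literals on `e`. -/
def posClause (e : Finset V) : SatClause V := signed (fun _ => true) e

lemma mem_posClause {e : Finset V} {l : V × Bool} : l ∈ posClause e ↔ l.1 ∈ e ∧ l.2 = true :=
  mem_signed

lemma mk_mem_posClause {e : Finset V} {v : V} {b : Bool} :
    (v, b) ∈ posClause e ↔ v ∈ e ∧ b = true := mem_posClause

lemma card_posClause (e : Finset V) : (posClause e).card = e.card := card_signed _ _

lemma clauseVars_posClause (e : Finset V) : clauseVars (posClause e) = e := clauseVars_signed _ _

lemma posClause_injective : Function.Injective (posClause : Finset V → SatClause V) :=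
  fun e f h => by rw [← clauseVars_posClause e, h, clauseVars_posClause]

lemma satisfies_posClause {a : V → Bool} {e : Finset V} :
    SatisfiesClause a (posClause e) ↔ ∀ v ∈ e, a v = true := satisfies_signed

/-- The variables occurring in `C` with sign `s`. -/
def signVars (s : Bool) (C : SatClause V) : Finset V := (C.filter fun l => l.2 = s).image Prod.fst

lemma mem_signVars {s : Bool} {C : SatClause V} {v : V} : v ∈ signVars s C ↔ (v, s) ∈ C := by
  simp only [signVars, mem_image, mem_filter, Prod.exists, exists_and_right, exists_eq_right]

lemma sign_eq_of_mem {k : ℕ} {C : SatClause V} (hC : IsKClause k C) {v : V} {b c : Bool}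
    (hb : (v, b) ∈ C) (hc : (v, c) ∈ C) : b = c := by
  have h : Set.InjOn Prod.fst (C : Set (V × Bool)) :=
    card_image_iff.1 (hC.2.trans hC.1.symm)
  exact (Prod.mk.inj (h hb hc rfl)).2

lemma disjoint_signVars {k : ℕ} {C : SatClause V} (hC : IsKClause k C) :
    Disjoint (signVars true C) (signVars false C) := by
  refine disjoint_left.2 fun v h1 h2 => ?_
  exact absurd (sign_eq_of_mem hC (mem_signVars.1 h1) (mem_signVars.1 h2)) (by simp)

lemma card_signVars_add {k : ℕ} {C : SatClause V} (hC : IsKClause k C) :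
    (signVars true C).card + (signVars false C).card = k := by
  rw [← card_union_of_disjoint (disjoint_signVars hC)]
  have : signVars true C ∪ signVars false C = clauseVars C := by
    ext v
    simp only [mem_union, mem_signVars, clauseVars, mem_image, Prod.exists, exists_and_right,
      exists_eq_right]
    constructor
    · rintro (h | h)
      · exact ⟨_, h⟩
      · exact ⟨_, h⟩
    · rintro ⟨(_ | _), h⟩ <;> simp [h]
  rw [this, hC.2]

lemma eq_posClause {C : SatClause V} (h : signVars false C = ∅) :
    C = posClause (signVars true C) := by
  ext ⟨v, b⟩
  rw [mk_mem_posClause, mem_signVars]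
  constructor
  · intro hv
    cases b
    · have := mem_signVars.2 hv
      rw [h] at this; simp at this
    · exact ⟨hv, rfl⟩
  · rintro ⟨hv, rfl⟩; exact hv

lemma eq_insert_posClause {C : SatClause V} {v : V} (h : signVars false C = {v}) :
    C = insert (v, false) (posClause (signVars true C)) := by
  ext ⟨u, b⟩
  rw [mem_insert, mk_mem_posClause, mem_signVars]
  cases b
  · rw [← mem_signVars, h]; simp
  · simp

/-- The clauses of `G` having a negative literal. -/
def nonpos (G : SatFormula V) : SatFormula V := G.filter fun C => (signVars false C).Nonempty

lemma mem_nonpos {G : SatFormula V} {C : SatClause V} :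
    C ∈ nonpos G ↔ C ∈ G ∧ (signVars false C).Nonempty := mem_filter

variable [Fintype V]

/-- The sets of variables carrying a positive clause of `G`. -/
def edges (G : SatFormula V) : Finset (Finset V) := univ.filter fun e => posClause e ∈ G

lemma mem_edges {G : SatFormula V} {e : Finset V} : e ∈ edges G ↔ posClause e ∈ G := by
  simp [edges]

lemma edges_subset {k : ℕ} {G : SatFormula V} (hG : IsKFormula k G) :
    edges G ⊆ (univ : Finset V).powersetCard k := fun e he =>
  mem_powersetCard.2 ⟨subset_univ _, by
    rw [← card_posClause]; exact (hG _ (mem_edges.1 he)).1⟩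

lemma eq_of_nonpos_edges {G G' : SatFormula V} (h1 : nonpos G = nonpos G')
    (h2 : edges G = edges G') : G = G' := by
  have key : ∀ G G' : SatFormula V, nonpos G = nonpos G' → edges G = edges G' → G ⊆ G' := by
    intro G G' h1 h2 C hC
    by_cases h : (signVars false C).Nonempty
    · exact (mem_nonpos.1 (h1 ▸ mem_nonpos.2 ⟨hC, h⟩)).1
    · have h3 := eq_posClause (not_nonempty_iff_eq_empty.1 h)
      rw [h3] at hC ⊢
      exact mem_edges.1 (h2 ▸ mem_edges.2 hC)
  exact (key G G' h1 h2).antisymm (key G' G h1.symm h2.symm)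

/-- The sets `P` such that `G` has the clause with literal `(v, s)` and positive literals
on `P`. -/
def link (G : SatFormula V) (v : V) (s : Bool) : Finset (Finset V) :=
  univ.filter fun P => v ∉ P ∧ insert (v, s) (posClause P) ∈ G

lemma mem_link {G : SatFormula V} {v : V} {s : Bool} {P : Finset V} :
    P ∈ link G v s ↔ v ∉ P ∧ insert (v, s) (posClause P) ∈ G := by
  simp [link]

lemma card_of_mem_link {k : ℕ} {G : SatFormula V} (hG : IsKFormula k G) {v : V} {s : Bool}
    {P : Finset V} (hP : P ∈ link G v s) : P.card = k - 1 := by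
  obtain ⟨h1, h2⟩ := mem_link.1 hP
  have := (hG _ h2).1
  rw [card_insert_of_notMem (by simp [mk_mem_posClause, h1]), card_posClause] at this
  omega

end Parts

section Gadgets

variable {V : Type*} [Fintype V] [DecidableEq V]

/-- A family of `(k-1)`-sets that, by minimality, is blocked by `edges G`. -/
def IsGadget (k : ℕ) (G : SatFormula V) (Φ : Finset (Finset V)) : Prop :=
  ∃ C ∈ nonpos G, ∃ (R : Finset V) (a : V), R.card = k - 2 ∧ a ∉ R ∧ a ∉ signVars false C ∧
    signVars true C ⊆ insert a R ∧ Disjoint R (signVars false C) ∧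
    Φ = insert (insert a R) ((signVars false C).image fun v => insert v R)

lemma IsGadget.nonempty {k : ℕ} {G : SatFormula V} {Φ : Finset (Finset V)} (h : IsGadget k G Φ) :
    Φ.Nonempty := by
  obtain ⟨C, -, R, a, -, -, -, -, -, rfl⟩ := h
  exact ⟨_, mem_insert_self _ _⟩

lemma IsGadget.card_le {k : ℕ} {G : SatFormula V} (hG : IsKFormula k G) {Φ : Finset (Finset V)}
    (h : IsGadget k G Φ) : Φ.card ≤ k + 1 := by
  obtain ⟨C, hC, R, a, -, -, -, -, -, rfl⟩ := h
  have := card_signVars_add (hG C (mem_nonpos.1 hC).1)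
  refine (card_insert_le _ _).trans ?_
  have := card_image_le (s := signVars false C) (f := fun v => insert v R)
  omega

lemma IsGadget.card_mem {k : ℕ} (hk : 2 ≤ k) {G : SatFormula V} {Φ : Finset (Finset V)}
    (h : IsGadget k G Φ) : ∀ F ∈ Φ, F.card = k - 1 := by
  obtain ⟨C, -, R, a, h1, h2, -, -, h3, rfl⟩ := h
  intro F hF
  rcases mem_insert.1 hF with hFa | hF
  · rw [hFa, card_insert_of_notMem h2]; omega
  · obtain ⟨v, hv, rfl⟩ := mem_image.1 hF
    rw [card_insert_of_notMem (disjoint_right.1 h3 hv)]; omega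

lemma IsGadget.blocks {k : ℕ} {G : SatFormula V} (hG : MinimalFormula G)
    {Φ : Finset (Finset V)} (h : IsGadget k G Φ) : Blocks Φ (edges G) := by
  obtain ⟨C, hC, R, a, h1, h2, h3, h4, h5, rfl⟩ := h
  intro b hb
  by_contra! hcon
  simp only [mem_biUnion, mem_insert, mem_image, id, not_exists, not_and] at hb
  have hba : b ≠ a := fun h => hb _ (Or.inl rfl) (h ▸ mem_insert_self _ _)
  obtain ⟨hCG, hneg⟩ := mem_nonpos.1 hC
  obtain ⟨w, hw, hw'⟩ := hG _ (mem_edges.1 (hcon _ (mem_insert_self _ _)))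
  rw [satisfies_posClause] at hw
  have hex : ∃ v ∈ signVars false C, w v = true := by
    by_contra! hall
    have hsat : SatisfiesClause w C := by
      rintro ⟨v, s⟩ hv
      cases s
      · exact Bool.eq_false_of_not_eq_true (hall v (mem_signVars.2 hv))
      · exact hw v (mem_insert_of_mem (h4 (mem_signVars.2 hv)))
    have := hw' C hCG hsat
    obtain ⟨v, hv⟩ := hneg
    rw [mem_signVars, this, mk_mem_posClause] at hv
    exact absurd hv.2 (by simp)
  obtain ⟨v, hv, hwv⟩ := hex
  have := hw' _ (mem_edges.1 (hcon _ (mem_insert_of_mem (mem_image_of_mem _ hv)))) ?_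
  · have := posClause_injective this
    have ha : a ∈ insert b (insert v R) := by rw [this]; simp
    rcases mem_insert.1 ha with h | h
    · exact hba h.symm
    · rcases mem_insert.1 h with h | h
      · exact h3 (h ▸ hv)
      · exact h2 h
  · rw [satisfies_posClause]
    intro u hu
    rcases mem_insert.1 hu with h | h
    · exact h ▸ hw b (mem_insert_self _ _)
    · rcases mem_insert.1 h with h | h
      · exact h ▸ hwv
      · exact hw u (mem_insert_of_mem (mem_insert_of_mem h))

end Gadgets

section Blocked

variable {V : Type} [Fintype V] [DecidableEq V]

/-- If all gadgets with given `C` meet `F` then `C` contains a partial clause that is heavy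
for `F`, or `C` has one negative literal only. -/
lemma exists_heavy_of_blocked {k : ℕ} (hk : 2 ≤ k) (hN : 4 * k ≤ Fintype.card V)
    {C : SatClause V} (hC : IsKClause k C) (hD : 2 ≤ (signVars false C).card)
    {F : Finset (Finset V)} (hF : ∀ f ∈ F, f.card = k - 1)
    (hmeet : ∀ (R : Finset V) (a : V), R.card = k - 2 → a ∉ R → a ∉ signVars false C →
      signVars true C ⊆ insert a R → Disjoint R (signVars false C) →
      insert a R ∈ F ∨ ∃ v ∈ signVars false C, insert v R ∈ F) :
    ∃ E ∈ heavy k (1 / (4 * k * 2 ^ k * k.factorial)) F, E ⊆ C ∧ ∀ l ∈ C \ E, l.2 = false := by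
  classical
  by_contra! hcon
  obtain ⟨P, hPdef⟩ : ∃ P, P = signVars true C := ⟨_, rfl⟩
  obtain ⟨D, hDdef⟩ : ∃ D, D = signVars false C := ⟨_, rfl⟩
  obtain ⟨N, hNdef⟩ : ∃ N, N = Fintype.card V := ⟨_, rfl⟩
  obtain ⟨c, hcdef⟩ : ∃ c : ℝ, c = 1 / (4 * k * 2 ^ k * k.factorial) := ⟨_, rfl⟩
  have hPD : P.card + D.card = k := by rw [hPdef, hDdef]; exact card_signVars_add hC
  have hdis : Disjoint P D := by rw [hPdef, hDdef]; exact disjoint_signVars hC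
  rw [← hDdef] at hD hmeet
  rw [← hPdef] at hmeet
  rw [← hcdef] at hcon
  rw [← hNdef] at hN
  have hkR : (0 : ℝ) < k := by exact_mod_cast (by omega : 0 < k)
  have hNR : (0 : ℝ) < N := by exact_mod_cast (by omega : 0 < N)
  have hNk : (4 * k : ℝ) ≤ N := by exact_mod_cast hN
  have hc : 0 < c := by rw [hcdef]; positivity
  obtain ⟨s, hs⟩ : ∃ s, s = D.card - 2 := ⟨_, rfl⟩
  -- few members of `F` contain `P`
  have hA : ((F.filter fun f => P ⊆ f).card : ℝ) ≤ c * N ^ (s + 1) := by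
    by_contra! h
    obtain ⟨l, hl, hl'⟩ := hcon (posClause P) (by
      refine mem_filter.2 ⟨mem_univ _, by rw [card_posClause]; omega, ?_⟩
      rw [card_posClause, clauseVars_posClause, ← hNdef, show k - 1 - P.card = s + 1 by omega]
      exact h.le.trans (by convert le_rfl)) (by
      rintro ⟨v, b⟩ hv
      obtain ⟨h1, rfl⟩ := mk_mem_posClause.1 hv
      rw [hPdef] at h1
      exact mem_signVars.1 h1)
    obtain ⟨h1, h2⟩ := mem_sdiff.1 hl
    refine h2 (mem_posClause.2 ⟨?_, by simpa using hl'⟩)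
    rw [hPdef, mem_signVars]
    convert h1
    simpa using hl'.symm
  have hB : ∀ v ∈ D, ((F.filter fun f => insert v P ⊆ f).card : ℝ) ≤ c * N ^ s := by
    intro v hv
    have hvP : v ∉ P := disjoint_right.1 hdis hv
    have hcard : (insert (v, false) (posClause P)).card = P.card + 1 := by
      rw [card_insert_of_notMem (by simp [mk_mem_posClause]), card_posClause]
    have hvars : clauseVars (insert (v, false) (posClause P)) = insert v P := by
      rw [clauseVars, image_insert]
      exact congrArg (insert v) (clauseVars_posClause P)
    by_contra! h
    obtain ⟨l, hl, hl'⟩ := hcon (insert (v, false) (posClause P)) (by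
      refine mem_filter.2 ⟨mem_univ _, by rw [hcard]; omega, ?_⟩
      rw [hcard, hvars, ← hNdef, show k - 1 - (P.card + 1) = s by omega]
      exact h.le.trans (by convert le_rfl)) (by
      rintro ⟨u, b⟩ hu
      rcases mem_insert.1 hu with h | h
      · rw [h]
        rw [hDdef] at hv
        exact mem_signVars.1 hv
      · obtain ⟨h1, rfl⟩ := mk_mem_posClause.1 h
        rw [hPdef] at h1
        exact mem_signVars.1 h1)
    obtain ⟨h1, h2⟩ := mem_sdiff.1 hl
    refine h2 (mem_insert_of_mem (mem_posClause.2 ⟨?_, by simpa using hl'⟩))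
    rw [hPdef, mem_signVars]
    convert h1
    simpa using hl'.symm
  -- the possible choices for `R`
  obtain ⟨𝓡, h𝓡⟩ : ∃ 𝓡, 𝓡 = ((univ \ (P ∪ D)).powersetCard s).image fun S => P ∪ S := ⟨_, rfl⟩
  have hmem : ∀ R ∈ 𝓡, R.card = k - 2 ∧ P ⊆ R ∧ Disjoint R D := by
    intro R hR
    rw [h𝓡] at hR
    obtain ⟨S, hS, rfl⟩ := mem_image.1 hR
    obtain ⟨hS1, hS2⟩ := mem_powersetCard.1 hS
    have hd : ∀ x ∈ S, x ∉ P ∧ x ∉ D := fun x hx => by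
      have := hS1 hx; simp at this; exact this
    refine ⟨?_, subset_union_left, ?_⟩
    · rw [card_union_of_disjoint (disjoint_right.2 fun x hx => (hd x hx).1), hS2]; omega
    · exact disjoint_union_left.2 ⟨hdis, disjoint_left.2 fun x hx => (hd x hx).2⟩
  have hcard𝓡 : 𝓡.card = (N - k).choose s := by
    rw [h𝓡, card_image_of_injOn, card_powersetCard, card_univ_sdiff,
      card_union_of_disjoint hdis, hPD, hNdef]
    intro S hS T hT h
    have hd : ∀ S ∈ (univ \ (P ∪ D)).powersetCard s, (P ∪ S) \ P = S := by
      intro S hS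
      rw [union_sdiff_left]
      refine sdiff_eq_self_of_disjoint (disjoint_left.2 fun x hx hxP => ?_)
      have := (mem_powersetCard.1 hS).1 hx
      simp [hxP] at this
    rw [← hd S hS, ← hd T hT]
    exact congrArg (· \ P) h
  have hbig : 4 * k * c * N ^ s ≤ (𝓡.card : ℝ) := by
    have h1 := Nat.pow_le_choose (α := ℝ) s (N - k)
    rw [div_le_iff₀ (by exact_mod_cast Nat.factorial_pos s), mul_comm] at h1
    have h2 : ((N : ℝ) / 2) ^ s ≤ ((N - k + 1 - s : ℕ) : ℝ) ^ s := by
      refine pow_le_pow_left₀ (by positivity) ?_ _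
      have : N ≤ (N - k + 1 - s) * 2 := by omega
      rw [div_le_iff₀ (by norm_num)]
      exact_mod_cast this
    have h3 : (s.factorial : ℝ) ≤ k.factorial := by
      exact_mod_cast Nat.factorial_le (by omega)
    have h4 : (2 : ℝ) ^ s ≤ 2 ^ k := pow_le_pow_right₀ (by norm_num) (by omega)
    rw [hcard𝓡]
    have h5 : ((N : ℝ) / 2) ^ s ≤ k.factorial * ((N - k).choose s : ℝ) :=
      (h2.trans h1).trans (by gcongr)
    rw [div_pow, div_le_iff₀ (by positivity)] at h5
    rw [hcdef]
    have hfac : (0 : ℝ) < k.factorial := by exact_mod_cast Nat.factorial_pos k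
    rw [show 4 * k * (1 / (4 * k * 2 ^ k * k.factorial)) * (N : ℝ) ^ s =
      (N : ℝ) ^ s / (2 ^ k * k.factorial) by field_simp]
    rw [div_le_iff₀ (by positivity)]
    calc (N : ℝ) ^ s ≤ k.factorial * ((N - k).choose s : ℝ) * 2 ^ s := h5
      _ ≤ k.factorial * ((N - k).choose s : ℝ) * 2 ^ k := by gcongr
      _ = _ := by ring
  -- the choices met through a negative variable
  obtain ⟨𝓑, h𝓑⟩ : ∃ 𝓑, 𝓑 = 𝓡.filter fun R => ∃ v ∈ D, insert v R ∈ F := ⟨_, rfl⟩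
  have hbad : (𝓑.card : ℝ) ≤ k * (c * N ^ s) := by
    have h1 : 𝓑 ⊆ D.biUnion fun v => 𝓡.filter fun R => insert v R ∈ F := by
      intro R hR
      rw [h𝓑] at hR
      obtain ⟨hR, v, hv, h⟩ := mem_filter.1 hR
      exact mem_biUnion.2 ⟨v, hv, mem_filter.2 ⟨hR, h⟩⟩
    have h2 : ∀ v ∈ D, ((𝓡.filter fun R => insert v R ∈ F).card : ℝ) ≤ c * N ^ s := by
      intro v hv
      refine le_trans (Nat.cast_le.2 ?_) (hB v hv)
      refine card_le_card_of_injOn (fun R => insert v R) ?_ ?_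
      · intro R hR
        obtain ⟨hR, h⟩ := mem_filter.1 hR
        exact mem_coe.2 (mem_filter.2 ⟨h, insert_subset_insert _ (hmem R hR).2.1⟩)
      · intro R hR T hT h
        have hd : ∀ R ∈ 𝓡, v ∉ R := fun R hR => disjoint_right.1 (hmem R hR).2.2 hv
        have e1 := erase_insert (hd R (mem_filter.1 hR).1)
        have e2 := erase_insert (hd T (mem_filter.1 hT).1)
        rw [← e1, ← e2]
        exact congrArg (erase · v) h
    calc (𝓑.card : ℝ) ≤ ∑ v ∈ D, ((𝓡.filter fun R => insert v R ∈ F).card : ℝ) := by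
          exact_mod_cast (card_le_card h1).trans card_biUnion_le
      _ ≤ ∑ v ∈ D, c * N ^ s := sum_le_sum h2
      _ = D.card * (c * N ^ s) := by rw [sum_const, nsmul_eq_mul]
      _ ≤ _ := by
        gcongr
        omega
  -- the other choices
  have hgood : ((𝓡 \ 𝓑).card : ℝ) ≤ 2 * k * (c * N ^ s) := by
    have h1 : ((𝓡 \ 𝓑).card : ℝ) * (N - 2 * k) ≤ k * (c * N ^ (s + 1)) := by
      have h2 : (𝓡 \ 𝓑).card * (N - 2 * k) ≤ k * (F.filter fun f => P ⊆ f).card := by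
        calc (𝓡 \ 𝓑).card * (N - 2 * k)
            ≤ ∑ R ∈ 𝓡 \ 𝓑, (univ \ (R ∪ D)).card := by
              rw [← smul_eq_mul]
              refine card_nsmul_le_sum _ _ _ fun R hR => ?_
              obtain ⟨h1, -, -⟩ := hmem R (mem_sdiff.1 hR).1
              rw [card_univ_sdiff, ← hNdef]
              have := card_union_le R D
              omega
          _ = ((𝓡 \ 𝓑).sigma fun R => univ \ (R ∪ D)).card := (card_sigma _ _).symm
          _ ≤ ((F.filter fun f => P ⊆ f).sigma fun f => f).card := by
              refine card_le_card_of_injOn (fun p => ⟨insert p.2 p.1, p.2⟩) ?_ ?_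
              · rintro ⟨R, a⟩ hp
                obtain ⟨hR, ha⟩ := mem_sigma.1 (mem_coe.1 hp)
                obtain ⟨hR1, hR2⟩ := mem_sdiff.1 hR
                obtain ⟨g1, g2, g3⟩ := hmem R hR1
                simp only [mem_sdiff, mem_univ, true_and, mem_union, not_or] at ha
                refine mem_coe.2 (mem_sigma.2 ⟨mem_filter.2 ⟨?_, g2.trans (subset_insert _ _)⟩,
                  mem_insert_self _ _⟩)
                rcases hmeet R a g1 ha.1 ha.2 (g2.trans (subset_insert _ _)) g3 with h | h
                · exact h
                · rw [h𝓑] at hR2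
                  exact absurd (mem_filter.2 ⟨hR1, h⟩) hR2
              · rintro ⟨R, a⟩ hp ⟨R', a'⟩ hp' h
                simp only [Sigma.mk.injEq, heq_eq_eq] at h
                obtain ⟨h1, rfl⟩ := h
                have ha : a ∉ R := fun h => by
                  have := (mem_sigma.1 (mem_coe.1 hp)).2
                  simp [h] at this
                have ha' : a ∉ R' := fun h => by
                  have := (mem_sigma.1 (mem_coe.1 hp')).2
                  simp [h] at this
                have : R = R' := by rw [← erase_insert ha, h1, erase_insert ha']
                subst this; rfl
          _ = ∑ f ∈ F.filter fun f => P ⊆ f, f.card := card_sigma _ _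
          _ ≤ (F.filter fun f => P ⊆ f).card • k := sum_le_card_nsmul _ _ _ fun f hf => by
              rw [hF f (mem_filter.1 hf).1]; omega
          _ = _ := by rw [smul_eq_mul, mul_comm]
      have h3 : ((𝓡 \ 𝓑).card : ℝ) * ((N - 2 * k : ℕ) : ℝ) ≤
          k * (F.filter fun f => P ⊆ f).card := by exact_mod_cast h2
      rw [Nat.cast_sub (by omega)] at h3
      push_cast at h3
      exact h3.trans (by gcongr)
    have h2 : ((𝓡 \ 𝓑).card : ℝ) * (N / 2) ≤ 2 * k * (c * N ^ s) * (N / 2) := by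
      calc ((𝓡 \ 𝓑).card : ℝ) * (N / 2) ≤ (𝓡 \ 𝓑).card * (N - 2 * k) := by
            gcongr; linarith
        _ ≤ _ := h1
        _ = _ := by rw [pow_succ]; ring
    exact le_of_mul_le_mul_right h2 (by positivity)
  have htot : (𝓡.card : ℝ) ≤ (𝓡 \ 𝓑).card + 𝓑.card := by
    exact_mod_cast (card_le_card (fun R hR => by
      by_cases h : R ∈ 𝓑
      · exact mem_union_right _ h
      · exact mem_union_left _ (mem_sdiff.2 ⟨hR, h⟩))).trans (card_union_le _ _)
  have : 0 < k * (c * (N : ℝ) ^ s) := by positivity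
  nlinarith

end Blocked

section Local

variable {V : Type} [Fintype V] [DecidableEq V]

/-- Every partial clause extends to few clauses of `G` by negative literals only. -/
def NegSparse (k : ℕ) (δ : ℝ) (G : SatFormula V) : Prop :=
  ∀ E : SatClause V, E.card < k →
    ((G.filter fun C => E ⊆ C ∧ ∀ l ∈ C \ E, l.2 = false).card : ℝ) ≤
      δ * (Fintype.card V : ℝ) ^ (k - E.card)

lemma signVars_insert_posClause_false {v : V} {Q : Finset V} :
    signVars false (insert (v, false) (posClause Q)) = {v} := by
  ext u; simp [mem_signVars, mk_mem_posClause]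

lemma signVars_insert_posClause_true {v : V} {Q : Finset V} :
    signVars true (insert (v, false) (posClause Q)) = Q := by
  ext u; simp [mem_signVars, mk_mem_posClause]

lemma assignable_nonpos {k : ℕ} (hk : 2 ≤ k) (hN : 4 * k ≤ Fintype.card V) {δ : ℝ} (hδ : 0 < δ)
    {G : SatFormula V} (hG : IsKFormula k G) (hsp : NegSparse k δ G)
    (hlink : ∀ v, ((k - 1).factorial * (link G v false).card : ℝ) <
      (δ * Fintype.card V) ^ (k - 1))
    {F : Finset (Finset V)} (hF : ∀ f ∈ F, f.card = k - 1)
    (hmeet : ∀ Φ, IsGadget k G Φ → ∃ f ∈ Φ, f ∈ F) :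
    Assignable k (2 * δ) (heavy k (1 / (4 * k * 2 ^ k * k.factorial)) F) (nonpos G) := by
  classical
  obtain ⟨c, hc⟩ : ∃ c : ℝ, c = 1 / (4 * k * 2 ^ k * k.factorial) := ⟨_, rfl⟩
  have hkR : (1 : ℝ) ≤ k := by exact_mod_cast (by omega : 1 ≤ k)
  have hc1 : c ≤ 1 := by
    rw [hc]
    refine div_le_one_of_le₀ ?_ (by positivity)
    have h1 : (1 : ℝ) ≤ k.factorial := by exact_mod_cast Nat.factorial_pos k
    have h2 : (1 : ℝ) ≤ 2 ^ k := one_le_pow₀ (by norm_num)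
    have h3 : (1 : ℝ) ≤ 4 * k * 2 ^ k := by nlinarith
    nlinarith
  rw [← hc]
  have hNpos : 0 < Fintype.card V := by omega
  have hne : Nonempty V := Fintype.card_pos_iff.1 hNpos
  obtain ⟨d, hd⟩ : ∃ d, d = ⌊δ * Fintype.card V⌋₊ := ⟨_, rfl⟩
  have hd1 : (d : ℝ) ≤ δ * Fintype.card V := hd ▸ Nat.floor_le (by positivity)
  have hd2 : δ * Fintype.card V < d + 1 := hd ▸ Nat.lt_floor_add_one _
  have hfac : ∀ v, ∃ f : Finset V → V, (∀ P ∈ link G v false, f P ∈ P) ∧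
      ∀ Q, ((link G v false).filter fun P => P.erase (f P) = Q).card ≤ d := by
    intro v
    apply exists_facet_assignment (j := k - 1)
    · exact fun P hP => card_of_mem_link hG hP
    · have : (δ * Fintype.card V) ^ (k - 1) ≤ ((d : ℝ) + 1) ^ (k - 1) :=
        pow_le_pow_left₀ (by positivity) hd2.le _
      exact_mod_cast (hlink v).trans_le this
  choose f hf1 hf2 using hfac
  have hex : ∀ C, ∃ E, C ∈ nonpos G → E ∈ heavy k c F ∧ E ⊆ C ∧
      ((∀ l ∈ C \ E, l.2 = false) ∨ ∃ v, signVars false C = {v} ∧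
        E = insert (v, false) (posClause ((signVars true C).erase (f v (signVars true C))))) := by
    intro C
    by_cases hC : C ∈ nonpos G
    swap
    · exact ⟨∅, fun h => absurd h hC⟩
    obtain ⟨hCG, hneg⟩ := mem_nonpos.1 hC
    have hCk := hG C hCG
    have hPD := card_signVars_add hCk
    by_cases hA : ∃ E ∈ heavy k c F, E ⊆ C ∧ ∀ l ∈ C \ E, l.2 = false
    · obtain ⟨E, h1, h2, h3⟩ := hA
      exact ⟨E, fun _ => ⟨h1, h2, Or.inl h3⟩⟩
    by_cases hD : 2 ≤ (signVars false C).card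
    · refine absurd ?_ hA
      rw [hc]
      refine exists_heavy_of_blocked hk hN hCk hD hF ?_
      intro R a h1 h2 h3 h4 h5
      obtain ⟨g, hg, hgF⟩ := hmeet _ ⟨C, hC, R, a, h1, h2, h3, h4, h5, rfl⟩
      rcases mem_insert.1 hg with h | h
      · exact Or.inl (h ▸ hgF)
      · obtain ⟨v, hv, rfl⟩ := mem_image.1 h
        exact Or.inr ⟨v, hv, hgF⟩
    obtain ⟨v, hv⟩ : ∃ v, signVars false C = {v} :=
      card_eq_one.1 (by have := hneg.card_pos; omega)
    obtain ⟨P, hP⟩ : ∃ P, P = signVars true C := ⟨_, rfl⟩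
    have hCeq : C = insert (v, false) (posClause P) := hP ▸ eq_insert_posClause hv
    have hvP : v ∉ P := by
      have := disjoint_signVars hCk
      rw [hv, ← hP] at this
      simpa using this
    have hPc : P.card = k - 1 := by rw [hv, card_singleton, ← hP] at hPD; omega
    have hPL : P ∈ link G v false := mem_link.2 ⟨hvP, hCeq ▸ hCG⟩
    have hfP := hf1 v P hPL
    have hPF : P ∉ F := by
      intro hPF
      refine hA ⟨posClause P, mem_filter.2 ⟨mem_univ _, by rw [card_posClause]; omega, ?_⟩, ?_, ?_⟩
      · rw [card_posClause, clauseVars_posClause, hPc, Nat.sub_self, pow_zero, mul_one]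
        refine hc1.trans ?_
        exact_mod_cast card_pos.2 ⟨P, mem_filter.2 ⟨hPF, subset_rfl⟩⟩
      · rw [hCeq]; exact subset_insert _ _
      · intro l hl
        rw [hCeq] at hl
        obtain ⟨h1, h2⟩ := mem_sdiff.1 hl
        rcases mem_insert.1 h1 with h | h
        · rw [h]
        · exact absurd h h2
    have hQF : insert v (P.erase (f v P)) ∈ F := by
      have hgad : IsGadget k G (insert (insert (f v P) (P.erase (f v P)))
          ((signVars false C).image fun u => insert u (P.erase (f v P)))) := by
        refine ⟨C, hC, P.erase (f v P), f v P, ?_, notMem_erase _ _, ?_, ?_, ?_, rfl⟩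
        · rw [card_erase_of_mem hfP]; omega
        · rw [hv, mem_singleton]; exact fun h => hvP (h ▸ hfP)
        · rw [insert_erase hfP, ← hP]
        · rw [hv, disjoint_singleton_right]; exact fun h => hvP (mem_of_mem_erase h)
      obtain ⟨g, hg, hgF⟩ := hmeet _ hgad
      rw [insert_erase hfP, hv, image_singleton] at hg
      rcases mem_insert.1 hg with h | h
      · exact absurd (h ▸ hgF) hPF
      · exact mem_singleton.1 h ▸ hgF
    refine ⟨insert (v, false) (posClause (P.erase (f v P))), fun _ => ⟨?_, ?_, Or.inr
      ⟨v, hv, by rw [← hP]⟩⟩⟩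
    · have hcard : (insert (v, false) (posClause (P.erase (f v P)))).card = k - 1 := by
        rw [card_insert_of_notMem (by simp [mk_mem_posClause]), card_posClause,
          card_erase_of_mem hfP]; omega
      refine mem_filter.2 ⟨mem_univ _, by omega, ?_⟩
      rw [hcard, Nat.sub_self, pow_zero, mul_one]
      refine hc1.trans ?_
      have : 0 < (F.filter fun g =>
          clauseVars (insert (v, false) (posClause (P.erase (f v P)))) ⊆ g).card := by
        refine card_pos.2 ⟨_, mem_filter.2 ⟨hQF, ?_⟩⟩
        rw [clauseVars, image_insert]
        exact insert_subset_insert _ (clauseVars_posClause _).subset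
      exact_mod_cast this
    · rw [hCeq]
      refine insert_subset_insert _ fun l hl => ?_
      obtain ⟨h1, h2⟩ := mem_posClause.1 hl
      exact mem_posClause.2 ⟨mem_of_mem_erase h1, h2⟩
  choose g hg using hex
  refine ⟨g, fun C hC => ⟨(hg C hC).1, (hg C hC).2.1⟩, fun E hE => ?_⟩
  obtain ⟨-, hEk, -⟩ := mem_filter.1 hE
  have hsub : (nonpos G).filter (fun C => g C = E) ⊆
      (G.filter fun C => E ⊆ C ∧ ∀ l ∈ C \ E, l.2 = false) ∪
      (nonpos G).filter (fun C => ∃ v, signVars false C = {v} ∧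
        E = insert (v, false) (posClause ((signVars true C).erase (f v (signVars true C))))) := by
    intro C hC'
    obtain ⟨hC, rfl⟩ := mem_filter.1 hC'
    obtain ⟨h1, h2, h3 | h3⟩ := hg C hC
    · exact mem_union_left _ (mem_filter.2 ⟨(mem_nonpos.1 hC).1, h2, h3⟩)
    · exact mem_union_right _ (mem_filter.2 ⟨hC, h3⟩)
  have hB : (((nonpos G).filter (fun C => ∃ v, signVars false C = {v} ∧
        E = insert (v, false) (posClause ((signVars true C).erase (f v (signVars true C)))))).card
          : ℝ) ≤ δ * (Fintype.card V : ℝ) ^ (k - E.card) := by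
    obtain ⟨X, hX⟩ : ∃ X, X = ((nonpos G).filter (fun C => ∃ v, signVars false C = {v} ∧
        E = insert (v, false) (posClause ((signVars true C).erase (f v (signVars true C)))))) :=
      ⟨_, rfl⟩
    rw [← hX]
    rcases X.eq_empty_or_nonempty with h0 | ⟨C₀, hC₀⟩
    · rw [h0, card_empty, Nat.cast_zero]; positivity
    rw [hX] at hC₀
    obtain ⟨hC₀G, v, hv, hEv⟩ := mem_filter.1 hC₀
    have hmemlink : ∀ C ∈ nonpos G, signVars false C = {v} →
        C = insert (v, false) (posClause (signVars true C)) ∧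
          signVars true C ∈ link G v false := by
      intro C hC hvC
      have h1 := eq_insert_posClause hvC
      have hCG := (mem_nonpos.1 hC).1
      refine ⟨h1, mem_link.2 ⟨?_, h1 ▸ hCG⟩⟩
      have := disjoint_signVars (hG C hCG)
      rw [hvC] at this
      simpa using this
    have hEcard : E.card = k - 1 := by
      obtain ⟨-, h2⟩ := hmemlink C₀ hC₀G hv
      have h3 := card_of_mem_link hG h2
      have h4 := card_pos.2 ⟨_, hf1 v _ h2⟩
      rw [hEv, card_insert_of_notMem (by simp [mk_mem_posClause]), card_posClause,
        card_erase_of_mem (hf1 v _ h2)]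
      omega
    have hXd : X.card ≤ d := by
      refine le_trans ?_ (hf2 v (signVars true E))
      have hv' : ∀ C ∈ X, C ∈ nonpos G ∧ signVars false C = {v} ∧
          E = insert (v, false) (posClause ((signVars true C).erase (f v (signVars true C)))) := by
        intro C hC
        rw [hX] at hC
        obtain ⟨h1, u, hu, hEu⟩ := mem_filter.1 hC
        have : ({u} : Finset V) = {v} := by
          rw [← signVars_insert_posClause_false (v := u), ← hEu, hEv,
            signVars_insert_posClause_false]
        have huv := singleton_injective this
        subst huv
        exact ⟨h1, hu, hEu⟩
      refine card_le_card_of_injOn (fun C => signVars true C) ?_ ?_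
      · intro C hC
        obtain ⟨h1, h2, h3⟩ := hv' C hC
        refine mem_coe.2 (mem_filter.2 ⟨(hmemlink C h1 h2).2, ?_⟩)
        conv_rhs => rw [h3, signVars_insert_posClause_true]
      · intro C hC C' hC' h
        obtain ⟨h1, h2, h3⟩ := hv' C hC
        obtain ⟨h1', h2', h3'⟩ := hv' C' hC'
        rw [(hmemlink C h1 h2).1, (hmemlink C' h1' h2').1]
        exact congrArg (fun P => insert (v, false) (posClause P)) h
    rw [hEcard, show k - (k - 1) = 1 by omega, pow_one]
    exact (Nat.cast_le.2 hXd).trans hd1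
  have hA := hsp E hEk
  have hcard := (card_le_card hsub).trans (card_union_le _ _)
  have hcard' : (((nonpos G).filter fun C => g C = E).card : ℝ) ≤
      (G.filter fun C => E ⊆ C ∧ ∀ l ∈ C \ E, l.2 = false).card +
      ((nonpos G).filter (fun C => ∃ v, signVars false C = {v} ∧
        E = insert (v, false) (posClause ((signVars true C).erase
          (f v (signVars true C)))))).card := by
    exact_mod_cast hcard
  calc _ ≤ _ := hcard'
    _ ≤ _ := add_le_add (by convert hA) hB
    _ = _ := by ring

end Local

lemma exists_mul_pow_le_exp (A : ℝ) (p : ℕ) {a : ℝ} (ha : 0 < a) :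
    ∃ n₀ : ℕ, ∀ n : ℕ, n₀ ≤ n → A * (n : ℝ) ^ p ≤ Real.exp (a * n) := by
  have h1 := (isLittleO_pow_exp_pos_mul_atTop p ha).comp_tendsto tendsto_natCast_atTop_atTop
  have h2 := h1.def (c := 1 / (|A| + 1)) (by positivity)
  obtain ⟨n₀, hn₀⟩ := Filter.eventually_atTop.1 h2
  refine ⟨n₀, fun n hn => ?_⟩
  have h3 := hn₀ n hn
  simp only [Function.comp, norm_pow, Real.norm_eq_abs, Real.abs_exp, Nat.abs_cast] at h3
  rw [one_div, ← div_eq_inv_mul, le_div_iff₀ (by positivity)] at h3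
  have h4 : (0 : ℝ) ≤ (n : ℝ) ^ p := by positivity
  nlinarith [le_abs_self A]

section LocalCount

variable {V : Type} [Fintype V] [DecidableEq V]

lemma card_le_of_nonpos_edges {k : ℕ} (hk : 2 ≤ k) {c η ε : ℝ} (hc : 0 < c) (hη : 0 < η)
    (hε : ∀ {V : Type} [Fintype V] [DecidableEq V] (S : Finset (SatFormula V))
      (P : Finset (SatClause V)), (∀ X ∈ S, IsKFormula k X ∧ Assignable k ε P X) →
      (S.card : ℝ) ≤ Real.exp (η * ∑ E ∈ P, (Fintype.card V : ℝ) ^ (k - E.card)))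
    (S : Finset (SatFormula V)) (K : Finset (Finset (Finset V)))
    (hK : ∀ Φ ∈ K, Φ.Nonempty ∧ Φ.card ≤ k + 1 ∧ ∀ F ∈ Φ, F.card = k - 1)
    (hdis : ∀ Φ ∈ K, ∀ Ψ ∈ K, Φ ≠ Ψ → Disjoint Φ Ψ) (hN : 2 * ((k + 1) * k) ≤ Fintype.card V)
    (hS : ∀ G ∈ S, IsKFormula k G ∧ (∀ Φ ∈ K, Blocks Φ (edges G)) ∧
      Assignable k ε (heavy k c (K.biUnion id)) (nonpos G)) :
    (S.card : ℝ) ≤ 2 ^ (Fintype.card V).choose k *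
      Real.exp (-(((1 / 2) ^ (k + 1) / (2 * ((k + 1) * k)) - η * (4 ^ k / c * (k + 1))) *
        (K.card * Fintype.card V))) := by
  classical
  have h1 : S.card ≤ (S.image nonpos).card *
      (((univ : Finset V).powersetCard k).powerset.filter fun H =>
        ∀ Φ ∈ K, Blocks Φ H).card := by
    rw [← card_product]
    refine card_le_card_of_injOn (fun G => (nonpos G, edges G)) ?_ ?_
    · intro G hG
      obtain ⟨g1, g2, -⟩ := hS G hG
      exact mem_coe.2 (mem_product.2 ⟨mem_image_of_mem _ hG, mem_filter.2
        ⟨mem_powerset.2 (edges_subset g1), g2⟩⟩)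
    · intro G _ G' _ h
      exact eq_of_nonpos_edges (Prod.mk.inj h).1 (Prod.mk.inj h).2
  have h2 := hε (S.image nonpos) (heavy k c (K.biUnion id)) (by
    intro X hX
    obtain ⟨G, hG, rfl⟩ := mem_image.1 hX
    obtain ⟨g1, -, g3⟩ := hS G hG
    exact ⟨fun C hC => g1 C (mem_nonpos.1 hC).1, g3⟩)
  have hF : ∀ f ∈ K.biUnion id, f.card = k - 1 := by
    intro f hf
    obtain ⟨Φ, h1, h2⟩ := mem_biUnion.1 hf
    exact (hK Φ h1).2.2 f h2
  have h3 := sum_heavy_le hc hF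
  have h4 : ((K.biUnion id).card : ℝ) ≤ K.card * (k + 1) := by
    have : (K.biUnion id).card ≤ K.card * (k + 1) := by
      refine card_biUnion_le.trans ?_
      exact sum_le_card_nsmul _ _ _ fun Φ hΦ => (hK Φ hΦ).2.1
    exact_mod_cast this
  have h5 : ((S.image nonpos).card : ℝ) ≤
      Real.exp (η * (4 ^ k / c * (k + 1)) * (K.card * Fintype.card V)) := by
    refine h2.trans (Real.exp_le_exp.2 ?_)
    calc η * ∑ E ∈ heavy k c (K.biUnion id), (Fintype.card V : ℝ) ^ (k - E.card)
        ≤ η * (4 ^ k / c * ((K.biUnion id).card * Fintype.card V)) := by gcongr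
      _ ≤ η * (4 ^ k / c * ((K.card * (k + 1)) * Fintype.card V)) := by gcongr
      _ = _ := by ring
  have h6 := card_blocks_le hk K hK hdis hN
  have h7 : (S.card : ℝ) ≤ ((S.image nonpos).card : ℝ) *
      ((((univ : Finset V).powersetCard k).powerset.filter fun H =>
        ∀ Φ ∈ K, Blocks Φ H).card : ℝ) := by exact_mod_cast h1
  refine h7.trans ((mul_le_mul h5 h6 (by positivity) (by positivity)).trans (le_of_eq ?_))
  rw [mul_left_comm, ← Real.exp_add]
  congr 2
  ring

/-- Families of at most `k + 1` sets of size `k - 1`. -/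
def smallFamilies (V : Type) [Fintype V] [DecidableEq V] (k : ℕ) : Finset (Finset (Finset V)) :=
  (range (k + 2)).biUnion fun i => ((univ : Finset V).powersetCard (k - 1)).powersetCard i

lemma card_smallFamilies_le {k : ℕ} (hV : 2 ≤ Fintype.card V) :
    (smallFamilies V k).card ≤ (k + 2) * Fintype.card V ^ (k * (k + 1)) := by
  refine card_biUnion_le.trans ((sum_le_card_nsmul _ _ (Fintype.card V ^ (k * (k + 1)))
    fun i hi => ?_).trans (by rw [card_range, smul_eq_mul]))
  rw [card_powersetCard, card_powersetCard, card_univ]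
  calc ((Fintype.card V).choose (k - 1)).choose i ≤ ((Fintype.card V).choose (k - 1)) ^ i :=
        Nat.choose_le_pow _ _
    _ ≤ (Fintype.card V ^ k) ^ i := by
        refine Nat.pow_le_pow_left ((Nat.choose_le_pow _ _).trans ?_) _
        exact Nat.pow_le_pow_right (by omega) (by omega)
    _ ≤ (Fintype.card V ^ k) ^ (k + 1) := by
        refine Nat.pow_le_pow_right (Nat.pow_pos (by omega)) ?_
        have := mem_range.1 hi; omega
    _ = _ := (pow_mul _ _ _).symm

lemma exists_blocked_family {k : ℕ} (hk : 2 ≤ k) (hN : 4 * k ≤ Fintype.card V) {δ : ℝ}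
    (hδ : 0 < δ) {G : SatFormula V} (hG : IsKFormula k G) (hmin : MinimalFormula G)
    (hsp : NegSparse k δ G) (hlink : ∀ v, ((k - 1).factorial * (link G v false).card : ℝ) <
      (δ * Fintype.card V) ^ (k - 1)) (hneg : (nonpos G).Nonempty) :
    ∃ K ∈ (smallFamilies V k).powerset, K.Nonempty ∧
      (∀ Φ ∈ K, Φ.Nonempty ∧ Φ.card ≤ k + 1 ∧ ∀ F ∈ Φ, F.card = k - 1) ∧
      (∀ Φ ∈ K, ∀ Ψ ∈ K, Φ ≠ Ψ → Disjoint Φ Ψ) ∧ (∀ Φ ∈ K, Blocks Φ (edges G)) ∧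
      Assignable k (2 * δ) (heavy k (1 / (4 * k * 2 ^ k * k.factorial)) (K.biUnion id))
        (nonpos G) := by
  classical
  obtain ⟨K, hK1, hK2, hK3⟩ := exists_maximal_disjoint
    ((univ : Finset (Finset (Finset V))).filter fun Φ => IsGadget k G Φ) id
    fun Φ hΦ => (mem_filter.1 hΦ).2.nonempty
  have hgad : ∀ Φ ∈ K, IsGadget k G Φ := fun Φ hΦ => (mem_filter.1 (hK1 hΦ)).2
  have hF : ∀ f ∈ K.biUnion id, f.card = k - 1 := by
    intro f hf
    obtain ⟨Φ, h1, h2⟩ := mem_biUnion.1 hf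
    exact (hgad Φ h1).card_mem hk f h2
  have hass := assignable_nonpos hk hN hδ hG hsp hlink hF (by
    intro Φ hΦ
    obtain ⟨Ψ, h1, h2⟩ := hK3 Φ (mem_filter.2 ⟨mem_univ _, hΦ⟩)
    obtain ⟨f, h3, h4⟩ := not_disjoint_iff.1 h2
    exact ⟨f, h3, mem_biUnion.2 ⟨Ψ, h1, h4⟩⟩)
  refine ⟨K, ?_, ?_, ?_, hK2, fun Φ hΦ => (hgad Φ hΦ).blocks hmin, hass⟩
  · refine mem_powerset.2 fun Φ hΦ => mem_biUnion.2 ⟨Φ.card, mem_range.2 ?_,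
      mem_powersetCard.2 ⟨fun f hf => ?_, rfl⟩⟩
    · have := (hgad Φ hΦ).card_le hG; omega
    · exact mem_powersetCard.2 ⟨subset_univ _, (hgad Φ hΦ).card_mem hk f hf⟩
  · obtain ⟨C, hC⟩ := hneg
    obtain ⟨g, hg, -⟩ := hass
    obtain ⟨-, -, h⟩ := mem_filter.1 (hg C hC).1
    by_contra hempty
    rw [not_nonempty_iff_eq_empty.1 hempty] at h
    have hkR : (0 : ℝ) < k := by exact_mod_cast (by omega : 0 < k)
    have hNR : (0 : ℝ) < Fintype.card V := by exact_mod_cast (by omega : 0 < Fintype.card V)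
    have hfac : (0 : ℝ) < k.factorial := by exact_mod_cast Nat.factorial_pos k
    have : 0 < 1 / (4 * k * 2 ^ k * k.factorial) *
      (Fintype.card V : ℝ) ^ (k - 1 - (g C).card) := by positivity
    simp at h
    simp at this
    linarith
  · exact fun Φ hΦ => ⟨(hgad Φ hΦ).nonempty, (hgad Φ hΦ).card_le hG, (hgad Φ hΦ).card_mem hk⟩

end LocalCount

lemma one_add_pow_sub_one_le {x : ℝ} (hx : 0 ≤ x) {m : ℕ} (h : m * x ≤ 1) :
    (1 + x) ^ m - 1 ≤ 2 * (m * x) := by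
  have h1 : (1 + x) ^ m ≤ Real.exp (m * x) := by
    rw [Real.exp_nat_mul]
    refine pow_le_pow_left₀ (by linarith) ?_ _
    linarith [Real.add_one_le_exp x]
  have h0 : 0 ≤ m * x := by positivity
  have h2 := Real.abs_exp_sub_one_le (x := m * x) (by rwa [abs_of_nonneg h0])
  rw [abs_of_nonneg h0] at h2
  linarith [le_abs_self (Real.exp (m * x) - 1)]

lemma sum_nonempty_subsets_le {α : Type*} [DecidableEq α] (Γ : Finset α) {x : ℝ} (hx : 0 ≤ x)
    (h : Γ.card * x ≤ 1) :
    ∑ K ∈ Γ.powerset.filter (fun K => K.Nonempty), x ^ K.card ≤ 2 * (Γ.card * x) := by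
  have h1 := Finset.sum_pow_mul_eq_add_pow x 1 Γ
  simp only [one_pow, mul_one] at h1
  have h2 : Γ.powerset = insert ∅ (Γ.powerset.filter (fun K => K.Nonempty)) := by
    ext K
    rcases K.eq_empty_or_nonempty with rfl | hK
    · simp
    · simp [hK, hK.ne_empty]
  rw [h2, sum_insert (by simp), card_empty, pow_zero, add_comm x 1] at h1
  linarith [one_add_pow_sub_one_le hx h]

/-- Formulas all of whose links of negative literals are sparse are rarely nonpositive. -/
lemma local_count (k : ℕ) (hk : 2 ≤ k) : ∃ δ > 0, ∃ ξ > 0, ∃ c > 0, ∃ n₀ : ℕ,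
    ∀ {V : Type} [Fintype V] [DecidableEq V] (S : Finset (SatFormula V)), n₀ ≤ Fintype.card V →
      (∀ G ∈ S, IsKFormula k G ∧ MinimalFormula G ∧ NegSparse k δ G ∧
        (∀ v, ((link G v false).card : ℝ) ≤ ξ * (Fintype.card V : ℝ) ^ (k - 1)) ∧
        (nonpos G).Nonempty) →
      (S.card : ℝ) ≤ 2 ^ (Fintype.card V).choose k * Real.exp (-(c * Fintype.card V)) := by
  classical
  have hkR : (0 : ℝ) < k := by exact_mod_cast (by omega : 0 < k)
  have hfac : (0 : ℝ) < k.factorial := by exact_mod_cast Nat.factorial_pos k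
  have hfac' : (0 : ℝ) < (k - 1).factorial := by exact_mod_cast Nat.factorial_pos (k - 1)
  obtain ⟨c₁, hc₁⟩ : ∃ c₁ : ℝ, c₁ = (1 / 2) ^ (k + 1) / (2 * ((k + 1) * k)) := ⟨_, rfl⟩
  have hc₁0 : 0 < c₁ := by rw [hc₁]; positivity
  obtain ⟨c₀, hc₀⟩ : ∃ c₀ : ℝ, c₀ = 1 / (4 * k * 2 ^ k * k.factorial) := ⟨_, rfl⟩
  have hc₀0 : 0 < c₀ := by rw [hc₀]; positivity
  obtain ⟨η, hη⟩ : ∃ η : ℝ, η = c₁ / 2 / (4 ^ k / c₀ * (k + 1)) := ⟨_, rfl⟩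
  have hη0 : 0 < η := by rw [hη]; positivity
  have hηc : η * (4 ^ k / c₀ * (k + 1)) = c₁ / 2 := by
    rw [hη]; field_simp
  obtain ⟨ε, hε0, hε⟩ := card_assignable_le k hη0
  obtain ⟨n₁, hn₁⟩ := exists_mul_pow_le_exp (2 * (k + 2)) (k * (k + 1))
    (a := c₁ / 4) (by positivity)
  refine ⟨ε / 2, by positivity, (ε / 2) ^ (k - 1) / (2 * (k - 1).factorial), by positivity,
    c₁ / 4, by positivity, n₁ + 2 * ((k + 1) * k) + 4 * k, ?_⟩
  intro V _ _ S hV hS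
  obtain ⟨N, hN⟩ : ∃ N, N = Fintype.card V := ⟨_, rfl⟩
  have hNpos : 0 < N := by omega
  have hNR : (0 : ℝ) < N := by exact_mod_cast hNpos
  have hex : ∀ G, ∃ K, G ∈ S → K ∈ (smallFamilies V k).powerset ∧ K.Nonempty ∧
      (∀ Φ ∈ K, Φ.Nonempty ∧ Φ.card ≤ k + 1 ∧ ∀ F ∈ Φ, F.card = k - 1) ∧
      (∀ Φ ∈ K, ∀ Ψ ∈ K, Φ ≠ Ψ → Disjoint Φ Ψ) ∧ (∀ Φ ∈ K, Blocks Φ (edges G)) ∧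
      Assignable k ε (heavy k c₀ (K.biUnion id)) (nonpos G) := by
    intro G
    by_cases hG : G ∈ S
    swap
    · exact ⟨∅, fun h => absurd h hG⟩
    obtain ⟨h1, h2, h3, h4, h5⟩ := hS G hG
    have hlink : ∀ v, ((k - 1).factorial * (link G v false).card : ℝ) <
        (ε / 2 * Fintype.card V) ^ (k - 1) := by
      intro v
      have h6 := h4 v
      rw [← hN] at h6 ⊢
      rw [mul_pow]
      have h7 : 0 < (ε / 2) ^ (k - 1) * (N : ℝ) ^ (k - 1) := by positivity
      calc ((k - 1).factorial * (link G v false).card : ℝ)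
          ≤ (k - 1).factorial * ((ε / 2) ^ (k - 1) / (2 * (k - 1).factorial) *
            (N : ℝ) ^ (k - 1)) := by gcongr
        _ = (ε / 2) ^ (k - 1) * (N : ℝ) ^ (k - 1) / 2 := by field_simp
        _ < _ := by linarith
    obtain ⟨K, hK, hK'⟩ := exists_blocked_family hk (by omega) (δ := ε / 2) (by positivity)
      h1 h2 h3 hlink h5
    rw [show 2 * (ε / 2) = ε by ring, ← hc₀] at hK'
    exact ⟨K, fun _ => ⟨hK, hK'⟩⟩
  choose K hK using hex
  obtain ⟨Γ, hΓ⟩ : ∃ Γ, Γ = smallFamilies V k := ⟨_, rfl⟩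
  obtain ⟨x, hx⟩ : ∃ x : ℝ, x = Real.exp (-(c₁ / 2 * N)) := ⟨_, rfl⟩
  have hx0 : 0 ≤ x := by rw [hx]; positivity
  have hfib : ∀ J ∈ Γ.powerset.filter (fun J => J.Nonempty),
      ((S.filter fun G => K G = J).card : ℝ) ≤ 2 ^ N.choose k * x ^ J.card := by
    intro J _
    rcases (S.filter fun G => K G = J).eq_empty_or_nonempty with h0 | ⟨G₀, hG₀⟩
    · rw [h0, card_empty, Nat.cast_zero]; positivity
    obtain ⟨hG₀S, rfl⟩ := mem_filter.1 hG₀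
    obtain ⟨-, -, g1, g2, -⟩ := hK G₀ hG₀S
    have := card_le_of_nonpos_edges hk hc₀0 hη0 hε (S.filter fun G => K G = K G₀) (K G₀) g1 g2
      (by omega) (fun G hG => by
        obtain ⟨hGS, hGK⟩ := mem_filter.1 hG
        obtain ⟨-, -, -, -, g3, g4⟩ := hK G hGS
        exact ⟨(hS G hGS).1, hGK ▸ g3, hGK ▸ g4⟩)
    rw [hηc, ← hc₁, ← hN] at this
    refine this.trans (le_of_eq ?_)
    rw [hx, ← Real.exp_nat_mul]
    congr 2
    ring
  have hcard : (S.card : ℝ) ≤ ∑ J ∈ Γ.powerset.filter (fun J => J.Nonempty),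
      2 ^ N.choose k * x ^ J.card := by
    have h1 := card_eq_sum_card_fiberwise (s := S)
      (t := Γ.powerset.filter (fun J => J.Nonempty)) (f := K) (fun G hG => by
        obtain ⟨g1, g2, -⟩ := hK G hG
        exact mem_coe.2 (mem_filter.2 ⟨hΓ ▸ g1, g2⟩))
    rw [h1]
    push_cast
    exact sum_le_sum hfib
  rw [← mul_sum] at hcard
  have hM : 2 * (Γ.card * x) ≤ Real.exp (-(c₁ / 4 * N)) := by
    have h1 : (Γ.card : ℝ) ≤ (k + 2) * (N : ℝ) ^ (k * (k + 1)) := by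
      have := card_smallFamilies_le (V := V) (k := k) (by omega)
      rw [← hΓ, ← hN] at this
      exact_mod_cast this
    have h2 := hn₁ N (by omega)
    calc 2 * (Γ.card * x) ≤ 2 * (((k + 2) * (N : ℝ) ^ (k * (k + 1))) * x) := by gcongr
      _ = 2 * (k + 2) * (N : ℝ) ^ (k * (k + 1)) * x := by ring
      _ ≤ Real.exp (c₁ / 4 * N) * x := by gcongr
      _ = _ := by rw [hx, ← Real.exp_add]; congr 1; ring
  have hexp1 : Real.exp (-(c₁ / 4 * N)) ≤ 1 := Real.exp_le_one_iff.2 (by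
    have : 0 ≤ c₁ / 4 * N := by positivity
    linarith)
  rw [← hN]
  refine hcard.trans (mul_le_mul_of_nonneg_left ?_ (by positivity))
  refine (sum_nonempty_subsets_le Γ hx0 ?_).trans hM
  have : 0 ≤ Γ.card * x := by positivity
  linarith

lemma card_almost_disjoint_le {β : Type*} [DecidableEq β] {U W : Finset β} (hW : W ⊆ U) :
    (U.powerset.filter fun H => (H ∩ W).card ≤ 1).card ≤
      (1 + W.card) * 2 ^ (U.card - W.card) := by
  have h1 : (W.powerset.filter fun A => A.card ≤ 1).card ≤ 1 + W.card := by
    have : (W.powerset.filter fun A => A.card ≤ 1) ⊆ insert ∅ (W.image fun w => {w}) := by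
      intro A hA
      obtain ⟨h1, h2⟩ := mem_filter.1 hA
      rcases Nat.lt_or_ge A.card 1 with h | h
      · rw [card_eq_zero.1 (by omega : A.card = 0)]; exact mem_insert_self _ _
      · obtain ⟨w, rfl⟩ := card_eq_one.1 (le_antisymm h2 h)
        exact mem_insert_of_mem (mem_image_of_mem _ (mem_powerset.1 h1 (mem_singleton_self w)))
    have h2 := (card_le_card this).trans (card_insert_le _ _)
    have h3 := card_image_le (s := W) (f := fun w => ({w} : Finset β))
    omega
  have h2 : (U.powerset.filter fun H => (H ∩ W).card ≤ 1).card ≤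
      ((W.powerset.filter fun A => A.card ≤ 1) ×ˢ (U \ W).powerset).card := by
    refine card_le_card_of_injOn (fun H => (H ∩ W, H \ W)) ?_ ?_
    · intro H hH
      obtain ⟨h1, h2⟩ := mem_filter.1 (mem_coe.1 hH)
      exact mem_coe.2 (mem_product.2 ⟨mem_filter.2 ⟨mem_powerset.2 inter_subset_right, h2⟩,
        mem_powerset.2 (sdiff_subset_sdiff (mem_powerset.1 h1) subset_rfl)⟩)
    · intro H _ H' _ h
      obtain ⟨h1, h2⟩ := Prod.mk.inj h
      rw [← sdiff_union_inter H W, ← sdiff_union_inter H' W, h1, h2]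
  rw [card_product, card_powerset, card_sdiff_of_subset hW] at h2
  exact h2.trans (Nat.mul_le_mul_right _ h1)

lemma two_pow_sub_le {u w : ℕ} {y : ℝ} (h : w ≤ u) (hy : y ≤ w) :
    (2 : ℝ) ^ (u - w) ≤ 2 ^ u * Real.exp (-(y * Real.log 2)) := by
  have h1 : (2 : ℝ) ^ (u - w) = 2 ^ u * Real.exp (-(w * Real.log 2)) := by
    have h2 : Real.exp (w * Real.log 2) = 2 ^ w := by
      rw [Real.exp_nat_mul, Real.exp_log (by norm_num)]
    rw [Real.exp_neg, h2, pow_sub₀ _ (by norm_num) h]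
  rw [h1]
  have := Real.log_pos (by norm_num : (1 : ℝ) < 2)
  gcongr

lemma pow_le_mul_choose {k m : ℕ} (hm : 2 * k ≤ m) :
    (m : ℝ) ^ k ≤ 2 ^ k * k.factorial * (m.choose k : ℝ) := by
  have h1 := Nat.pow_le_choose (α := ℝ) k m
  rw [div_le_iff₀ (by exact_mod_cast Nat.factorial_pos k)] at h1
  have h2 : ((m : ℝ) / 2) ^ k ≤ ((m + 1 - k : ℕ) : ℝ) ^ k := by
    refine pow_le_pow_left₀ (by positivity) ?_ _
    have : m ≤ (m + 1 - k) * 2 := by omega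
    rw [div_le_iff₀ (by norm_num)]
    exact_mod_cast this
  have h3 := h2.trans h1
  rw [div_pow, div_le_iff₀ (by positivity)] at h3
  linarith

section Dense

variable {V : Type} [Fintype V] [DecidableEq V]

/-- Every set of at least `δ n` vertices contains two edges. -/
def DenseEdges (δ : ℝ) (G : SatFormula V) : Prop :=
  ∀ X : Finset V, δ * Fintype.card V ≤ X.card → 2 ≤ ((edges G).filter fun e => e ⊆ X).card

lemma card_le_exp_mul_edges {k : ℕ} {ζ η : ℝ}
    (hζ : ∀ (V : Type) [DecidableEq V] (A : Finset (SatClause V)) (N : ℝ)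
      (S : Finset (SatFormula V)), 0 ≤ N → (A.card : ℝ) ≤ 2 ^ k * N →
      (∀ B ∈ S, B ⊆ A ∧ (B.card : ℝ) ≤ ζ * N) → (S.card : ℝ) ≤ Real.exp (η * N))
    (S : Finset (SatFormula V)) (T : Finset (Finset (Finset V)))
    (hS : ∀ G ∈ S, IsKFormula k G ∧ ((nonpos G).card : ℝ) ≤ ζ * (Fintype.card V : ℝ) ^ k ∧
      edges G ∈ T) :
    (S.card : ℝ) ≤ Real.exp (η * (Fintype.card V : ℝ) ^ k) * T.card := by
  classical
  have h1 : S.card ≤ (S.image nonpos).card * T.card := by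
    rw [← card_product]
    refine card_le_card_of_injOn (fun G => (nonpos G, edges G)) ?_ ?_
    · intro G hG
      exact mem_coe.2 (mem_product.2 ⟨mem_image_of_mem _ hG, (hS G hG).2.2⟩)
    · intro G _ G' _ h
      exact eq_of_nonpos_edges (Prod.mk.inj h).1 (Prod.mk.inj h).2
  have h2 := hζ V (kClauses V k) ((Fintype.card V : ℝ) ^ k) (S.image nonpos) (by positivity) (by
      rw [← mul_pow]; exact_mod_cast card_kClauses_le k) (by
      intro X hX
      obtain ⟨G, hG, rfl⟩ := mem_image.1 hX
      obtain ⟨g1, g2, -⟩ := hS G hG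
      exact ⟨fun C hC => mem_kClauses.2 (g1 C (mem_nonpos.1 hC).1), g2⟩)
  calc (S.card : ℝ) ≤ (S.image nonpos).card * T.card := by exact_mod_cast h1
    _ ≤ _ := by gcongr

lemma card_not_denseEdges_le {k : ℕ} {δ : ℝ} (hδ : 0 < δ) (hN : 2 * k ≤ δ * Fintype.card V) :
    (((((univ : Finset V).powersetCard k).powerset).filter fun H =>
      ∃ X : Finset V, δ * Fintype.card V ≤ X.card ∧ (H.filter fun e => e ⊆ X).card ≤ 1).card : ℝ) ≤
      2 ^ Fintype.card V * ((1 + (Fintype.card V : ℝ) ^ k) * (2 ^ (Fintype.card V).choose k *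
        Real.exp (-(δ ^ k / (2 ^ k * k.factorial) * (Fintype.card V : ℝ) ^ k * Real.log 2)))) := by
  classical
  obtain ⟨U, hU⟩ : ∃ U, U = (univ : Finset V).powersetCard k := ⟨_, rfl⟩
  have hUc : U.card = (Fintype.card V).choose k := by rw [hU, card_powersetCard, card_univ]
  rw [← hU]
  have hsub : (U.powerset.filter fun H =>
      ∃ X : Finset V, δ * Fintype.card V ≤ X.card ∧ (H.filter fun e => e ⊆ X).card ≤ 1) ⊆
      ((univ : Finset (Finset V)).filter fun X => δ * Fintype.card V ≤ X.card).biUnion fun X =>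
        U.powerset.filter fun H => (H ∩ X.powersetCard k).card ≤ 1 := by
    intro H hH
    obtain ⟨h1, X, h2, h3⟩ := mem_filter.1 hH
    refine mem_biUnion.2 ⟨X, mem_filter.2 ⟨mem_univ _, h2⟩, mem_filter.2 ⟨h1, ?_⟩⟩
    refine (card_le_card fun e he => ?_).trans h3
    obtain ⟨h4, h5⟩ := mem_inter.1 he
    exact mem_filter.2 ⟨h4, (mem_powersetCard.1 h5).1⟩
  have hone : ∀ X ∈ ((univ : Finset (Finset V)).filter fun X => δ * Fintype.card V ≤ X.card),
      ((U.powerset.filter fun H => (H ∩ X.powersetCard k).card ≤ 1).card : ℝ) ≤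
      (1 + (Fintype.card V : ℝ) ^ k) * (2 ^ (Fintype.card V).choose k *
        Real.exp (-(δ ^ k / (2 ^ k * k.factorial) * (Fintype.card V : ℝ) ^ k * Real.log 2))) := by
    intro X hX
    have hX := (mem_filter.1 hX).2
    have hWU : X.powersetCard k ⊆ U := by
      rw [hU]; exact powersetCard_mono (subset_univ _)
    have h1 := card_almost_disjoint_le hWU
    have hfac : (0 : ℝ) < k.factorial := by exact_mod_cast Nat.factorial_pos k
    have h2 : δ ^ k / (2 ^ k * k.factorial) * (Fintype.card V : ℝ) ^ k ≤
        (X.powersetCard k).card := by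
      rw [card_powersetCard, div_mul_eq_mul_div, div_le_iff₀ (by positivity), ← mul_pow]
      have h3 : 2 * k ≤ X.card := by exact_mod_cast hN.trans hX
      have h4 := pow_le_mul_choose h3
      calc (δ * Fintype.card V) ^ k ≤ (X.card : ℝ) ^ k := by gcongr
        _ ≤ _ := by linarith
    have h3 := two_pow_sub_le (card_le_card hWU) h2
    rw [hUc] at h3
    have h4 : ((X.powersetCard k).card : ℝ) ≤ (Fintype.card V : ℝ) ^ k := by
      have := (card_le_card hWU).trans (hUc.le.trans (Nat.choose_le_pow _ _))
      exact_mod_cast this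
    have h5 : ((U.powerset.filter fun H => (H ∩ X.powersetCard k).card ≤ 1).card : ℝ) ≤
        (1 + (X.powersetCard k).card) * 2 ^ (U.card - (X.powersetCard k).card) := by
      exact_mod_cast h1
    rw [hUc] at h5
    refine h5.trans ?_
    gcongr
  calc _ ≤ ((∑ X ∈ ((univ : Finset (Finset V)).filter fun X => δ * Fintype.card V ≤ X.card),
        (U.powerset.filter fun H => (H ∩ X.powersetCard k).card ≤ 1).card : ℕ) : ℝ) :=
        Nat.cast_le.2 ((card_le_card hsub).trans card_biUnion_le)
    _ ≤ ∑ X ∈ ((univ : Finset (Finset V)).filter fun X => δ * Fintype.card V ≤ X.card), _ := by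
        push_cast; exact sum_le_sum hone
    _ = _ * _ := by rw [sum_const, nsmul_eq_mul]
    _ ≤ _ := by
        gcongr
        have := (card_filter_le (univ : Finset (Finset V))
          fun X => δ * Fintype.card V ≤ X.card).trans
          (by rw [card_univ, Fintype.card_finset])
        exact_mod_cast this

end Dense

lemma exists_small_exp (k : ℕ) {η : ℝ} (hη : 0 < η) : ∃ ζ > 0, ∀ ζ' ≤ ζ,
    ∀ (V : Type) [DecidableEq V] (A : Finset (SatClause V)) (N : ℝ)
      (S : Finset (SatFormula V)), 0 ≤ N → (A.card : ℝ) ≤ 2 ^ k * N →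
      (∀ B ∈ S, B ⊆ A ∧ (B.card : ℝ) ≤ ζ' * N) → (S.card : ℝ) ≤ Real.exp (η * N) := by
  obtain ⟨ζ, hζ, h⟩ := exists_card_small_subsets_le.{0} (2 ^ k) hη
  refine ⟨ζ, hζ, fun ζ' hζ' V _ A N S h0 hA hS => h _ A N S h0 hA fun B hB => ?_⟩
  exact ⟨(hS B hB).1, (hS B hB).2.trans (by gcongr)⟩

/-- Most formulas with few nonpositive clauses have `DenseEdges`. -/
lemma dense_count (k : ℕ) (hk : 2 ≤ k) {δ : ℝ} (hδ : 0 < δ) : ∃ ζ > 0, ∀ ζ' ≤ ζ, ∃ n₀ : ℕ,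
    ∀ {V : Type} [Fintype V] [DecidableEq V] (S : Finset (SatFormula V)), n₀ ≤ Fintype.card V →
      (∀ G ∈ S, IsKFormula k G ∧ ((nonpos G).card : ℝ) ≤ ζ' * (Fintype.card V : ℝ) ^ k ∧
        ¬ DenseEdges δ G) →
      (S.card : ℝ) ≤ 2 ^ (Fintype.card V).choose k * Real.exp (-(Fintype.card V)) := by
  classical
  have hfac : (0 : ℝ) < k.factorial := by exact_mod_cast Nat.factorial_pos k
  have hlog := Real.log_pos (by norm_num : (1 : ℝ) < 2)
  obtain ⟨a, ha⟩ : ∃ a : ℝ, a = δ ^ k / (2 ^ k * k.factorial) * Real.log 2 / 2 := ⟨_, rfl⟩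
  have ha0 : 0 < a := by rw [ha]; positivity
  obtain ⟨ζ, hζ, hsmall⟩ := exists_small_exp k ha0
  refine ⟨ζ, hζ, fun ζ' hζ' => ?_⟩
  obtain ⟨n₁, hn₁⟩ := exists_mul_pow_le_exp 2 k (a := 1) one_pos
  obtain ⟨n₂, hn₂⟩ := exists_nat_ge (2 * k / δ)
  obtain ⟨n₃, hn₃⟩ := exists_nat_ge (3 / a)
  refine ⟨n₁ + n₂ + n₃ + 1, ?_⟩
  intro V _ _ S hV hS
  obtain ⟨N, hN⟩ : ∃ N, N = Fintype.card V := ⟨_, rfl⟩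
  rw [← hN] at hV
  have hN1 : (1 : ℝ) ≤ N := by exact_mod_cast (by omega : 1 ≤ N)
  have h2k : 2 * k ≤ δ * (Fintype.card V : ℝ) := by
    rw [← hN]
    have : (n₂ : ℝ) ≤ N := by exact_mod_cast (by omega : n₂ ≤ N)
    have := hn₂.trans this
    rw [div_le_iff₀ hδ] at this
    linarith
  have h1 := card_le_exp_mul_edges (hsmall ζ' hζ') S
    ((((univ : Finset V).powersetCard k).powerset).filter fun H =>
      ∃ X : Finset V, δ * Fintype.card V ≤ X.card ∧ (H.filter fun e => e ⊆ X).card ≤ 1) (by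
    intro G hG
    obtain ⟨g1, g2, g3⟩ := hS G hG
    refine ⟨g1, g2, mem_filter.2 ⟨mem_powerset.2 (edges_subset g1), ?_⟩⟩
    unfold DenseEdges at g3
    push Not at g3
    obtain ⟨X, hX, hX'⟩ := g3
    exact ⟨X, hX, by convert (by omega : ((edges G).filter fun e => e ⊆ X).card ≤ 1)⟩)
  have h2 := card_not_denseEdges_le (V := V) (k := k) hδ h2k
  rw [← hN] at h1 h2 ⊢
  have h3 : (2 : ℝ) ^ N ≤ Real.exp N := by
    have := Real.add_one_le_exp 1
    rw [← mul_one (N : ℝ), Real.exp_nat_mul]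
    gcongr
    linarith
  have h4 : 1 + (N : ℝ) ^ k ≤ Real.exp N := by
    have := hn₁ N (by omega)
    rw [one_mul] at this
    have := one_le_pow₀ (n := k) hN1
    linarith
  have h5 : 3 * (N : ℝ) ≤ a * N ^ k := by
    have h6 : (n₃ : ℝ) ≤ N := by exact_mod_cast (by omega : n₃ ≤ N)
    have h7 := hn₃.trans h6
    rw [div_le_iff₀ ha0] at h7
    calc 3 * (N : ℝ) ≤ (N * a) * N := by gcongr
      _ = a * N ^ 2 := by ring
      _ ≤ a * N ^ k := by gcongr
  refine h1.trans ((mul_le_mul_of_nonneg_left h2 (Real.exp_pos _).le).trans ?_)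
  calc Real.exp (a * N ^ k) * (2 ^ N * ((1 + (N : ℝ) ^ k) * (2 ^ N.choose k *
        Real.exp (-(δ ^ k / (2 ^ k * k.factorial) * (N : ℝ) ^ k * Real.log 2)))))
      ≤ Real.exp (a * N ^ k) * (Real.exp N * (Real.exp N * (2 ^ N.choose k *
        Real.exp (-(δ ^ k / (2 ^ k * k.factorial) * (N : ℝ) ^ k * Real.log 2))))) := by gcongr
    _ = 2 ^ N.choose k * Real.exp (2 * N - a * N ^ k) := by
        have : δ ^ k / (2 ^ k * k.factorial) * (N : ℝ) ^ k * Real.log 2 = 2 * a * N ^ k := by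
          rw [ha]; ring
        rw [this, show 2 * (N : ℝ) - a * N ^ k = a * N ^ k + (N + (N + -(2 * a * N ^ k))) by ring,
          Real.exp_add, Real.exp_add, Real.exp_add]
        ring
    _ ≤ _ := by
        gcongr
        linarith

section Sparse

variable {V : Type} [Fintype V] [DecidableEq V]

lemma negSparse_of_denseEdges {k : ℕ} {δ : ℝ} (hδ : 0 < δ) (hN : 1 ≤ δ * Fintype.card V)
    {G : SatFormula V} (hG : IsKFormula k G) (hmin : MinimalFormula G) (hd : DenseEdges δ G) :
    NegSparse k (2 * δ) G := by
  classical
  intro E hE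
  obtain ⟨S, hS⟩ : ∃ S, S = G.filter fun C => E ⊆ C ∧ ∀ l ∈ C \ E, l.2 = false := ⟨_, rfl⟩
  suffices h : (S.card : ℝ) ≤ 2 * δ * (Fintype.card V : ℝ) ^ (k - E.card) by
    rw [hS] at h; convert h
  have hN0 : (0 : ℝ) < Fintype.card V := by
    by_contra! h
    nlinarith
  have hN1 : (1 : ℝ) ≤ Fintype.card V := by exact_mod_cast (by exact_mod_cast hN0 : 0 < Fintype.card V)
  rcases S.eq_empty_or_nonempty with h0 | ⟨C₀, hC₀⟩
  · rw [h0, card_empty, Nat.cast_zero]; positivity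
  have hmem : ∀ C ∈ S, C ∈ G ∧ E ⊆ C ∧ ∀ l ∈ C \ E, l.2 = false := fun C hC => by
    rw [hS] at hC; exact mem_filter.1 hC
  obtain ⟨hC₀G, hEC₀, -⟩ := hmem C₀ hC₀
  obtain ⟨w, hw, hw'⟩ := hmin C₀ hC₀G
  obtain ⟨X, hX⟩ : ∃ X : Finset V, X = univ.filter fun v => w v = true := ⟨_, rfl⟩
  have hXδ : (X.card : ℝ) < δ * Fintype.card V := by
    by_contra! h
    have h2 := hd X h
    have h3 : ((edges G).filter fun e => e ⊆ X).card ≤ 1 := by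
      have hsat : ∀ e ∈ (edges G).filter fun e => e ⊆ X, posClause e = C₀ := by
        intro e he
        obtain ⟨h1, h2⟩ := mem_filter.1 he
        refine hw' _ (mem_edges.1 h1) (satisfies_posClause.2 fun v hv => ?_)
        have := h2 hv
        rw [hX] at this
        exact (mem_filter.1 this).2
      refine card_le_one.2 fun e he f hf => posClause_injective ?_
      rw [hsat e he, hsat f hf]
    omega
  have hinj : (S.erase C₀).card ≤
      (X ×ˢ (univ : Finset V).powersetCard (k - E.card - 1)).card := by
    have hex : ∀ C, ∃ v, C ∈ S.erase C₀ → v ∈ X ∧ (v, false) ∈ C \ E := by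
      intro C
      by_cases hC : C ∈ S.erase C₀
      swap
      · rcases S.eq_empty_or_nonempty with h | _
        · rw [h] at hC₀; simp at hC₀
        · have : Nonempty V := Fintype.card_pos_iff.1 (by exact_mod_cast hN0)
          exact ⟨Classical.arbitrary V, fun h => absurd h hC⟩
      obtain ⟨hne, hC'⟩ := mem_erase.1 hC
      obtain ⟨g1, g2, g3⟩ := hmem C hC'
      have hns : ¬ SatisfiesClause w C := fun h => hne (hw' C g1 h)
      unfold SatisfiesClause at hns
      push Not at hns
      obtain ⟨⟨v, b⟩, hl, hl'⟩ := hns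
      have hlE : (v, b) ∉ E := fun h => hl' (hw _ (hEC₀ h))
      have hb := g3 _ (mem_sdiff.2 ⟨hl, hlE⟩)
      simp only at hb
      subst hb
      refine ⟨v, fun _ => ⟨?_, mem_sdiff.2 ⟨hl, hlE⟩⟩⟩
      rw [hX]
      exact mem_filter.2 ⟨mem_univ _, by simpa using hl'⟩
    choose f hf using hex
    have hrec : ∀ C ∈ S.erase C₀,
        C = E ∪ (insert (f C) ((signVars false (C \ E)).erase (f C))).image fun v => (v, false) := by
      intro C hC
      obtain ⟨h1, h2⟩ := hf C hC
      obtain ⟨g1, g2, g3⟩ := hmem C (mem_of_mem_erase hC)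
      rw [insert_erase (mem_signVars.2 h2)]
      ext ⟨v, b⟩
      constructor
      · intro hv
        by_cases hvE : (v, b) ∈ E
        · exact mem_union_left _ hvE
        · have hb := g3 _ (mem_sdiff.2 ⟨hv, hvE⟩)
          simp only at hb
          subst hb
          exact mem_union_right _ (mem_image.2 ⟨v, mem_signVars.2 (mem_sdiff.2 ⟨hv, hvE⟩), rfl⟩)
      · intro hv
        rcases mem_union.1 hv with h | h
        · exact g2 h
        · obtain ⟨u, hu, h⟩ := mem_image.1 h
          rw [← h]
          exact (mem_sdiff.1 (mem_signVars.1 hu)).1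
    refine card_le_card_of_injOn (fun C => (f C, (signVars false (C \ E)).erase (f C))) ?_ ?_
    · intro C hC
      have hC := mem_coe.1 hC
      obtain ⟨h1, h2⟩ := hf C hC
      obtain ⟨g1, g2, g3⟩ := hmem C (mem_of_mem_erase hC)
      refine mem_coe.2 (mem_product.2 ⟨h1, mem_powersetCard.2 ⟨subset_univ _, ?_⟩⟩)
      have h3 : (signVars false (C \ E)).card = k - E.card := by
        rw [signVars, card_image_of_injOn, filter_true_of_mem g3, card_sdiff_of_subset g2,
          (hG C g1).1]
        intro l hl l' hl' h
        have e1 := (mem_filter.1 (mem_coe.1 hl)).2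
        have e2 := (mem_filter.1 (mem_coe.1 hl')).2
        exact Prod.ext h (e1.trans e2.symm)
      simp only
      rw [card_erase_of_mem (mem_signVars.2 h2), h3]
    · intro C hC C' hC' h
      obtain ⟨h1, h2⟩ := Prod.mk.inj h
      rw [hrec C hC, hrec C' hC', h2, h1]
  rw [card_product, card_powersetCard, card_univ, card_erase_of_mem hC₀] at hinj
  have h1 : (S.card : ℝ) ≤ 1 + X.card * (Fintype.card V : ℝ) ^ (k - E.card - 1) := by
    have : S.card ≤ 1 + X.card * Fintype.card V ^ (k - E.card - 1) := by
      have := Nat.mul_le_mul_left X.card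
        (Nat.choose_le_pow (k - E.card - 1) (Fintype.card V))
      first
      | omega
      | (have := Nat.mul_le_mul_left X.card
          (Nat.choose_le_pow (Fintype.card V) (k - E.card - 1)); omega)
    exact_mod_cast this
  have h2 : (Fintype.card V : ℝ) ^ (k - E.card) =
      Fintype.card V * (Fintype.card V : ℝ) ^ (k - E.card - 1) := by
    rw [← pow_succ']; congr 1; omega
  have h3 : (1 : ℝ) ≤ (Fintype.card V : ℝ) ^ (k - E.card - 1) := one_le_pow₀ hN1
  rw [h2]
  nlinarith

end Sparse

section Clash
variable {V : Type} [Fintype V] [DecidableEq V]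

/-- The `k`-sets `e` for which two distinct vertices `a, b ∈ e` satisfy `e \ b ∈ A` and
`e \ a ∈ B`. -/
def clash (k : ℕ) (A B : Finset (Finset V)) : Finset (Finset V) :=
  ((univ : Finset V).powersetCard k).filter fun e =>
    ∃ a ∈ e, ∃ b ∈ e, a ≠ b ∧ e.erase b ∈ A ∧ e.erase a ∈ B

lemma clash_subset (k : ℕ) (A B : Finset (Finset V)) :
    clash k A B ⊆ (univ : Finset V).powersetCard k := filter_subset _ _

lemma disjoint_edges_clash {k : ℕ} {G : SatFormula V} (hmin : MinimalFormula G) (v : V) :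
    Disjoint (edges G) (clash k (link G v false) (link G v true)) := by
  refine disjoint_left.2 fun e he hc => ?_
  obtain ⟨-, a, ha, b, hb, hab, h1, h2⟩ := mem_filter.1 hc
  obtain ⟨hv1, h1⟩ := mem_link.1 h1
  obtain ⟨hv2, h2⟩ := mem_link.1 h2
  have hve : v ∉ e := by
    intro hv
    rcases eq_or_ne v b with h | h
    · exact hv2 (mem_erase.2 ⟨fun h' => hab (h'.symm.trans h), hv⟩)
    · exact hv1 (mem_erase.2 ⟨h, hv⟩)
  obtain ⟨w, hw, hw'⟩ := hmin _ (mem_edges.1 he)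
  rw [satisfies_posClause] at hw
  have key : ∀ s u, insert (v, s) (posClause (e.erase u)) ∈ G → w v ≠ s := by
    intro s u hG hs
    have := hw' _ hG (by
      intro l hl
      rcases mem_insert.1 hl with rfl | hl
      · exact hs
      · obtain ⟨h3, h4⟩ := mem_posClause.1 hl
        rw [h4]; exact hw _ (mem_of_mem_erase h3))
    have h5 : (v, s) ∈ posClause e := this ▸ mem_insert_self _ _
    exact hve (mem_posClause.1 h5).1
  have h3 := key _ _ h1
  have h4 := key _ _ h2
  cases h : w v <;> simp_all

lemma link_nonpos (G : SatFormula V) (v : V) : link (nonpos G) v false = link G v false := by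
  ext P
  rw [mem_link, mem_link, mem_nonpos]
  constructor
  · exact fun h => ⟨h.1, h.2.1⟩
  · exact fun h => ⟨h.1, h.2, v, mem_signVars.2 (mem_insert_self _ _)⟩

lemma link_subset {k : ℕ} {G : SatFormula V} (hG : IsKFormula k G) (v : V) (s : Bool) :
    link G v s ⊆ (univ : Finset V).powersetCard (k - 1) := fun _ hP =>
  mem_powersetCard.2 ⟨subset_univ _, card_of_mem_link hG hP⟩

/-- Every vertex has few clashes between its two links. -/
def FewClashes (k : ℕ) (γ : ℝ) (G : SatFormula V) : Prop :=
  ∀ v, ((clash k (link G v false) (link G v true)).card : ℝ) ≤ γ * (Fintype.card V : ℝ) ^ k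

lemma card_many_clashes_le {k : ℕ} {γ : ℝ} (S : Finset (SatFormula V)) (v : V)
    (hS : ∀ G ∈ S, IsKFormula k G ∧ MinimalFormula G ∧
      γ * (Fintype.card V : ℝ) ^ k ≤ (clash k (link G v false) (link G v true)).card) :
    (S.card : ℝ) ≤ 2 ^ (Fintype.card V).choose k *
      Real.exp (-(γ * (Fintype.card V : ℝ) ^ k * Real.log 2)) *
        ((S.image nonpos).card * 2 ^ (Fintype.card V).choose (k - 1)) := by
  classical
  obtain ⟨w, hw⟩ : ∃ w : ℕ, w = ⌈γ * (Fintype.card V : ℝ) ^ k⌉₊ := ⟨_, rfl⟩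
  obtain ⟨U, hU⟩ : ∃ U, U = (univ : Finset V).powersetCard k := ⟨_, rfl⟩
  have hUc : U.card = (Fintype.card V).choose k := by rw [hU, card_powersetCard, card_univ]
  rcases S.eq_empty_or_nonempty with hS0 | ⟨G₀, hG₀⟩
  · rw [hS0]; simp
  have hwU : ∀ G ∈ S, w ≤ (clash k (link G v false) (link G v true)).card := fun G hG => by
    rw [hw]; exact Nat.ceil_le.2 (hS G hG).2.2
  have hcU : ∀ A B : Finset (Finset V), clash k A B ⊆ U := fun A B => by
    rw [hU]; exact clash_subset _ _ _
  have hfib : ∀ p ∈ S.image (fun G => (nonpos G, link G v true)),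
      (S.filter fun G => (nonpos G, link G v true) = p).card ≤ 2 ^ (U.card - w) := by
    intro p hp
    obtain ⟨G₁, hG₁, rfl⟩ := mem_image.1 hp
    obtain ⟨M, hM⟩ : ∃ M, M = clash k (link G₁ v false) (link G₁ v true) := ⟨_, rfl⟩
    calc _ ≤ (U \ M).powerset.card := by
          refine card_le_card_of_injOn edges ?_ ?_
          · intro G hG
            obtain ⟨hG, hp⟩ := mem_filter.1 hG
            obtain ⟨h1, h2⟩ := Prod.mk.inj hp
            have h3 := disjoint_edges_clash (k := k) (hS G hG).2.1 v
            rw [← link_nonpos G, h1, h2, link_nonpos, ← hM] at h3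
            refine mem_powerset.2 (subset_sdiff.2 ⟨?_, h3⟩)
            rw [hU]; exact edges_subset (hS G hG).1
          · intro G hG G' hG' h
            have h1 := (Prod.mk.inj (mem_filter.1 hG).2).1
            have h2 := (Prod.mk.inj (mem_filter.1 hG').2).1
            exact eq_of_nonpos_edges (h1.trans h2.symm) h
      _ = 2 ^ (U.card - M.card) := by
          rw [card_powerset, card_sdiff_of_subset (by rw [hM]; exact hcU _ _)]
      _ ≤ 2 ^ (U.card - w) := by
          have := hwU _ hG₁
          rw [← hM] at this
          exact Nat.pow_le_pow_right (by norm_num) (by omega)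
  have h1 := card_le_mul_card_image S _ hfib
  have h2 : (S.image (fun G => (nonpos G, link G v true))).card ≤
      (S.image nonpos).card * 2 ^ (Fintype.card V).choose (k - 1) := by
    rw [← card_univ, ← card_powersetCard, ← card_powerset, ← card_product]
    refine card_le_card fun p hp => ?_
    obtain ⟨G, hG, rfl⟩ := mem_image.1 hp
    exact mem_product.2 ⟨mem_image_of_mem _ hG, mem_powerset.2 (link_subset (hS G hG).1 v true)⟩
  have h3 := two_pow_sub_le (u := U.card) (w := w) (y := γ * (Fintype.card V : ℝ) ^ k)
    ((hwU _ hG₀).trans (card_le_card (hcU _ _))) (by rw [hw]; exact Nat.le_ceil _)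
  rw [← hUc]
  calc (S.card : ℝ) ≤ 2 ^ (U.card - w) *
        ((S.image nonpos).card * 2 ^ (Fintype.card V).choose (k - 1)) := by
        exact_mod_cast h1.trans (Nat.mul_le_mul_left _ h2)
    _ ≤ _ := by gcongr

lemma card_image_nonpos_le {k : ℕ} {ζ η : ℝ}
    (hζ : ∀ (V : Type) [DecidableEq V] (A : Finset (SatClause V)) (N : ℝ)
      (S : Finset (SatFormula V)), 0 ≤ N → (A.card : ℝ) ≤ 2 ^ k * N →
      (∀ B ∈ S, B ⊆ A ∧ (B.card : ℝ) ≤ ζ * N) → (S.card : ℝ) ≤ Real.exp (η * N))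
    (S : Finset (SatFormula V))
    (hS : ∀ G ∈ S, IsKFormula k G ∧ ((nonpos G).card : ℝ) ≤ ζ * (Fintype.card V : ℝ) ^ k) :
    ((S.image nonpos).card : ℝ) ≤ Real.exp (η * (Fintype.card V : ℝ) ^ k) := by
  refine hζ V (kClauses V k) _ _ (by positivity) ?_ ?_
  · have := card_kClauses_le (V := V) k
    rw [← mul_pow]; exact_mod_cast this
  · intro B hB
    obtain ⟨G, hG, rfl⟩ := mem_image.1 hB
    exact ⟨fun C hC => mem_kClauses.2 ((hS G hG).1 C (mem_nonpos.1 hC).1), (hS G hG).2⟩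

/-- Most minimal formulas with few nonpositive clauses have `FewClashes`. -/
lemma clash_count (k : ℕ) (hk : 2 ≤ k) {γ : ℝ} (hγ : 0 < γ) : ∃ ζ > 0, ∀ ζ' ≤ ζ, ∃ n₀ : ℕ,
    ∀ {V : Type} [Fintype V] [DecidableEq V] (S : Finset (SatFormula V)), n₀ ≤ Fintype.card V →
      (∀ G ∈ S, IsKFormula k G ∧ MinimalFormula G ∧
        ((nonpos G).card : ℝ) ≤ ζ' * (Fintype.card V : ℝ) ^ k ∧ ¬ FewClashes k γ G) →
      (S.card : ℝ) ≤ 2 ^ (Fintype.card V).choose k * Real.exp (-(Fintype.card V)) := by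
  classical
  have hlog := Real.log_pos (by norm_num : (1 : ℝ) < 2)
  have ha0 : 0 < γ * Real.log 2 := by positivity
  obtain ⟨ζ, hζ, h⟩ := exists_small_exp k (show 0 < γ * Real.log 2 / 3 by positivity)
  obtain ⟨n₂, hn₂⟩ := exists_nat_gt (9 / (γ * Real.log 2))
  refine ⟨ζ, hζ, fun ζ' hζ' => ⟨n₂ + 1, fun {V} _ _ S hn hS => ?_⟩⟩
  obtain ⟨N, hN⟩ : ∃ N, N = Fintype.card V := ⟨_, rfl⟩
  rw [← hN] at hn
  have hN1 : (1 : ℝ) ≤ N := by exact_mod_cast (by omega : 1 ≤ N)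
  have h1 : ∀ v, ((S.filter fun G => γ * (Fintype.card V : ℝ) ^ k ≤
      (clash k (link G v false) (link G v true)).card).card : ℝ) ≤
      2 ^ N.choose k * Real.exp (-(γ * (N : ℝ) ^ k * Real.log 2)) *
        (Real.exp (γ * Real.log 2 / 3 * (N : ℝ) ^ k) * Real.exp ((N : ℝ) ^ (k - 1))) := by
    intro v
    have h2 := card_many_clashes_le (S.filter fun G => γ * (Fintype.card V : ℝ) ^ k ≤
      (clash k (link G v false) (link G v true)).card) v (fun G hG => by
        obtain ⟨hG, h3⟩ := mem_filter.1 hG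
        exact ⟨(hS G hG).1, (hS G hG).2.1, h3⟩)
    refine h2.trans ?_
    have h3 := card_image_nonpos_le (h ζ' hζ') S fun G hG => ⟨(hS G hG).1, (hS G hG).2.2.1⟩
    have h4 : (2 : ℝ) ^ N.choose (k - 1) ≤ Real.exp ((N : ℝ) ^ (k - 1)) := by
      have h5 := Real.add_one_le_exp 1
      have h6 : (N.choose (k - 1) : ℝ) ≤ (N : ℝ) ^ (k - 1) := by
        exact_mod_cast Nat.choose_le_pow N (k - 1)
      calc (2 : ℝ) ^ N.choose (k - 1) ≤ Real.exp 1 ^ N.choose (k - 1) := by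
            gcongr; linarith
        _ = Real.exp (N.choose (k - 1)) := by rw [← Real.exp_nat_mul, mul_one]
        _ ≤ _ := Real.exp_le_exp.2 h6
    rw [← hN] at h3 ⊢
    have h7 : (((S.filter fun G => γ * (N : ℝ) ^ k ≤
      (clash k (link G v false) (link G v true)).card).image nonpos).card : ℝ) ≤
        (S.image nonpos).card := by
      exact_mod_cast card_le_card (image_subset_image (filter_subset _ _))
    have h8 := h7.trans h3
    gcongr
  have h2 : (S.card : ℝ) ≤ ∑ v : V, ((S.filter fun G => γ * (Fintype.card V : ℝ) ^ k ≤
      (clash k (link G v false) (link G v true)).card).card : ℝ) := by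
    have : S ⊆ univ.biUnion fun v => S.filter fun G => γ * (Fintype.card V : ℝ) ^ k ≤
        (clash k (link G v false) (link G v true)).card := by
      intro G hG
      obtain ⟨-, -, -, h3⟩ := hS G hG
      unfold FewClashes at h3
      push Not at h3
      obtain ⟨v, hv⟩ := h3
      exact mem_biUnion.2 ⟨v, mem_univ _, mem_filter.2 ⟨hG, hv.le⟩⟩
    exact_mod_cast (card_le_card this).trans card_biUnion_le
  refine h2.trans ((sum_le_sum fun v _ => h1 v).trans ?_)
  rw [sum_const, card_univ, nsmul_eq_mul, ← hN]
  have h3 : (N : ℝ) ≤ Real.exp N := by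
    have := Real.add_one_le_exp (N : ℝ); linarith
  have hpow : (N : ℝ) ^ k = N * (N : ℝ) ^ (k - 1) := by
    rw [← pow_succ', Nat.sub_add_cancel (by omega)]
  have h4 : 9 ≤ γ * Real.log 2 * N := by
    rw [div_lt_iff₀ ha0] at hn₂
    have : (n₂ : ℝ) ≤ N := by exact_mod_cast (by omega : n₂ ≤ N)
    nlinarith
  have h5 : 9 * (N : ℝ) ^ (k - 1) ≤ γ * Real.log 2 * (N : ℝ) ^ k := by
    rw [hpow, ← mul_assoc]; gcongr
  have h6 : (N : ℝ) ≤ (N : ℝ) ^ (k - 1) := by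
    have : N ^ 1 ≤ N ^ (k - 1) := Nat.pow_le_pow_right (by omega) (by omega)
    rw [pow_one] at this
    exact_mod_cast this
  calc (N : ℝ) * (2 ^ N.choose k * Real.exp (-(γ * (N : ℝ) ^ k * Real.log 2)) *
        (Real.exp (γ * Real.log 2 / 3 * (N : ℝ) ^ k) * Real.exp ((N : ℝ) ^ (k - 1))))
      ≤ Real.exp N * (2 ^ N.choose k * Real.exp (-(γ * (N : ℝ) ^ k * Real.log 2)) *
        (Real.exp (γ * Real.log 2 / 3 * (N : ℝ) ^ k) * Real.exp ((N : ℝ) ^ (k - 1)))) := by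
        gcongr
    _ = 2 ^ N.choose k * Real.exp (N + (-(γ * (N : ℝ) ^ k * Real.log 2) +
        (γ * Real.log 2 / 3 * (N : ℝ) ^ k + (N : ℝ) ^ (k - 1)))) := by
        rw [Real.exp_add, Real.exp_add, Real.exp_add]; ring
    _ ≤ _ := by
        gcongr
        nlinarith

end Clash

section LinkPairs
variable {V : Type} [Fintype V] [DecidableEq V]

/-- Resampling one coordinate does not change an average. -/
lemma Ex_update [Nonempty V] {m : ℕ} (l : Fin m) (f : (Fin m → V) → ℝ) :
    Ex (fun x => Ex fun a => f (Function.update x l a)) = Ex f := by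
  let j : Fin m → Fin m ⊕ Unit := fun i => if i = l then Sum.inr () else Sum.inl i
  have hj : Function.Injective j := by
    intro i i' h
    simp only [j] at h
    split_ifs at h with h1 h2 h2
    · rw [h1, h2]
    · exact Sum.inl.inj h
  rw [← Ex_comp_inj hj f, Ex_sum_arrow]
  refine Ex_congr fun x => ?_
  rw [← Ex_equiv (Equiv.funUnique Unit V)]
  refine Ex_congr fun b => ?_
  congr 1
  funext i
  by_cases hi : i = l
  · subst hi; simp [j]
  · simp [j, hi]

/-- The set of values of a tuple away from the coordinate `l`. -/
def facet {m : ℕ} (x : Fin m → V) (l : Fin m) : Finset V := (univ.erase l).image x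

lemma facet_update {m : ℕ} (x : Fin m → V) (l : Fin m) (a : V) :
    facet (Function.update x l a) l = facet x l :=
  image_congr fun _ hi => Function.update_of_ne (ne_of_mem_erase hi) _ _

lemma image_eq_insert_facet {m : ℕ} (x : Fin m → V) (l : Fin m) :
    univ.image x = insert (x l) (facet x l) := by
  rw [facet, ← image_insert, insert_erase (mem_univ l)]

lemma image_update {m : ℕ} (x : Fin m → V) (l : Fin m) (a : V) :
    univ.image (Function.update x l a) = insert a (facet x l) := by
  rw [image_eq_insert_facet _ l, Function.update_self, facet_update]

lemma erase_image_eq_facet {m : ℕ} {x : Fin m → V} (hx : Function.Injective x) (l : Fin m) :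
    (univ.image x).erase (x l) = facet x l := by
  rw [facet, ← image_erase hx]

/-- The proportion of vertices extending `S` to a member of `A`. -/
noncomputable def deg (A : Finset (Finset V)) (S : Finset V) : ℝ := Ex fun a => ind (insert a S ∈ A)

lemma deg_nonneg (A : Finset (Finset V)) (S : Finset V) : 0 ≤ deg A S :=
  Ex_nonneg fun _ => ind_nonneg _

lemma Ex_low_degree_le [Nonempty V] {m : ℕ} (A : Finset (Finset V)) (l : Fin m) {η : ℝ}
    (hη : 0 ≤ η) :
    Ex (fun x : Fin m → V => ind (univ.image x ∈ A ∧ ¬ η ≤ deg A (facet x l))) ≤ η := by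
  rw [← Ex_update l]
  refine Ex_le_of_le fun x => ?_
  simp only [image_update, facet_update]
  by_cases h : η ≤ deg A (facet x l)
  · simp only [h, not_true_eq_false, and_false, ind_false not_false]
    exact (Ex_const_le le_rfl).trans hη
  · refine le_trans (Ex_mono fun a => ind_mono And.left) (not_le.1 h).le

lemma pow_mul_Ex_image_mem {m : ℕ} {F : Finset (Finset V)}
    (hF : F ⊆ (univ : Finset V).powersetCard m) :
    (Fintype.card V : ℝ) ^ m * Ex (fun z : Fin m → V => ind (univ.image z ∈ F)) =
      m.factorial * F.card := by
  rw [Ex_tuples_image (V := V) (k := m) (fun f => ind (f ∈ F)) (fun f hf => ind_false fun h => by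
    have := (mem_powersetCard.1 (hF h)).2
    omega), sum_ind, filter_mem_eq_inter, inter_eq_right.2 hF]

lemma Ex_both_le [Nonempty V] {m : ℕ} (A B : Finset (Finset V)) (l : Fin m) {η γ : ℝ}
    (hη : 0 < η)
    (hc : ((clash (m + 1) A B).card : ℝ) ≤ γ * (Fintype.card V : ℝ) ^ (m + 1)) :
    Ex (fun x : Fin m → V => ind (η ≤ deg A (facet x l) ∧ η ≤ deg B (facet x l))) ≤
      ((m + 1).factorial * γ + ((m : ℝ) + 1) ^ 2 / Fintype.card V) / η ^ 2 := by
  have hN : (0 : ℝ) < Fintype.card V := by exact_mod_cast Fintype.card_pos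
  have h1 : Ex (fun x : Fin m → V => deg A (facet x l) * deg B (facet x l)) =
      Ex (fun b => Ex (fun x : Fin m → V =>
        ind (univ.image x ∈ A ∧ insert b (facet x l) ∈ B))) := by
    rw [Ex_comm]
    have := Ex_update l (fun x : Fin m → V => ind (univ.image x ∈ A) * deg B (facet x l))
    simp only [image_update, facet_update, Ex_mul_const] at this
    rw [show (fun x : Fin m → V => deg A (facet x l) * deg B (facet x l)) =
      fun x => Ex (fun a => ind (insert a (facet x l) ∈ A)) * deg B (facet x l) from rfl, this]
    refine Ex_congr fun x => ?_
    rw [deg, ← Ex_const_mul]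
    exact Ex_congr fun b => (ind_and _ _).symm
  have h2 : Ex (fun b => Ex (fun x : Fin m → V =>
        ind (univ.image x ∈ A ∧ insert b (facet x l) ∈ B))) ≤
      Ex (fun z : Fin (m + 1) → V => ind (univ.image z ∈ clash (m + 1) A B)) +
        Ex (fun z : Fin (m + 1) → V => ind (¬ Function.Injective z)) := by
    rw [← Ex_add, ← Ex_equiv (Fin.consEquiv fun _ : Fin (m + 1) => V), Ex_prod]
    refine Ex_mono fun b => Ex_mono fun x => ?_
    refine ind_le_of_pos (add_nonneg (ind_nonneg _) (ind_nonneg _)) fun ⟨h3, h4⟩ => ?_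
    obtain ⟨z, hz⟩ : ∃ z : Fin (m + 1) → V, z = Fin.cons b x := ⟨_, rfl⟩
    change 1 ≤ ind (univ.image (Fin.cons b x : Fin (m + 1) → V) ∈ clash (m + 1) A B) +
      ind (¬ Function.Injective (Fin.cons b x : Fin (m + 1) → V))
    rw [← hz]
    by_cases hinj : Function.Injective z
    · rw [ind_true (p := univ.image z ∈ _)]
      · linarith [ind_nonneg (¬ Function.Injective z)]
      have hxinj : Function.Injective x := by
        rw [hz] at hinj; exact (Fin.cons_injective_iff.1 hinj).2
      have hb : b ∉ univ.image x := by
        rw [hz] at hinj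
        have := (Fin.cons_injective_iff.1 hinj).1
        simpa using this
      have him : univ.image z = insert b (univ.image x) := by
        ext v
        rw [hz]
        simp [Fin.exists_fin_succ, eq_comm]
      rw [him]
      refine mem_filter.2 ⟨mem_powersetCard.2 ⟨subset_univ _, ?_⟩, x l, ?_, b, ?_, ?_, ?_, ?_⟩
      · rw [card_insert_of_notMem hb, card_image_of_injective _ hxinj, card_univ, Fintype.card_fin]
      · exact mem_insert_of_mem (mem_image_of_mem _ (mem_univ _))
      · exact mem_insert_self _ _
      · rintro rfl; exact hb (mem_image_of_mem _ (mem_univ _))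
      · rwa [erase_insert hb]
      · rw [erase_insert_of_ne, erase_image_eq_facet hxinj]
        · exact h4
        · rintro rfl; exact hb (mem_image_of_mem _ (mem_univ _))
    · rw [ind_true hinj]; linarith [ind_nonneg (univ.image z ∈ clash (m + 1) A B)]
  have h3 : Ex (fun z : Fin (m + 1) → V => ind (univ.image z ∈ clash (m + 1) A B)) ≤
      (m + 1).factorial * γ := by
    have h4 := pow_mul_Ex_image_mem (clash_subset (m + 1) A B)
    have h5 : (0 : ℝ) < (Fintype.card V : ℝ) ^ (m + 1) := by positivity
    refine le_of_mul_le_mul_left ?_ h5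
    rw [h4]
    calc ((m + 1).factorial : ℝ) * (clash (m + 1) A B).card
        ≤ (m + 1).factorial * (γ * (Fintype.card V : ℝ) ^ (m + 1)) := by gcongr
      _ = _ := by ring
  have h4 := Ex_not_injective_le (I := Fin (m + 1)) (V := V)
  rw [Fintype.card_fin] at h4
  push_cast at h4
  rw [le_div_iff₀ (by positivity), ← Ex_mul_const]
  refine le_trans (Ex_mono (g := fun x : Fin m → V => deg A (facet x l) * deg B (facet x l))
    fun x => ?_) (h1.le.trans (h2.trans (add_le_add h3 h4)))
  by_cases h : η ≤ deg A (facet x l) ∧ η ≤ deg B (facet x l)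
  · rw [ind_true h, one_mul, sq]
    exact mul_le_mul h.1 h.2 hη.le (hη.le.trans h.1)
  · rw [ind_false h, zero_mul]
    exact mul_nonneg (deg_nonneg _ _) (deg_nonneg _ _)

/-- All facets of the tuple have degree at least `η` in `A`. -/
def Allowed {m : ℕ} (η : ℝ) (A : Finset (Finset V)) (x : Fin m → V) : Prop :=
  ∀ l, η ≤ deg A (facet x l)

lemma Ex_exceptional_le [Nonempty V] {m : ℕ} (A : Finset (Finset V)) {η : ℝ} (hη : 0 ≤ η) :
    Ex (fun x : Fin m → V => ind (univ.image x ∈ A ∧ ¬ Allowed η A x)) ≤ m * η := by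
  have h1 : ∀ x : Fin m → V, ind (univ.image x ∈ A ∧ ¬ Allowed η A x) ≤
      ∑ l : Fin m, ind (univ.image x ∈ A ∧ ¬ η ≤ deg A (facet x l)) := by
    intro x
    refine le_trans (ind_mono fun h => ?_) (ind_exists_le univ _)
    obtain ⟨h1, h2⟩ := h
    unfold Allowed at h2
    push Not at h2
    obtain ⟨l, hl⟩ := h2
    exact ⟨l, mem_univ _, h1, not_le.2 hl⟩
  refine (Ex_mono h1).trans ?_
  rw [Ex_sum]
  refine (sum_le_sum fun l _ => Ex_low_degree_le A l hη).trans ?_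
  simp

lemma Ex_neither_ge [Nonempty V] {m : ℕ} (hm : 1 ≤ m) {A B : Finset (Finset V)} {ξ η β : ℝ}
    (hη : 0 ≤ η) (hmη : 2 * (m * η) ≤ ξ) (hβ : 0 ≤ β) (hβξ : 4 * β ≤ ξ)
    (hmβ : 16 * (m * β) ≤ ξ ^ 2)
    (hA : ξ ≤ Ex fun x : Fin m → V => ind (univ.image x ∈ A))
    (hB : ξ ≤ Ex fun x : Fin m → V => ind (univ.image x ∈ B))
    (hboth : ∀ l, Ex (fun x : Fin m → V => ind (η ≤ deg A (facet x l) ∧ η ≤ deg B (facet x l))) ≤ β) :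
    ξ ^ 2 / (32 * m) ≤ Ex fun x : Fin m → V => ind (¬ Allowed η A x ∧ ¬ Allowed η B x) := by
  have hm0 : (0 : ℝ) < m := by exact_mod_cast hm
  have hξ : 0 ≤ ξ := le_trans (by positivity) hmη
  obtain ⟨ν, hν⟩ : ∃ ν, ν = Ex fun x : Fin m → V => ind (¬ Allowed η A x ∧ ¬ Allowed η B x) :=
    ⟨_, rfl⟩
  obtain ⟨p, hp⟩ : ∃ p, p = Ex fun x : Fin m → V => ind (Allowed η B x) := ⟨_, rfl⟩
  have hallowed : ∀ D : Finset (Finset V), (ξ ≤ Ex fun x : Fin m → V => ind (univ.image x ∈ D)) →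
      ξ / 2 ≤ Ex fun x : Fin m → V => ind (Allowed η D x) := by
    intro D hD
    have h1 : Ex (fun x : Fin m → V => ind (univ.image x ∈ D)) ≤
        Ex (fun x : Fin m → V => ind (Allowed η D x)) + m * η := by
      refine le_trans ?_ (add_le_add_right (Ex_exceptional_le D hη) _)
      rw [← Ex_add]
      refine Ex_mono fun x => le_trans (ind_mono fun h => ?_) (ind_or_le _ _)
      by_cases h' : Allowed η D x
      · exact Or.inl h'
      · exact Or.inr ⟨h, h'⟩
    linarith
  have h1 := hallowed B hB
  have h2 := hallowed A hA
  rw [← hp] at h1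
  rw [← hν]
  have h3 : ξ / 2 ≤ 1 - p + β := by
    have : Ex (fun x : Fin m → V => ind (Allowed η A x)) ≤
        Ex (fun x : Fin m → V => 1 - ind (Allowed η B x)) + β := by
      refine le_trans ?_ (add_le_add_right (hboth ⟨0, hm⟩) _)
      rw [← Ex_add]
      refine Ex_mono fun x => ?_
      rw [← ind_not]
      refine le_trans (ind_mono fun h => ?_) (ind_or_le _ _)
      by_cases h' : Allowed η B x
      · exact Or.inr ⟨h _, h' _⟩
      · exact Or.inl h'
    rw [Ex_sub, Ex_const, ← hp] at this
    linarith
  have h4 : p * (1 - p) ≤ Ex (fun R : Fin m → V => Ex fun R' : Fin m → V =>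
      ind (Allowed η B R ≠ Allowed η B R')) := by
    have : p * (1 - p) = Ex (fun R : Fin m → V => Ex fun R' : Fin m → V =>
        ind (Allowed η B R) * (1 - ind (Allowed η B R'))) := by
      simp only [Ex_const_mul, Ex_mul_const, Ex_sub, Ex_const, hp]
    rw [this]
    refine Ex_mono fun R => Ex_mono fun R' => ?_
    rw [← ind_not, ← ind_and]
    exact ind_mono fun h h' => h.2 (h' ▸ h.1)
  have h5 : ∀ l : Fin m, Ex (fun R : Fin m → V => Ex fun a : V =>
      ind (Allowed η B R ≠ Allowed η B (Function.update R l a))) ≤ 2 * ν + β := by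
    intro l
    have h6 : Ex (fun R : Fin m → V => Ex fun a : V =>
        ind (¬ Allowed η A (Function.update R l a) ∧ ¬ Allowed η B (Function.update R l a))) = ν := by
      rw [hν, Ex_update l (fun y : Fin m → V => ind (¬ Allowed η A y ∧ ¬ Allowed η B y))]
    have h7 : ν = Ex (fun R : Fin m → V => Ex fun _ : V =>
        ind (¬ Allowed η A R ∧ ¬ Allowed η B R)) := by
      rw [hν]; exact Ex_congr fun R => (Ex_const _).symm
    have h8 : Ex (fun R : Fin m → V => Ex fun _ : V =>
        ind (η ≤ deg A (facet R l) ∧ η ≤ deg B (facet R l))) ≤ β :=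
      le_trans (Ex_congr fun R => Ex_const _).le (hboth l)
    refine le_trans ?_ (add_le_add (add_le_add h7.ge h6.le) h8 |>.trans (by linarith))
    rw [← Ex_add, ← Ex_add]
    refine Ex_mono fun R => ?_
    rw [← Ex_add, ← Ex_add]
    refine Ex_mono fun a => le_trans (ind_mono fun h => ?_)
      ((ind_or_le _ _).trans (add_le_add_left (ind_or_le _ _) _))
    by_cases h9 : Allowed η B R
    · have h10 : ¬ Allowed η B (Function.update R l a) := fun h' =>
        h (propext ⟨fun _ => h', fun _ => h9⟩)
      by_cases h11 : Allowed η A (Function.update R l a)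
      · have := h11 l
        rw [facet_update] at this
        exact Or.inr ⟨this, h9 l⟩
      · exact Or.inl (Or.inr ⟨h11, h10⟩)
    · have h10 : Allowed η B (Function.update R l a) := by
        by_contra h'
        exact h (propext ⟨fun h => absurd h h9, fun h => absurd h h'⟩)
      by_cases h11 : Allowed η A R
      · have := h10 l
        rw [facet_update] at this
        exact Or.inr ⟨h11 l, this⟩
      · exact Or.inl (Or.inl ⟨h11, h9⟩)
  have h6 := (h4.trans (hybrid_le (Allowed η B))).trans (sum_le_sum fun l _ => h5 l)
  rw [sum_const, card_univ, Fintype.card_fin, nsmul_eq_mul] at h6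
  rw [div_le_iff₀ (by positivity)]
  have h7 : ξ ^ 2 / 8 ≤ p * (1 - p) := by
    calc ξ ^ 2 / 8 = ξ / 2 * (ξ / 4) := by ring
      _ ≤ p * (1 - p) := mul_le_mul h1 (by linarith) (by positivity) (by linarith)
  linarith

end LinkPairs

section LinkPairCount
variable {V : Type} [Fintype V] [DecidableEq V]

/-- The `(m-1)`-sets of degree at least `η`. -/
noncomputable def rich (m : ℕ) (η : ℝ) (A : Finset (Finset V)) : Finset (Finset V) := by
  classical
  exact ((univ : Finset V).powersetCard (m - 1)).filter fun S => η ≤ deg A S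

/-- The `m`-sets all of whose facets lie in `D`. -/
def spanned (m : ℕ) (D : Finset (Finset V)) : Finset (Finset V) :=
  ((univ : Finset V).powersetCard m).filter fun e => ∀ u ∈ e, e.erase u ∈ D

lemma spanned_subset (m : ℕ) (D : Finset (Finset V)) :
    spanned m D ⊆ (univ : Finset V).powersetCard m := filter_subset _ _

lemma image_mem_spanned_rich {m : ℕ} {η : ℝ} {A : Finset (Finset V)} {x : Fin m → V}
    (hx : Function.Injective x) :
    univ.image x ∈ spanned m (rich m η A) ↔ Allowed η A x := by
  have hc : (univ.image x).card = m := by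
    rw [card_image_of_injective _ hx, card_univ, Fintype.card_fin]
  have h1 : ∀ l, facet x l ∈ rich m η A ↔ η ≤ deg A (facet x l) := by
    intro l
    have : (facet x l).card = m - 1 := by
      rw [facet, card_image_of_injective _ hx, card_erase_of_mem (mem_univ l), card_univ,
        Fintype.card_fin]
    simp [rich, mem_powersetCard, this]
  simp only [spanned, mem_filter, mem_powersetCard, subset_univ, hc, true_and, mem_image, mem_univ,
    forall_exists_index, forall_apply_eq_imp_iff, erase_image_eq_facet hx, h1]
  rfl

lemma injective_of_card_image {m : ℕ} {x : Fin m → V} (h : (univ.image x).card = m) :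
    Function.Injective x := by
  have : (univ.image x).card = (univ : Finset (Fin m)).card := by simpa using h
  exact fun a b hab => card_image_iff.1 this (mem_coe.2 (mem_univ a)) (mem_coe.2 (mem_univ b)) hab

lemma card_sdiff_spanned_le [Nonempty V] {m : ℕ} {A : Finset (Finset V)}
    (hA : A ⊆ (univ : Finset V).powersetCard m) {η : ℝ} (hη : 0 ≤ η) :
    ((A \ spanned m (rich m η A)).card : ℝ) ≤ m * η * (Fintype.card V : ℝ) ^ m := by
  have h1 := pow_mul_Ex_image_mem (sdiff_subset.trans hA : A \ spanned m (rich m η A) ⊆ _)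
  have h2 : Ex (fun x : Fin m → V => ind (univ.image x ∈ A \ spanned m (rich m η A))) ≤ m * η := by
    refine le_trans (Ex_mono fun x => ind_mono fun h => ?_) (Ex_exceptional_le A hη)
    obtain ⟨h3, h4⟩ := mem_sdiff.1 h
    rw [image_mem_spanned_rich (injective_of_card_image (mem_powersetCard.1 (hA h3)).2)] at h4
    exact ⟨h3, h4⟩
  have h3 : (1 : ℝ) ≤ m.factorial := by exact_mod_cast Nat.factorial_pos m
  calc ((A \ spanned m (rich m η A)).card : ℝ)
      ≤ m.factorial * (A \ spanned m (rich m η A)).card := le_mul_of_one_le_left (by positivity) h3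
    _ = (Fintype.card V : ℝ) ^ m * _ := h1.symm
    _ ≤ (Fintype.card V : ℝ) ^ m * (m * η) := by gcongr
    _ = _ := by ring

lemma card_spanned_add_le [Nonempty V] {m : ℕ} (hm : 1 ≤ m) {A B : Finset (Finset V)} {η β ν : ℝ}
    (hboth : ∀ l, Ex (fun x : Fin m → V => ind (η ≤ deg A (facet x l) ∧ η ≤ deg B (facet x l))) ≤ β)
    (hν : ν ≤ Ex fun x : Fin m → V => ind (¬ Allowed η A x ∧ ¬ Allowed η B x)) :
    ((spanned m (rich m η A)).card : ℝ) + (spanned m (rich m η B)).card ≤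
      (Fintype.card V).choose m -
        (ν - β - (m : ℝ) ^ 2 / Fintype.card V) / m.factorial * (Fintype.card V : ℝ) ^ m := by
  obtain ⟨P, hP⟩ : ∃ P, P = spanned m (rich m η A) := ⟨_, rfl⟩
  obtain ⟨Q, hQ⟩ : ∃ Q, Q = spanned m (rich m η B) := ⟨_, rfl⟩
  obtain ⟨U, hU⟩ : ∃ U, U = (univ : Finset V).powersetCard m := ⟨_, rfl⟩
  have hPU : P ⊆ U := by rw [hP, hU]; exact spanned_subset _ _
  have hQU : Q ⊆ U := by rw [hQ, hU]; exact spanned_subset _ _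
  have hUc : U.card = (Fintype.card V).choose m := by rw [hU, card_powersetCard, card_univ]
  have hfac : (0 : ℝ) < m.factorial := by exact_mod_cast Nat.factorial_pos m
  have h1 := pow_mul_Ex_image_mem (m := m) (F := P ∩ Q) (by rw [← hU]; exact inter_subset_left.trans hPU)
  have h2 := pow_mul_Ex_image_mem (m := m) (F := U \ (P ∪ Q)) (by rw [← hU]; exact sdiff_subset)
  have h3 : Ex (fun x : Fin m → V => ind (univ.image x ∈ P ∩ Q)) ≤ β := by
    refine le_trans (Ex_mono fun x => ind_mono fun h => ?_) (hboth ⟨0, hm⟩)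
    obtain ⟨h4, h5⟩ := mem_inter.1 h
    have h6 := hPU h4
    rw [hU] at h6
    have hx := injective_of_card_image (mem_powersetCard.1 h6).2
    rw [hP, image_mem_spanned_rich hx] at h4
    rw [hQ, image_mem_spanned_rich hx] at h5
    exact ⟨h4 _, h5 _⟩
  have h4 : ν ≤ Ex (fun x : Fin m → V => ind (univ.image x ∈ U \ (P ∪ Q))) +
      (m : ℝ) ^ 2 / Fintype.card V := by
    have h5 := Ex_not_injective_le (I := Fin m) (V := V)
    rw [Fintype.card_fin] at h5
    refine (hν.trans ?_).trans (add_le_add_right h5 _)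
    rw [← Ex_add]
    refine Ex_mono fun x => le_trans (ind_mono fun h => ?_) (ind_or_le _ _)
    by_cases hx : Function.Injective x
    · refine Or.inl (mem_sdiff.2 ⟨?_, ?_⟩)
      · rw [hU]
        exact mem_powersetCard.2 ⟨subset_univ _, by
          rw [card_image_of_injective _ hx, card_univ, Fintype.card_fin]⟩
      · rw [mem_union, hP, hQ, image_mem_spanned_rich hx, image_mem_spanned_rich hx]
        tauto
    · exact Or.inr hx
  have h5 : P.card + Q.card + (U \ (P ∪ Q)).card = U.card + (P ∩ Q).card := by
    rw [card_sdiff_of_subset (union_subset hPU hQU)]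
    have := card_union_add_card_inter P Q
    have := card_le_card (union_subset hPU hQU)
    omega
  have h5 : (P.card : ℝ) + Q.card + (U \ (P ∪ Q)).card = U.card + (P ∩ Q).card := by
    exact_mod_cast h5
  rw [← hP, ← hQ, ← hUc]
  have h6 : (0 : ℝ) ≤ (Fintype.card V : ℝ) ^ m := by positivity
  have h7 : (m.factorial : ℝ) * (P ∩ Q).card ≤ (Fintype.card V : ℝ) ^ m * β := by
    rw [← h1]; gcongr
  have h8 : (Fintype.card V : ℝ) ^ m * (ν - (m : ℝ) ^ 2 / Fintype.card V) ≤
      m.factorial * (U \ (P ∪ Q)).card := by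
    rw [← h2]; gcongr; linarith
  have h9 : (ν - β - (m : ℝ) ^ 2 / Fintype.card V) / m.factorial * (Fintype.card V : ℝ) ^ m ≤
      (U \ (P ∪ Q)).card - (P ∩ Q).card := by
    rw [div_mul_eq_mul_div, div_le_iff₀ hfac]
    linarith
  linarith

lemma card_pairs_le {m M : ℕ} {η ε h : ℝ}
    (hε : ∀ (α : Type) [DecidableEq α] (A : Finset α) (N : ℝ) (S : Finset (Finset α)), 0 ≤ N →
      (A.card : ℝ) ≤ 1 * N → (∀ B ∈ S, B ⊆ A ∧ (B.card : ℝ) ≤ ε * N) →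
        (S.card : ℝ) ≤ Real.exp (h * N))
    (T : Finset (Finset (Finset V) × Finset (Finset V)))
    (hT : ∀ p ∈ T, p.1 ⊆ (univ : Finset V).powersetCard m ∧ p.2 ⊆ (univ : Finset V).powersetCard m ∧
      ((p.1 \ spanned m (rich m η p.1)).card : ℝ) ≤ ε * (Fintype.card V : ℝ) ^ m ∧
      ((p.2 \ spanned m (rich m η p.2)).card : ℝ) ≤ ε * (Fintype.card V : ℝ) ^ m ∧
      (spanned m (rich m η p.1)).card + (spanned m (rich m η p.2)).card ≤ M) :
    (T.card : ℝ) ≤ 2 ^ M * ((2 ^ (Fintype.card V).choose (m - 1)) ^ 2 *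
      Real.exp (h * (Fintype.card V : ℝ) ^ m) ^ 2) := by
  classical
  obtain ⟨D, hD⟩ : ∃ D, D = ((univ : Finset V).powersetCard (m - 1)).powerset := ⟨_, rfl⟩
  obtain ⟨X, hX⟩ : ∃ X, X = (((univ : Finset V).powersetCard m).powerset).filter
    (fun B : Finset (Finset V) => (B.card : ℝ) ≤ ε * (Fintype.card V : ℝ) ^ m) := ⟨_, rfl⟩
  have hDc : D.card = 2 ^ (Fintype.card V).choose (m - 1) := by
    rw [hD, card_powerset, card_powersetCard, card_univ]
  have hXc : (X.card : ℝ) ≤ Real.exp (h * (Fintype.card V : ℝ) ^ m) := by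
    refine hε _ ((univ : Finset V).powersetCard m) _ X (by positivity) ?_ ?_
    · rw [card_powersetCard, card_univ, one_mul]
      exact_mod_cast Nat.choose_le_pow _ m
    · intro B hB
      rw [hX] at hB
      exact ⟨mem_powerset.1 (mem_filter.1 hB).1, (mem_filter.1 hB).2⟩
  let key : Finset (Finset V) × Finset (Finset V) →
      (Finset (Finset V) × Finset (Finset V)) × (Finset (Finset V) × Finset (Finset V)) := fun p =>
    ((rich m η p.1, rich m η p.2),
      (p.1 \ spanned m (rich m η p.1), p.2 \ spanned m (rich m η p.2)))
  have hfib : ∀ q ∈ T.image key, (T.filter fun p => key p = q).card ≤ 2 ^ M := by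
    intro q hq
    obtain ⟨p₀, hp₀, rfl⟩ := mem_image.1 hq
    obtain ⟨P, hP⟩ : ∃ P, P = spanned m (rich m η p₀.1) := ⟨_, rfl⟩
    obtain ⟨Q, hQ⟩ : ∃ Q, Q = spanned m (rich m η p₀.2) := ⟨_, rfl⟩
    calc _ ≤ (P.powerset ×ˢ Q.powerset).card := by
          refine card_le_card_of_injOn (fun p => (p.1 ∩ P, p.2 ∩ Q)) ?_ ?_
          · intro p _
            exact mem_coe.2 (mem_product.2
              ⟨mem_powerset.2 inter_subset_right, mem_powerset.2 inter_subset_right⟩)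
          · intro p hp p' hp' h
            have h1 := (mem_filter.1 (mem_coe.1 hp)).2
            have h2 := (mem_filter.1 (mem_coe.1 hp')).2
            simp only [key, Prod.mk.injEq] at h1 h2
            obtain ⟨⟨h3, h4⟩, h5, h6⟩ := h1
            obtain ⟨⟨h3', h4'⟩, h5', h6'⟩ := h2
            rw [h3, ← hP] at h5
            rw [h4, ← hQ] at h6
            rw [h3', ← hP] at h5'
            rw [h4', ← hQ] at h6'
            obtain ⟨h7, h8⟩ := Prod.mk.inj h
            refine Prod.ext ?_ ?_
            · rw [← sdiff_union_inter p.1 P, ← sdiff_union_inter p'.1 P, h7, h5, h5']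
            · rw [← sdiff_union_inter p.2 Q, ← sdiff_union_inter p'.2 Q, h8, h6, h6']
      _ = 2 ^ (P.card + Q.card) := by rw [card_product, card_powerset, card_powerset, pow_add]
      _ ≤ 2 ^ M := by
          have := (hT p₀ hp₀).2.2.2.2
          rw [← hP, ← hQ] at this
          exact Nat.pow_le_pow_right (by norm_num) this
  have h1 := card_le_mul_card_image T _ hfib
  have h2 : (T.image key).card ≤ ((D ×ˢ D) ×ˢ (X ×ˢ X)).card := by
    refine card_le_card fun q hq => ?_
    obtain ⟨p, hp, rfl⟩ := mem_image.1 hq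
    obtain ⟨h3, h4, h5, h6, -⟩ := hT p hp
    have hr : ∀ A : Finset (Finset V), rich m η A ∈ D := fun A => by
      rw [hD]; exact mem_powerset.2 (by unfold rich; exact filter_subset _ _)
    refine mem_product.2 ⟨mem_product.2 ⟨hr _, hr _⟩, mem_product.2 ⟨?_, ?_⟩⟩
    · rw [hX]; exact mem_filter.2 ⟨mem_powerset.2 (sdiff_subset.trans h3), h5⟩
    · rw [hX]; exact mem_filter.2 ⟨mem_powerset.2 (sdiff_subset.trans h4), h6⟩
  rw [card_product, card_product, card_product, hDc, ← sq, ← sq] at h2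
  calc (T.card : ℝ) ≤ 2 ^ M * ((2 ^ (Fintype.card V).choose (m - 1)) ^ 2 * (X.card : ℝ) ^ 2) := by
        exact_mod_cast h1.trans (Nat.mul_le_mul_left _ h2)
    _ ≤ _ := by gcongr

/-- Pairs of dense `m`-graphs with few clashes are rare. -/
lemma pair_count (m : ℕ) (hm : 1 ≤ m) {ξ : ℝ} (hξ : 0 < ξ) : ∃ γ > 0, ∃ c > 0, ∃ n₀ : ℕ,
    ∀ {V : Type} [Fintype V] [DecidableEq V] (T : Finset (Finset (Finset V) × Finset (Finset V))),
      n₀ ≤ Fintype.card V →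
      (∀ p ∈ T, p.1 ⊆ (univ : Finset V).powersetCard m ∧
        p.2 ⊆ (univ : Finset V).powersetCard m ∧
        ξ * (Fintype.card V : ℝ) ^ m ≤ p.1.card ∧ ξ * (Fintype.card V : ℝ) ^ m ≤ p.2.card ∧
        ((clash (m + 1) p.1 p.2).card : ℝ) ≤ γ * (Fintype.card V : ℝ) ^ (m + 1)) →
      (T.card : ℝ) ≤ 2 ^ (Fintype.card V).choose m *
        Real.exp (-(c * (Fintype.card V : ℝ) ^ m)) := by
  classical
  have hlog := Real.log_pos (by norm_num : (1 : ℝ) < 2)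
  have hlog1 : Real.log 2 ≤ 1 := by
    have := Real.log_le_sub_one_of_pos (by norm_num : (0 : ℝ) < 2); linarith
  have hm0 : (0 : ℝ) < m := by exact_mod_cast hm
  have hfac : (0 : ℝ) < m.factorial := by exact_mod_cast Nat.factorial_pos m
  obtain ⟨ν, hν⟩ : ∃ ν, ν = ξ ^ 2 / (32 * m) := ⟨_, rfl⟩
  have hν0 : 0 < ν := by rw [hν]; positivity
  obtain ⟨c, hc⟩ : ∃ c, c = ν / (2 * m.factorial) * Real.log 2 / 4 := ⟨_, rfl⟩
  have hc0 : 0 < c := by rw [hc]; positivity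
  obtain ⟨ε, hε0, hε⟩ := exists_card_small_subsets_le.{0} 1 (show 0 < c / 2 by positivity)
  obtain ⟨η, hη⟩ : ∃ η, η = min (ξ / (2 * m)) (ε / m) := ⟨_, rfl⟩
  have hη0 : 0 < η := by rw [hη]; positivity
  have hη1 : 2 * (m * η) ≤ ξ := by
    have : η ≤ ξ / (2 * m) := by rw [hη]; exact min_le_left _ _
    rw [le_div_iff₀ (by positivity)] at this; linarith
  have hη2 : m * η ≤ ε := by
    have : η ≤ ε / m := by rw [hη]; exact min_le_right _ _
    rw [le_div_iff₀ (by positivity)] at this; linarith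
  obtain ⟨β, hβ⟩ : ∃ β, β = min (ξ / 4) (min (ξ ^ 2 / (16 * m)) (ν / 4)) := ⟨_, rfl⟩
  have hβ0 : 0 < β := by rw [hβ]; positivity
  have hβ1 : 4 * β ≤ ξ := by
    have : β ≤ ξ / 4 := by rw [hβ]; exact min_le_left _ _
    linarith
  have hβ2 : 16 * (m * β) ≤ ξ ^ 2 := by
    have : β ≤ ξ ^ 2 / (16 * m) := by
      rw [hβ]; exact (min_le_right _ _).trans (min_le_left _ _)
    rw [le_div_iff₀ (by positivity)] at this; linarith
  have hβ3 : β ≤ ν / 4 := by rw [hβ]; exact (min_le_right _ _).trans (min_le_right _ _)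
  obtain ⟨γ, hγ⟩ : ∃ γ, γ = β * η ^ 2 / (2 * (m + 1).factorial) := ⟨_, rfl⟩
  have hfac1 : (0 : ℝ) < (m + 1).factorial := by exact_mod_cast Nat.factorial_pos (m + 1)
  have hγ0 : 0 < γ := by rw [hγ]; positivity
  obtain ⟨n₁, hn₁⟩ := exists_nat_gt (((m : ℝ) + 1) ^ 2 / (β * η ^ 2 / 2))
  obtain ⟨n₂, hn₂⟩ := exists_nat_gt ((m : ℝ) ^ 2 / (ν / 4))
  obtain ⟨n₃, hn₃⟩ := exists_nat_gt (2 / c)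
  refine ⟨γ, hγ0, c, hc0, n₁ + n₂ + n₃ + 1, fun {V} _ _ T hn hT => ?_⟩
  obtain ⟨N, hN⟩ : ∃ N, N = Fintype.card V := ⟨_, rfl⟩
  have hV : Nonempty V := Fintype.card_pos_iff.1 (by omega)
  rw [← hN] at hn
  have hN0 : (0 : ℝ) < N := by exact_mod_cast (by omega : 0 < N)
  have hN1 : ((m : ℝ) + 1) ^ 2 / N ≤ β * η ^ 2 / 2 := by
    have : (n₁ : ℝ) ≤ N := by exact_mod_cast (by omega : n₁ ≤ N)
    rw [div_le_iff₀ hN0, ← div_le_iff₀' (by positivity)]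
    exact hn₁.le.trans this
  have hN2 : (m : ℝ) ^ 2 / N ≤ ν / 4 := by
    have : (n₂ : ℝ) ≤ N := by exact_mod_cast (by omega : n₂ ≤ N)
    rw [div_le_iff₀ hN0, ← div_le_iff₀' (by positivity)]
    exact hn₂.le.trans this
  have hN3 : 2 ≤ c * N := by
    have : (n₃ : ℝ) ≤ N := by exact_mod_cast (by omega : n₃ ≤ N)
    rw [← div_le_iff₀' hc0]
    exact hn₃.le.trans this
  obtain ⟨w, hw⟩ : ∃ w : ℝ, w = ν / (2 * m.factorial) * (N : ℝ) ^ m := ⟨_, rfl⟩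
  have hw0 : 0 ≤ w := by rw [hw]; positivity
  have hpt : ∀ p ∈ T, ((spanned m (rich m η p.1)).card : ℝ) + (spanned m (rich m η p.2)).card ≤
      N.choose m - w := by
    intro p hp
    obtain ⟨h1, h2, h3, h4, h5⟩ := hT p hp
    have hdens : ∀ A : Finset (Finset V), A ⊆ (univ : Finset V).powersetCard m →
        ξ * (Fintype.card V : ℝ) ^ m ≤ A.card →
        ξ ≤ Ex fun x : Fin m → V => ind (univ.image x ∈ A) := by
      intro A hA hξA
      have h6 := pow_mul_Ex_image_mem hA
      have h7 : (0 : ℝ) < (Fintype.card V : ℝ) ^ m := by rw [← hN]; positivity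
      refine le_of_mul_le_mul_left ?_ h7
      rw [h6]
      have h8 : (1 : ℝ) ≤ m.factorial := by exact_mod_cast Nat.factorial_pos m
      calc (Fintype.card V : ℝ) ^ m * ξ ≤ A.card := by linarith
        _ ≤ m.factorial * A.card := le_mul_of_one_le_left (by positivity) h8
    have hboth : ∀ l : Fin m, Ex (fun x : Fin m → V =>
        ind (η ≤ deg p.1 (facet x l) ∧ η ≤ deg p.2 (facet x l))) ≤ β := by
      intro l
      refine (Ex_both_le p.1 p.2 l hη0 h5).trans ?_
      rw [div_le_iff₀ (by positivity), ← hN]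
      have : ((m + 1).factorial : ℝ) * γ = β * η ^ 2 / 2 := by rw [hγ]; field_simp
      linarith
    have h6 := Ex_neither_ge hm hη0.le hη1 hβ0.le hβ1 hβ2 (hdens _ h1 h3) (hdens _ h2 h4) hboth
    rw [← hν] at h6
    refine (card_spanned_add_le hm hboth h6).trans ?_
    rw [← hN, hw]
    have h7 : ν / (2 * m.factorial) ≤ (ν - β - (m : ℝ) ^ 2 / N) / m.factorial := by
      rw [show ν / (2 * (m.factorial : ℝ)) = (ν / 2) / m.factorial by field_simp]
      gcongr
      linarith
    gcongr
  rcases T.eq_empty_or_nonempty with hT0 | ⟨p₀, hp₀⟩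
  · rw [hT0]; simp; positivity
  have hwN : w ≤ N.choose m := by
    have := hpt p₀ hp₀
    have : (0 : ℝ) ≤ (spanned m (rich m η p₀.1)).card + (spanned m (rich m η p₀.2)).card := by
      positivity
    linarith
  have hceil : ⌈w⌉₊ ≤ N.choose m := Nat.ceil_le.2 hwN
  have h1 := card_pairs_le (m := m) (M := N.choose m - ⌈w⌉₊) (η := η) hε T (fun p hp => by
    obtain ⟨h1, h2, -⟩ := hT p hp
    refine ⟨h1, h2, ?_, ?_, ?_⟩
    · exact (card_sdiff_spanned_le h1 hη0.le).trans (by gcongr)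
    · exact (card_sdiff_spanned_le h2 hη0.le).trans (by gcongr)
    · have h3 := hpt p hp
      have h4 : w ≤ ((N.choose m - ((spanned m (rich m η p.1)).card +
          (spanned m (rich m η p.2)).card) : ℕ) : ℝ) := by
        rw [Nat.cast_sub]
        · push_cast; linarith
        · have : ((spanned m (rich m η p.1)).card : ℝ) + (spanned m (rich m η p.2)).card ≤
            N.choose m := by linarith
          exact_mod_cast this
      have h5 := Nat.ceil_le.2 h4
      have h6 : (spanned m (rich m η p.1)).card + (spanned m (rich m η p.2)).card ≤
          N.choose m := by
        have : ((spanned m (rich m η p.1)).card : ℝ) + (spanned m (rich m η p.2)).card ≤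
            N.choose m := by linarith
        exact_mod_cast this
      omega)
  have h2 := two_pow_sub_le (y := w) hceil (Nat.le_ceil w)
  have h3 : ((2 : ℝ) ^ N.choose (m - 1)) ^ 2 ≤ Real.exp (c * (N : ℝ) ^ m) := by
    have h5 := Real.add_one_le_exp 1
    have h6 : (N.choose (m - 1) : ℝ) ≤ (N : ℝ) ^ (m - 1) := by
      exact_mod_cast Nat.choose_le_pow N (m - 1)
    have h7 : (N : ℝ) ^ m = N * (N : ℝ) ^ (m - 1) := by
      rw [← pow_succ', Nat.sub_add_cancel hm]
    calc ((2 : ℝ) ^ N.choose (m - 1)) ^ 2 ≤ (Real.exp 1 ^ N.choose (m - 1)) ^ 2 := by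
          gcongr; linarith
      _ = Real.exp (2 * N.choose (m - 1)) := by
          rw [← Real.exp_nat_mul, mul_one, ← Real.exp_nat_mul]; norm_num
      _ ≤ _ := by
          refine Real.exp_le_exp.2 ?_
          rw [h7, ← mul_assoc]
          have : (0 : ℝ) ≤ (N : ℝ) ^ (m - 1) := by positivity
          nlinarith
  rw [← hN] at h1 ⊢
  refine h1.trans ?_
  calc (2 : ℝ) ^ (N.choose m - ⌈w⌉₊) * (((2 : ℝ) ^ N.choose (m - 1)) ^ 2 *
        Real.exp (c / 2 * (N : ℝ) ^ m) ^ 2)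
      ≤ (2 ^ N.choose m * Real.exp (-(w * Real.log 2))) * (Real.exp (c * (N : ℝ) ^ m) *
        Real.exp (c / 2 * (N : ℝ) ^ m) ^ 2) := by gcongr
    _ = 2 ^ N.choose m * Real.exp (-(w * Real.log 2) + (c * (N : ℝ) ^ m + 2 *
        (c / 2 * (N : ℝ) ^ m))) := by
        rw [← Real.exp_nat_mul, Real.exp_add, Real.exp_add]; push_cast; ring
    _ ≤ _ := by
        have : w * Real.log 2 = 4 * c * (N : ℝ) ^ m := by rw [hw, hc]; ring
        rw [this]
        have : 0 ≤ c * (N : ℝ) ^ m := by positivity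
        gcongr
        linarith

end LinkPairCount

section Restrict

variable {V : Type} [Fintype V] [DecidableEq V] {k : ℕ}

/-- The clauses of `G` avoiding the variables in `Y`. -/
def restrict (k : ℕ) (Y : Finset V) (G : SatFormula V) : SatFormula {v // v ∉ Y} :=
  (kClauses {v // v ∉ Y} k).filter fun C => cmap Subtype.val C ∈ G

lemma mem_restrict {Y : Finset V} {G : SatFormula V} {C : SatClause {v // v ∉ Y}} :
    C ∈ restrict k Y G ↔ IsKClause k C ∧ cmap Subtype.val C ∈ G := by
  rw [restrict, mem_filter, mem_kClauses]

lemma isKFormula_restrict (Y : Finset V) (G : SatFormula V) : IsKFormula k (restrict k Y G) :=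
  fun _ hC => (mem_restrict.1 hC).1

lemma minimal_restrict (Y : Finset V) {G : SatFormula V} (hG : MinimalFormula G) :
    MinimalFormula (restrict k Y G) := by
  intro C hC
  obtain ⟨w, hw, hw'⟩ := hG _ (mem_restrict.1 hC).2
  refine ⟨w ∘ Subtype.val, satisfies_cmap.1 hw, fun C' hC' h => ?_⟩
  exact cmap_injective Subtype.val_injective (hw' _ (mem_restrict.1 hC').2 (satisfies_cmap.2 h))

lemma card_cmap {U W : Type*} [DecidableEq U] [DecidableEq W] {x : U → W}
    (hx : Function.Injective x) (C : SatClause U) : (cmap x C).card = C.card :=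
  card_image_of_injective _ fun a b h => by
    obtain ⟨h1, h2⟩ := Prod.mk.inj h
    exact Prod.ext (hx h1) h2

lemma card_not_mem (Y : Finset V) : Fintype.card {v // v ∉ Y} = Fintype.card V - Y.card := by
  rw [Fintype.card_subtype, ← card_compl]
  congr 1
  ext v; simp

lemma negSparse_restrict {Y : Finset V} (hY : 2 * Y.card ≤ Fintype.card V) {δ δ' : ℝ}
    (hδ : 0 ≤ δ) (h : δ * 2 ^ k ≤ δ') {G : SatFormula V} (hG : NegSparse k δ G) :
    NegSparse k δ' (restrict k Y G) := by
  intro E hE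
  have h1 := hG (cmap Subtype.val E) (by rwa [card_cmap Subtype.val_injective])
  rw [card_cmap Subtype.val_injective] at h1
  have h2 : ((restrict k Y G).filter fun C => E ⊆ C ∧ ∀ l ∈ C \ E, l.2 = false).card ≤
      (G.filter fun C => cmap Subtype.val E ⊆ C ∧
        ∀ l ∈ C \ cmap Subtype.val E, l.2 = false).card := by
    refine card_le_card_of_injOn (cmap Subtype.val) ?_
      (cmap_injective Subtype.val_injective).injOn
    intro C hC
    obtain ⟨hC, h3, h4⟩ := mem_filter.1 (mem_coe.1 hC)
    refine mem_coe.2 (mem_filter.2 ⟨(mem_restrict.1 hC).2, image_subset_image h3, ?_⟩)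
    rintro ⟨v, b⟩ hl
    obtain ⟨hl1, hl2⟩ := mem_sdiff.1 hl
    obtain ⟨u, hu, rfl⟩ := mem_cmap.1 hl1
    exact h4 (u, b) (mem_sdiff.2 ⟨hu, fun h => hl2 (mem_cmap.2 ⟨u, h, rfl⟩)⟩)
  have h3 : (Fintype.card V : ℝ) ≤ 2 * Fintype.card {v // v ∉ Y} := by
    rw [card_not_mem]
    have : Fintype.card V ≤ 2 * (Fintype.card V - Y.card) := by omega
    exact_mod_cast this
  have h4 : (Fintype.card V : ℝ) ^ (k - E.card) ≤
      2 ^ k * (Fintype.card {v // v ∉ Y} : ℝ) ^ (k - E.card) := by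
    refine (pow_le_pow_left₀ (by positivity) h3 _).trans ?_
    rw [mul_pow]
    gcongr
    · norm_num
    · omega
  calc _ ≤ _ := Nat.cast_le.2 h2
    _ ≤ _ := h1
    _ ≤ δ * (2 ^ k * (Fintype.card {v // v ∉ Y} : ℝ) ^ (k - E.card)) := by gcongr
    _ = δ * 2 ^ k * (Fintype.card {v // v ∉ Y} : ℝ) ^ (k - E.card) := by ring
    _ ≤ _ := by gcongr

lemma cmap_insert_posClause (Y : Finset V) (v : {v // v ∉ Y}) (s : Bool)
    (P : Finset {v // v ∉ Y}) : cmap Subtype.val (insert (v, s) (posClause P)) =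
      insert (v.1, s) (posClause (P.image Subtype.val)) := by
  ext ⟨u, b⟩
  simp only [mem_cmap, mem_insert, mk_mem_posClause, Prod.mk.injEq, mem_image]
  constructor
  · rintro ⟨u, ⟨rfl, rfl⟩ | ⟨h1, rfl⟩, rfl⟩
    · exact Or.inl ⟨rfl, rfl⟩
    · exact Or.inr ⟨⟨u, h1, rfl⟩, rfl⟩
  · rintro (⟨rfl, rfl⟩ | ⟨⟨u, h1, rfl⟩, rfl⟩)
    · exact ⟨v, Or.inl ⟨rfl, rfl⟩, rfl⟩
    · exact ⟨u, Or.inr ⟨h1, rfl⟩, rfl⟩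

lemma card_link_restrict_le (Y : Finset V) (G : SatFormula V) (v : {v // v ∉ Y}) (s : Bool) :
    (link (restrict k Y G) v s).card ≤ (link G v.1 s).card := by
  refine card_le_card_of_injOn (fun P => P.image Subtype.val) ?_
    (image_injective Subtype.val_injective).injOn
  intro P hP
  obtain ⟨h1, h2⟩ := mem_link.1 (mem_coe.1 hP)
  have := (mem_restrict.1 h2).2
  rw [cmap_insert_posClause] at this
  refine mem_coe.2 (mem_link.2 ⟨?_, this⟩)
  rw [mem_image]
  rintro ⟨u, hu, huv⟩
  exact h1 (Subtype.ext huv ▸ hu)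

/-- The clauses of `G` with a literal on a variable of `Y` and a negative literal on another
variable. -/
def mixed (Y : Finset V) (G : SatFormula V) : SatFormula V :=
  G.filter fun C => ∃ v ∈ Y, ∃ b, (v, b) ∈ C ∧ ∃ u, u ≠ v ∧ (u, false) ∈ C

lemma exists_cmap_eq {Y : Finset V} {C : SatClause V} (hC : IsKClause k C)
    (h : Disjoint (clauseVars C) Y) :
    ∃ D : SatClause {v // v ∉ Y}, IsKClause k D ∧ cmap Subtype.val D = C := by
  have h0 : cmap Subtype.val ((univ : Finset ({v // v ∉ Y} × Bool)).filter
      fun l => (l.1.1, l.2) ∈ C) = C := by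
    ext ⟨v, b⟩
    rw [mem_cmap]
    constructor
    · rintro ⟨u, hu, rfl⟩; exact (mem_filter.1 hu).2
    · intro hv
      exact ⟨⟨v, disjoint_left.1 h (mem_image_of_mem Prod.fst hv)⟩, by simpa using hv, rfl⟩
  refine ⟨_, ⟨?_, ?_⟩, h0⟩
  · rw [← card_cmap Subtype.val_injective, h0, hC.1]
  · rw [← card_image_of_injective _ Subtype.val_injective, ← clauseVars_cmap, h0, hC.2]

lemma subset_of_restrict_link_mixed {Y : Finset V} {G G' : SatFormula V} (hG : IsKFormula k G)
    (h1 : restrict k Y G = restrict k Y G') (h2 : ∀ v ∈ Y, ∀ s, link G v s = link G' v s)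
    (h3 : mixed Y G = mixed Y G') : G ⊆ G' := by
  intro C hC
  have hk := hG C hC
  by_cases hd : Disjoint (clauseVars C) Y
  · obtain ⟨D, hD, rfl⟩ := exists_cmap_eq hk hd
    exact (mem_restrict.1 (h1 ▸ mem_restrict.2 ⟨hD, hC⟩)).2
  obtain ⟨v, hv, hvY⟩ := not_disjoint_iff.1 hd
  obtain ⟨⟨v, b⟩, hvb, rfl⟩ := mem_image.1 hv
  by_cases hm : C ∈ mixed Y G
  · exact (mem_filter.1 (h3 ▸ hm)).1
  have hneg : ∀ u, (u, false) ∈ C → u = v := by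
    intro u hu
    by_contra huv
    exact hm (mem_filter.2 ⟨hC, v, hvY, b, hvb, u, huv, hu⟩)
  have key : ∀ s P, v ∉ P → C = insert (v, s) (posClause P) → C ∈ G' := by
    intro s P hP h
    rw [h] at hC ⊢
    exact (mem_link.1 (h2 v hvY s ▸ mem_link.2 ⟨hP, hC⟩)).2
  cases b
  · refine key false (signVars true C) ?_ (eq_insert_posClause ?_)
    · exact disjoint_right.1 (disjoint_signVars hk) (mem_signVars.2 hvb)
    · ext u
      rw [mem_signVars, mem_singleton]
      exact ⟨hneg u, fun h => h ▸ hvb⟩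
  · refine key true ((signVars true C).erase v) (notMem_erase _ _) ?_
    have hpos : signVars false C = ∅ := by
      rw [eq_empty_iff_forall_notMem]
      intro u hu
      rw [mem_signVars] at hu
      have := hneg u hu
      exact absurd (sign_eq_of_mem hk hvb (this ▸ hu)) (by simp)
    conv_lhs => rw [eq_posClause hpos]
    ext ⟨u, b⟩
    simp only [mem_insert, mk_mem_posClause, mem_erase, Prod.mk.injEq, mem_signVars]
    constructor
    · rintro ⟨h, rfl⟩
      by_cases hu : u = v
      · exact Or.inl ⟨hu, rfl⟩
      · exact Or.inr ⟨⟨hu, h⟩, rfl⟩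
    · rintro (⟨rfl, rfl⟩ | ⟨⟨-, h⟩, rfl⟩)
      · exact ⟨hvb, rfl⟩
      · exact ⟨h, rfl⟩

lemma card_le_restrict_link_mixed {Y : Finset V} {S : Finset (SatFormula V)}
    (hS : ∀ G ∈ S, IsKFormula k G) (A : Finset (SatFormula {v // v ∉ Y}))
    (hA : ∀ G ∈ S, restrict k Y G ∈ A) (T : Finset (Finset (Finset V) × Finset (Finset V)))
    (hT : ∀ G ∈ S, ∀ v ∈ Y, (link G v false, link G v true) ∈ T)
    (R : Finset (SatFormula V)) (hR : ∀ G ∈ S, mixed Y G ∈ R) :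
    S.card ≤ A.card * T.card ^ Y.card * R.card := by
  have : T.card ^ Y.card = (Fintype.piFinset fun _ : Y => T).card := by
    rw [Fintype.card_piFinset, prod_const, card_univ, Fintype.card_coe]
  rw [this, ← card_product, ← card_product]
  refine card_le_card_of_injOn (fun G => ((restrict k Y G,
    fun v : Y => (link G v.1 false, link G v.1 true)), mixed Y G)) ?_ ?_
  · intro G hG
    refine mem_coe.2 (mem_product.2 ⟨mem_product.2 ⟨hA G hG, ?_⟩, hR G hG⟩)
    exact Fintype.mem_piFinset.2 fun v => hT G hG v.1 v.2
  · intro G hG G' hG' h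
    simp only [Prod.mk.injEq] at h
    obtain ⟨⟨h1, h2⟩, h3⟩ := h
    have h4 : ∀ v ∈ Y, ∀ s, link G v s = link G' v s := by
      intro v hv s
      have := congrFun h2 ⟨v, hv⟩
      simp only [Prod.mk.injEq] at this
      cases s
      exacts [this.1, this.2]
    exact (subset_of_restrict_link_mixed (hS G hG) h1 h4 h3).antisymm
      (subset_of_restrict_link_mixed (hS G' hG') h1.symm (fun v hv s => (h4 v hv s).symm) h3.symm)

end Restrict

section Mixed

variable {V : Type} [Fintype V] [DecidableEq V]

lemma card_mixed_le {k : ℕ} (hk : 2 ≤ k) (Y : Finset V) {δ : ℝ} (hδ : 0 ≤ δ) {G : SatFormula V}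
    (hG : IsKFormula k G) (hs : NegSparse k δ G) :
    ((mixed Y G).card : ℝ) ≤ 2 ^ (k - 1) * δ * (Y.card * (Fintype.card V : ℝ) ^ (k - 1)) := by
  have h1 : mixed Y G ⊆ ((kClauses V (k - 1)).filter fun E => ¬ Disjoint (clauseVars E) Y).biUnion
      fun E => G.filter fun C => E ⊆ C ∧ ∀ l ∈ C \ E, l.2 = false := by
    intro C hC
    obtain ⟨hC, v, hv, b, hvb, u, huv, hu⟩ := mem_filter.1 hC
    have hk' := hG C hC
    have hinj : Set.InjOn Prod.fst (C : Set (V × Bool)) := card_image_iff.1 (hk'.2.trans hk'.1.symm)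
    have hcard : (C.erase (u, false)).card = k - 1 := by rw [card_erase_of_mem hu, hk'.1]
    refine mem_biUnion.2 ⟨C.erase (u, false), mem_filter.2 ⟨mem_kClauses.2 ⟨hcard, ?_⟩, ?_⟩,
      mem_filter.2 ⟨hC, erase_subset _ _, ?_⟩⟩
    · rw [clauseVars, card_image_of_injOn (hinj.mono (by simp)), hcard]
    · refine not_disjoint_iff.2 ⟨v, mem_image.2 ⟨(v, b), mem_erase.2 ⟨?_, hvb⟩, rfl⟩, hv⟩
      exact fun h => huv (Prod.mk.inj h).1.symm
    · intro l hl
      obtain ⟨h1, h2⟩ := mem_sdiff.1 hl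
      by_contra h3
      exact h2 (mem_erase.2 ⟨fun h => h3 (h ▸ rfl), h1⟩)
  have h2 : ((mixed Y G).card : ℝ) ≤ ∑ E ∈ (kClauses V (k - 1)).filter
      fun E => ¬ Disjoint (clauseVars E) Y, δ * (Fintype.card V : ℝ) := by
    refine (Nat.cast_le.2 ((card_le_card h1).trans card_biUnion_le)).trans ?_
    rw [Nat.cast_sum]
    refine sum_le_sum fun E hE => ?_
    have h3 := (mem_kClauses.1 (mem_filter.1 hE).1).1
    have := hs E (by omega)
    rwa [h3, show k - (k - 1) = 1 by omega, pow_one] at this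
  rw [sum_const, nsmul_eq_mul] at h2
  have h3 := card_kClauses_touching_le (k - 1) Y
  have h4 : (((kClauses V (k - 1)).filter fun E => ¬ Disjoint (clauseVars E) Y).card : ℝ) ≤
      2 * Y.card * (2 * Fintype.card V) ^ (k - 1 - 1) := by exact_mod_cast h3
  obtain ⟨j, rfl⟩ : ∃ j, k = j + 2 := ⟨k - 2, by omega⟩
  simp only [show j + 2 - 1 = j + 1 by omega, show j + 1 - 1 = j by omega] at *
  calc _ ≤ _ := h2
    _ ≤ (2 * Y.card * (2 * Fintype.card V : ℝ) ^ j) * (δ * Fintype.card V) := by gcongr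
    _ = _ := by rw [mul_pow]; ring

lemma exists_card_mixed_le (k : ℕ) (hk : 2 ≤ k) {η : ℝ} (hη : 0 < η) :
    ∃ δ > 0, ∀ {V : Type} [Fintype V] [DecidableEq V] (Y : Finset V) (S : Finset (SatFormula V)),
      (∀ G ∈ S, IsKFormula k G ∧ NegSparse k δ G) →
      ((S.image (mixed Y)).card : ℝ) ≤
        Real.exp (η * (Y.card * (Fintype.card V : ℝ) ^ (k - 1))) := by
  obtain ⟨ε, hε, h⟩ := exists_card_small_subsets_le.{0} (2 ^ k) hη
  refine ⟨ε / 2 ^ (k - 1), by positivity, fun {V} _ _ Y S hS => ?_⟩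
  refine h (SatClause V) ((kClauses V k).filter fun C => ¬ Disjoint (clauseVars C) Y) _ _
    (by positivity) ?_ ?_
  · have := card_kClauses_touching_le k Y
    have h4 : (((kClauses V k).filter fun E => ¬ Disjoint (clauseVars E) Y).card : ℝ) ≤
      2 * Y.card * (2 * Fintype.card V) ^ (k - 1) := by exact_mod_cast this
    refine h4.trans (le_of_eq ?_)
    obtain ⟨j, rfl⟩ : ∃ j, k = j + 1 := ⟨k - 1, by omega⟩
    rw [Nat.add_sub_cancel, mul_pow]; ring
  · intro B hB
    obtain ⟨G, hG, rfl⟩ := mem_image.1 hB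
    refine ⟨fun C hC => ?_, ?_⟩
    · obtain ⟨hC, v, hv, b, hvb, -⟩ := mem_filter.1 hC
      exact mem_filter.2 ⟨mem_kClauses.2 ((hS G hG).1 C hC),
        not_disjoint_iff.2 ⟨v, mem_image_of_mem Prod.fst hvb, hv⟩⟩
    · have := card_mixed_le hk Y (by positivity) (hS G hG).1 (hS G hG).2
      rwa [mul_div_cancel₀ _ (by positivity)] at this

lemma sum_card_link_le {G : SatFormula V} (Y : Finset V) :
    ∑ v ∈ Y, (link G v false).card ≤ (nonpos G).card := by
  rw [← card_sigma]
  refine card_le_card_of_injOn (fun p => insert (p.1, false) (posClause p.2)) ?_ ?_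
  · rintro ⟨v, P⟩ hp
    obtain ⟨-, hP⟩ := mem_sigma.1 (mem_coe.1 hp)
    dsimp only at hP ⊢
    refine mem_coe.2 (mem_nonpos.2 ⟨(mem_link.1 hP).2, ?_⟩)
    rw [signVars_insert_posClause_false]
    exact singleton_nonempty _
  · rintro ⟨v, P⟩ - ⟨u, Q⟩ - h
    dsimp only at h
    have h1 := congrArg (signVars false) h
    have h2 := congrArg (signVars true) h
    rw [signVars_insert_posClause_false, signVars_insert_posClause_false, singleton_inj] at h1
    rw [signVars_insert_posClause_true, signVars_insert_posClause_true] at h2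
    subst h1 h2; rfl

end Mixed

lemma choose_add_mul_choose_le (m b j : ℕ) :
    m.choose (j + 2) + b * (m + b).choose (j + 1) ≤
      (m + b).choose (j + 2) + b ^ 2 * (m + b) ^ j := by
  have h1 : ∀ b, m.choose (j + 2) + b * m.choose (j + 1) ≤ (m + b).choose (j + 2) := by
    intro b
    induction b with
    | zero => simp
    | succ b ih =>
      rw [← add_assoc, Nat.choose_succ_succ' (m + b) (j + 1)]
      have := Nat.choose_le_choose (j + 1) (Nat.le_add_right m b)
      linarith [add_one_mul b (m.choose (j + 1))]
  have h2 : ∀ b, (m + b).choose (j + 1) ≤ m.choose (j + 1) + b * (m + b) ^ j := by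
    intro b
    induction b with
    | zero => simp
    | succ b ih =>
      rw [← add_assoc, Nat.choose_succ_succ' (m + b) j]
      have h3 := Nat.choose_le_pow (m + b) j
      have h4 : (m + b) ^ j ≤ (m + b + 1) ^ j := Nat.pow_le_pow_left (by omega) _
      nlinarith
  nlinarith [h1 b, h2 b]

section Exceptional

variable {V : Type} [Fintype V] [DecidableEq V]

lemma card_le_two_mul {k : ℕ} {A : Finset (SatFormula V)} (hA : ∀ G ∈ A, IsKFormula k G)
    (h : ((A.filter fun G => (nonpos G).Nonempty).card : ℝ) ≤ 2 ^ (Fintype.card V).choose k) :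
    (A.card : ℝ) ≤ 2 * 2 ^ (Fintype.card V).choose k := by
  have h1 : (A.filter fun G => ¬ (nonpos G).Nonempty).card ≤ 2 ^ (Fintype.card V).choose k := by
    have : ((univ : Finset V).powersetCard k).powerset.card = 2 ^ (Fintype.card V).choose k := by
      rw [card_powerset, card_powersetCard, card_univ]
    rw [← this]
    refine card_le_card_of_injOn edges ?_ ?_
    · intro G hG
      exact mem_coe.2 (mem_powerset.2 (edges_subset (hA G (mem_filter.1 (mem_coe.1 hG)).1)))
    · intro G hG G' hG' h
      have h2 := not_nonempty_iff_eq_empty.1 (mem_filter.1 (mem_coe.1 hG)).2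
      have h3 := not_nonempty_iff_eq_empty.1 (mem_filter.1 (mem_coe.1 hG')).2
      exact eq_of_nonpos_edges (h2.trans h3.symm) h
  have h2 : ((A.filter fun G => ¬ (nonpos G).Nonempty).card : ℝ) ≤
      2 ^ (Fintype.card V).choose k := by exact_mod_cast h1
  have h3 := card_filter_add_card_filter_not (s := A) (fun G => (nonpos G).Nonempty)
  have h4 : ((A.filter fun G => (nonpos G).Nonempty).card : ℝ) +
    (A.filter fun G => ¬ (nonpos G).Nonempty).card = A.card := by exact_mod_cast h3
  linarith

lemma card_le_of_exceptional {j : ℕ} {Y : Finset V} {S : Finset (SatFormula V)} {c : ℝ}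
    (hS : ∀ G ∈ S, IsKFormula (j + 2) G) (hY : (Y.card : ℝ) ≤ c / 4 * Fintype.card V)
    (hA : ((S.image (restrict (j + 2) Y)).card : ℝ) ≤
      2 * 2 ^ (Fintype.card V - Y.card).choose (j + 2))
    {T : Finset (Finset (Finset V) × Finset (Finset V))}
    (hT : ∀ G ∈ S, ∀ v ∈ Y, (link G v false, link G v true) ∈ T)
    (hTc : (T.card : ℝ) ≤ 2 ^ (Fintype.card V).choose (j + 1) *
      Real.exp (-(c * (Fintype.card V : ℝ) ^ (j + 1))))
    (hR : ((S.image (mixed Y)).card : ℝ) ≤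
      Real.exp (c / 4 * (Y.card * (Fintype.card V : ℝ) ^ (j + 1)))) :
    (S.card : ℝ) ≤ 2 * 2 ^ (Fintype.card V).choose (j + 2) *
      Real.exp (-(c / 2 * (Fintype.card V : ℝ) ^ (j + 1))) ^ Y.card := by
  have h0 := card_le_restrict_link_mixed hS _ (fun G hG => mem_image_of_mem _ hG) T hT _
    (fun G hG => mem_image_of_mem (mixed Y) hG)
  have h1 : (S.card : ℝ) ≤ (S.image (restrict (j + 2) Y)).card * (T.card : ℝ) ^ Y.card *
    (S.image (mixed Y)).card := by exact_mod_cast h0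
  obtain ⟨n, hn⟩ : ∃ n, n = Fintype.card V := ⟨_, rfl⟩
  obtain ⟨b, hb⟩ : ∃ b, b = Y.card := ⟨_, rfl⟩
  have hbn : b ≤ n := by rw [hb, hn]; exact card_le_univ Y
  simp only [← hn, ← hb] at hY hA hTc hR h1 ⊢
  have h2 := choose_add_mul_choose_le (n - b) b j
  rw [Nat.sub_add_cancel hbn] at h2
  have h3 : (2 : ℝ) ^ (b ^ 2 * n ^ j) ≤ Real.exp (c / 4 * (b * (n : ℝ) ^ (j + 1))) := by
    calc (2 : ℝ) ^ (b ^ 2 * n ^ j) ≤ Real.exp 1 ^ (b ^ 2 * n ^ j) := by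
          gcongr; linarith [Real.add_one_le_exp 1]
      _ = Real.exp ((b ^ 2 * n ^ j : ℕ) : ℝ) := by rw [← Real.exp_nat_mul, mul_one]
      _ ≤ _ := by
        apply Real.exp_le_exp.2
        push_cast
        calc (b : ℝ) ^ 2 * (n : ℝ) ^ j = b * (b * (n : ℝ) ^ j) := by ring
          _ ≤ (c / 4 * n) * (b * (n : ℝ) ^ j) := by gcongr
          _ = _ := by ring
  calc (S.card : ℝ) ≤ _ := h1
    _ ≤ (2 * 2 ^ (n - b).choose (j + 2)) * (2 ^ n.choose (j + 1) *
        Real.exp (-(c * (n : ℝ) ^ (j + 1)))) ^ b * Real.exp (c / 4 * (b * (n : ℝ) ^ (j + 1))) := by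
        gcongr
    _ = 2 * (2 ^ ((n - b).choose (j + 2) + b * n.choose (j + 1))) *
        (Real.exp (-(c * (n : ℝ) ^ (j + 1))) ^ b * Real.exp (c / 4 * (b * (n : ℝ) ^ (j + 1)))) := by
        rw [mul_pow, pow_add, ← pow_mul, mul_comm b]; ring
    _ ≤ 2 * (2 ^ (n.choose (j + 2) + b ^ 2 * n ^ j)) *
        (Real.exp (-(c * (n : ℝ) ^ (j + 1))) ^ b * Real.exp (c / 4 * (b * (n : ℝ) ^ (j + 1)))) := by
        gcongr
        norm_num
    _ ≤ 2 * (2 ^ n.choose (j + 2) * Real.exp (c / 4 * (b * (n : ℝ) ^ (j + 1)))) *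
        (Real.exp (-(c * (n : ℝ) ^ (j + 1))) ^ b * Real.exp (c / 4 * (b * (n : ℝ) ^ (j + 1)))) := by
        rw [pow_add]; gcongr
    _ = 2 * 2 ^ n.choose (j + 2) * (Real.exp (c / 4 * (b * (n : ℝ) ^ (j + 1))) *
        (Real.exp (-(c * (n : ℝ) ^ (j + 1))) ^ b * Real.exp (c / 4 * (b * (n : ℝ) ^ (j + 1))))) := by
        ring
    _ = _ := by
        rw [← Real.exp_nat_mul, ← Real.exp_nat_mul, ← Real.exp_add, ← Real.exp_add]
        congr 2; ring

/-- The vertices of large negative link. -/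
noncomputable def exceptional (k : ℕ) (ξ : ℝ) (G : SatFormula V) : Finset V :=
  open Classical in
  univ.filter fun v => ξ * (Fintype.card V : ℝ) ^ (k - 1) < (link G v false).card

lemma mem_exceptional {k : ℕ} {ξ : ℝ} {G : SatFormula V} {v : V} :
    v ∈ exceptional k ξ G ↔ ξ * (Fintype.card V : ℝ) ^ (k - 1) < (link G v false).card := by
  simp [exceptional]

lemma card_exceptional_le {k : ℕ} (hk : 1 ≤ k) (hV : 0 < Fintype.card V) {ξ κ : ℝ} (hξ : 0 < ξ)
    {G : SatFormula V} (hG : ((nonpos G).card : ℝ) ≤ ξ * κ * (Fintype.card V : ℝ) ^ k) :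
    ((exceptional k ξ G).card : ℝ) ≤ κ * Fintype.card V := by
  have h1 : (∑ v ∈ exceptional k ξ G, ((link G v false).card : ℝ)) ≤ (nonpos G).card := by
    exact_mod_cast sum_card_link_le (G := G) (exceptional k ξ G)
  have h2 : ∑ v ∈ exceptional k ξ G, ξ * (Fintype.card V : ℝ) ^ (k - 1) ≤
    ∑ v ∈ exceptional k ξ G, ((link G v false).card : ℝ) :=
    sum_le_sum fun v hv => (mem_exceptional.1 hv).le
  rw [sum_const, nsmul_eq_mul] at h2
  obtain ⟨j, rfl⟩ : ∃ j, k = j + 1 := ⟨k - 1, by omega⟩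
  rw [Nat.add_sub_cancel] at h2
  have h3 : 0 < ξ * (Fintype.card V : ℝ) ^ j := by
    have : (0 : ℝ) < Fintype.card V := by exact_mod_cast hV
    positivity
  refine le_of_mul_le_mul_right (h2.trans (h1.trans (hG.trans (le_of_eq ?_)))) h3
  ring

end Exceptional

/-- Few minimal formulas with few nonpositive clauses, sparse and with few clashes, have a
nonpositive clause. -/
lemma sparse_count (k : ℕ) (hk : 2 ≤ k) : ∃ δ > 0, ∃ γ > 0, ∃ ζ > 0, ∃ c > 0, ∃ n₀ : ℕ,
    ∀ {V : Type} [Fintype V] [DecidableEq V] (S : Finset (SatFormula V)), n₀ ≤ Fintype.card V →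
      (∀ G ∈ S, IsKFormula k G ∧ MinimalFormula G ∧ NegSparse k δ G ∧ FewClashes k γ G ∧
        ((nonpos G).card : ℝ) ≤ ζ * (Fintype.card V : ℝ) ^ k ∧
        (∀ v, (link G v false).card ≤ (link G v true).card) ∧ (nonpos G).Nonempty) →
      (S.card : ℝ) ≤ 2 ^ (Fintype.card V).choose k * Real.exp (-(c * Fintype.card V)) := by
  classical
  obtain ⟨δ₁, hδ₁, ξ₁, hξ₁, c₁, hc₁, n₁, hloc⟩ := local_count k hk
  obtain ⟨ξ, hξ⟩ : ∃ ξ : ℝ, ξ = ξ₁ / 2 ^ k := ⟨_, rfl⟩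
  have hξ0 : 0 < ξ := by rw [hξ]; positivity
  have hξle : ξ ≤ ξ₁ := by
    rw [hξ]; exact div_le_self hξ₁.le (one_le_pow₀ (by norm_num))
  obtain ⟨γ, hγ, c, hc, n₂, hpair⟩ := pair_count (k - 1) (by omega) hξ0
  obtain ⟨δ₂, hδ₂, hmix⟩ := exists_card_mixed_le k hk (η := c / 4) (by positivity)
  obtain ⟨δ, hδ⟩ : ∃ δ : ℝ, δ = min (δ₁ / 2 ^ k) δ₂ := ⟨_, rfl⟩
  have hδ0 : 0 < δ := by rw [hδ]; exact lt_min (by positivity) hδ₂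
  have hδ1 : δ * 2 ^ k ≤ δ₁ := by
    rw [← le_div_iff₀ (by positivity), hδ]; exact min_le_left _ _
  have hδle : δ ≤ δ₁ := le_trans (le_mul_of_one_le_right hδ0.le (one_le_pow₀ (by norm_num))) hδ1
  have hδ2 : δ ≤ δ₂ := by rw [hδ]; exact min_le_right _ _
  obtain ⟨κ, hκ⟩ : ∃ κ : ℝ, κ = min (1 / 2) (c / 4) := ⟨_, rfl⟩
  have hκ0 : 0 < κ := by rw [hκ]; exact lt_min (by norm_num) (by positivity)
  obtain ⟨n₃, hn₃⟩ := exists_mul_pow_le_exp 5 1 (show 0 < min c₁ (c / 4) / 2 by positivity)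
  have hmono : ∀ {V : Type} [Fintype V] [DecidableEq V] {δ δ' : ℝ} {G : SatFormula V}, δ ≤ δ' →
      NegSparse k δ G → NegSparse k δ' G := by
    intro V _ _ δ δ' G h hG E hE
    exact (hG E hE).trans (by gcongr)
  refine ⟨δ, hδ0, γ, hγ, ξ * κ, by positivity, min c₁ (c / 4) / 2, by positivity,
    2 * n₁ + n₂ + n₃ + 1, fun {V} _ _ S hn hS => ?_⟩
  obtain ⟨n, hnV⟩ : ∃ n, n = Fintype.card V := ⟨_, rfl⟩
  obtain ⟨x, hx⟩ : ∃ x : ℝ, x = Real.exp (-(c / 2 * (n : ℝ) ^ (k - 1))) := ⟨_, rfl⟩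
  have hx0 : 0 < x := by rw [hx]; positivity
  have hY : ∀ G ∈ S, ((exceptional k ξ G).card : ℝ) ≤ κ * n := by
    intro G hG
    rw [hnV]
    exact card_exceptional_le (by omega) (by omega) hξ0 (hS G hG).2.2.2.2.1
  have hlink : ∀ G : SatFormula V, ∀ v ∉ exceptional k ξ G,
      ((link G v false).card : ℝ) ≤ ξ * (n : ℝ) ^ (k - 1) := by
    intro G v hv
    rw [mem_exceptional, ← hnV] at hv
    exact not_lt.1 hv
  have hempty : ((S.filter fun G => exceptional k ξ G = ∅).card : ℝ) ≤
      2 ^ n.choose k * Real.exp (-(c₁ * n)) := by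
    rw [hnV]
    refine hloc _ (by omega) fun G hG => ?_
    obtain ⟨hG, hE⟩ := mem_filter.1 hG
    obtain ⟨h1, h2, h3, h4, h5, h6, h7⟩ := hS G hG
    refine ⟨h1, h2, hmono hδle h3, fun v => ?_, h7⟩
    refine (hlink G v (by rw [hE]; simp)).trans ?_
    rw [← hnV]; gcongr
  have hfix : ∀ Y ∈ (univ : Finset V).powerset.filter (fun Y => Y.Nonempty),
      ((S.filter fun G => exceptional k ξ G = Y).card : ℝ) ≤
        2 * 2 ^ n.choose k * x ^ Y.card := by
    intro Y _
    obtain ⟨SY, hSY⟩ : ∃ SY, SY = S.filter fun G => exceptional k ξ G = Y := ⟨_, rfl⟩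
    rw [← hSY]
    rcases SY.eq_empty_or_nonempty with hSe | ⟨G₀, hG₀⟩
    · rw [hSe, card_empty, Nat.cast_zero]; positivity
    have hb : (Y.card : ℝ) ≤ κ * n := by
      rw [hSY] at hG₀
      obtain ⟨h1, h2⟩ := mem_filter.1 hG₀
      rw [← h2]; exact hY _ h1
    have hκ1 : κ ≤ 1 / 2 := by rw [hκ]; exact min_le_left _ _
    have hκ2 : κ ≤ c / 4 := by rw [hκ]; exact min_le_right _ _
    have hb2 : 2 * Y.card ≤ n := by
      have : (2 * Y.card : ℝ) ≤ n := by
        nlinarith [(by positivity : (0 : ℝ) ≤ n)]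
      exact_mod_cast this
    have hmem : ∀ G ∈ SY, G ∈ S ∧ exceptional k ξ G = Y := by
      intro G hG; rw [hSY] at hG; exact mem_filter.1 hG
    have hcard : Fintype.card {v // v ∉ Y} = n - Y.card := by rw [card_not_mem, hnV]
    have hA : ((SY.image (restrict k Y)).card : ℝ) ≤ 2 * 2 ^ (n - Y.card).choose k := by
      rw [← hcard]
      refine card_le_two_mul (fun G' hG' => ?_) ((hloc _ ?_ ?_).trans ?_)
      · obtain ⟨G, -, rfl⟩ := mem_image.1 hG'
        exact isKFormula_restrict _ _
      · rw [hcard]; omega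
      · intro G' hG'
        obtain ⟨hG', hne⟩ := mem_filter.1 hG'
        obtain ⟨G, hG, rfl⟩ := mem_image.1 hG'
        obtain ⟨hGS, hGY⟩ := hmem G hG
        obtain ⟨h1, h2, h3, h4, h5, h6, h7⟩ := hS G hGS
        refine ⟨isKFormula_restrict _ _, minimal_restrict _ h2,
          negSparse_restrict (by omega) hδ0.le hδ1 h3, fun v => ?_, hne⟩
        have h8 := hlink G v.1 (by rw [hGY]; exact v.2)
        have h9 : (n : ℝ) ≤ 2 * Fintype.card {v // v ∉ Y} := by
          rw [hcard]
          have : n ≤ 2 * (n - Y.card) := by omega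
          exact_mod_cast this
        calc ((link (restrict k Y G) v false).card : ℝ) ≤ (link G v.1 false).card := by
              exact_mod_cast card_link_restrict_le Y G v false
          _ ≤ ξ * (n : ℝ) ^ (k - 1) := h8
          _ ≤ ξ * (2 * Fintype.card {v // v ∉ Y} : ℝ) ^ (k - 1) := by gcongr
          _ = ξ * 2 ^ (k - 1) * (Fintype.card {v // v ∉ Y} : ℝ) ^ (k - 1) := by
              rw [mul_pow]; ring
          _ ≤ ξ * 2 ^ k * (Fintype.card {v // v ∉ Y} : ℝ) ^ (k - 1) := by
              gcongr
              · norm_num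
              · omega
          _ = _ := by rw [hξ]; field_simp
      · refine mul_le_of_le_one_right (by positivity) (Real.exp_le_one_iff.2 ?_)
        have : 0 ≤ c₁ * Fintype.card {v // v ∉ Y} := by positivity
        linarith
    obtain ⟨T, hT⟩ : ∃ T, T = SY.biUnion fun G => Y.image fun v => (link G v false, link G v true) :=
      ⟨_, rfl⟩
    have hTc : (T.card : ℝ) ≤ 2 ^ n.choose (k - 1) * Real.exp (-(c * (n : ℝ) ^ (k - 1))) := by
      rw [hnV]
      refine hpair T (by omega) fun p hp => ?_
      rw [hT] at hp
      obtain ⟨G, hG, hp⟩ := mem_biUnion.1 hp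
      obtain ⟨v, hv, rfl⟩ := mem_image.1 hp
      obtain ⟨hGS, hGY⟩ := hmem G hG
      obtain ⟨h1, h2, h3, h4, h5, h6, h7⟩ := hS G hGS
      have h8 := (mem_exceptional.1 (hGY.symm ▸ hv)).le
      refine ⟨link_subset h1 _ _, link_subset h1 _ _, h8, h8.trans (Nat.cast_le.2 (h6 v)), ?_⟩
      have := h4 v
      rw [show k - 1 + 1 = k by omega]
      exact this
    have hTm : ∀ G ∈ SY, ∀ v ∈ Y, (link G v false, link G v true) ∈ T := by
      intro G hG v hv
      rw [hT]
      exact mem_biUnion.2 ⟨G, hG, mem_image_of_mem (fun v => (link G v false, link G v true)) hv⟩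
    have hR := hmix Y SY fun G hG =>
      ⟨(hS G (hmem G hG).1).1, hmono hδ2 (hS G (hmem G hG).1).2.2.1⟩
    have hbc : (Y.card : ℝ) ≤ c / 4 * n := hb.trans (by gcongr)
    have hK : ∀ G ∈ SY, IsKFormula k G := fun G hG => (hS G (hmem G hG).1).1
    subst hnV
    obtain ⟨j, rfl⟩ : ∃ j, k = j + 2 := ⟨k - 2, by omega⟩
    rw [hx]
    exact card_le_of_exceptional hK hbc hA hTm hTc hR
  have hn1 : 1 ≤ n := by omega
  have hxn : x ≤ Real.exp (-(c / 2 * n)) := by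
    rw [hx]
    apply Real.exp_le_exp.2
    have : (n : ℝ) ≤ (n : ℝ) ^ (k - 1) := le_self_pow₀ (by exact_mod_cast hn1) (by omega)
    have := mul_le_mul_of_nonneg_left this (by positivity : 0 ≤ c / 2)
    linarith
  obtain ⟨a, ha⟩ : ∃ a : ℝ, a = min c₁ (c / 4) / 2 := ⟨_, rfl⟩
  have ha0 : 0 < a := by rw [ha]; positivity
  have ha1 : 2 * a ≤ c₁ := by rw [ha]; linarith [min_le_left c₁ (c / 4)]
  have ha2 : 4 * a ≤ c / 2 := by rw [ha]; linarith [min_le_right c₁ (c / 4)]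
  rw [← ha] at hn₃ ⊢
  have h5 := hn₃ n (by omega)
  rw [pow_one] at h5
  have hn1' : (1 : ℝ) ≤ n := by exact_mod_cast hn1
  have hnx : 5 * (n * x) ≤ Real.exp (-(2 * a * n)) := by
    calc 5 * (n * x) = (5 * n) * x := by ring
      _ ≤ Real.exp (a * n) * Real.exp (-(c / 2 * n)) := by gcongr
      _ = Real.exp (a * n - c / 2 * n) := by rw [← Real.exp_add]; congr 1
      _ ≤ _ := by
        apply Real.exp_le_exp.2
        nlinarith
  have hsum := sum_nonempty_subsets_le (univ : Finset V) hx0.le (by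
    rw [card_univ, ← hnV]
    have : Real.exp (-(2 * a * n)) ≤ 1 := by
      apply Real.exp_le_one_iff.2
      have : 0 ≤ 2 * a * n := by positivity
      linarith
    have : 0 ≤ n * x := by positivity
    linarith)
  rw [card_univ, ← hnV] at hsum
  have hsplit : S = (S.filter fun G => exceptional k ξ G = ∅) ∪
      ((univ : Finset V).powerset.filter (fun Y => Y.Nonempty)).biUnion fun Y =>
        S.filter fun G => exceptional k ξ G = Y := by
    ext G
    simp only [mem_union, mem_filter, mem_biUnion, mem_powerset]
    constructor
    · intro hG
      rcases (exceptional k ξ G).eq_empty_or_nonempty with h | h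
      · exact Or.inl ⟨hG, h⟩
      · exact Or.inr ⟨_, ⟨subset_univ _, h⟩, hG, rfl⟩
    · rintro (h | ⟨_, -, h, -⟩) <;> first | exact h.1 | exact h
  have hcount : (S.card : ℝ) ≤ ((S.filter fun G => exceptional k ξ G = ∅).card : ℝ) +
      ∑ Y ∈ (univ : Finset V).powerset.filter (fun Y => Y.Nonempty),
        ((S.filter fun G => exceptional k ξ G = Y).card : ℝ) := by
    have : S.card ≤ (S.filter fun G => exceptional k ξ G = ∅).card +
      ∑ Y ∈ (univ : Finset V).powerset.filter (fun Y => Y.Nonempty),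
        (S.filter fun G => exceptional k ξ G = Y).card := by
      conv_lhs => rw [hsplit]
      exact (card_union_le _ _).trans (Nat.add_le_add_left card_biUnion_le _)
    exact_mod_cast this
  rw [← hnV]
  calc (S.card : ℝ) ≤ _ := hcount
    _ ≤ 2 ^ n.choose k * Real.exp (-(c₁ * n)) +
        ∑ Y ∈ (univ : Finset V).powerset.filter (fun Y => Y.Nonempty),
          2 * 2 ^ n.choose k * x ^ Y.card := add_le_add hempty (sum_le_sum hfix)
    _ ≤ 2 ^ n.choose k * Real.exp (-(2 * a * n)) + 2 ^ n.choose k * (4 * (n * x)) := by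
        rw [← mul_sum]
        refine add_le_add ?_ ?_
        · gcongr
        · calc _ ≤ 2 * 2 ^ n.choose k * (2 * (n * x)) := by gcongr
            _ = _ := by ring
    _ ≤ 2 ^ n.choose k * (2 * Real.exp (-(2 * a * n))) := by
        rw [← mul_add]
        gcongr
        have : 0 ≤ n * x := by positivity
        linarith
    _ ≤ _ := by
        gcongr
        calc 2 * Real.exp (-(2 * a * n)) ≤ Real.exp (a * n) * Real.exp (-(2 * a * n)) := by
              gcongr; linarith
          _ = _ := by rw [← Real.exp_add]; congr 1; ring

lemma near_count (k : ℕ) (hk : 2 ≤ k) : ∃ ζ > 0, ∃ c > 0, ∃ n₀ : ℕ,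
    ∀ {V : Type} [Fintype V] [DecidableEq V] (S : Finset (SatFormula V)), n₀ ≤ Fintype.card V →
      (∀ G ∈ S, IsKFormula k G ∧ MinimalFormula G ∧
        ((nonpos G).card : ℝ) ≤ ζ * (Fintype.card V : ℝ) ^ k ∧
        (∀ v, (link G v false).card ≤ (link G v true).card) ∧ (nonpos G).Nonempty) →
      (S.card : ℝ) ≤ 2 ^ (Fintype.card V).choose k * Real.exp (-(c * Fintype.card V)) := by
  classical
  obtain ⟨δ, hδ, γ, hγ, ζ₁, hζ₁, c₁, hc₁, n₁, h1⟩ := sparse_count k hk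
  obtain ⟨ζ₂, hζ₂, h2⟩ := dense_count k hk (half_pos hδ)
  obtain ⟨ζ₃, hζ₃, h3⟩ := clash_count k hk hγ
  obtain ⟨ζ, hζ⟩ : ∃ ζ : ℝ, ζ = min ζ₁ (min ζ₂ ζ₃) := ⟨_, rfl⟩
  have hζ1 : ζ ≤ ζ₁ := by rw [hζ]; exact min_le_left _ _
  have hζ2 : ζ ≤ ζ₂ := by rw [hζ]; exact (min_le_right _ _).trans (min_le_left _ _)
  have hζ3 : ζ ≤ ζ₃ := by rw [hζ]; exact (min_le_right _ _).trans (min_le_right _ _)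
  obtain ⟨n₂, h2⟩ := h2 ζ hζ2
  obtain ⟨n₃, h3⟩ := h3 ζ hζ3
  obtain ⟨a, ha⟩ : ∃ a : ℝ, a = min c₁ 1 := ⟨_, rfl⟩
  have ha0 : 0 < a := by rw [ha]; positivity
  have ha1 : a ≤ c₁ := by rw [ha]; exact min_le_left _ _
  have ha2 : a ≤ 1 := by rw [ha]; exact min_le_right _ _
  obtain ⟨n₄, h4⟩ := exists_mul_pow_le_exp 3 0 (half_pos ha0)
  obtain ⟨n₅, h5⟩ := exists_nat_ge (1 / (δ / 2))
  refine ⟨ζ, by rw [hζ]; positivity, a / 2, half_pos ha0, n₁ + n₂ + n₃ + n₄ + n₅,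
    fun {V} _ _ S hn hS => ?_⟩
  have e1 := h1 (S.filter fun G => DenseEdges (δ / 2) G ∧ FewClashes k γ G) (by omega) (by
    intro G hG
    obtain ⟨hG, hd, hc⟩ := mem_filter.1 hG
    obtain ⟨g1, g2, g3, g4, g5⟩ := hS G hG
    refine ⟨g1, g2, ?_, hc, g3.trans (by gcongr), g4, g5⟩
    have : (1 : ℝ) ≤ δ / 2 * Fintype.card V := by
      rw [div_le_iff₀ (by positivity)] at h5
      refine h5.trans ?_
      rw [mul_comm]
      have : (n₅ : ℝ) ≤ Fintype.card V := by exact_mod_cast (by omega : n₅ ≤ Fintype.card V)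
      gcongr
    have h := negSparse_of_denseEdges (half_pos hδ) this g1 g2 hd
    rwa [mul_div_cancel₀ _ (by norm_num : (2 : ℝ) ≠ 0)] at h)
  have e2 := h2 (S.filter fun G => ¬ DenseEdges (δ / 2) G) (by omega) (by
    intro G hG
    obtain ⟨hG, hd⟩ := mem_filter.1 hG
    obtain ⟨g1, g2, g3, g4, g5⟩ := hS G hG
    exact ⟨g1, g3, hd⟩)
  have e3 := h3 (S.filter fun G => ¬ FewClashes k γ G) (by omega) (by
    intro G hG
    obtain ⟨hG, hd⟩ := mem_filter.1 hG
    obtain ⟨g1, g2, g3, g4, g5⟩ := hS G hG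
    exact ⟨g1, g2, g3, hd⟩)
  have hsub : S ⊆ (S.filter fun G => DenseEdges (δ / 2) G ∧ FewClashes k γ G) ∪
      ((S.filter fun G => ¬ DenseEdges (δ / 2) G) ∪ S.filter fun G => ¬ FewClashes k γ G) := by
    intro G hG
    simp only [mem_union, mem_filter]
    tauto
  have hcard : (S.card : ℝ) ≤ (S.filter fun G => DenseEdges (δ / 2) G ∧ FewClashes k γ G).card +
      ((S.filter fun G => ¬ DenseEdges (δ / 2) G).card +
        (S.filter fun G => ¬ FewClashes k γ G).card) := by
    exact_mod_cast (card_le_card hsub).trans ((card_union_le _ _).trans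
      (Nat.add_le_add_left (card_union_le _ _) _))
  obtain ⟨n, hnV⟩ : ∃ n, n = Fintype.card V := ⟨_, rfl⟩
  rw [← hnV] at e1 e2 e3 hn ⊢
  have h6 := h4 n (by omega)
  rw [pow_zero, mul_one] at h6
  have b1 : Real.exp (-(c₁ * n)) ≤ Real.exp (-(a * n)) := by
    apply Real.exp_le_exp.2; gcongr
  have b2 : Real.exp (-(n : ℝ)) ≤ Real.exp (-(a * n)) := by
    apply Real.exp_le_exp.2
    have := mul_le_mul_of_nonneg_right ha2 (Nat.cast_nonneg n : (0 : ℝ) ≤ n)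
    linarith
  calc (S.card : ℝ) ≤ _ := hcard
    _ ≤ 2 ^ n.choose k * Real.exp (-(a * n)) + (2 ^ n.choose k * Real.exp (-(a * n)) +
        2 ^ n.choose k * Real.exp (-(a * n))) := by
        refine add_le_add (e1.trans ?_) (add_le_add (e2.trans ?_) (e3.trans ?_)) <;> gcongr
    _ = 2 ^ n.choose k * (3 * Real.exp (-(a * n))) := by ring
    _ ≤ 2 ^ n.choose k * (Real.exp (a / 2 * n) * Real.exp (-(a * n))) := by gcongr
    _ = _ := by
        rw [← Real.exp_add]; congr 2; ring

section Flip

variable {V : Type*} [DecidableEq V]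

/-- Negate the variables on which `σ` is false. -/
def flip (σ : V → Bool) (C : SatClause V) : SatClause V := C.image fun l => (l.1, l.2 == σ l.1)

lemma mem_flip {σ : V → Bool} {C : SatClause V} {v : V} {b : Bool} :
    (v, b) ∈ flip σ C ↔ (v, b == σ v) ∈ C := by
  simp only [flip, mem_image, Prod.mk.injEq, Prod.exists]
  constructor
  · rintro ⟨u, s, hu, rfl, rfl⟩
    have : ((s == σ u) == σ u) = s := by cases s <;> cases σ u <;> rfl
    rwa [this]
  · intro h
    exact ⟨v, _, h, rfl, by cases b <;> cases σ v <;> rfl⟩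

lemma flip_flip (σ : V → Bool) (C : SatClause V) : flip σ (flip σ C) = C := by
  ext ⟨v, b⟩
  rw [mem_flip, mem_flip]
  have : ((b == σ v) == σ v) = b := by cases b <;> cases σ v <;> rfl
  rw [this]

lemma isKClause_flip {k : ℕ} (σ : V → Bool) {C : SatClause V} (hC : IsKClause k C) :
    IsKClause k (flip σ C) := by
  constructor
  · rw [← hC.1]
    refine le_antisymm card_image_le ?_
    conv_lhs => rw [← flip_flip σ C]
    exact card_image_le
  · rw [← hC.2]
    simp only [clauseVars, flip, image_image]
    rfl

lemma satisfies_flip {σ a : V → Bool} {C : SatClause V} :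
    SatisfiesClause a (flip σ C) ↔ SatisfiesClause (fun v => a v == σ v) C := by
  constructor
  · rintro h ⟨v, b⟩ hl
    have := h (v, b == σ v) (mem_image_of_mem (fun l : V × Bool => (l.1, l.2 == σ l.1)) hl)
    dsimp only at this ⊢
    rw [this]; cases b <;> cases σ v <;> rfl
  · rintro h ⟨v, b⟩ hl
    have := h _ (mem_flip.1 hl)
    dsimp only at this ⊢
    revert this
    cases a v <;> cases b <;> cases σ v <;> simp

lemma cons_flip {σ τ : V → Bool} {C : SatClause V} :
    Cons τ (flip σ C) ↔ Cons (fun v => τ v == σ v) C := by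
  rw [← satisfies_iff_cons, satisfies_flip, satisfies_iff_cons]

/-- Flip every clause of a formula. -/
def flipForm (σ : V → Bool) (G : SatFormula V) : SatFormula V := G.image (flip σ)

lemma mem_flipForm {σ : V → Bool} {G : SatFormula V} {C : SatClause V} :
    C ∈ flipForm σ G ↔ flip σ C ∈ G := by
  rw [flipForm, mem_image]
  constructor
  · rintro ⟨D, hD, rfl⟩; rwa [flip_flip]
  · exact fun h => ⟨_, h, flip_flip σ C⟩

lemma flipForm_flipForm (σ : V → Bool) (G : SatFormula V) : flipForm σ (flipForm σ G) = G := by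
  ext C; rw [mem_flipForm, mem_flipForm, flip_flip]

lemma isKFormula_flipForm {k : ℕ} (σ : V → Bool) {G : SatFormula V} (hG : IsKFormula k G) :
    IsKFormula k (flipForm σ G) := by
  intro C hC
  have := isKClause_flip σ (hG _ (mem_flipForm.1 hC))
  rwa [flip_flip] at this

lemma minimal_flipForm (σ : V → Bool) {G : SatFormula V} (hG : MinimalFormula G) :
    MinimalFormula (flipForm σ G) := by
  intro C hC
  obtain ⟨w, hw, hw'⟩ := hG _ (mem_flipForm.1 hC)
  refine ⟨fun v => w v == σ v, satisfies_flip.1 hw, fun C' hC' h => ?_⟩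
  have := hw' _ (mem_flipForm.1 hC') (satisfies_flip.2 h)
  rw [← flip_flip σ C', this, flip_flip]

lemma inconsistent_flipForm (σ τ : V → Bool) (G : SatFormula V) :
    inconsistent τ (flipForm σ G) = inconsistent (fun v => τ v == σ v) G := by
  classical
  refine card_nbij' (flip σ) (flip σ) ?_ ?_ (fun C _ => flip_flip σ C) fun C _ => flip_flip σ C
  · intro C hC
    obtain ⟨h1, h2⟩ := mem_filter.1 (mem_coe.1 hC)
    refine mem_coe.2 (mem_filter.2 ⟨mem_flipForm.1 h1, ?_⟩)
    rwa [← cons_flip, flip_flip]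
  · intro C hC
    obtain ⟨h1, h2⟩ := mem_filter.1 (mem_coe.1 hC)
    refine mem_coe.2 (mem_filter.2 ⟨mem_flipForm.2 (by rwa [flip_flip]), ?_⟩)
    rwa [cons_flip]

lemma cons_true_iff {C : SatClause V} :
    Cons (fun _ => true) C ↔ signVars false C = ∅ := by
  rw [eq_empty_iff_forall_notMem]
  constructor
  · intro h v hv
    exact absurd (h _ (mem_signVars.1 hv)) (by simp)
  · rintro h ⟨v, b⟩ hl
    cases b
    · exact absurd (mem_signVars.2 hl) (h v)
    · rfl

lemma card_nonpos (G : SatFormula V) : (nonpos G).card = inconsistent (fun _ => true) G := by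
  classical
  rw [nonpos, inconsistent]
  congr 1
  refine filter_congr fun C _ => ?_
  rw [cons_true_iff, nonempty_iff_ne_empty]

lemma card_link_false_le [Fintype V] {G : SatFormula V} (v : V)
    (h : inconsistent (fun _ => true) G ≤ inconsistent (Function.update (fun _ => true) v false) G) :
    (link G v false).card ≤ (link G v true).card := by
  classical
  obtain ⟨τ, hτ⟩ : ∃ τ : V → Bool, τ = Function.update (fun _ => true) v false := ⟨_, rfl⟩
  have hτv : τ v = false := by rw [hτ]; simp
  have hτu : ∀ u, u ≠ v → τ u = true := fun u hu => by rw [hτ]; simp [hu]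
  rw [← hτ] at h
  obtain ⟨A, hA⟩ : ∃ A, A = G.filter fun C => ¬ Cons (fun _ => true) C := ⟨_, rfl⟩
  obtain ⟨B, hB⟩ : ∃ B, B = G.filter fun C => ¬ Cons τ C := ⟨_, rfl⟩
  have hAB : A.card ≤ B.card := by
    rw [hA, hB]; unfold inconsistent at h; convert h
  have h1 : (A \ B).card ≤ (B \ A).card := by
    have e1 := card_sdiff_add_card_inter A B
    have e2 := card_sdiff_add_card_inter B A
    rw [inter_comm] at e2
    omega
  refine le_trans ?_ (h1.trans ?_)
  · refine card_le_card_of_injOn (fun P => insert (v, false) (posClause P)) ?_ ?_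
    · intro P hP
      obtain ⟨hvP, hP⟩ := mem_link.1 (mem_coe.1 hP)
      refine mem_coe.2 (mem_sdiff.2 ⟨?_, ?_⟩)
      · rw [hA]
        refine mem_filter.2 ⟨hP, fun hc => ?_⟩
        exact absurd (hc _ (mem_insert_self _ _)) (by simp)
      · rw [hB]
        refine fun hc => (mem_filter.1 hc).2 ?_
        rintro ⟨u, b⟩ hl
        rw [mem_insert, mk_mem_posClause] at hl
        rcases hl with hl | ⟨hu, hb⟩
        · obtain ⟨rfl, rfl⟩ := Prod.mk.inj hl
          exact hτv.symm
        · dsimp only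
          rw [hb, hτu u fun h => hvP (h ▸ hu)]
    · intro P hP Q hQ hPQ
      have := congrArg (signVars true) hPQ
      ext u
      have h3 := Finset.ext_iff.1 this u
      simpa [mem_signVars, mk_mem_posClause] using h3
  · have key : ∀ C ∈ B \ A, (v, true) ∈ C ∧
        C = insert (v, true) (posClause ((signVars true C).erase v)) ∧ C ∈ G := by
      intro C hC
      obtain ⟨h2, h3⟩ := mem_sdiff.1 hC
      rw [hB] at h2
      obtain ⟨hCG, h2⟩ := mem_filter.1 h2
      have hpos : Cons (fun _ => true) C := by
        by_contra h4
        exact h3 (by rw [hA]; exact mem_filter.2 ⟨hCG, h4⟩)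
      have hv : (v, true) ∈ C := by
        by_contra hv
        refine h2 ?_
        rintro ⟨u, b⟩ hl
        have hb : b = true := hpos _ hl
        subst hb
        dsimp only
        rw [hτu u]
        rintro rfl
        exact hv hl
      refine ⟨hv, ?_, hCG⟩
      ext ⟨u, b⟩
      simp only [mem_insert, mk_mem_posClause, mem_erase, Prod.mk.injEq, mem_signVars]
      constructor
      · intro hl
        have hb : b = true := hpos _ hl
        subst hb
        by_cases hu : u = v
        · exact Or.inl ⟨hu, rfl⟩
        · exact Or.inr ⟨⟨hu, hl⟩, rfl⟩
      · rintro (⟨rfl, rfl⟩ | ⟨⟨-, h⟩, rfl⟩)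
        · exact hv
        · exact h
    refine card_le_card_of_injOn (fun C => (signVars true C).erase v) ?_ ?_
    · intro C hC
      obtain ⟨h2, h3, h4⟩ := key C (mem_coe.1 hC)
      refine mem_coe.2 (mem_link.2 ⟨notMem_erase _ _, ?_⟩)
      rwa [← h3]
    · intro C hC D hD h
      dsimp only at h
      rw [(key C (mem_coe.1 hC)).2.1, (key D (mem_coe.1 hD)).2.1, h]

end Flip

lemma near_nonunate_count (k : ℕ) (hk : 2 ≤ k) : ∃ ζ > 0, ∃ c > 0, ∃ n₀ : ℕ,
    ∀ {V : Type} [Fintype V] [DecidableEq V] (S : Finset (SatFormula V)), n₀ ≤ Fintype.card V →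
      (∀ G ∈ S, IsKFormula k G ∧ MinimalFormula G ∧
        (∃ σ, (inconsistent σ G : ℝ) ≤ ζ * (Fintype.card V : ℝ) ^ k) ∧
        ∀ σ, inconsistent σ G ≠ 0) →
      (S.card : ℝ) ≤ 2 ^ Fintype.card V *
        (2 ^ (Fintype.card V).choose k * Real.exp (-(c * Fintype.card V))) := by
  classical
  obtain ⟨ζ, hζ, c, hc, n₀, h⟩ := near_count k hk
  refine ⟨ζ, hζ, c, hc, n₀, fun {V} _ _ S hn hS => ?_⟩
  obtain ⟨Q, hQ⟩ : ∃ Q : Finset (SatFormula V), Q = univ.filter fun G => IsKFormula k G ∧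
    MinimalFormula G ∧ ((nonpos G).card : ℝ) ≤ ζ * (Fintype.card V : ℝ) ^ k ∧
    (∀ v, (link G v false).card ≤ (link G v true).card) ∧ (nonpos G).Nonempty := ⟨_, rfl⟩
  have h1 := h Q hn fun G hG => by rw [hQ] at hG; exact (mem_filter.1 hG).2
  have h2 : S ⊆ ((univ : Finset (V → Bool)) ×ˢ Q).image fun p => flipForm p.1 p.2 := by
    intro G hG
    obtain ⟨hk', hmin, ⟨τ, hτ⟩, hne⟩ := hS G hG
    obtain ⟨σ, -, hσ⟩ := exists_min_image (univ : Finset (V → Bool))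
      (fun σ => inconsistent σ G) ⟨τ, mem_univ _⟩
    have h3 : inconsistent (fun _ => true) (flipForm σ G) = inconsistent σ G := by
      rw [inconsistent_flipForm]; congr 1; ext v; cases σ v <;> rfl
    refine mem_image.2 ⟨(σ, flipForm σ G), mem_product.2 ⟨mem_univ _, ?_⟩, flipForm_flipForm σ G⟩
    rw [hQ]
    refine mem_filter.2 ⟨mem_univ _, isKFormula_flipForm σ hk', minimal_flipForm σ hmin, ?_,
      fun v => card_link_false_le v ?_, ?_⟩
    · rw [card_nonpos, h3]
      exact (Nat.cast_le.2 (hσ τ (mem_univ _))).trans hτ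
    · rw [h3, inconsistent_flipForm]
      exact hσ _ (mem_univ _)
    · rw [← card_pos, card_nonpos, h3]
      exact Nat.pos_of_ne_zero (hne σ)
  have h3 : S.card ≤ 2 ^ Fintype.card V * Q.card := by
    refine (card_le_card h2).trans (card_image_le.trans (le_of_eq ?_))
    rw [card_product, card_univ, Fintype.card_fun, Fintype.card_bool]
  calc (S.card : ℝ) ≤ 2 ^ Fintype.card V * Q.card := by exact_mod_cast h3
    _ ≤ _ := by gcongr

/-- The binomial coefficient is asymptotic to `n ^ k / k!`. -/
lemma one_sub_mul_pow_div_le_choose {k : ℕ} (hk : 1 ≤ k) {c : ℝ} (hc : 0 < c) : ∃ n₀ : ℕ, ∀ n ≥ n₀,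
    (1 - c) * ((n : ℝ) ^ k / k.factorial) ≤ n.choose k := by
  obtain ⟨n₁, hn₁⟩ := exists_nat_ge ((k : ℝ) * k / c)
  refine ⟨n₁ + k + 1, fun n hn => ?_⟩
  have h1 := Nat.pow_le_choose (α := ℝ) k n
  refine le_trans ?_ h1
  rw [← mul_div_assoc]
  gcongr
  have hn0 : (0 : ℝ) < n := by exact_mod_cast (by omega : 0 < n)
  have hkn : (k : ℝ) ≤ n := by exact_mod_cast (by omega : k ≤ n)
  have h2 := one_add_mul_le_pow (a := -(k : ℝ) / n) (by
    rw [le_div_iff₀ hn0]; linarith) k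
  have h3 : (k : ℝ) * k / n ≤ c := by
    rw [div_le_iff₀ hc] at hn₁
    rw [div_le_iff₀ hn0, mul_comm c]
    refine hn₁.trans ?_
    have : (n₁ : ℝ) ≤ n := by exact_mod_cast (by omega : n₁ ≤ n)
    gcongr
  have h4 : 1 - c ≤ (1 + -(k : ℝ) / n) ^ k := by
    refine le_trans ?_ h2
    have : (k : ℝ) * (-(k : ℝ) / n) = -(k * k / n) := by ring
    rw [this]; linarith
  calc (1 - c) * (n : ℝ) ^ k ≤ (1 + -(k : ℝ) / n) ^ k * (n : ℝ) ^ k := by gcongr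
    _ = (n - k : ℝ) ^ k := by
        rw [← mul_pow]; congr 1; field_simp; ring
    _ ≤ _ := by
        refine pow_le_pow_left₀ (by linarith) ?_ k
        rw [Nat.cast_sub (by omega)]
        push_cast; linarith

lemma le_choose_add (d i : ℕ) : d + 1 ≤ (d + (i + 1)).choose (i + 1) := by
  induction d with
  | zero => simp
  | succ d ih =>
    rw [show d + 1 + (i + 1) = d + (i + 1) + 1 by omega, Nat.choose_succ_succ']
    have : 0 < (d + (i + 1)).choose i := Nat.choose_pos (by omega)
    omega

lemma exists_mul_two_pow_choose_le (k : ℕ) (hk : 2 ≤ k) {ε : ℝ} (hε : 0 < ε) : ∃ n₀ : ℕ,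
    ∀ n ≥ n₀, (n : ℝ) * 2 ^ (n - 1).choose k ≤ ε * 2 ^ n.choose k := by
  obtain ⟨n₁, hn₁⟩ := exists_mul_pow_le_exp (2 ^ k / ε) 1 (Real.log_pos (by norm_num : (1 : ℝ) < 2))
  refine ⟨n₁ + k + 1, fun n hn => ?_⟩
  have h1 := hn₁ n (by omega)
  rw [pow_one, mul_comm (Real.log 2), Real.exp_nat_mul, Real.exp_log (by norm_num), div_mul_eq_mul_div,
    div_le_iff₀ hε] at h1
  obtain ⟨i, rfl⟩ : ∃ i, k = i + 2 := ⟨k - 2, by omega⟩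
  obtain ⟨d, rfl⟩ : ∃ d, n = d + (i + 1) + 1 := ⟨n - (i + 2), by omega⟩
  have h2 : (2 : ℝ) ^ d ≤ 2 ^ (d + (i + 1)).choose (i + 1) :=
    pow_le_pow_right₀ (by norm_num) ((Nat.le_succ d).trans (le_choose_add d i))
  rw [Nat.add_sub_cancel, Nat.choose_succ_succ' (d + (i + 1)) (i + 1), pow_add]
  have h3 : ((d + (i + 1) + 1 : ℕ) : ℝ) ≤ ε * 2 ^ d := by
    have h4 : (2 : ℝ) ^ (d + (i + 1) + 1) = 2 ^ (i + 2) * 2 ^ d := by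
      rw [← pow_add]; congr 1; omega
    rw [h4] at h1
    have h5 : (0 : ℝ) < 2 ^ (i + 2) := by positivity
    refine le_of_mul_le_mul_left (h1.trans (le_of_eq ?_)) h5
    ring
  calc _ ≤ (ε * 2 ^ (d + (i + 1)).choose (i + 1)) * 2 ^ (d + (i + 1)).choose (i + 1 + 1) := by
        gcongr
        exact h3.trans (by gcongr)
    _ = _ := by ring

lemma card_minForms_le (k : ℕ) (hk : 2 ≤ k) {ε : ℝ} (hε : 0 < ε) : ∃ n₀ : ℕ, ∀ n ≥ n₀,
    ((minForms (Fin n) k).card : ℝ) ≤ (1 + ε) * 2 ^ (n + n.choose k) := by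
  classical
  obtain ⟨ζ, hζ, c, hc, n₁, hnear⟩ := near_nonunate_count k hk
  obtain ⟨c', hc', n₂, hfar⟩ := far_count k hk hζ
  obtain ⟨n₃, h3⟩ := one_sub_mul_pow_div_le_choose (k := k) (by omega) hc'
  obtain ⟨n₄, h4⟩ := exists_mul_pow_le_exp (2 / ε) 0 hc
  obtain ⟨n₅, h5⟩ := exists_mul_pow_le_exp (2 / ε) 0 (Real.log_pos (by norm_num : (1 : ℝ) < 2))
  refine ⟨n₁ + n₂ + n₃ + n₄ + n₅, fun n hn => ?_⟩
  have hF : Fintype.card (Fin n) = n := Fintype.card_fin n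
  obtain ⟨M, hM⟩ : ∃ M, M = minForms (Fin n) k := ⟨_, rfl⟩
  rw [← hM]
  have hMm : ∀ G ∈ M, IsKFormula k G ∧ MinimalFormula G := fun G hG => by
    rw [hM] at hG; exact mem_minForms.1 hG
  have e1 := card_consistent_le k (M.filter fun G => ∃ σ, inconsistent σ G = 0)
    (fun G hG => (hMm G (mem_filter.1 hG).1).1) (by
      intro G hG
      obtain ⟨σ, hσ⟩ := (mem_filter.1 hG).2
      refine ⟨σ, fun C hC => ?_⟩
      by_contra hcon
      have := card_eq_zero.1 hσ
      exact absurd (this ▸ mem_filter.2 ⟨hC, hcon⟩) (notMem_empty C))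
  have e2 := hfar (M.filter fun G => ∀ σ, ζ * (Fintype.card (Fin n) : ℝ) ^ k < inconsistent σ G)
    (by omega) (by
      intro G hG
      obtain ⟨h1, h2⟩ := mem_filter.1 hG
      exact ⟨(hMm G h1).1, (hMm G h1).2, h2⟩)
  have e3 := hnear (M.filter fun G =>
      (∃ σ, (inconsistent σ G : ℝ) ≤ ζ * (Fintype.card (Fin n) : ℝ) ^ k) ∧
        ∀ σ, inconsistent σ G ≠ 0) (by omega) (by
      intro G hG
      obtain ⟨h1, h2⟩ := mem_filter.1 hG
      exact ⟨(hMm G h1).1, (hMm G h1).2, h2⟩)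
  have hsub : M ⊆ (M.filter fun G => ∃ σ, inconsistent σ G = 0) ∪
      ((M.filter fun G => ∀ σ, ζ * (Fintype.card (Fin n) : ℝ) ^ k < inconsistent σ G) ∪
      M.filter fun G => (∃ σ, (inconsistent σ G : ℝ) ≤ ζ * (Fintype.card (Fin n) : ℝ) ^ k) ∧
        ∀ σ, inconsistent σ G ≠ 0) := by
    intro G hG
    simp only [mem_union, mem_filter, hG, true_and]
    by_cases g1 : ∃ σ, inconsistent σ G = 0
    · exact Or.inl g1
    · push Not at g1
      by_cases g2 : ∃ σ, (inconsistent σ G : ℝ) ≤ ζ * (Fintype.card (Fin n) : ℝ) ^ k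
      · exact Or.inr (Or.inr ⟨g2, g1⟩)
      · push Not at g2
        exact Or.inr (Or.inl g2)
  have hcard : (M.card : ℝ) ≤ (M.filter fun G => ∃ σ, inconsistent σ G = 0).card +
      ((M.filter fun G => ∀ σ, ζ * (Fintype.card (Fin n) : ℝ) ^ k < inconsistent σ G).card +
      (M.filter fun G => (∃ σ, (inconsistent σ G : ℝ) ≤ ζ * (Fintype.card (Fin n) : ℝ) ^ k) ∧
        ∀ σ, inconsistent σ G ≠ 0).card) := by
    exact_mod_cast (card_le_card hsub).trans ((card_union_le _ _).trans
      (Nat.add_le_add_left (card_union_le _ _) _))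
  have e1' : ((M.filter fun G => ∃ σ, inconsistent σ G = 0).card : ℝ) ≤ 2 ^ (n + n.choose k) := by
    rw [hF] at e1; exact_mod_cast e1
  rw [hF] at e2 e3 hcard
  have e4 := h4 n (by omega)
  have e5 := h5 n (by omega)
  rw [pow_zero, mul_one, div_le_iff₀ hε] at e4 e5
  rw [mul_comm (Real.log 2), Real.exp_nat_mul, Real.exp_log (by norm_num)] at e5
  have f2 : (2 : ℝ) ^ ((1 - c') * ((n : ℝ) ^ k / k.factorial)) ≤ ε / 2 * 2 ^ (n + n.choose k) := by
    calc _ ≤ (2 : ℝ) ^ ((n.choose k : ℕ) : ℝ) :=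
          Real.rpow_le_rpow_of_exponent_le (by norm_num) (h3 n (by omega))
      _ = 1 * 2 ^ n.choose k := by rw [Real.rpow_natCast, one_mul]
      _ ≤ (ε / 2 * 2 ^ n) * 2 ^ n.choose k := by gcongr; linarith
      _ = _ := by rw [pow_add]; ring
  have f3 : (2 : ℝ) ^ n * (2 ^ n.choose k * Real.exp (-(c * n))) ≤
      ε / 2 * 2 ^ (n + n.choose k) := by
    have : Real.exp (-(c * n)) ≤ ε / 2 := by
      rw [Real.exp_neg, inv_le_iff_one_le_mul₀ (Real.exp_pos _)]
      linarith
    calc _ ≤ (2 : ℝ) ^ n * (2 ^ n.choose k * (ε / 2)) := by gcongr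
      _ = _ := by rw [pow_add]; ring
  linarith

end KSat


/-- Fix `k ≥ 2`. For every `ε > 0` there is `n₀` such that for all `n ≥ n₀`,
the number of `k`-SAT functions on `n` Boolean variables lies between
`(1−ε)·2^(n + C(n,k))` and `(1+ε)·2^(n + C(n,k))`. -/
theorem ksat_function_count (k : ℕ) (hk : 2 ≤ k) (ε : ℝ) (hε : 0 < ε) :
    ∃ n₀ : ℕ, ∀ n ≥ n₀,
      (1 - ε) * 2 ^ (n + n.choose k) ≤
        (Set.ncard {f : (Fin n → Bool) → Bool | IsKSatFunction k n f} : ℝ) ∧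
      (Set.ncard {f : (Fin n → Bool) → Bool | IsKSatFunction k n f} : ℝ) ≤
        (1 + ε) * 2 ^ (n + n.choose k) := by
  obtain ⟨n₁, h1⟩ := KSat.card_minForms_le k hk hε
  obtain ⟨n₂, h2⟩ := KSat.exists_mul_two_pow_choose_le k hk hε
  refine ⟨n₁ + n₂, fun n hn => ⟨?_, ?_⟩⟩
  · have h3 := KSat.card_covering (V := Fin n) k
    rw [Fintype.card_fin] at h3
    have h4 : (2 : ℝ) ^ n.choose k ≤
        (KSat.covering (Fin n) k).card + n * 2 ^ (n - 1).choose k := by exact_mod_cast h3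
    have h5 : (2 : ℝ) ^ n * (KSat.covering (Fin n) k).card ≤
        (Set.ncard {f : (Fin n → Bool) → Bool | IsKSatFunction k n f} : ℝ) := by
      exact_mod_cast KSat.le_ncard_ksat k n
    have h6 := h2 n (by omega)
    calc (1 - ε) * 2 ^ (n + n.choose k) = 2 ^ n * (2 ^ n.choose k - ε * 2 ^ n.choose k) := by
          rw [pow_add]; ring
      _ ≤ 2 ^ n * (KSat.covering (Fin n) k).card := by gcongr; linarith
      _ ≤ _ := h5
  · exact (Nat.cast_le.2 (KSat.ncard_ksat_le k n)).trans (h1 n (by omega))
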